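/- There is a constant C such that for every n ≥ 1 and every finite field F with |F| = q, the projective symplectic group PSp(2n, F), defined as the quotient of the symplectic group Sp(2n, F) by its center, has a presentation with at most C generators and at most C relators whose length is at most C·(1 + log₂ n + log₂ q). -/

import Mathlib

/-- `G` has a presentation with at most `g` generators, at most `r` relators, and
length (number of generators plus the total length of the reduced relator words) at
most `L`. -/
def HasBoundedPresentation (G : Type) [Group G] (g r : ℕ) (L : ℝ) : Prop :=
  ∃ (m : ℕ) (π : FreeGroup (Fin m) →* G) (R : Finset (FreeGroup (Fin m))),
    m ≤ g ∧ Function.Surjective π ∧ R.card ≤ r ∧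
    π.ker = Subgroup.normalClosure (R : Set (FreeGroup (Fin m))) ∧
    ((m + ∑ w ∈ R, FreeGroup.norm w : ℕ) : ℝ) ≤ L

set_option linter.all false
open scoped commutatorElement

/-- `x` is a product of at most `k` elements of `S` or inverses of such. -/
def Bl {G : Type} [Group G] (S : Set G) (k : ℕ) (x : G) : Prop :=
  ∃ l : List G, l.length ≤ k ∧ (∀ y ∈ l, y ∈ S ∨ y⁻¹ ∈ S) ∧ l.prod = x

namespace Bl

variable {G H : Type} [Group G] [Group H] {S S' : Set G} {k k' : ℕ} {x y : G}

theorem one : Bl S k (1 : G) := ⟨[], by simp⟩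

theorem of (h : x ∈ S) (hk : 1 ≤ k := by norm_num) : Bl S k x := ⟨[x], by simp [h, hk]⟩

theorem mono (h : Bl S k x) (hS : S ⊆ S') (hk : k ≤ k') : Bl S' k' x := by
  obtain ⟨l, h1, h2, h3⟩ := h
  exact ⟨l, h1.trans hk, fun y hy => (h2 y hy).imp (fun h => hS h) (fun h => hS h), h3⟩

theorem le (h : Bl S k x) (hk : k ≤ k') : Bl S k' x := h.mono le_rfl hk

theorem mul (hx : Bl S k x) (hy : Bl S k' y) : Bl S (k + k') (x * y) := by
  obtain ⟨l, h1, h2, h3⟩ := hx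
  obtain ⟨l', h1', h2', h3'⟩ := hy
  refine ⟨l ++ l', by simp; omega, ?_, by simp [h3, h3']⟩
  intro z hz
  rcases List.mem_append.1 hz with h | h
  exacts [h2 z h, h2' z h]

theorem inv (hx : Bl S k x) : Bl S k x⁻¹ := by
  obtain ⟨l, h1, h2, h3⟩ := hx
  refine ⟨(l.map (·⁻¹)).reverse, by simpa, ?_, by rw [← h3, List.prod_inv_reverse]⟩
  intro z hz
  simp only [List.mem_reverse, List.mem_map] at hz
  obtain ⟨y, hy, rfl⟩ := hz
  rw [inv_inv]
  exact (h2 y hy).symm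

theorem conj (hx : Bl S k x) (hy : Bl S k' y) : Bl S (k + k' + k) (x * y * x⁻¹) :=
  (hx.mul hy).mul hx.inv

theorem comm (hx : Bl S k x) (hy : Bl S k' y) : Bl S (k + k' + k + k') ⁅x, y⁆ := by
  rw [commutatorElement_def]; exact ((hx.mul hy).mul hx.inv).mul hy.inv

theorem pow (hx : Bl S k x) (n : ℕ) : Bl S (n * k) (x ^ n) := by
  induction n with
  | zero => simpa using one
  | succ n ih => rw [pow_succ, Nat.succ_mul]; exact ih.mul hx

theorem lprod (l : List G) (h : ∀ y ∈ l, Bl S k y) : Bl S (l.length * k) l.prod := by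
  induction l with
  | nil => simpa using one
  | cons a l ih =>
    rw [List.prod_cons]
    exact ((h a (by simp)).mul (ih fun y hy => h y (by simp [hy]))).le (by rw [List.length_cons, Nat.succ_mul, add_comm])

theorem comp (h : ∀ s ∈ S, Bl S' k s) (hx : Bl S k' x) : Bl S' (k' * k) x := by
  obtain ⟨l, h1, h2, rfl⟩ := hx
  refine (lprod l fun y hy => ?_).le (Nat.mul_le_mul_right k h1)
  rcases h2 y hy with h' | h'
  · exact h y h'
  · simpa using (h _ h').inv

theorem map (f : G →* H) (hx : Bl S k x) : Bl (f '' S) k (f x) := by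
  obtain ⟨l, h1, h2, rfl⟩ := hx
  refine ⟨l.map f, by simpa, ?_, (map_list_prod f l).symm⟩
  intro z hz
  obtain ⟨y, hy, rfl⟩ := List.mem_map.1 hz
  rw [← map_inv]
  exact (h2 y hy).imp (fun h => ⟨_, h, rfl⟩) (fun h => ⟨_, h, rfl⟩)

theorem mem_closure (hx : Bl S k x) : x ∈ Subgroup.closure S := by
  obtain ⟨l, h1, h2, rfl⟩ := hx
  refine Subgroup.list_prod_mem _ fun y hy => ?_
  rcases h2 y hy with h' | h'
  · exact Subgroup.subset_closure h'
  · simpa using (Subgroup.closure S).inv_mem (Subgroup.subset_closure h')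

theorem norm_le {I : Type} [DecidableEq I] {w : FreeGroup I}
    (h : Bl (Set.range (FreeGroup.of : I → FreeGroup I)) k w) : FreeGroup.norm w ≤ k := by
  obtain ⟨l, h1, h2, rfl⟩ := h
  refine le_trans ?_ h1
  clear h1
  induction l with
  | nil => simp
  | cons a l ih =>
    rw [List.prod_cons, List.length_cons]
    refine (FreeGroup.norm_mul_le _ _).trans ?_
    have := ih fun y hy => h2 y (by simp [hy])
    have h3 : FreeGroup.norm a ≤ 1 := by
      rcases h2 a (by simp) with ⟨i, hi⟩ | ⟨i, hi⟩
      · rw [← hi]; simp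
      · rw [← FreeGroup.norm_inv_eq, ← hi]; simp
    omega

theorem exists_word {I : Type} {g : I → G} (h : Bl (Set.range g) k x) :
    ∃ w, Bl (Set.range (FreeGroup.of : I → FreeGroup I)) k w ∧ FreeGroup.lift g w = x := by
  obtain ⟨l, h1, h2, rfl⟩ := h
  induction l generalizing k with
  | nil => exact ⟨1, one, by simp⟩
  | cons a l ih =>
    obtain ⟨w, hw, hw'⟩ := ih le_rfl fun y hy => h2 y (by simp [hy])
    have : ∃ v, Bl (Set.range (FreeGroup.of : I → FreeGroup I)) 1 v ∧ FreeGroup.lift g v = a := by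
      rcases h2 a (by simp) with ⟨i, hi⟩ | ⟨i, hi⟩
      · exact ⟨FreeGroup.of i, of (Set.mem_range_self i), by simpa⟩
      · exact ⟨(FreeGroup.of i)⁻¹, (of (Set.mem_range_self i)).inv, by simp [hi]⟩
    obtain ⟨v, hv, hv'⟩ := this
    exact ⟨v * w, (hv.mul hw).le (by simpa [add_comm] using h1), by simp [hv', hw']⟩

end Bl

/-- `G` has a presentation with at most `c` generators and relators, relators have length at most
`c * ℓ`, and the elements of `T` are words of length at most `c * ℓ` in the generators. -/
def SP (c ℓ : ℕ) (G : Type) [Group G] (T : Set G) : Prop :=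
  ∃ (I J : Type) (_ : Fintype I) (_ : Fintype J) (g : I → G) (R : J → FreeGroup I),
    Fintype.card I ≤ c ∧ Fintype.card J ≤ c ∧
    (∀ j, Bl (Set.range FreeGroup.of) (c * ℓ) (R j)) ∧
    (∀ j, FreeGroup.lift g (R j) = 1) ∧
    (∀ t ∈ T, Bl (Set.range g) (c * ℓ) t) ∧
    Subgroup.closure (Set.range g) = ⊤ ∧
    ∀ (Γ : Type) [Group Γ] (γ : I → Γ), (∀ j, FreeGroup.lift γ (R j) = 1) →
      ∃ φ : G →* Γ, ∀ i, φ (g i) = γ i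

namespace SP

variable {G H K : Type} [Group G] [Group H] [Group K] {T T' : Set G} {c c' k ℓ ℓ' : ℕ}

theorem mono (h : SP c ℓ G T) (hc : c ≤ c') (hl : ℓ ≤ ℓ') (hT : T' ⊆ T) : SP c' ℓ' G T' := by
  obtain ⟨I, J, _, _, g, R, h1, h2, h3, h4, h5, h6, h7⟩ := h
  have := Nat.mul_le_mul hc hl
  exact ⟨I, J, _, _, g, R, h1.trans hc, h2.trans hc, fun j => (h3 j).le this, h4,
    fun t ht => (h5 t (hT ht)).le this, h6, fun Γ _ => h7 Γ⟩

theorem ball (h : SP c ℓ G T) (k : ℕ) (hk : 1 ≤ k) : SP (k * c) ℓ G {x | Bl T k x} := by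
  obtain ⟨I, J, _, _, g, R, h1, h2, h3, h4, h5, h6, h7⟩ := h
  have e : c ≤ k * c := Nat.le_mul_of_pos_left _ hk
  have := Nat.mul_le_mul e (le_refl ℓ)
  exact ⟨I, J, _, _, g, R, h1.trans e, h2.trans e, fun j => (h3 j).le this, h4,
    fun t ht => (Bl.comp h5 ht).le (by rw [mul_assoc]), h6, fun Γ _ => h7 Γ⟩

theorem gens (h : SP c ℓ G T) (hl : 1 ≤ ℓ) : ∃ a : Fin c → G, Subgroup.closure (Set.range a) = ⊤ ∧
    SP c ℓ G (T ∪ Set.range a) := by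
  obtain ⟨I, J, _, _, g, R, h1, h2, h3, h4, h5, h6, h7⟩ := h
  have : ∃ a : Fin c → G, Set.range g ⊆ Set.range a ∧ Set.range a ⊆ Set.range g ∪ {1} := by
    let e := Fintype.equivFin I
    refine ⟨fun i => if hi : (i : ℕ) < Fintype.card I then g (e.symm ⟨i, hi⟩) else 1, ?_, ?_⟩
    · rintro _ ⟨i, rfl⟩
      refine ⟨⟨e i, (e i).2.trans_le h1⟩, by simp⟩
    · rintro _ ⟨i, rfl⟩
      dsimp only
      split_ifs <;> simp
  obtain ⟨a, ha, ha'⟩ := this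
  refine ⟨a, top_le_iff.1 (h6 ▸ Subgroup.closure_mono ha), I, J, _, _, g, R, h1, h2, h3, h4, ?_,
    h6, fun Γ _ => h7 Γ⟩
  rintro t (ht | ht)
  · exact h5 t ht
  · rcases ha' ht with ht' | ht'
    · refine Bl.of ht' ?_
      obtain ⟨i, rfl⟩ := ht'
      have : 1 ≤ c := le_trans (Fintype.card_pos_iff.2 ⟨i⟩) h1
      exact Nat.mul_pos this hl
    · rw [ht']; exact Bl.one

theorem equiv (h : SP c ℓ G T) (e : G ≃* H) : SP c ℓ H (e '' T) := by
  obtain ⟨I, J, _, _, g, R, h1, h2, h3, h4, h5, h6, h7⟩ := h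
  have hl : ∀ w, FreeGroup.lift (fun i => e (g i)) w = e (FreeGroup.lift g w) := fun w => by
    have : FreeGroup.lift (fun i => e (g i)) = e.toMonoidHom.comp (FreeGroup.lift g) := by
      ext; simp
    rw [this]; rfl
  have hr : Set.range (fun i => e (g i)) = e.toMonoidHom '' Set.range g := by
    ext; simp
  refine ⟨I, J, _, _, fun i => e (g i), R, h1, h2, h3, fun j => by rw [hl, h4, map_one], ?_, ?_, ?_⟩
  · rintro _ ⟨t, ht, rfl⟩
    rw [hr]
    exact (h5 t ht).map e.toMonoidHom
  · rw [hr, ← MonoidHom.map_closure, h6, ← MonoidHom.range_eq_map]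
    exact MonoidHom.range_eq_top.2 e.surjective
  · intro Γ _ γ hγ
    obtain ⟨φ, hφ⟩ := h7 Γ γ hγ
    exact ⟨φ.comp e.symm.toMonoidHom, fun i => by simp [hφ]⟩

theorem finite (G : Type) [Group G] [Finite G] (c ℓ : ℕ) (hl : 1 ≤ ℓ) (hc : Nat.card G ≤ c) :
    SP (c ^ 2 + 3) ℓ G Set.univ := by
  classical
  cases nonempty_fintype G
  rw [Nat.card_eq_fintype_card] at hc
  have h3 : 3 ≤ (c ^ 2 + 3) * ℓ := by nlinarith [Nat.zero_le (c^2)]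
  have of' : ∀ i : G, Bl (Set.range (FreeGroup.of : G → FreeGroup G)) 1 (FreeGroup.of i) :=
    fun i => Bl.of ⟨i, rfl⟩
  refine ⟨G, G × G, inferInstance, inferInstance, id,
    fun p => FreeGroup.of p.1 * FreeGroup.of p.2 * (FreeGroup.of (p.1 * p.2))⁻¹, ?_, ?_, ?_, ?_, ?_,
    ?_, ?_⟩
  · nlinarith
  · rw [Fintype.card_prod]; nlinarith
  · rintro ⟨a, b⟩
    exact (((of' a).mul (of' b)).mul (of' (a * b)).inv).le h3
  · rintro ⟨a, b⟩; simp
  · intro t _; exact Bl.of ⟨t, rfl⟩ (by omega)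
  · simp
  · intro Γ _ γ hγ
    refine ⟨MonoidHom.mk' γ fun a b => ?_, fun i => rfl⟩
    have := hγ (a, b)
    simp only [map_mul, FreeGroup.lift_apply_of, map_inv] at this
    exact (mul_inv_eq_one.1 this).symm

theorem free (I : Type) [Fintype I] (ℓ : ℕ) (k : ℕ) (hk : Fintype.card I ≤ k) :
    SP k ℓ (FreeGroup I) {x | Bl (Set.range FreeGroup.of) (k * ℓ) x} := by
  refine ⟨I, Empty, inferInstance, inferInstance, FreeGroup.of, Empty.elim, hk, by simp, by simp,
    by simp, fun t ht => ht, FreeGroup.closure_range_of I, ?_⟩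
  intro Γ _ γ _
  exact ⟨FreeGroup.lift γ, by simp⟩

theorem coprod {T₂ : Set H} (h : SP c ℓ G T) (h' : SP c' ℓ H T₂) :
    SP (c + c') ℓ (Monoid.Coprod G H) (Monoid.Coprod.inl '' T ∪ Monoid.Coprod.inr '' T₂) := by
  obtain ⟨I, J, _, _, g, R, h1, h2, h3, h4, h5, h6, h7⟩ := h
  obtain ⟨I', J', _, _, g', R', h1', h2', h3', h4', h5', h6', h7'⟩ := h'
  let gg : I ⊕ I' → Monoid.Coprod G H :=
    Sum.elim (fun i => Monoid.Coprod.inl (g i)) (fun i => Monoid.Coprod.inr (g' i))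
  have e1 : c * ℓ ≤ (c + c') * ℓ := Nat.mul_le_mul_right _ (by omega)
  have e2 : c' * ℓ ≤ (c + c') * ℓ := Nat.mul_le_mul_right _ (by omega)
  have r1 : Monoid.Coprod.inl '' Set.range g ⊆ Set.range gg := by
    rintro _ ⟨_, ⟨i, rfl⟩, rfl⟩; exact ⟨Sum.inl i, rfl⟩
  have r2 : Monoid.Coprod.inr '' Set.range g' ⊆ Set.range gg := by
    rintro _ ⟨_, ⟨i, rfl⟩, rfl⟩; exact ⟨Sum.inr i, rfl⟩
  have l1 : ∀ (Γ : Type) [Group Γ] (γ : I ⊕ I' → Γ) w, FreeGroup.lift γ (FreeGroup.map Sum.inl w)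
      = FreeGroup.lift (γ ∘ Sum.inl) w := by
    intro Γ _ γ w
    have : (FreeGroup.lift γ).comp (FreeGroup.map Sum.inl) = FreeGroup.lift (γ ∘ Sum.inl) := by
      ext; simp
    rw [← this]; rfl
  have l2 : ∀ (Γ : Type) [Group Γ] (γ : I ⊕ I' → Γ) w, FreeGroup.lift γ (FreeGroup.map Sum.inr w)
      = FreeGroup.lift (γ ∘ Sum.inr) w := by
    intro Γ _ γ w
    have : (FreeGroup.lift γ).comp (FreeGroup.map Sum.inr) = FreeGroup.lift (γ ∘ Sum.inr) := by
      ext; simp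
    rw [← this]; rfl
  refine ⟨I ⊕ I', J ⊕ J', inferInstance, inferInstance, gg,
    Sum.elim (fun j => FreeGroup.map Sum.inl (R j)) (fun j => FreeGroup.map Sum.inr (R' j)),
    ?_, ?_, ?_, ?_, ?_, ?_, ?_⟩
  · rw [Fintype.card_sum]; omega
  · rw [Fintype.card_sum]; omega
  · rintro (j | j)
    · refine ((h3 j).map (FreeGroup.map Sum.inl)).mono ?_ e1
      rintro _ ⟨_, ⟨i, rfl⟩, rfl⟩; exact ⟨Sum.inl i, by simp⟩
    · refine ((h3' j).map (FreeGroup.map Sum.inr)).mono ?_ e2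
      rintro _ ⟨_, ⟨i, rfl⟩, rfl⟩; exact ⟨Sum.inr i, by simp⟩
  · rintro (j | j)
    · simp only [Sum.elim_inl, l1]
      have : FreeGroup.lift (gg ∘ Sum.inl) = Monoid.Coprod.inl.comp (FreeGroup.lift g) := by
        ext; simp [gg]
      rw [this, MonoidHom.comp_apply, h4, map_one]
    · simp only [Sum.elim_inr, l2]
      have : FreeGroup.lift (gg ∘ Sum.inr) = Monoid.Coprod.inr.comp (FreeGroup.lift g') := by
        ext; simp [gg]
      rw [this, MonoidHom.comp_apply, h4', map_one]
  · rintro _ (⟨t, ht, rfl⟩ | ⟨t, ht, rfl⟩)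
    · exact ((h5 t ht).map (Monoid.Coprod.inl : G →* Monoid.Coprod G H)).mono r1 e1
    · exact ((h5' t ht).map (Monoid.Coprod.inr : H →* Monoid.Coprod G H)).mono r2 e2
  · rw [← top_le_iff, ← Monoid.Coprod.range_inl_sup_range_inr, sup_le_iff]
    constructor
    · rw [MonoidHom.range_eq_map, ← h6, MonoidHom.map_closure]
      exact Subgroup.closure_mono r1
    · rw [MonoidHom.range_eq_map, ← h6', MonoidHom.map_closure]
      exact Subgroup.closure_mono r2
  · intro Γ _ γ hγ
    obtain ⟨φ, hφ⟩ := h7 Γ (γ ∘ Sum.inl) fun j => by rw [← l1]; exact hγ (Sum.inl j)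
    obtain ⟨φ', hφ'⟩ := h7' Γ (γ ∘ Sum.inr) fun j => by rw [← l2]; exact hγ (Sum.inr j)
    refine ⟨Monoid.Coprod.lift φ φ', ?_⟩
    rintro (i | i)
    · simp [gg, hφ]
    · simp [gg, hφ']

/-- Adding relators. -/
theorem quot {T : Set K} (h : SP c ℓ K T) (f : K →* G) (hf : Function.Surjective f)
    {N : Type} [Fintype N] (hN : Fintype.card N ≤ c') (E : N → K) (hE : ∀ i, Bl T k (E i))
    (hE1 : ∀ i, f (E i) = 1)
    (hker : f.ker ≤ Subgroup.normalClosure (Set.range E)) :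
    SP ((k + 1) * c + c') ℓ G (f '' T) := by
  obtain ⟨I, J, _, _, g, R, h1, h2, h3, h4, h5, h6, h7⟩ := h
  have e1 : c * ℓ ≤ ((k + 1) * c + c') * ℓ :=
    Nat.mul_le_mul_right _ (by nlinarith)
  have e2 : k * (c * ℓ) ≤ ((k + 1) * c + c') * ℓ := by
    rw [← mul_assoc]; exact Nat.mul_le_mul_right _ (by nlinarith)
  have hw : ∀ i, ∃ w, Bl (Set.range (FreeGroup.of : I → FreeGroup I)) (k * (c * ℓ)) w ∧
      FreeGroup.lift g w = E i := fun i => Bl.exists_word (Bl.comp h5 (hE i))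
  choose w hw1 hw2 using hw
  have hl : FreeGroup.lift (fun i => f (g i)) = f.comp (FreeGroup.lift g) := by
    ext; simp
  have hr : Set.range (fun i => f (g i)) = f '' Set.range g := by
    ext; simp
  refine ⟨I, J ⊕ N, inferInstance, inferInstance, fun i => f (g i), Sum.elim R w, ?_, ?_, ?_, ?_,
    ?_, ?_, ?_⟩
  · nlinarith
  · rw [Fintype.card_sum]; nlinarith
  · rintro (j | j)
    · exact (h3 j).le e1
    · exact (hw1 j).le e2
  · rintro (j | j)
    · simp only [hl, MonoidHom.comp_apply, Sum.elim_inl, h4, map_one]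
    · simp only [hl, MonoidHom.comp_apply, Sum.elim_inr, hw2, hE1]
  · rintro _ ⟨t, ht, rfl⟩
    rw [hr]
    exact ((h5 t ht).map f).le e1
  · rw [hr, ← MonoidHom.map_closure, h6, ← MonoidHom.range_eq_map]
    exact MonoidHom.range_eq_top.2 hf
  · intro Γ _ γ hγ
    obtain ⟨φ, hφ⟩ := h7 Γ γ fun j => hγ (Sum.inl j)
    have hφl : FreeGroup.lift γ = φ.comp (FreeGroup.lift g) := by
      ext i; simp [hφ]
    have hk : f.ker ≤ φ.ker := hker.trans <| Subgroup.normalClosure_le_normal <| by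
      rintro _ ⟨i, rfl⟩
      have := hγ (Sum.inr i)
      rw [hφl] at this
      simpa [hw2] using this
    refine ⟨f.liftOfSurjective hf ⟨φ, hk⟩, fun i => ?_⟩
    have := MonoidHom.liftOfRightInverse_comp_apply f _ (Function.rightInverse_surjInv hf) ⟨φ, hk⟩ (g i)
    rw [← hφ]
    exact this

/-- Adding relators, with the injectivity criterion phrased through an arbitrary quotient. -/
theorem assemble {T : Set K} (h : SP c ℓ K T) (f : K →* G) (hf : Function.Surjective f)
    {N : Type} [Fintype N] (hN : Fintype.card N ≤ c') (E : N → K) (hE : ∀ i, Bl T k (E i))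
    (hE1 : ∀ i, f (E i) = 1)
    (hker : ∀ (Γ : Type) [Group Γ] (ψ : K →* Γ) (π : Γ →* G), Function.Surjective ψ →
      (∀ x, π (ψ x) = f x) → (∀ i, ψ (E i) = 1) → Function.Injective π) :
    SP ((k + 1) * c + c') ℓ G (f '' T) := by
  refine quot h f hf hN E hE hE1 ?_
  have hle : Subgroup.normalClosure (Set.range E) ≤ f.ker :=
    Subgroup.normalClosure_le_normal (by rintro _ ⟨i, rfl⟩; exact hE1 i)
  have := hker (K ⧸ Subgroup.normalClosure (Set.range E)) (QuotientGroup.mk' _)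
    (QuotientGroup.lift _ f hle) (QuotientGroup.mk'_surjective _) (fun x => rfl)
    (fun i => (QuotientGroup.eq_one_iff _).2 (Subgroup.subset_normalClosure ⟨i, rfl⟩))
  intro x hx
  rw [← QuotientGroup.eq_one_iff]
  apply this
  rw [map_one]
  exact hx

/-- Direct powers. -/
theorem pi (r : ℕ) (h : SP c ℓ G T) (hl : 1 ≤ ℓ) :
    SP (r * c + (r * c) ^ 2 + 4 + r * c) ℓ (Fin r → G) {x | ∀ i, x i ∈ T} := by
  classical
  obtain ⟨I, J, _, _, g, R, h1, h2, h3, h4, h5, h6, h7⟩ := h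
  set c0 := r * c + (r * c) ^ 2 + 4 + r * c with hc0
  let gg : Fin r × I → (Fin r → G) := fun p => Pi.mulSingle p.1 (g p.2)
  have hgg : ∀ (i : Fin r) (w), FreeGroup.lift gg (FreeGroup.map (Prod.mk i) w)
      = Pi.mulSingle i (FreeGroup.lift g w) := by
    intro i w
    have : (FreeGroup.lift gg).comp (FreeGroup.map (Prod.mk i)) =
      (MonoidHom.mulSingle (fun _ : Fin r => G) i).comp (FreeGroup.lift g) := by
      ext x : 1; simp [gg]
    exact DFunLike.congr_fun this w
  have hsub : ∀ i : Fin r, (MonoidHom.mulSingle (fun _ : Fin r => G) i) '' Set.range g ⊆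
      Set.range gg := by
    rintro i _ ⟨_, ⟨x, rfl⟩, rfl⟩; exact ⟨(i, x), rfl⟩
  have of' : ∀ i, Bl (Set.range (FreeGroup.of : Fin r × I → _)) 1 (FreeGroup.of i) :=
    fun i => Bl.of ⟨i, rfl⟩
  have e0 : r * (c * ℓ) ≤ c0 * ℓ := by
    rw [← mul_assoc]; exact Nat.mul_le_mul_right _ (by omega)
  have eprod : ∀ x : Fin r → G, x = (List.ofFn fun i => (Pi.mulSingle i (x i) : Fin r → G)).prod := by
    intro x
    funext j
    have := congrArg List.prod (List.map_ofFn (f := fun i => (Pi.mulSingle i (x i) : Fin r → G))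
      (g := Pi.evalMonoidHom (fun _ : Fin r => G) j))
    rw [← map_list_prod] at this
    simp only [Pi.evalMonoidHom_apply] at this
    rw [this]
    have key : ∀ (m : ℕ) (f : Fin m → G) (j : Fin m), (∀ i, i ≠ j → f i = 1) →
        (List.ofFn f).prod = f j := by
      intro m
      induction m with
      | zero => intro f j; exact j.elim0
      | succ m ih =>
        intro f j hj
        rw [List.ofFn_succ, List.prod_cons]
        rcases Fin.eq_zero_or_eq_succ j with rfl | ⟨j, rfl⟩
        · rw [List.prod_eq_one, mul_one]
          intro y hy
          obtain ⟨i, rfl⟩ := (List.mem_ofFn' _ _).1 hy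
          exact hj _ (Fin.succ_ne_zero _)
        · rw [hj 0 (Fin.succ_ne_zero _).symm, one_mul]
          exact ih _ j fun i hi => hj _ (by simpa using hi)
    rw [key r _ j]
    · simp
    · intro i hi
      simp [Pi.mulSingle_eq_of_ne hi.symm]
  refine ⟨Fin r × I, (Fin r × J) ⊕ ((Fin r × I) × (Fin r × I)), inferInstance, inferInstance, gg,
    Sum.elim (fun p => FreeGroup.map (Prod.mk p.1) (R p.2))
      (fun p => if p.1.1 = p.2.1 then 1 else ⁅FreeGroup.of p.1, FreeGroup.of p.2⁆),
    ?_, ?_, ?_, ?_, ?_, ?_, ?_⟩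
  · rw [Fintype.card_prod, Fintype.card_fin]
    have := Nat.mul_le_mul_left r h1
    omega
  · simp only [Fintype.card_sum, Fintype.card_prod, Fintype.card_fin]
    have := Nat.mul_le_mul_left r h1
    have h' := Nat.mul_le_mul_left r h2
    have := Nat.mul_le_mul this this
    rw [← pow_two (r * c)] at this
    omega
  · rintro (⟨i, j⟩ | ⟨a, b⟩)
    · refine ((h3 j).map (FreeGroup.map (Prod.mk i))).mono ?_ (le_trans ?_ e0)
      · rintro _ ⟨_, ⟨x, rfl⟩, rfl⟩; exact ⟨(i, x), by simp⟩
      · exact Nat.le_mul_of_pos_left _ (i.pos)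
    · dsimp only [Sum.elim_inr]
      split_ifs
      · exact Bl.one
      · refine ((of' a).comm (of' b)).le ?_
        nlinarith
  · rintro (⟨i, j⟩ | ⟨a, b⟩)
    · simp [hgg, h4]
    · dsimp only [Sum.elim_inr]
      split_ifs with hab
      · simp
      · rw [map_commutatorElement, commutatorElement_eq_one_iff_commute]
        simp only [FreeGroup.lift_apply_of, gg]
        exact Pi.mulSingle_commute hab _ _
  · intro t ht
    rw [eprod t]
    refine (Bl.lprod (k := c * ℓ) _ ?_).le (by simpa using e0)
    intro y hy
    obtain ⟨i, rfl⟩ := (List.mem_ofFn' _ _).1 hy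
    exact ((h5 _ (ht i)).map (MonoidHom.mulSingle (fun _ : Fin r => G) i)).mono (hsub i) le_rfl
  · rw [← top_le_iff]
    intro x _
    rw [eprod x]
    refine Subgroup.list_prod_mem _ ?_
    intro y hy
    obtain ⟨i, rfl⟩ := (List.mem_ofFn' _ _).1 hy
    have : x i ∈ Subgroup.closure (Set.range g) := by rw [h6]; trivial
    have := Subgroup.mem_map_of_mem (MonoidHom.mulSingle (fun _ : Fin r => G) i) this
    rw [MonoidHom.map_closure] at this
    exact Subgroup.closure_mono (hsub i) this
  · intro Γ _ γ hγ
    have : ∀ i : Fin r, ∃ φ : G →* Γ, ∀ x, φ (g x) = γ (i, x) := by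
      intro i
      apply h7 Γ (fun x => γ (i, x))
      intro j
      have h0 := hγ (Sum.inl (i, j))
      have : FreeGroup.lift (fun x => γ (i, x)) = (FreeGroup.lift γ).comp (FreeGroup.map (Prod.mk i)) := by
        ext; simp
      rw [this]; exact h0
    choose φ hφ using this
    have hcomm : Pairwise fun i j => ∀ x y, Commute (φ i x) (φ j y) := by
      intro i j hij x y
      have hx : x ∈ Subgroup.closure (Set.range g) := by rw [h6]; trivial
      have hy : y ∈ Subgroup.closure (Set.range g) := by rw [h6]; trivial
      induction hx using Subgroup.closure_induction with
      | one => simp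
      | mul a b _ _ ha hb => rw [map_mul]; exact ha.mul_left hb
      | inv a _ ha => rw [map_inv]; exact ha.inv_left
      | mem a ha =>
        obtain ⟨a, rfl⟩ := ha
        induction hy using Subgroup.closure_induction with
        | one => simp
        | mul a b _ _ ha hb => rw [map_mul]; exact ha.mul_right hb
        | inv a _ ha => rw [map_inv]; exact ha.inv_right
        | mem b hb =>
          obtain ⟨b, rfl⟩ := hb
          have := hγ (Sum.inr ((i, a), (j, b)))
          simp only [Sum.elim_inr, if_neg hij, map_commutatorElement, FreeGroup.lift_apply_of] at this
          rw [hφ, hφ]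
          exact commutatorElement_eq_one_iff_commute.1 this
    refine ⟨MonoidHom.noncommPiCoprod φ hcomm, ?_⟩
    rintro ⟨i, x⟩
    simp only [gg]
    rw [MonoidHom.noncommPiCoprod_mulSingle, hφ]

end SP

theorem SP.toHBP {G : Type} [Group G] {T : Set G} {c ℓ : ℕ} (h : SP c ℓ G T) (C : ℕ) (L : ℝ)
    (hC : c ≤ C) (hL : ((c + c * (c * ℓ) : ℕ) : ℝ) ≤ L) : HasBoundedPresentation G C C L := by
  classical
  obtain ⟨I, J, _, _, g, R, h1, h2, h3, h4, h5, h6, h7⟩ := h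
  let e := Fintype.equivFin I
  let π : FreeGroup (Fin (Fintype.card I)) →* G := FreeGroup.lift (g ∘ e.symm)
  let R' : J → FreeGroup (Fin (Fintype.card I)) := fun j => FreeGroup.map e (R j)
  have hπR : ∀ j, π (R' j) = 1 := by
    intro j
    rw [← h4 j]
    have : π.comp (FreeGroup.map e) = FreeGroup.lift g := by ext; simp [π]
    rw [← this]; rfl
  refine ⟨Fintype.card I, π, Finset.univ.image R', h1.trans hC, ?_, ?_, ?_, ?_⟩
  · rw [← MonoidHom.range_eq_top, ← top_le_iff, ← h6, Subgroup.closure_le]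
    rintro _ ⟨i, rfl⟩
    exact ⟨FreeGroup.of (e i), by simp [π]⟩
  · exact Finset.card_image_le.trans (by rw [Finset.card_univ]; omega)
  · apply le_antisymm
    · intro x hx
      obtain ⟨φ, hφ⟩ := h7 (FreeGroup (Fin (Fintype.card I)) ⧸ Subgroup.normalClosure
        ((Finset.univ.image R' : Finset _) : Set (FreeGroup (Fin (Fintype.card I)))))
        (fun i => QuotientGroup.mk (FreeGroup.of (e i))) (by
          intro j
          have : FreeGroup.lift (fun i => (QuotientGroup.mk (FreeGroup.of (e i)) :
            FreeGroup (Fin (Fintype.card I)) ⧸ Subgroup.normalClosure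
        ((Finset.univ.image R' : Finset _) : Set (FreeGroup (Fin (Fintype.card I)))))) =
            (QuotientGroup.mk' _).comp (FreeGroup.map e) := by ext; simp
          rw [this]
          refine (QuotientGroup.eq_one_iff _).2 (Subgroup.subset_normalClosure ?_)
          simp [R'])
      have : φ.comp π = QuotientGroup.mk' _ := by
        ext i; simp [π, hφ]
      rw [← QuotientGroup.eq_one_iff]
      have h' := DFunLike.congr_fun this x
      rw [MonoidHom.comp_apply, (hx : π x = 1), map_one] at h'
      exact h'.symm
    · apply Subgroup.normalClosure_le_normal
      intro x hx
      simp only [Finset.coe_image, Finset.coe_univ, Set.image_univ, Set.mem_range] at hx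
      obtain ⟨j, rfl⟩ := hx
      exact hπR j
  · refine le_trans ?_ hL
    norm_cast
    refine Nat.add_le_add h1 ?_
    refine (Finset.sum_le_card_nsmul _ _ (c * ℓ) ?_).trans ?_
    · intro w hw
      obtain ⟨j, _, rfl⟩ := Finset.mem_image.1 hw
      refine Bl.norm_le (((h3 j).map (FreeGroup.map e)).mono ?_ le_rfl)
      rintro _ ⟨_, ⟨i, rfl⟩, rfl⟩; exact ⟨e i, by simp⟩
    · rw [smul_eq_mul]
      refine Nat.mul_le_mul_right _ (Finset.card_image_le.trans ?_)
      rwa [Finset.card_univ]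

namespace SL2

open Matrix (det_fin_two adjugate_fin_two)
open scoped Matrix

variable {F : Type} [Field F]

/-- upper unipotent -/
def U (t : F) : Matrix.SpecialLinearGroup (Fin 2) F := ⟨!![1, t; 0, 1], by simp [det_fin_two]⟩
/-- Weyl element -/
def W : Matrix.SpecialLinearGroup (Fin 2) F := ⟨!![0, 1; -1, 0], by simp [det_fin_two]⟩
/-- torus -/
def D (t : Fˣ) : Matrix.SpecialLinearGroup (Fin 2) F :=
  ⟨!![(t : F), 0; 0, ((t⁻¹ : Fˣ) : F)], by simp [det_fin_two]⟩

theorem ext' {A B : Matrix.SpecialLinearGroup (Fin 2) F}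
    (h : (A : Matrix (Fin 2) (Fin 2) F) = (B : Matrix (Fin 2) (Fin 2) F)) : A = B := Subtype.ext h

theorem coe_X (t : F) : (U t : Matrix (Fin 2) (Fin 2) F) = !![1, t; 0, 1] := rfl
theorem coe_W : ((W : Matrix.SpecialLinearGroup (Fin 2) F) : Matrix (Fin 2) (Fin 2) F) = !![0, 1; -1, 0] := rfl
theorem coe_D (t : Fˣ) : (D t : Matrix (Fin 2) (Fin 2) F) = !![(t : F), 0; 0, ((t⁻¹ : Fˣ) : F)] := rfl
theorem coe_Winv : ((W⁻¹ : Matrix.SpecialLinearGroup (Fin 2) F) : Matrix (Fin 2) (Fin 2) F) = !![0, -1; 1, 0] := by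
  rw [Matrix.SpecialLinearGroup.coe_inv, coe_W, adjugate_fin_two]; simp

theorem X_add (s t : F) : U (s + t) = U s * U t := by
  apply ext'; rw [Matrix.SpecialLinearGroup.coe_mul]; simp [coe_X, add_comm]

theorem X_zero : U (0 : F) = 1 := by
  apply ext'; rw [Matrix.SpecialLinearGroup.coe_one, coe_X]; simp [Matrix.one_fin_two]

theorem D_mul (s t : Fˣ) : D (s * t) = D s * D t := by
  apply ext'; rw [Matrix.SpecialLinearGroup.coe_mul]; simp [coe_D, mul_comm]

theorem D_one : D (1 : Fˣ) = 1 := by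
  apply ext'; rw [Matrix.SpecialLinearGroup.coe_one, coe_D]; simp [Matrix.one_fin_two]

theorem D_X (t : Fˣ) (a : F) : D t * U a * (D t)⁻¹ = U (t ^ 2 * a) := by
  rw [mul_inv_eq_iff_eq_mul]
  apply ext'; simp only [Matrix.SpecialLinearGroup.coe_mul]; simp [coe_D, coe_X]; field_simp

theorem W_D (t : Fˣ) : W * D t * W⁻¹ = (D t)⁻¹ := by
  rw [mul_inv_eq_iff_eq_mul, eq_inv_mul_iff_mul_eq]
  apply ext'; simp only [Matrix.SpecialLinearGroup.coe_mul]; simp [coe_D, coe_W]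

theorem D_W (t : Fˣ) : D t * W = U (t : F) * (W * U ((t⁻¹ : Fˣ) : F) * W⁻¹) * U (t : F) := by
  apply ext'; simp only [Matrix.SpecialLinearGroup.coe_mul]; simp [coe_D, coe_X, coe_W, coe_Winv]

theorem bruhat (g : Matrix.SpecialLinearGroup (Fin 2) F) : Bl (Set.range U ∪ {W}) 6 g := by
  have hX : ∀ t : F, Bl (Set.range U ∪ {W}) 1 (U t) := fun t => Bl.of (Or.inl ⟨t, rfl⟩)
  have hW : Bl (Set.range U ∪ {W}) 1 (W : Matrix.SpecialLinearGroup (Fin 2) F) := Bl.of (Or.inr rfl)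
  have key : ∀ g : Matrix.SpecialLinearGroup (Fin 2) F, g 1 0 ≠ 0 → Bl (Set.range U ∪ {W}) 5 g := by
    intro g hg
    have hd := g.det_coe
    rw [det_fin_two] at hd
    have : g = U ((g 0 0 - 1) / g 1 0) * (W * U (-g 1 0) * W⁻¹) * U ((g 1 1 - 1) / g 1 0) := by
      apply ext'; simp only [Matrix.SpecialLinearGroup.coe_mul]
      simp only [coe_X, coe_W, coe_Winv]
      ext i j
      fin_cases i <;> fin_cases j <;> simp <;> field_simp <;>
        first | ring1 | linear_combination hd | linear_combination -hd
    rw [this]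
    exact ((hX _).mul (hW.conj (hX _))).mul (hX _)
  by_cases h : g 1 0 = 0
  · have h2 : ((W * g : Matrix.SpecialLinearGroup (Fin 2) F) : Matrix (Fin 2) (Fin 2) F) 1 0 ≠ 0 := by
      have hd := g.det_coe
      rw [det_fin_two, h, mul_zero, sub_zero] at hd
      rw [Matrix.SpecialLinearGroup.coe_mul, coe_W]
      simp [Matrix.mul_apply, Fin.sum_univ_two]
      intro h0
      rw [h0] at hd; simp at hd
    have := (hW.inv.mul (key _ h2))
    simpa using this
  · exact (key g h).le (by norm_num)

/-- The abstract Bruhat argument. -/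
theorem abstract_inj (om : Fˣ) (hom : ∀ t : Fˣ, ∃ i : ℕ, t = om ^ i) {Γ : Type} [Group Γ]
    (u : F → Γ) (w h : Γ) (hu : ∀ a b, u (a + b) = u a * u b)
    (h1 : ∀ a, h * u a * h⁻¹ = u (om ^ 2 * a)) (h2 : w * h * w⁻¹ = h⁻¹)
    (h3 : w = u 1 * (w * u 1 * w⁻¹) * u 1)
    (h4 : h * w = u om * (w * u ((om⁻¹ : Fˣ) : F) * w⁻¹) * u om)
    (π : Γ →* Matrix.SpecialLinearGroup (Fin 2) F) (pu : ∀ a, π (u a) = U a) (pw : π w = W)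
    (hgen : ∀ L' : Subgroup Γ, (∀ a, u a ∈ L') → w ∈ L' →
      (∀ (t : Fˣ) (g : Γ), g * w = u t * (w * u ((t⁻¹ : Fˣ) : F) * w⁻¹) * u t → g ∈ L') → L' = ⊤) :
    Function.Injective π := by
  have u0 : u 0 = 1 := by
    have := hu 0 0; rw [add_zero] at this; exact (mul_eq_left.1 this.symm)
  have un : ∀ a, (u a)⁻¹ = u (-a) := fun a => by
    rw [inv_eq_iff_mul_eq_one, ← hu, add_neg_cancel, u0]
  let n : Fˣ → Γ := fun t => u t * (w * u ((t⁻¹ : Fˣ) : F) * w⁻¹) * u t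
  have hw : h * w = w * h⁻¹ := by
    rw [mul_inv_eq_iff_eq_mul] at h2
    rw [eq_mul_inv_iff_mul_eq, mul_assoc, h2]; group
  have hw' : w⁻¹ * h⁻¹ = h * w⁻¹ := by
    have := congrArg (·⁻¹) hw; simp only [mul_inv_rev, inv_inv] at this; exact this
  have h1' : ∀ a, h⁻¹ * u a * h = u (((om⁻¹ : Fˣ) : F) ^ 2 * a) := by
    intro a
    have := h1 (((om⁻¹ : Fˣ) : F) ^ 2 * a)
    rw [← mul_assoc, ← mul_pow] at this
    simp only [Units.mul_inv, one_pow, one_mul] at this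
    rw [← this]; group
  have hn : ∀ t, h * n t * h⁻¹ = n (om ^ 2 * t) := by
    intro t
    have e : h * n t * h⁻¹ = (h * u t * h⁻¹) * ((h * w) * u ((t⁻¹ : Fˣ) : F) * (w⁻¹ * h⁻¹)) *
        (h * u t * h⁻¹) := by simp only [n]; group
    rw [e, h1, hw, hw']
    have e2 : w * h⁻¹ * u ((t⁻¹ : Fˣ) : F) * (h * w⁻¹) = w * (h⁻¹ * u ((t⁻¹ : Fˣ) : F) * h) * w⁻¹ := by
      group
    rw [e2, h1']
    simp only [n]
    congr 4
    simp [mul_comm]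
  have hni : ∀ i : ℕ, n (om ^ i) = h ^ i * w := by
    intro i
    induction i using Nat.strong_induction_on with
    | _ i ih =>
      match i, ih with
      | 0, _ => simp only [n, pow_zero, one_mul]; simpa using h3.symm
      | 1, _ => simp only [n, pow_one]; exact h4.symm
      | (i + 2), ih =>
        have := hn (om ^ i)
        rw [← pow_add, add_comm 2 i] at this
        rw [← this, ih i (by omega)]
        have : h * (h ^ i * w) * h⁻¹ = h ^ (i + 1) * (w * h⁻¹) := by
          rw [pow_succ']; group
        rw [this, ← hw, pow_succ _ (i+1)]; group
  choose ix hix using hom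
  let H : Fˣ → Γ := fun t => n t * w⁻¹
  have HH : ∀ i : ℕ, H (om ^ i) = h ^ i := fun i => by simp only [H]; rw [hni]; group
  have Hmul : ∀ s t, H (s * t) = H s * H t := by
    intro s t; rw [hix s, hix t, ← pow_add, HH, HH, HH, pow_add]
  have H1 : H 1 = 1 := by simpa using HH 0
  have Hinv : ∀ t, H t⁻¹ = (H t)⁻¹ := fun t => by
    rw [eq_inv_iff_mul_eq_one, ← Hmul, inv_mul_cancel, H1]
  have Hu : ∀ t a, H t * u a * (H t)⁻¹ = u (t ^ 2 * a) := by
    intro t a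
    rw [hix t, HH]
    induction ix t with
    | zero => simp
    | succ i ih =>
      have : h ^ (i + 1) * u a * (h ^ (i + 1))⁻¹ = h * (h ^ i * u a * (h ^ i)⁻¹) * h⁻¹ := by
        rw [pow_succ']; group
      rw [this, ih, h1]; congr 1; push_cast; ring
  have Hw : ∀ t, w * H t = H t⁻¹ * w := by
    intro t
    have : ∀ i : ℕ, w * h ^ i * w⁻¹ = (h ^ i)⁻¹ := by
      intro i
      rw [← conj_pow, h2, inv_pow]
    rw [Hinv, hix t, HH, ← this]; group
  have Hn : ∀ t, H t * w = n t := fun t => by simp [H]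
  have ninv : ∀ t, (n t)⁻¹ = n (-t) := by
    intro t; simp only [n, mul_inv_rev, un, inv_inv, Units.val_neg, inv_neg, mul_assoc]
  have n1 : n 1 = w := by simpa using hni 0
  have w2 : w * w = H (-1) := by
    have e1 : w⁻¹ = H (-1) * w := by rw [Hn, ← ninv, n1]
    have e2 : H (-1) * H (-1) = 1 := by rw [← Hmul]; simpa using H1
    have : H (-1) * (w * w) = 1 := by rw [← mul_assoc, ← e1]; group
    rw [← mul_left_cancel_iff (a := H (-1)), this, e2]
  have winv : w⁻¹ = H (-1) * w := by rw [Hn, ← ninv, n1]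
  -- moving rules
  have Hu' : ∀ t a, H t * u a = u (t ^ 2 * a) * H t := fun t a => by rw [← Hu]; group
  have uH' : ∀ t a, u a * H t = H t * u (((t⁻¹ : Fˣ) : F) ^ 2 * a) := fun t a => by
    rw [Hu']; congr 2; rw [← mul_assoc, ← mul_pow]; simp
  let S : Set Γ := {x | (∃ a t, x = u a * H t) ∨ ∃ a t b, x = u a * H t * w * u b}
  have Su : ∀ a x, x ∈ S → u a * x ∈ S := by
    rintro a x (⟨b, t, rfl⟩ | ⟨b, t, c, rfl⟩)
    · exact Or.inl ⟨a + b, t, by rw [hu]; group⟩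
    · exact Or.inr ⟨a + b, t, c, by rw [hu]; group⟩
  have SH : ∀ s x, x ∈ S → H s * x ∈ S := by
    rintro s x (⟨b, t, rfl⟩ | ⟨b, t, c, rfl⟩)
    · exact Or.inl ⟨s ^ 2 * b, s * t, by rw [← mul_assoc, Hu', Hmul]; group⟩
    · exact Or.inr ⟨s ^ 2 * b, s * t, c, by
        rw [Hmul, ← mul_assoc, ← mul_assoc, ← mul_assoc, Hu']; group⟩
  have wuw : ∀ a : Fˣ, w * u a * w = u (-((a⁻¹ : Fˣ) : F)) * H a⁻¹ * w * u (-((a⁻¹ : Fˣ) : F)) * H (-1) := by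
    intro a
    have : n a⁻¹ = u ((a⁻¹ : Fˣ) : F) * (w * u a * w⁻¹) * u ((a⁻¹ : Fˣ) : F) := by
      simp only [n]; rw [inv_inv]
    rw [← Hn] at this
    have e : w * u a * w = w * u a * w⁻¹ * (w * w) := by group
    rw [e, w2, ← un]
    have e3 : w * u a * w⁻¹ = (u ((a⁻¹ : Fˣ) : F))⁻¹ * (H a⁻¹ * w) * (u ((a⁻¹ : Fˣ) : F))⁻¹ := by
      rw [this]; group
    rw [e3]; group
  have Sw : ∀ x, x ∈ S → w * x ∈ S := by
    rintro x (⟨b, t, rfl⟩ | ⟨b, t, c, rfl⟩)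
    · refine Or.inr ⟨0, t⁻¹, ((t⁻¹ : Fˣ) : F) ^ 2 * b, ?_⟩
      rw [uH', u0, one_mul, ← Hw]; group
    · have e : w * (u b * H t * w * u c) = (w * u b * w) * H t⁻¹ * u c := by
        have := Hw t⁻¹
        rw [inv_inv] at this
        simp only [mul_assoc]
        rw [← mul_assoc (H t), ← this]; group
      rw [e]
      by_cases hb : b = 0
      · subst hb
        rw [u0, mul_one, w2, ← Hmul, Hu']
        exact Or.inl ⟨_, _, rfl⟩
      · obtain ⟨b, rfl⟩ : ∃ b' : Fˣ, b = b' := ⟨Units.mk0 b hb, rfl⟩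
        rw [wuw]
        set d := -((b⁻¹ : Fˣ) : F)
        refine Or.inr ⟨d, b⁻¹ * (-1 * t⁻¹)⁻¹, (((-1 * t⁻¹ : Fˣ)⁻¹ : Fˣ) : F) ^ 2 * d + c, ?_⟩
        rw [hu, Hmul]
        have e5 := uH' (-1 * t⁻¹) d
        have e6 := Hw (-1 * t⁻¹)
        calc u d * H b⁻¹ * w * u d * H (-1) * H t⁻¹ * u c
            = u d * H b⁻¹ * w * (u d * H (-1 * t⁻¹)) * u c := by rw [Hmul]; group
          _ = u d * H b⁻¹ * (w * H (-1 * t⁻¹)) * u (((-1 * t⁻¹ : Fˣ)⁻¹ : Fˣ) ^ 2 * d) * u c := by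
            rw [e5]; group
          _ = _ := by rw [e6]; group
  have Sall : ∀ g : Γ, g ∈ S := by
    let L' : Subgroup Γ :=
      { carrier := {g | (∀ x, x ∈ S → g * x ∈ S) ∧ ∀ x, x ∈ S → g⁻¹ * x ∈ S}
        one_mem' := by simp
        mul_mem' := by
          rintro a b ⟨ha, ha'⟩ ⟨hb, hb'⟩
          refine ⟨fun x hx => ?_, fun x hx => ?_⟩
          · rw [mul_assoc]; exact ha _ (hb _ hx)
          · rw [mul_inv_rev, mul_assoc]; exact hb' _ (ha' _ hx)
        inv_mem' := by
          rintro a ⟨ha, ha'⟩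
          exact ⟨ha', by simpa using ha⟩ }
    have hLH : ∀ t, H t ∈ L' := fun t => ⟨SH t, by rw [← Hinv]; exact SH _⟩
    have : L' = ⊤ := by
      apply hgen
      · exact fun a => ⟨Su a, by rw [un]; exact Su _⟩
      · refine ⟨Sw, fun x hx => ?_⟩
        rw [winv, mul_assoc]; exact SH _ _ (Sw _ hx)
      · intro t g hg
        have : g = H t := by
          simp only [H, n]; rw [← hg]; group
        rw [this]; exact hLH t
    intro g
    have hg : g ∈ L' := by rw [this]; trivial
    have := hg.1 1 (Or.inl ⟨0, 1, by rw [u0, H1, one_mul]⟩)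
    rwa [mul_one] at this
  have pH : ∀ t, π (H t) = D t := by
    intro t
    simp only [H, n, map_mul, map_inv, pu, pw]
    rw [← D_W]; group
  rw [injective_iff_map_eq_one]
  intro g hg
  rcases Sall g with ⟨a, t, rfl⟩ | ⟨a, t, b, rfl⟩
  · rw [map_mul, pu, pH] at hg
    have hg := congrArg (fun M : Matrix.SpecialLinearGroup (Fin 2) F => (M : Matrix (Fin 2) (Fin 2) F)) hg
    simp only [Matrix.SpecialLinearGroup.coe_mul, coe_X, coe_D, Matrix.SpecialLinearGroup.coe_one] at hg
    have h00 := congrFun (congrFun hg 0) 0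
    have h01 := congrFun (congrFun hg 0) 1
    simp at h00 h01
    rw [h01, u0, h00, H1, one_mul]
  · exfalso
    simp only [map_mul, pu, pH, pw] at hg
    have hg := congrArg (fun M : Matrix.SpecialLinearGroup (Fin 2) F => (M : Matrix (Fin 2) (Fin 2) F)) hg
    simp only [Matrix.SpecialLinearGroup.coe_mul, coe_X, coe_D, coe_W, Matrix.SpecialLinearGroup.coe_one] at hg
    have h10 := congrFun (congrFun hg 1) 0
    simp at h10

end SL2

namespace SL2
open Polynomial

theorem baum_comm {Γ : Type} [Group Γ] (x a b : Γ) (hab : Commute a b)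
    (hb : b * x * b⁻¹ = x * (a * x * a⁻¹)) (hx : Commute x (a * x * a⁻¹)) (n : ℕ) :
    Commute x (a ^ n * x * (a ^ n)⁻¹) := by
  let c : ℕ → Γ := fun n => a ^ n * x * (a ^ n)⁻¹
  have hshift : ∀ k m n, Commute (c m) (c n) → Commute (c (k + m)) (c (k + n)) := by
    intro k m n h
    have e : ∀ m, c (k + m) = MulAut.conj (a ^ k) (c m) := by
      intro m; simp only [c, MulAut.conj_apply, pow_add]; group
    rw [e, e]; exact h.map _
  have hbc : ∀ k, MulAut.conj b (c k) = c k * c (k + 1) := by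
    intro k
    have e1 : b * a ^ k = a ^ k * b := ((hab.pow_left k).eq).symm
    have e2 : (a ^ k)⁻¹ * b⁻¹ = b⁻¹ * (a ^ k)⁻¹ := by
      rw [← mul_inv_rev, ← mul_inv_rev, e1]
    have : b * c k * b⁻¹ = a ^ k * (b * x * b⁻¹) * (a ^ k)⁻¹ := by
      calc b * (a ^ k * x * (a ^ k)⁻¹) * b⁻¹ = (b * a ^ k) * x * ((a ^ k)⁻¹ * b⁻¹) := by group
        _ = _ := by rw [e1, e2]; group
    rw [MulAut.conj_apply, this, hb]; simp only [c, pow_succ]; group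
  have c0 : c 0 = x := by simp [c]
  have key : ∀ n, Commute (c 0) (c n) := by
    intro n
    induction n using Nat.strong_induction_on with
    | _ n ih =>
      match n, ih with
      | 0, _ => exact Commute.refl _
      | 1, _ => rw [c0]; simpa [c] using hx
      | (n + 2), ih =>
        have h1 := (ih (n + 1) (by omega)).map (MulAut.conj b)
        rw [hbc, hbc, zero_add] at h1
        have h2 : Commute (c 0 * c 1) (c (n + 1)) := by
          refine (ih (n + 1) (by omega)).mul_left ?_
          have := hshift 1 0 n (ih n (by omega))
          rwa [add_comm 1 n] at this
        have h3 : Commute (c 0 * c 1) (c (n + 2)) := by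
          have := h2.inv_right.mul_right h1
          simpa using this
        have h4 : Commute (c 1) (c (n + 2)) := by
          have := hshift 1 0 (n + 1) (ih (n + 1) (by omega))
          rwa [add_comm 1 (n + 1)] at this
        have := h3.mul_left h4.inv_left
        simpa using this
  have := key n
  rwa [c0] at this

theorem baum_v {Γ : Type} [Group Γ] (x a b : Γ) (hab : Commute a b)
    (hb : b * x * b⁻¹ = x * (a * x * a⁻¹)) (hx : Commute x (a * x * a⁻¹)) :
    ∃ v : ℤ[X] → Γ, (∀ P Q, v (P + Q) = v P * v Q) ∧ v 1 = x ∧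
      (∀ P, v (X * P) = a * v P * a⁻¹) ∧ ∀ P, v P = 1 → ∀ Q, v (P * Q) = 1 := by
  let c : ℕ → Γ := fun n => a ^ n * x * (a ^ n)⁻¹
  have hcomm : ∀ m n, Commute (c m) (c n) := by
    have : ∀ m k, Commute (c m) (c (m + k)) := by
      intro m k
      have e : c (m + k) = MulAut.conj (a ^ m) (c k) := by
        simp only [c, MulAut.conj_apply, pow_add]; group
      have e' : c m = MulAut.conj (a ^ m) x := rfl
      rw [e, e']
      exact (baum_comm x a b hab hb hx k).map _
    intro m n
    rcases le_total m n with h | h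
    · obtain ⟨k, rfl⟩ := Nat.exists_eq_add_of_le h; exact this m k
    · obtain ⟨k, rfl⟩ := Nat.exists_eq_add_of_le h; exact (this n k).symm
  let A : Subgroup Γ := Subgroup.closure (Set.range c)
  let _inst : CommGroup A := Subgroup.closureCommGroupOfComm (k := Set.range c) (by
    rintro _ ⟨m, rfl⟩ _ ⟨n, rfl⟩; exact hcomm m n)
  have hA : ∀ y ∈ A, MulAut.conj a y ∈ A := by
    intro y hy
    have : A.map (MulAut.conj a).toMonoidHom ≤ A := by
      rw [MonoidHom.map_closure, Subgroup.closure_le]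
      rintro _ ⟨_, ⟨n, rfl⟩, rfl⟩
      refine Subgroup.subset_closure ⟨n + 1, ?_⟩
      simp only [c, MulEquiv.coe_toMonoidHom, MulAut.conj_apply, pow_succ']; group
    exact this ⟨y, hy, rfl⟩
  let φ0 : A →* A := MonoidHom.mk' (fun y => ⟨MulAut.conj a y, hA y y.2⟩) (by
    intro y z; apply Subtype.ext
    show MulAut.conj a ((y : Γ) * z) = _
    rw [map_mul]; rfl)
  let φ : Module.End ℤ (Additive A) := (MonoidHom.toAdditive φ0).toIntLinearMap
  let x0 : A := ⟨x, Subgroup.subset_closure ⟨0, by simp [c]⟩⟩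
  refine ⟨fun P => ((aeval φ P (Additive.ofMul x0)).toMul : A), ?_, ?_, ?_, ?_⟩
  · intro P Q
    simp only [map_add, LinearMap.add_apply, toMul_add]
    rfl
  · simp only [map_one]; rfl
  · intro P
    simp only [map_mul, aeval_X]; rfl
  · intro P hP Q
    rw [mul_comm]
    have hP' : aeval φ P (Additive.ofMul x0) = 0 := by
      apply Additive.toMul.injective
      exact Subtype.ext hP
    simp only [map_mul, Module.End.mul_apply, hP', map_zero]
    rfl

/-- base-4 words -/
def dig {G : Type} [Group G] (x η : G) (d : ℕ) : G :=
  if h : d = 0 then 1 else x ^ (d % 4) * (η * dig x η (d / 4) * η⁻¹)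
termination_by d
decreasing_by omega

/-- Horner words -/
def hor {G : Type} [Group G] (x η a : G) : List ℕ → G
  | [] => 1
  | d :: l => dig x η d * (a * hor x η a l * a⁻¹)

theorem dig_map {G H : Type} [Group G] [Group H] (f : G →* H) (x η : G) (d : ℕ) :
    f (dig x η d) = dig (f x) (f η) d := by
  induction d using Nat.strong_induction_on with
  | _ d ih =>
    rw [dig, dig.eq_def (f x)]
    split_ifs with h
    · simp
    · rw [map_mul, map_mul, map_mul, ih (d / 4) (by omega), map_pow, map_inv]

theorem hor_map {G H : Type} [Group G] [Group H] (f : G →* H) (x η a : G) (l : List ℕ) :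
    f (hor x η a l) = hor (f x) (f η) (f a) l := by
  induction l with
  | nil => simp [hor]
  | cons d l ih => simp [hor, ih, dig_map]

theorem dig_bl {G : Type} [Group G] {S : Set G} {x η : G} (hx : x ∈ S) (hη : η ∈ S) (L d : ℕ)
    (hd : d < 2 ^ L) : Bl S (5 * L) (dig x η d) := by
  induction L using Nat.strong_induction_on generalizing d with
  | _ L ih =>
    rw [dig]
    split_ifs with h
    · exact Bl.one
    · rcases L with _ | L
      · simp at hd; omega
      have h2 : Bl S (5 * L) (dig x η (d / 4)) := by
        refine ih L (by omega) _ ?_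
        rw [pow_succ] at hd
        omega
      have h1 : Bl S 3 (x ^ (d % 4)) := ((Bl.of (k := 1) hx).pow (d % 4)).le (by omega)
      exact (h1.mul ((Bl.of (k := 1) hη).conj h2)).le (by omega)

theorem hor_bl {G : Type} [Group G] {S : Set G} {x η a : G} (hx : x ∈ S) (hη : η ∈ S) (ha : a ∈ S)
    (L : ℕ) (l : List ℕ) (hd : ∀ d ∈ l, d < 2 ^ L) : Bl S ((5 * L + 2) * l.length) (hor x η a l) := by
  induction l with
  | nil => exact Bl.one
  | cons d l ih =>
    have h1 := dig_bl hx hη L d (hd d (by simp))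
    have h2 := ih fun d' h => hd d' (by simp [h])
    refine (h1.mul ((Bl.of (k := 1) ha).conj h2)).le ?_
    rw [List.length_cons]; ring_nf; omega

theorem dig_eq {G : Type} [Group G] {x η : G} {m B : ℕ} (h : η * x * η⁻¹ = x ^ m)
    (hB : m = 4 ∨ B < 4) (d : ℕ) (hd : d ≤ B) : dig x η d = x ^ d := by
  induction d using Nat.strong_induction_on with
  | _ d ih =>
    rw [dig]
    split_ifs with h0
    · simp [h0]
    · rw [ih (d / 4) (by omega) (by omega)]
      rcases hB with rfl | hB
      · rw [← conj_pow, h, ← pow_mul, ← pow_add]; congr 1; omega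
      · have : d / 4 = 0 := by omega
        rw [this]; simp; congr 1; omega

/-- polynomial with given digits -/
noncomputable def lpoly (R : Type) [CommRing R] : List ℕ → R[X]
  | [] => 0
  | d :: l => (d : R[X]) + X * lpoly R l

theorem lpoly_ofFn (R : Type) [CommRing R] (n : ℕ) (f : Fin n → ℕ) :
    lpoly R (List.ofFn f) = ∑ i : Fin n, (f i : R[X]) * X ^ (i : ℕ) := by
  induction n with
  | zero => simp [lpoly]
  | succ n ih =>
    rw [List.ofFn_succ, lpoly, ih, Fin.sum_univ_succ, Finset.mul_sum]
    congr 1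
    · simp
    · refine Finset.sum_congr rfl fun i _ => ?_
      rw [Fin.val_succ, pow_succ]; ring

theorem lpoly_map {R S : Type} [CommRing R] [CommRing S] (f : R →+* S) (l : List ℕ) :
    (lpoly R l).map f = lpoly S l := by
  induction l with
  | nil => simp [lpoly]
  | cons d l ih => simp [lpoly, ih]

theorem hor_eq {Γ : Type} [Group Γ] {x η a : Γ} {m B : ℕ} (h : η * x * η⁻¹ = x ^ m)
    (hB : m = 4 ∨ B < 4) (v : ℤ[X] → Γ) (hv : ∀ P Q, v (P + Q) = v P * v Q) (hv1 : v 1 = x)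
    (hva : ∀ P, v (X * P) = a * v P * a⁻¹) (l : List ℕ) (hl : ∀ d ∈ l, d ≤ B) :
    hor x η a l = v (lpoly ℤ l) := by
  have v0 : v 0 = 1 := by
    have := hv 0 0; rw [add_zero] at this; exact (mul_eq_left.1 this.symm)
  have vn : ∀ d : ℕ, v (d : ℤ[X]) = x ^ d := by
    intro d
    induction d with
    | zero => simp [v0]
    | succ d ih => rw [Nat.cast_succ, hv, ih, hv1, pow_succ]
  induction l with
  | nil => simp [hor, lpoly, v0]
  | cons d l ih =>
    rw [hor, lpoly, hv, vn, hva, ih fun d' h' => hl d' (by simp [h']),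
      dig_eq h hB d (hl d (by simp))]

end SL2

namespace SL2
open Polynomial

theorem adjoin_top {F : Type} [Field F] [Fintype F] (hq : 9 < Fintype.card F) (p : ℕ) [Fact p.Prime]
    [CharP F p] [Algebra (ZMod p) F] (om : Fˣ) (hord : orderOf om = Fintype.card F - 1)
    (c : F) (hc : c = om ^ 2 + ((om⁻¹ : Fˣ) : F) ^ 2) (α : F)
    (hα : c ∈ IntermediateField.adjoin (ZMod p) {α}) :
    Algebra.adjoin (ZMod p) {α} = ⊤ := by
  classical
  set K := IntermediateField.adjoin (ZMod p) {α} with hK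
  have hKtop : K = ⊤ := by
    by_contra hne
    have hfr : 2 ≤ Module.finrank K F := by
      have h0 : 0 < Module.finrank K F := Module.finrank_pos
      have h1 : Module.finrank K F ≠ 1 := fun h => hne (IntermediateField.finrank_eq_one_iff_eq_top.1 h)
      omega
    have : Fintype K := Fintype.ofFinite K
    have hcard : Fintype.card F = Fintype.card K ^ Module.finrank K F := Module.card_eq_pow_finrank
    have hk2 : Fintype.card K ^ 2 ≤ Fintype.card F := by
      rw [hcard]; exact Nat.pow_le_pow_right Fintype.card_pos hfr
    have hCK : CharP K p := RingHom.charP (algebraMap K F) (algebraMap K F).injective p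
    obtain ⟨m, hp, hm⟩ := FiniteField.card K p
    set k := Fintype.card K with hk
    have hck : c ^ k = c := by
      have := FiniteField.pow_card (⟨c, hα⟩ : K)
      exact congrArg Subtype.val this
    have hk1 : 1 < k := Fintype.one_lt_card
    set θ : F := (om : F) ^ 2
    have hθ : θ ≠ 0 := pow_ne_zero _ om.ne_zero
    have hc2 : c = θ + θ⁻¹ := by rw [hc]; simp [θ]
    rw [hc2, hm, add_pow_char_pow, ← hm, inv_pow] at hck
    have hy : θ ^ k ≠ 0 := pow_ne_zero _ hθ
    have hprod : (θ ^ k - θ) * (θ ^ k * θ - 1) = 0 := by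
      field_simp at hck
      linear_combination hck
    have hle : Fintype.card F - 1 ≤ 2 * (k + 1) := by
      rw [← hord]
      rcases mul_eq_zero.1 hprod with h | h
      · have : om ^ (2 * (k - 1)) = 1 := by
          ext
          have e : θ ^ k = θ ^ (k - 1) * θ := by rw [← pow_succ]; congr 1; omega
          rw [e, sub_eq_zero] at h
          have := mul_right_cancel₀ hθ (h.trans (one_mul θ).symm)
          rw [Units.val_pow_eq_pow_val, Units.val_one, pow_mul]; exact this
        exact (Nat.le_of_dvd (by omega) (orderOf_dvd_of_pow_eq_one this)).trans (by omega)
      · have : om ^ (2 * (k + 1)) = 1 := by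
          ext
          rw [← pow_succ, sub_eq_zero] at h
          rw [Units.val_pow_eq_pow_val, Units.val_one, pow_mul]; exact h
        exact (Nat.le_of_dvd (by omega) (orderOf_dvd_of_pow_eq_one this))
    have hle2 : Fintype.card F ≤ 2 * (k + 1) + 1 := by omega
    have : k ≤ 3 := by
      by_contra hcon
      have : 4 ≤ k := by omega
      nlinarith
    interval_cases k <;> omega
  have := IntermediateField.adjoin_simple_toSubalgebra_of_isAlgebraic
    (Algebra.IsAlgebraic.isAlgebraic (R := ZMod p) α)
  rw [← this, ← hK, hKtop, IntermediateField.top_toSubalgebra]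

theorem params (F : Type) [Field F] [Fintype F] (hq : 9 < Fintype.card F) (p : ℕ) [Fact p.Prime]
    [CharP F p] [Algebra (ZMod p) F] :
    ∃ (om a b e : Fˣ) (m : ℕ), (∀ t : Fˣ, ∃ i : ℕ, t = om ^ i) ∧ (b : F) ^ 2 = 1 + (a : F) ^ 2 ∧
      Algebra.adjoin (ZMod p) {(a : F) ^ 2} = ⊤ ∧ (e : F) ^ 2 = m ∧ (m = 4 ∨ p < 4) ∧ m ≤ 4 := by
  classical
  obtain ⟨om, hom⟩ := IsCyclic.exists_monoid_generator (α := Fˣ)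
  have hord : orderOf om = Fintype.card F - 1 := by
    rw [orderOf_eq_card_of_forall_mem_powers hom, Nat.card_eq_fintype_card, Fintype.card_units]
  have hom' : ∀ t : Fˣ, ∃ i : ℕ, t = om ^ i := fun t => by
    obtain ⟨i, hi⟩ := hom t; exact ⟨i, hi.symm⟩
  have hsm : ∀ i : ℕ, 0 < i → i < 9 → (om : F) ^ i ≠ 1 := by
    intro i hi hi9 h
    have : om ^ i = 1 := by ext; simpa using h
    have := Nat.le_of_dvd hi (orderOf_dvd_of_pow_eq_one this)
    omega
  have hne := om.ne_zero
  by_cases h2 : p = 2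
  · subst h2
    have h1 : (1 + om : F) ≠ 0 := by
      intro h
      apply hsm 1 (by norm_num) (by norm_num)
      rw [pow_one]
      have := CharTwo.add_eq_zero.1 h
      exact this.symm
    refine ⟨om, om, Units.mk0 _ h1, 1, 1, hom', ?_, ?_, by simp, Or.inr (by norm_num), by norm_num⟩
    · simp [CharTwo.add_sq]
    · refine adjoin_top hq 2 om hord _ rfl _ ?_
      have := IntermediateField.mem_adjoin_simple_self (ZMod 2) ((om : F) ^ 2)
      refine add_mem this ?_
      simpa using inv_mem this
  · have h20 : (2 : F) ≠ 0 := by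
      intro h
      have : (p : ℕ) ∣ 2 := (CharP.cast_eq_zero_iff F p 2).1 (by exact_mod_cast h)
      exact h2 ((Nat.prime_dvd_prime_iff_eq (Fact.out) Nat.prime_two).1 this)
    have ha : ((om : F) - (om : F)⁻¹) / 2 ≠ 0 := by
      refine div_ne_zero ?_ h20
      intro h
      apply hsm 2 (by norm_num) (by norm_num)
      field_simp at h
      linear_combination h
    have hb : ((om : F) + (om : F)⁻¹) / 2 ≠ 0 := by
      refine div_ne_zero ?_ h20
      intro h
      apply hsm 4 (by norm_num) (by norm_num)
      field_simp at h
      linear_combination ((om : F) ^ 2 - 1) * h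
    refine ⟨om, Units.mk0 _ ha, Units.mk0 _ hb, Units.mk0 2 h20, 4, hom', ?_, ?_, ?_, Or.inl rfl, le_rfl⟩
    · simp only [Units.val_mk0]; field_simp; ring
    · refine adjoin_top hq p om hord _ rfl _ ?_
      have := IntermediateField.mem_adjoin_simple_self (ZMod p) (((Units.mk0 _ ha : Fˣ) : F) ^ 2)
      have e : (om : F) ^ 2 + ((om⁻¹ : Fˣ) : F) ^ 2 =
          4 * ((Units.mk0 _ ha : Fˣ) : F) ^ 2 + 2 := by
        simp only [Units.val_mk0, Units.val_inv_eq_inv_val]; field_simp; ring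
      rw [e]
      refine add_mem (mul_mem ?_ this) ?_
      · exact ofNat_mem _ 4
      · exact ofNat_mem _ 2
    · simp; norm_num

/-- digit lists representing field elements and generating relations -/
theorem digits (F : Type) [Field F] [Fintype F] (p : ℕ) [Fact p.Prime]
    [CharP F p] [Algebra (ZMod p) F] (α : F) (hα : Algebra.adjoin (ZMod p) {α} = ⊤) :
    ∃ (L f : ℕ), p < 2 ^ L ∧ (5 * L + 2) * (f + 1) ≤ 40 * (1 + Nat.log 2 (Fintype.card F)) ∧
      (∀ t : F, ∃ l : List ℕ, l.length ≤ f + 1 ∧ (∀ d ∈ l, d < p) ∧ aeval α (lpoly ℤ l) = t) ∧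
      ∃ l : List ℕ, l.length ≤ f + 1 ∧ (∀ d ∈ l, d < p) ∧ aeval α (lpoly ℤ l) = 0 ∧
        ∀ P : ℤ[X], aeval α P = 0 → ∃ Q S, P = lpoly ℤ l * Q + (p : ℤ[X]) * S := by
  classical
  have hp : p.Prime := Fact.out
  set μ := minpoly (ZMod p) α with hμ
  have hintg : IsIntegral (ZMod p) α := Algebra.IsIntegral.isIntegral α
  have hμm : μ.Monic := minpoly.monic hintg
  have hcast : ∀ n : ℕ, (n : ZMod p).val = n % p := fun n => ZMod.val_natCast p n
  have eval_map : ∀ P : ℤ[X], aeval α P = aeval α (P.map (Int.castRingHom (ZMod p))) := by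
    intro P
    rw [aeval_def, aeval_def, eval₂_map]
    congr 1
    exact RingHom.ext_int _ _
  -- digits list of a polynomial
  have lst : ∀ (f : ℕ) (P : (ZMod p)[X]), P.natDegree ≤ f → ∃ l : List ℕ, l.length = f + 1 ∧ (∀ d ∈ l, d < p) ∧
      lpoly (ZMod p) l = P := by
    intro f P hP
    refine ⟨List.ofFn fun i : Fin (f + 1) => (P.coeff i).val, by simp, ?_, ?_⟩
    · intro d hd
      obtain ⟨i, rfl⟩ := (List.mem_ofFn' _ _).1 hd
      exact ZMod.val_lt _
    · rw [lpoly_ofFn]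
      conv_rhs => rw [P.as_sum_range' (f + 1) (by omega)]
      rw [Finset.sum_range]
      refine Finset.sum_congr rfl fun i _ => ?_
      rw [← C_mul_X_pow_eq_monomial]
      congr 1
      rw [← C_eq_natCast]; simp
  have lst' : ∀ l, (lpoly ℤ l).map (Int.castRingHom (ZMod p)) = lpoly (ZMod p) l := fun l => lpoly_map _ l
  refine ⟨Nat.log 2 p + 1, μ.natDegree, Nat.lt_pow_succ_log_self (by norm_num) p, ?_, ?_, ?_⟩
  · -- size
    have hfin : Module.finrank (ZMod p) F = μ.natDegree := by
      have h1 : IntermediateField.adjoin (ZMod p) {α} = ⊤ := by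
        rw [← top_le_iff]
        intro x _
        have : x ∈ Algebra.adjoin (ZMod p) {α} := by rw [hα]; trivial
        exact IntermediateField.algebra_adjoin_le_adjoin _ _ this
      have h2 := IntermediateField.adjoin.finrank hintg
      rw [h1, IntermediateField.finrank_top'] at h2
      exact h2
    have hcard : Fintype.card F = p ^ μ.natDegree := by
      rw [← hfin, Module.card_eq_pow_finrank (K := ZMod p), ZMod.card]
    have hlog : Nat.log 2 p * μ.natDegree ≤ Nat.log 2 (Fintype.card F) := by
      apply Nat.le_log_of_pow_le (by norm_num)
      rw [hcard, pow_mul]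
      exact Nat.pow_le_pow_left (Nat.pow_log_le_self 2 hp.ne_zero) _
    have h1 : 1 ≤ Nat.log 2 p := Nat.le_log_of_pow_le (by norm_num) (by simpa using hp.two_le)
    have h2 : 1 ≤ μ.natDegree := minpoly.natDegree_pos hintg
    nlinarith
  · intro t
    have ht : t ∈ Algebra.adjoin (ZMod p) {α} := by rw [hα]; trivial
    rw [Algebra.adjoin_singleton_eq_range_aeval] at ht
    obtain ⟨P, hP⟩ := ht
    have hP : aeval α P = t := hP
    obtain ⟨l, h1, h2, h3⟩ := lst μ.natDegree (P %ₘ μ) (natDegree_modByMonic_le P hμm)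
    refine ⟨l, h1.le, h2, ?_⟩
    rw [eval_map, lst', h3, ← hP]
    exact minpoly.aeval_modByMonic_minpoly P α
  · obtain ⟨l, h1, h2, h3⟩ := lst μ.natDegree μ le_rfl
    refine ⟨l, h1.le, h2, by rw [eval_map, lst', h3]; exact minpoly.aeval _ _, fun P hP => ?_⟩
    rw [eval_map] at hP
    obtain ⟨Q0, hQ0⟩ := minpoly.dvd (ZMod p) α hP
    obtain ⟨Q, rfl⟩ := map_surjective (Int.castRingHom (ZMod p)) (ZMod.intCast_surjective) Q0
    have h0 : (P - lpoly ℤ l * Q).map (Int.castRingHom (ZMod p)) = 0 := by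
      rw [Polynomial.map_sub, Polynomial.map_mul, lst', h3, hQ0, sub_self]
    have : C (p : ℤ) ∣ P - lpoly ℤ l * Q := by
      rw [C_dvd_iff_dvd_coeff]
      intro i
      have := congrArg (fun R => coeff R i) h0
      simp only [coeff_map, coeff_zero] at this
      exact (ZMod.intCast_zmod_eq_zero_iff_dvd _ _).1 this
    obtain ⟨S, hS⟩ := this
    refine ⟨Q, S, ?_⟩
    have e : (C (p : ℤ) : ℤ[X]) = (p : ℤ[X]) := by simp
    rw [← e, ← hS]; ring

end SL2

namespace SL2
open Polynomial

/-- the relators for SL₂ in the generators x, w, h_a, h_b, h_om, η -/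
def rel {G : Type} [Group G] (m p : ℕ) (lmin lom : List ℕ) (l li : Fin 4 → List ℕ) (g : Fin 6 → G) :
    Fin 10 ⊕ Fin 4 → G
  | .inl i => ![⁅g 2, g 3⁆, g 3 * g 0 * (g 3)⁻¹ * (g 0 * (g 2 * g 0 * (g 2)⁻¹))⁻¹,
      ⁅g 0, g 2 * g 0 * (g 2)⁻¹⁆, g 5 * g 0 * (g 5)⁻¹ * (g 0 ^ m)⁻¹, dig (g 0) (g 5) p,
      hor (g 0) (g 5) (g 2) lmin, ⁅g 4, g 2⁆, g 4 * g 0 * (g 4)⁻¹ * (hor (g 0) (g 5) (g 2) lom)⁻¹,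
      g 1 * g 4 * (g 1)⁻¹ * g 4, g 1 * (g 0 * (g 1 * g 0 * (g 1)⁻¹) * g 0)⁻¹] i
  | .inr i => g (i.natAdd 2) * g 1 * (hor (g 0) (g 5) (g 2) (l i) *
      (g 1 * hor (g 0) (g 5) (g 2) (li i) * (g 1)⁻¹) * hor (g 0) (g 5) (g 2) (l i))⁻¹

theorem rel_map {G H : Type} [Group G] [Group H] (f : G →* H) (m p : ℕ) (lmin lom : List ℕ)
    (l li : Fin 4 → List ℕ) (g : Fin 6 → G) (j) :
    f (rel m p lmin lom l li g j) = rel m p lmin lom l li (f ∘ g) j := by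
  rcases j with j | j
  · fin_cases j <;> simp [rel, dig_map, hor_map, commutatorElement_def]
  · simp [rel, hor_map]

theorem rel_bl {m p : ℕ} {lmin lom : List ℕ} {l li : Fin 4 → List ℕ} (B : ℕ) (hm : m ≤ 4)
    (hp : Bl (Set.range (FreeGroup.of : Fin 6 → _)) B (dig (.of 0) (.of 5) p))
    (h1 : ∀ l' : List ℕ, l' = lmin ∨ l' = lom ∨ (∃ i, l' = l i) ∨ (∃ i, l' = li i) →
      Bl (Set.range (FreeGroup.of : Fin 6 → _)) B (hor (.of 0) (.of 5) (.of 2) l')) (j) :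
    Bl (Set.range (FreeGroup.of : Fin 6 → _)) (8 + 3 * B) (rel m p lmin lom l li FreeGroup.of j) := by
  have o : ∀ i, Bl (Set.range (FreeGroup.of : Fin 6 → _)) 1 (.of i) := fun i => Bl.of ⟨i, rfl⟩
  rcases j with j | j
  · fin_cases j
    · exact ((o 2).comm (o 3)).le (by omega)
    · exact (((o 3).conj (o 0)).mul ((o 0).mul ((o 2).conj (o 0))).inv).le (by omega)
    · exact ((o 0).comm ((o 2).conj (o 0))).le (by omega)
    · exact (((o 5).conj (o 0)).mul ((o 0).pow m).inv).le (by omega)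
    · exact hp.le (by omega)
    · exact (h1 lmin (by simp)).le (by omega)
    · exact ((o 4).comm (o 2)).le (by omega)
    · exact (((o 4).conj (o 0)).mul (h1 lom (by simp)).inv).le (by omega)
    · exact (((o 1).conj (o 4)).mul (o 4)).le (by omega)
    · exact ((o 1).mul (((o 0).mul ((o 1).conj (o 0))).mul (o 0)).inv).le (by omega)
  · have a := h1 (l j) (by simp)
    have b := h1 (li j) (by simp)
    exact (((o _).mul (o 1)).mul ((a.mul ((o 1).conj b)).mul a).inv).le (by omega)

theorem main : ∃ c : ℕ, ∀ (F : Type) [Field F] [Fintype F],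
    SP c (1 + Nat.log 2 (Fintype.card F)) (Matrix.SpecialLinearGroup (Fin 2) F) Set.univ := by
  refine ⟨max ((9 ^ 4) ^ 2 + 3) (6 * (2 * 200 + 14 + 0)), fun F _ _ => ?_⟩
  classical
  set ℓ := 1 + Nat.log 2 (Fintype.card F) with hℓ
  rcases le_or_gt (Fintype.card F) 9 with hq | hq
  · have : Nat.card (Matrix.SpecialLinearGroup (Fin 2) F) ≤ 9 ^ 4 := by
      have h1 : Nat.card (Matrix.SpecialLinearGroup (Fin 2) F) ≤ Nat.card (Fin 2 → Fin 2 → F) :=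
        Nat.card_le_card_of_injective (fun A => A.1) Subtype.val_injective
      refine h1.trans ?_
      rw [Nat.card_fun, Nat.card_fun, Nat.card_eq_fintype_card, Nat.card_eq_fintype_card, Fintype.card_fin,
        ← pow_mul]
      exact Nat.pow_le_pow_left hq _
    exact (SP.finite _ (9 ^ 4) ℓ (by omega) this).mono (le_max_left _ _) le_rfl le_rfl
  refine SP.mono ?_ (le_max_right _ _) le_rfl le_rfl
  obtain ⟨p, hCp⟩ := CharP.exists F
  haveI := hCp
  haveI : Fact p.Prime := ⟨CharP.char_is_prime F p⟩
  letI : Algebra (ZMod p) F := ZMod.algebra F p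
  obtain ⟨om, a, b, e, m, hom, hab, hadj, hem, hmp, hm4⟩ := params F hq p
  obtain ⟨L, f, hpL, hsize, hrep, lmin, hml, hmd, hm0, hmgen⟩ := digits F p ((a : F) ^ 2) hadj
  choose rep hr1 hr2 hr3 using hrep
  set ts : Fin 4 → Fˣ := ![a, b, om, e] with hts
  set l : Fin 4 → List ℕ := fun i => rep (ts i) with hl
  set li : Fin 4 → List ℕ := fun i => rep ((ts i)⁻¹ : Fˣ) with hli
  set lom := rep ((om : F) ^ 2) with hlom
  let gens : Fin 6 → Matrix.SpecialLinearGroup (Fin 2) F := ![U 1, W, D a, D b, D om, D e]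
  let π0 : FreeGroup (Fin 6) →* Matrix.SpecialLinearGroup (Fin 2) F := FreeGroup.lift gens
  let v0 : ℤ[X] → Matrix.SpecialLinearGroup (Fin 2) F := fun P => U (aeval ((a : F) ^ 2) P)
  have v0a : ∀ P Q, v0 (P + Q) = v0 P * v0 Q := fun P Q => by simp only [v0]; rw [map_add, X_add]
  have v01 : v0 1 = U 1 := by simp [v0]
  have v0X : ∀ P, v0 (X * P) = D a * v0 P * (D a)⁻¹ := fun P => by
    simp only [v0]; rw [D_X, map_mul, aeval_X]
  have Upow : ∀ (t : F) (n : ℕ), U t ^ n = U (n * t) := fun t n => by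
    induction n with
    | zero => simp [X_zero]
    | succ n ih => rw [pow_succ, ih, ← X_add]; congr 1; push_cast; ring
  have hη0 : D e * U 1 * (D e)⁻¹ = (U (1 : F)) ^ m := by rw [D_X, Upow, hem]
  have horr : ∀ l : List ℕ, (∀ d ∈ l, d < p) → hor (U 1) (D e) (D a) l = U (aeval ((a : F) ^ 2) (lpoly ℤ l)) :=
    fun l h => hor_eq (B := p) hη0 hmp v0 v0a v01 v0X l (fun d hd => (h d hd).le)
  have Dcomm : ∀ s t : Fˣ, ⁅D s, D t⁆ = 1 := fun s t => by
    rw [commutatorElement_eq_one_iff_mul_comm, ← D_mul, ← D_mul, mul_comm]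
  have hreal : ∀ j, π0 (rel m p lmin lom l li FreeGroup.of j) = 1 := by
    intro j
    rw [rel_map]
    have e0 : (π0 ∘ FreeGroup.of) = gens := by ext1 i; simp [π0]
    rw [e0]
    rcases j with j | j
    · fin_cases j
      · exact Dcomm a b
      · change D b * U 1 * (D b)⁻¹ * (U 1 * (D a * U 1 * (D a)⁻¹))⁻¹ = 1
        rw [mul_inv_eq_one, D_X, D_X, ← X_add, hab, mul_one, mul_one]
      · change ⁅U 1, D a * U 1 * (D a)⁻¹⁆ = 1
        rw [commutatorElement_eq_one_iff_mul_comm, D_X, ← X_add, ← X_add, add_comm]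
      · exact mul_inv_eq_one.2 hη0
      · change dig (U 1) (D e) p = 1
        rw [dig_eq hη0 hmp p le_rfl, Upow, CharP.cast_eq_zero, zero_mul, X_zero]
      · change hor (U 1) (D e) (D a) lmin = 1
        rw [horr _ hmd, hm0, X_zero]
      · exact Dcomm om a
      · change D om * U 1 * (D om)⁻¹ * (hor (U 1) (D e) (D a) lom)⁻¹ = 1
        rw [mul_inv_eq_one, horr _ (hr2 _), hr3, D_X, mul_one]
      · change W * D om * W⁻¹ * D om = 1
        rw [W_D, inv_mul_cancel]
      · change W * (U 1 * (W * U 1 * W⁻¹) * U 1)⁻¹ = 1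
        have := D_W (1 : Fˣ)
        rw [D_one] at this
        rw [mul_inv_eq_one]; simpa using this
    · have : gens (j.natAdd 2) = D (ts j) := by fin_cases j <;> rfl
      change gens (j.natAdd 2) * W * (hor (U 1) (D e) (D a) (l j) *
        (W * hor (U 1) (D e) (D a) (li j) * W⁻¹) * hor (U 1) (D e) (D a) (l j))⁻¹ = 1
      rw [this, mul_inv_eq_one, horr _ (hr2 _), horr _ (hr2 _), hr3, hr3, D_W]
  have hworb : ∀ l : List ℕ, l.length ≤ f + 1 → (∀ d ∈ l, d < p) →
      Bl (Set.range (FreeGroup.of : Fin 6 → _)) (40 * ℓ) (hor (.of 0) (.of 5) (.of 2) l) := by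
    intro l h1 h2
    refine (hor_bl (Set.mem_range_self 0) (Set.mem_range_self 5) (Set.mem_range_self 2) L l fun d hd => (h2 d hd).trans hpL).le ?_
    exact (Nat.mul_le_mul_left _ h1).trans hsize
  have hUin : ∀ t : F, ∃ x : FreeGroup (Fin 6), Bl (Set.range FreeGroup.of) (200 * ℓ) x ∧ π0 x = U t := by
    intro t
    refine ⟨_, (hworb (rep t) (hr1 t) (hr2 t)).le (by omega), ?_⟩
    rw [hor_map]
    have := horr (rep t) (hr2 t)
    rw [hr3] at this
    simpa [π0, gens] using this
  have hWin : ∃ x : FreeGroup (Fin 6), Bl (Set.range FreeGroup.of) (200 * ℓ) x ∧ π0 x = W :=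
    ⟨.of 1, Bl.of ⟨1, rfl⟩ (by omega), by simp [π0, gens]⟩
  have hfree := SP.free (Fin 6) ℓ 200 (by simp)
  set T : Set (FreeGroup (Fin 6)) := {x | Bl (Set.range FreeGroup.of) (200 * ℓ) x} with hT
  have hsub : Set.range U ∪ {W} ⊆ π0 '' T := by
    rintro _ (⟨t, rfl⟩ | rfl)
    · obtain ⟨x, h1, h2⟩ := hUin t; exact ⟨x, h1, h2⟩
    · obtain ⟨x, h1, h2⟩ := hWin; exact ⟨x, h1, h2⟩
  have hbr : ∀ g : Matrix.SpecialLinearGroup (Fin 2) F, Bl (π0 '' T) 6 g := fun g =>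
    (bruhat g).mono hsub le_rfl
  have hsurj : Function.Surjective π0 := by
    intro g
    have := (hbr g).mem_closure
    rw [← MonoidHom.mem_range]
    refine (Subgroup.closure_le _).2 ?_ this
    rintro _ ⟨x, _, rfl⟩; exact ⟨x, rfl⟩
  have key : SP ((1 + 1) * 200 + 14) ℓ (Matrix.SpecialLinearGroup (Fin 2) F) (π0 '' T) := by
    refine SP.assemble hfree π0 hsurj (N := Fin 10 ⊕ Fin 4) (by simp)
      (rel m p lmin lom l li FreeGroup.of) (fun j => Bl.of ?_) hreal ?_
    · refine (rel_bl (40 * ℓ) hm4 ?_ ?_ j).le (by omega)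
      · refine (dig_bl (Set.mem_range_self 0) (Set.mem_range_self 5) L p hpL).le ?_
        nlinarith
      · rintro l' (rfl | rfl | ⟨i, rfl⟩ | ⟨i, rfl⟩)
        · exact hworb _ hml hmd
        · exact hworb _ (hr1 _) (hr2 _)
        · exact hworb _ (hr1 _) (hr2 _)
        · exact hworb _ (hr1 _) (hr2 _)
    intro Γ _ ψ π hψ hπ hrel
    set γ : Fin 6 → Γ := fun i => ψ (.of i) with hγ
    have hrel : ∀ j, rel m p lmin lom l li γ j = 1 := fun j => by
      have := hrel j; rw [rel_map] at this; exact this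
    have r0 : ⁅γ 2, γ 3⁆ = 1 := hrel (.inl 0)
    have r1 : γ 3 * γ 0 * (γ 3)⁻¹ * (γ 0 * (γ 2 * γ 0 * (γ 2)⁻¹))⁻¹ = 1 := hrel (.inl 1)
    have r2 : ⁅γ 0, γ 2 * γ 0 * (γ 2)⁻¹⁆ = 1 := hrel (.inl 2)
    have r3 : γ 5 * γ 0 * (γ 5)⁻¹ * (γ 0 ^ m)⁻¹ = 1 := hrel (.inl 3)
    have r4 : dig (γ 0) (γ 5) p = 1 := hrel (.inl 4)
    have r5 : hor (γ 0) (γ 5) (γ 2) lmin = 1 := hrel (.inl 5)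
    have r6 : ⁅γ 4, γ 2⁆ = 1 := hrel (.inl 6)
    have r7 : γ 4 * γ 0 * (γ 4)⁻¹ * (hor (γ 0) (γ 5) (γ 2) lom)⁻¹ = 1 := hrel (.inl 7)
    have r8 : γ 1 * γ 4 * (γ 1)⁻¹ * γ 4 = 1 := hrel (.inl 8)
    have r9 : γ 1 * (γ 0 * (γ 1 * γ 0 * (γ 1)⁻¹) * γ 0)⁻¹ = 1 := hrel (.inl 9)
    have r10 : ∀ i : Fin 4, γ (i.natAdd 2) * γ 1 * (hor (γ 0) (γ 5) (γ 2) (l i) *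
      (γ 1 * hor (γ 0) (γ 5) (γ 2) (li i) * (γ 1)⁻¹) * hor (γ 0) (γ 5) (γ 2) (l i))⁻¹ = 1 :=
      fun i => hrel (.inr i)
    rw [mul_inv_eq_one] at r1 r3 r7 r9
    rw [commutatorElement_eq_one_iff_commute] at r0 r2 r6
    obtain ⟨v, va, v1, vX, vid⟩ := baum_v (γ 0) (γ 2) (γ 3) r0 r1 r2
    have v00 : v 0 = 1 := by
      have := va 0 0; rw [add_zero] at this; exact (mul_eq_left.1 this.symm)
    have vn : ∀ P, v (-P) = (v P)⁻¹ := fun P => by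
      rw [eq_inv_iff_mul_eq_one, ← va, neg_add_cancel, v00]
    have horv : ∀ l : List ℕ, (∀ d ∈ l, d < p) → hor (γ 0) (γ 5) (γ 2) l = v (lpoly ℤ l) :=
      fun l h => hor_eq (B := p) r3 hmp v va v1 vX l (fun d hd => (h d hd).le)
    have vnat : ∀ n : ℕ, v n = γ 0 ^ n := fun n => by
      induction n with
      | zero => simp [v00]
      | succ n ih => rw [Nat.cast_succ, va, ih, v1, pow_succ]
    have vp : v p = 1 := by rw [vnat, ← dig_eq r3 hmp p le_rfl, r4]
    have vm : v (lpoly ℤ lmin) = 1 := by rw [← horv _ hmd, r5]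
    have vker : ∀ P, aeval ((a : F) ^ 2) P = 0 → v P = 1 := by
      intro P hP
      obtain ⟨Q, S, rfl⟩ := hmgen P hP
      rw [va, vid _ vm, vid _ vp, one_mul]
    have vcong : ∀ P Q, aeval ((a : F) ^ 2) P = aeval ((a : F) ^ 2) Q → v P = v Q := by
      intro P Q h
      have := vker (P - Q) (by rw [map_sub, h, sub_self])
      rw [sub_eq_add_neg, va, vn] at this
      exact mul_inv_eq_one.1 this
    let u : F → Γ := fun t => v (lpoly ℤ (rep t))
    have uv : ∀ P, u (aeval ((a : F) ^ 2) P) = v P := fun P => vcong _ _ (hr3 _)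
    have vu : ∀ t, ∃ P, t = aeval ((a : F) ^ 2) P := fun t => ⟨_, (hr3 t).symm⟩
    have hu : ∀ s t, u (s + t) = u s * u t := by
      intro s t
      obtain ⟨P, rfl⟩ := vu s
      obtain ⟨Q, rfl⟩ := vu t
      rw [← map_add, uv, uv, uv, va]
    have u1 : u 1 = γ 0 := by
      have := uv 1; rw [map_one] at this; rw [this, v1]
    have horu : ∀ t, hor (γ 0) (γ 5) (γ 2) (rep t) = u t := fun t => horv _ (hr2 t)
    have h1 : ∀ t, γ 4 * u t * (γ 4)⁻¹ = u (om ^ 2 * t) := by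
      intro t
      obtain ⟨P, rfl⟩ := vu t
      obtain ⟨P0, hP0⟩ := vu ((om : F) ^ 2)
      rw [hP0, ← map_mul, uv, uv]
      -- induction on P
      induction P using Polynomial.induction_on with
      | C n =>
        have key : ∀ n : ℕ, γ 4 * v n * (γ 4)⁻¹ = v (P0 * n) := by
          intro n
          induction n with
          | zero => simp [v00]
          | succ n ih =>
            rw [Nat.cast_succ, va, v1, mul_add, va, mul_one, ← ih]
            have : γ 4 * γ 0 * (γ 4)⁻¹ = v P0 := by
              rw [r7, horu, hP0, uv]
            rw [← this]; group
        rcases Int.eq_nat_or_neg n with ⟨k, rfl | rfl⟩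
        · simpa using key k
        · have := congrArg (·⁻¹) (key k)
          simp only [mul_inv_rev, inv_inv] at this
          simp only [map_neg, mul_neg, vn]
          simpa [mul_assoc] using this
      | add P Q hP hQ => rw [mul_add, va, va, ← hP, ← hQ]; group
      | monomial n c ih =>
        have e1 : (C c * X ^ (n + 1) : ℤ[X]) = X * (C c * X ^ n) := by ring
        rw [e1, vX, show P0 * (X * (C c * X ^ n)) = X * (P0 * (C c * X ^ n)) by ring, vX, ← ih]
        have := r6.eq
        have h2 : γ 4 * γ 2 * v (C c * X ^ n) * (γ 4 * γ 2)⁻¹ = γ 2 * γ 4 * v (C c * X ^ n) * (γ 2 * γ 4)⁻¹ := by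
          rw [this]
        simpa [mul_assoc] using h2
    have r10' : ∀ i : Fin 4, γ (i.natAdd 2) * γ 1 =
        u (ts i) * (γ 1 * u (((ts i)⁻¹ : Fˣ) : F) * (γ 1)⁻¹) * u (ts i) := by
      intro i
      have := r10 i
      rw [mul_inv_eq_one] at this
      rw [this, horu, horu]
    have pγ : ∀ i, π (γ i) = gens i := fun i => by rw [hγ, hπ]; simp [π0]
    refine abstract_inj om hom u (γ 1) (γ 4) hu h1 ?_ ?_ (r10' 2) π ?_ (pγ 1) ?_
    · exact eq_inv_of_mul_eq_one_left r8
    · rw [u1]; exact r9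
    · intro t
      rw [← horu, hor_map, pγ, pγ, pγ]
      have := horr (rep t) (hr2 t)
      rw [hr3] at this
      exact this
    · intro L' hLu hLw hLt
      rw [eq_top_iff]
      rintro x -
      obtain ⟨y, rfl⟩ := hψ x
      have hg : ∀ i, γ i ∈ L' := by
        intro i
        have h4 : ∀ i : Fin 4, γ (i.natAdd 2) ∈ L' := fun i => hLt (ts i) _ (r10' i)
        fin_cases i
        · have := hLu 1; rw [u1] at this; exact this
        · exact hLw
        · exact h4 0
        · exact h4 1
        · exact h4 2
        · exact h4 3
      induction y using FreeGroup.induction_on with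
      | C1 => rw [map_one]; exact one_mem _
      | of i => exact hg i
      | inv_of i _ => rw [map_inv]; exact inv_mem (hg i)
      | mul x y hx hy => rw [map_mul]; exact mul_mem hx hy
  have := key.ball 6 (by norm_num)
  refine this.mono le_rfl le_rfl ?_
  intro g _
  exact hbr g

end SL2

/-- assemble, with a list of relators -/
theorem SP.assembleL {K G : Type} [Group K] [Group G] {c ℓ k : ℕ} {T : Set K} (h : SP c ℓ K T) (f : K →* G)
    (hf : Function.Surjective f) (c' : ℕ) (L : List K) (hN : L.length ≤ c') (hE : ∀ e ∈ L, Bl T k e)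
    (hE1 : ∀ e ∈ L, f e = 1)
    (hker : ∀ (Γ : Type) [Group Γ] (ψ : K →* Γ) (π : Γ →* G), Function.Surjective ψ →
      (∀ x, π (ψ x) = f x) → (∀ e ∈ L, ψ e = 1) → Function.Injective π) :
    SP ((k + 1) * c + c') ℓ G (f '' T) := by
  refine SP.assemble h f hf (N := Fin L.length) (by simpa using hN) (fun i => L.get i)
    (fun i => hE _ (List.get_mem _ _)) (fun i => hE1 _ (List.get_mem _ _)) ?_
  intro Γ _ ψ π h1 h2 h3
  refine hker Γ ψ π h1 h2 ?_
  intro e he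
  obtain ⟨i, rfl⟩ := List.get_of_mem he
  exact h3 i

section star
variable {ι Γ : Type} [DecidableEq ι] [Group Γ]

theorem starPerm_inj (o : ι) (z : ι → Γ) (π : Γ →* Equiv.Perm ι)
    (hπ : ∀ x, x ≠ o → π (z x) = Equiv.swap o x)
    (h2 : ∀ x, x ≠ o → z x * z x = 1)
    (h3 : ∀ x y, x ≠ o → y ≠ o → x ≠ y → z x * z y * z x = z y * z x * z y)
    (h4 : ∀ x y w, x ≠ o → y ≠ o → w ≠ o → x ≠ y → x ≠ w → y ≠ w → Commute (z x * z y * z x) (z w))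
    [Finite ι] (g : Γ) (hg : g ∈ Subgroup.closure {g | ∃ x, x ≠ o ∧ g = z x}) (h1 : π g = 1) : g = 1 := by
  classical
  cases nonempty_fintype ι
  have main : ∀ J : Finset ι, o ∉ J → ∀ g ∈ Subgroup.closure (z '' J), π g = 1 → g = 1 := by
    intro J
    induction J using Finset.induction_on with
    | empty => intro _ g hg _; simpa using hg
    | insert y J hy ih =>
      intro ho g hg h1
      have hyo : y ≠ o := fun h => ho (by simp [h])
      have hoJ : o ∉ J := fun h => ho (by simp [h])
      have hJo : ∀ x ∈ J, x ≠ o := fun x hx h => hoJ (h ▸ hx)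
      have hJy : ∀ x ∈ J, x ≠ y := fun x hx h => hy (h ▸ hx)
      set ΓJ := Subgroup.closure (z '' J) with hΓJ
      have zin : ∀ x ∈ J, z x ∈ ΓJ := fun x hx => Subgroup.subset_closure ⟨x, hx, rfl⟩
      have fixy : ∀ γ ∈ ΓJ, π γ y = y := by
        intro γ hγ
        have : ΓJ ≤ (MulAction.stabilizer (Equiv.Perm ι) y).comap π := by
          rw [hΓJ, Subgroup.closure_le]
          rintro _ ⟨x, hx, rfl⟩
          simp only [SetLike.mem_coe, Subgroup.mem_comap, MulAction.mem_stabilizer_iff]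
          rw [hπ x (hJo x hx), Equiv.Perm.smul_def]
          exact Equiv.swap_apply_of_ne_of_ne hyo (hJy x hx).symm
        exact this hγ
      -- coset description
      have cos : ∀ g ∈ Subgroup.closure (z '' (insert y J : Finset ι)),
          g ∈ ΓJ ∨ (∃ γ ∈ ΓJ, g = z y * γ) ∨ ∃ x ∈ J, ∃ γ ∈ ΓJ, g = z x * z y * γ := by
        intro g hg
        have step : ∀ x ∈ insert y J, ∀ g, (g ∈ ΓJ ∨ (∃ γ ∈ ΓJ, g = z y * γ) ∨ ∃ x ∈ J, ∃ γ ∈ ΓJ, g = z x * z y * γ) →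
            (z x * g ∈ ΓJ ∨ (∃ γ ∈ ΓJ, z x * g = z y * γ) ∨ ∃ x' ∈ J, ∃ γ ∈ ΓJ, z x * g = z x' * z y * γ) := by
          intro w hw g hg
          rw [Finset.mem_insert] at hw
          rcases hw with rfl | hw
          · rcases hg with hg | ⟨γ, hγ, rfl⟩ | ⟨x, hx, γ, hγ, rfl⟩
            · exact Or.inr (Or.inl ⟨g, hg, rfl⟩)
            · left; rw [← mul_assoc, h2 _ hyo, one_mul]; exact hγ
            · right; right
              refine ⟨x, hx, z x * γ, mul_mem (zin x hx) hγ, ?_⟩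
              have := h3 x w (hJo x hx) hyo (hJy x hx)
              rw [← mul_assoc, ← mul_assoc, ← this, mul_assoc _ (z x) γ]
          · rcases hg with hg | ⟨γ, hγ, rfl⟩ | ⟨x, hx, γ, hγ, rfl⟩
            · left; exact mul_mem (zin w hw) hg
            · right; right; exact ⟨w, hw, γ, hγ, by rw [mul_assoc]⟩
            · by_cases hxw : w = x
              · subst hxw
                right; left
                exact ⟨γ, hγ, by rw [mul_assoc, ← mul_assoc, h2 _ (hJo w hw), one_mul]⟩
              · right; right
                refine ⟨x, hx, z x * z w * z x * γ, mul_mem (mul_mem (mul_mem (zin x hx) (zin w hw)) (zin x hx)) hγ, ?_⟩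
                have := h4 x w y (hJo x hx) (hJo w hw) hyo (Ne.symm hxw) (hJy x hx) (hJy w hw)
                have e : z x * z y * (z x * z w * z x * γ) = z x * (z x * z w * z x * z y) * γ := by
                  rw [this.eq]; simp only [mul_assoc]
                rw [e]
                have : z x * (z x * z w * z x * z y) * γ = (z x * z x) * z w * z x * z y * γ := by
                  simp only [mul_assoc]
                rw [this, h2 x (hJo x hx), one_mul]; simp only [mul_assoc]
        have inv : ∀ x ∈ insert y J, (z x)⁻¹ = z x := by
          intro x hx
          apply inv_eq_of_mul_eq_one_left
          exact h2 x (by rintro rfl; exact ho hx)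
        induction hg using Subgroup.closure_induction_left with
        | one => left; exact one_mem _
        | mul_left x hx g hg ih2 =>
          obtain ⟨x, hx, rfl⟩ := hx
          exact step x hx g ih2
        | inv_mul_cancel x hx g hg ih2 =>
          obtain ⟨x, hx, rfl⟩ := hx
          rw [inv x hx]
          exact step x hx g ih2
      rcases cos g hg with h | ⟨γ, hγ, rfl⟩ | ⟨x, hx, γ, hγ, rfl⟩
      · exact ih hoJ g h h1
      · exfalso
        have := congrArg (fun f => f y) h1
        simp only [map_mul, Equiv.Perm.mul_apply, fixy γ hγ, hπ y hyo, Equiv.swap_apply_right, Equiv.Perm.one_apply] at this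
        exact hyo this.symm
      · exfalso
        have := congrArg (fun f => f y) h1
        simp only [map_mul, Equiv.Perm.mul_apply, fixy γ hγ, hπ y hyo, hπ x (hJo x hx), Equiv.swap_apply_right, Equiv.swap_apply_left, Equiv.Perm.one_apply] at this
        exact hJy x hx this
  refine main (Finset.univ.erase o) (by simp) g ?_ h1
  convert hg using 2
  ext g
  simp [eq_comm]

/-- a subgroup containing swaps `o x` for all `x` is everything -/
theorem perm_top_of_star [Finite ι] (o : ι) (T : Subgroup (Equiv.Perm ι)) (h : ∀ x, Equiv.swap o x ∈ T) : T = ⊤ := by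
  have hs : ∀ x y, Equiv.swap x y ∈ T := by
    intro x y
    by_cases hxy : x = y
    · subst hxy; rw [Equiv.swap_self]; exact one_mem _
    by_cases hx : x = o
    · subst hx; exact h y
    by_cases hy : y = o
    · subst hy; rw [Equiv.swap_comm]; exact h x
    have := Equiv.swap_mul_swap_mul_swap (x := x) (y := o) (z := y) hx hxy
    have e : Equiv.swap o y * Equiv.swap x o * Equiv.swap o y = Equiv.swap y x := this
    rw [Equiv.swap_comm x y, ← e]
    exact mul_mem (mul_mem (h y) (by rw [Equiv.swap_comm]; exact h x)) (h y)
  rw [eq_top_iff, ← Equiv.Perm.closure_isSwap, Subgroup.closure_le]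
  rintro _ ⟨x, y, _, rfl⟩
  exact hs x y

/-- small support permutations are short products of swaps at `o` -/
theorem swap_bl (o : ι) (x y : ι) : Bl (Set.range (Equiv.swap o)) 3 (Equiv.swap x y) := by
  have hh : ∀ x, Bl (Set.range (Equiv.swap o)) 1 (Equiv.swap o x) := fun x => Bl.of ⟨x, rfl⟩
  by_cases hxy : x = y
  · subst hxy; rw [Equiv.swap_self]; exact Bl.one
  by_cases hx : x = o
  · subst hx; exact (hh y).le (by norm_num)
  have e : Equiv.swap o y * Equiv.swap x o * Equiv.swap o y = Equiv.swap y x :=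
    Equiv.swap_mul_swap_mul_swap (x := x) (y := o) (z := y) hx hxy
  rw [Equiv.swap_comm x y, ← e, Equiv.swap_comm x o]
  exact ((hh y).mul (hh x)).mul (hh y)

theorem supp_bl (o : ι) (S : Finset ι) (f : Equiv.Perm ι) (h : ∀ x, x ∉ S → f x = x) :
    Bl (Set.range (Equiv.swap o)) (3 * S.card) f := by
  induction S using Finset.induction_on generalizing f with
  | empty =>
    have : f = 1 := by ext x; simp [h x]
    rw [this]; exact Bl.one
  | insert a S ha ih =>
    have h2 := ih (Equiv.swap a (f a) * f) (by
      intro x hx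
      rw [Equiv.Perm.mul_apply]
      by_cases hxa : x = a
      · subst hxa; simp
      · have hfx : f x = x := h x (by simp [hxa, hx])
        rw [hfx]
        refine Equiv.swap_apply_of_ne_of_ne hxa ?_
        intro he
        exact hxa (f.injective (hfx.trans he)))
    have := (swap_bl o a (f a)).mul h2
    rw [← mul_assoc, Equiv.swap_mul_self, one_mul] at this
    exact this.le (by rw [Finset.card_insert_of_notMem ha]; omega)
end star

/-- lifting words -/
theorem Bl.lift {G H : Type} [Group G] [Group H] {S : Set G} {k : ℕ} (f : G →* H) {y : H} (h : Bl (f '' S) k y) :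
    ∃ x, Bl S k x ∧ f x = y := by
  obtain ⟨l, h1, h2, rfl⟩ := h
  have : ∀ l : List H, (∀ y ∈ l, y ∈ f '' S ∨ y⁻¹ ∈ f '' S) → ∃ x, Bl S l.length x ∧ f x = l.prod := by
    intro l
    induction l with
    | nil => intro _; exact ⟨1, Bl.one, by simp⟩
    | cons a l ih =>
      intro h
      obtain ⟨x, hx, hx2⟩ := ih fun y hy => h y (by simp [hy])
      rcases h a (by simp) with ⟨s, hs, hs2⟩ | ⟨s, hs, hs2⟩
      · exact ⟨s * x, ((Bl.of hs (k := 1)).mul hx).le (by simp; omega), by simp [hs2, hx2]⟩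
      · exact ⟨s⁻¹ * x, ((Bl.of hs (k := 1)).inv.mul hx).le (by simp; omega), by simp [hs2, hx2]⟩
  obtain ⟨x, hx, hx2⟩ := this l h2
  exact ⟨x, hx.le h1, hx2⟩

namespace P1
open SL2
open scoped Matrix

variable {p : ℕ} [Fact p.Prime]

instance instDecOP (X : Type) [DecidableEq X] : DecidableEq (OnePoint X) := inferInstanceAs (DecidableEq (Option X))

abbrev SL (p : ℕ) := Matrix.SpecialLinearGroup (Fin 2) (ZMod p)
abbrev X (p : ℕ) := OnePoint (ZMod p)

/-- action on the projective line -/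
noncomputable def pm (p : ℕ) [Fact p.Prime] : SL p →* Equiv.Perm (X p) :=
  (MulAction.toPermHom (GL (Fin 2) (ZMod p)) (OnePoint (ZMod p))).comp Matrix.SpecialLinearGroup.toGL

theorem pm_inf0 (g : SL p) (h : g.1 1 0 = 0) : pm p g OnePoint.infty = OnePoint.infty := by
  simp only [pm, MonoidHom.comp_apply, MulAction.toPermHom_apply, MulAction.toPerm_apply]
  rw [OnePoint.smul_infty_eq_ite]
  exact if_pos h

theorem pm_inf1 (g : SL p) (h : g.1 1 0 ≠ 0) : pm p g OnePoint.infty = ((g.1 0 0 / g.1 1 0 : ZMod p) : X p) := by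
  simp only [pm, MonoidHom.comp_apply, MulAction.toPermHom_apply, MulAction.toPerm_apply]
  rw [OnePoint.smul_infty_eq_ite]
  exact if_neg h

theorem pm_some0 (g : SL p) (x : ZMod p) (h : g.1 1 0 * x + g.1 1 1 = 0) : pm p g (x : X p) = OnePoint.infty := by
  simp only [pm, MonoidHom.comp_apply, MulAction.toPermHom_apply, MulAction.toPerm_apply]
  rw [OnePoint.smul_some_eq_ite]
  exact if_pos h

theorem pm_some1 (g : SL p) (x : ZMod p) (h : g.1 1 0 * x + g.1 1 1 ≠ 0) :
    pm p g (x : X p) = (((g.1 0 0 * x + g.1 0 1) / (g.1 1 0 * x + g.1 1 1) : ZMod p) : X p) := by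
  simp only [pm, MonoidHom.comp_apply, MulAction.toPermHom_apply, MulAction.toPerm_apply]
  rw [OnePoint.smul_some_eq_ite]
  exact if_neg h

@[simp] theorem pmU_inf (t : ZMod p) : pm p (U t) OnePoint.infty = OnePoint.infty := pm_inf0 _ rfl
@[simp] theorem pmU (t x : ZMod p) : pm p (U t) (x : X p) = ((x + t : ZMod p) : X p) := by
  have e : (U t).1 = !![1, t; 0, 1] := rfl
  rw [pm_some1 _ _ (by rw [e]; simp)]; congr 1; rw [e]; simp
@[simp] theorem pmD_inf (t : (ZMod p)ˣ) : pm p (D t) OnePoint.infty = OnePoint.infty := pm_inf0 _ rfl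
@[simp] theorem pmD (t : (ZMod p)ˣ) (x : ZMod p) : pm p (D t) (x : X p) = ((t ^ 2 * x : ZMod p) : X p) := by
  have e1 : (D t).1 1 0 = 0 := rfl
  have e2 : (D t).1 1 1 = ((t⁻¹ : (ZMod p)ˣ) : ZMod p) := rfl
  have e3 : (D t).1 0 0 = (t : ZMod p) := rfl
  have e4 : (D t).1 0 1 = 0 := rfl
  have h0 := t.ne_zero
  have h1 := (t⁻¹).ne_zero
  rw [pm_some1 _ _ (by rw [e1, e2, zero_mul, zero_add]; exact h1)]; congr 1
  rw [e1, e2, e3, e4, zero_mul, zero_add, add_zero, Units.val_inv_eq_inv_val]; field_simp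
@[simp] theorem pmW_inf : pm p (W : SL p) OnePoint.infty = ((0 : ZMod p) : X p) := by
  have e : (W : SL p).1 = !![0, 1; -1, 0] := rfl
  rw [pm_inf1 _ (by rw [e]; simp)]; congr 1; rw [e]; simp
@[simp] theorem pmW_zero : pm p (W : SL p) ((0 : ZMod p) : X p) = OnePoint.infty := by
  have e : (W : SL p).1 = !![0, 1; -1, 0] := rfl
  rw [pm_some0]; rw [e]; simp

/-- transversal -/
def gam : X p → SL p
  | none => 1
  | some x => U x * W

theorem gam_inf : gam (OnePoint.infty : X p) = 1 := rfl
theorem gam_some (x : ZMod p) : gam (x : X p) = U x * W := rfl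

theorem pm_gam (x : X p) : pm p (gam x) OnePoint.infty = x := by
  induction x using OnePoint.rec with
  | infty => rw [gam_inf]; simp
  | coe x => rw [gam_some]; simp

theorem U_nat (n : ℕ) (t : ZMod p) : U t ^ n = U (n * t : ZMod p) := by
  induction n with
  | zero => simp [X_zero]
  | succ n ih => rw [pow_succ, ih, ← X_add]; congr 1; push_cast; ring
theorem U_pow (s : ZMod p) : U s = U (1 : ZMod p) ^ s.val := by
  rw [U_nat]; simp
theorem D_pow (t : (ZMod p)ˣ) (n : ℕ) : D (t ^ n) = D t ^ n := by
  induction n with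
  | zero => simp [D_one]
  | succ n ih => rw [pow_succ, D_mul, ih, pow_succ]

theorem stab (g : SL p) (hg : pm p g OnePoint.infty = OnePoint.infty) : ∃ t s, g = D t * U s := by
  have h10 : g 1 0 = 0 := by
    by_contra h; rw [pm_inf1 g h] at hg; exact OnePoint.coe_ne_infty _ hg
  have hd := g.det_coe
  rw [Matrix.det_fin_two, h10, mul_zero, sub_zero] at hd
  have h0 : g 0 0 ≠ 0 := by intro h; rw [h] at hd; simp at hd
  refine ⟨Units.mk0 _ h0, g 0 1 / g 0 0, ?_⟩
  apply ext'; rw [Matrix.SpecialLinearGroup.coe_mul]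
  simp only [coe_D, coe_X]
  ext i j
  fin_cases i <;> fin_cases j <;> simp [h10]
  · field_simp
  · exact eq_inv_of_mul_eq_one_right hd

section fam
variable {Γ : Type} [Group Γ] (η : SL p →* Γ) (ζ : Γ)

/-- the conjugates family -/
def fam (x : X p) : Γ := η (gam x) * ζ * (η (gam x))⁻¹

theorem fam_inf : fam η ζ OnePoint.infty = ζ := by simp [fam, gam_inf]

theorem fam_conj (om : (ZMod p)ˣ) (hom : ∀ t : (ZMod p)ˣ, ∃ i : ℕ, t = om ^ i)
    (h1 : Commute (η (U 1)) ζ) (h2 : Commute (η (D om)) ζ) (g : SL p) (x : X p) :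
    η g * fam η ζ x * (η g)⁻¹ = fam η ζ (pm p g x) := by
  have key : ∀ g, pm p g OnePoint.infty = OnePoint.infty → Commute (η g) ζ := by
    intro g hg
    obtain ⟨t, s, rfl⟩ := stab g hg
    obtain ⟨i, rfl⟩ := hom t
    rw [U_pow, D_pow, map_mul, map_pow, map_pow]
    exact (h2.pow_left i).mul_left (h1.pow_left _)
  have h := key ((gam (pm p g x))⁻¹ * g * gam x) (by
    rw [map_mul, map_mul, Equiv.Perm.mul_apply, Equiv.Perm.mul_apply, pm_gam, map_inv, Equiv.Perm.inv_eq_iff_eq, pm_gam])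
  have h3 : η g * η (gam x) = η (gam (pm p g x)) * η ((gam (pm p g x))⁻¹ * g * gam x) := by
    rw [← map_mul, ← map_mul]; congr 1; group
  calc η g * fam η ζ x * (η g)⁻¹ = (η g * η (gam x)) * ζ * (η g * η (gam x))⁻¹ := by unfold fam; group
    _ = fam η ζ (pm p g x) := by
      rw [h3, mul_assoc (η (gam (pm p g x))), h.eq]; unfold fam; group
end fam

theorem trans2 (x y : X p) (h : x ≠ y) : ∃ g : SL p, pm p g OnePoint.infty = x ∧ pm p g ((0 : ZMod p) : X p) = y := by
  have h2 : (pm p (gam x)).symm y ≠ OnePoint.infty := by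
    intro h3; apply h; rw [Equiv.symm_apply_eq, pm_gam] at h3; exact h3.symm
  obtain ⟨t, ht⟩ := OnePoint.ne_infty_iff_exists.1 h2
  refine ⟨gam x * U t, by simp [pm_gam], ?_⟩
  rw [map_mul, Equiv.Perm.mul_apply, pmU, zero_add, ht]; simp

theorem trans3 (om : (ZMod p)ˣ) (hom : ∀ t : (ZMod p)ˣ, ∃ i : ℕ, t = om ^ i) (x y w : X p) (h : x ≠ y) (hx : w ≠ x) (hy : w ≠ y) :
    ∃ g : SL p, pm p g OnePoint.infty = x ∧ pm p g ((0 : ZMod p) : X p) = y ∧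
     (pm p g ((1 : ZMod p) : X p) = w ∨ pm p g (((om : ZMod p)) : X p) = w) := by
  obtain ⟨g, rfl, rfl⟩ := trans2 x y h
  have h2 : (pm p g).symm w ≠ OnePoint.infty := by
    intro h3; apply hx; rw [Equiv.symm_apply_eq] at h3; exact h3
  obtain ⟨t, ht⟩ := OnePoint.ne_infty_iff_exists.1 h2
  have h0 : t ≠ 0 := by
    rintro rfl; apply hy; rw [eq_comm, Equiv.symm_apply_eq] at ht; exact ht
  obtain ⟨i, hi⟩ := hom (Units.mk0 t h0)
  have hi' : t = (om : ZMod p) ^ i := by simpa using congrArg Units.val hi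
  rcases Nat.even_or_odd' i with ⟨j, rfl | rfl⟩
  · refine ⟨g * D (om ^ j), by simp, by simp, Or.inl ?_⟩
    rw [map_mul, Equiv.Perm.mul_apply, pmD, ← Equiv.eq_symm_apply, ← ht, hi']
    congr 1; push_cast; ring
  · refine ⟨g * D (om ^ j), by simp, by simp, Or.inr ?_⟩
    rw [map_mul, Equiv.Perm.mul_apply, pmD, ← Equiv.eq_symm_apply, ← ht, hi']
    congr 1; push_cast; ring

/-- triviality of homs -/
theorem triv_of_U {Q : Type} [Group Q] (f : SL p →* Q) (h : f (U 1) = 1) : ∀ g, f g = 1 := by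
  have hU : ∀ s, f (U s) = 1 := fun s => by rw [U_pow, map_pow, h, one_pow]
  have hW : f W = 1 := by
    have := D_W (F := ZMod p) 1
    rw [D_one, one_mul] at this
    have h2 := congrArg f this
    simpa [hU] using h2
  intro g
  have := ((bruhat g).map f).mem_closure
  have h2 : Subgroup.closure (f '' (Set.range U ∪ {W})) ≤ ⊥ := by
    rw [Subgroup.closure_le]
    rintro _ ⟨_, ⟨s, rfl⟩ | rfl, rfl⟩
    · simp [hU]
    · simp [hW]
  simpa using h2 this

theorem triv_of_D {Q : Type} [Group Q] (f : SL p →* Q) (om : (ZMod p)ˣ) (hom : (om : ZMod p) ^ 2 ≠ 1) (h : f (D om) = 1) : ∀ g, f g = 1 := by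
  apply triv_of_U
  have hne : (om : ZMod p) ^ 2 - 1 ≠ 0 := sub_ne_zero.2 hom
  have h1 : ∀ a : ZMod p, f (U ((om ^ 2 - 1) * a)) = 1 := by
    intro a
    have := congrArg f (D_X om a)
    simp only [map_mul, map_inv, h, one_mul, inv_one, mul_one] at this
    have e : ((om : ZMod p) ^ 2 * a) = (om ^ 2 - 1) * a + a := by ring
    rw [e, X_add, map_mul] at this
    simpa using this.symm
  have := h1 ((om : ZMod p) ^ 2 - 1)⁻¹
  rwa [mul_inv_cancel₀ hne] at this

theorem norm_of {Γ : Type} [Group Γ] {G : Type} [Group G] (f : G →* Γ) (S : Set Γ) (h : ∀ g, ∀ x ∈ S, f g * x * (f g)⁻¹ ∈ Subgroup.closure S)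
    (g : G) (x : Γ) (hx : x ∈ Subgroup.closure S) : f g * x * (f g)⁻¹ ∈ Subgroup.closure S := by
  have : Subgroup.closure S ≤ (Subgroup.closure S).comap (MulAut.conj (f g)).toMonoidHom := by
    rw [Subgroup.closure_le]
    intro x hx
    simpa using h g x hx
  simpa using this hx

theorem exists_om (p : ℕ) [Fact p.Prime] (hp : 5 ≤ p) : ∃ om : (ZMod p)ˣ, (∀ t : (ZMod p)ˣ, ∃ i : ℕ, t = om ^ i) ∧ (om : ZMod p) ^ 2 ≠ 1 ∧ orderOf om = p - 1 := by
  obtain ⟨om, h⟩ := IsCyclic.exists_generator (α := (ZMod p)ˣ)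
  have ho : orderOf om = p - 1 := by
    rw [orderOf_eq_card_of_forall_mem_zpowers h, Nat.card_eq_fintype_card, ZMod.card_units]
  refine ⟨om, ?_, ?_, ho⟩
  · intro t
    obtain ⟨i, hi⟩ := (mem_powers_iff_mem_zpowers.2 (h t))
    exact ⟨i, hi.symm⟩
  · intro h2
    have : om ^ 2 = 1 := by ext; simpa using h2
    have := orderOf_dvd_of_pow_eq_one this
    rw [ho] at this
    have := Nat.le_of_dvd (by norm_num) this
    omega
end P1

theorem coprod_mem {G H Γ : Type} [Group G] [Group H] [Group Γ] (ψ : Monoid.Coprod G H →* Γ) (P : Subgroup Γ)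
    (h1 : ∀ g, ψ (Monoid.Coprod.inl g) ∈ P) (h2 : ∀ g, ψ (Monoid.Coprod.inr g) ∈ P) (x : Monoid.Coprod G H) : ψ x ∈ P := by
  induction x using Monoid.Coprod.induction_on with
  | inl m => exact h1 m
  | inr n => exact h2 n
  | mul x y hx hy => rw [map_mul]; exact mul_mem hx hy

theorem free1_mem {Γ : Type} [Group Γ] (ψ : FreeGroup Unit →* Γ) (P : Subgroup Γ)
    (h1 : ψ (FreeGroup.of ()) ∈ P) (x : FreeGroup Unit) : ψ x ∈ P := by
  induction x using FreeGroup.induction_on with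
  | C1 => rw [map_one]; exact one_mem _
  | of x => exact h1
  | inv_of x h => rw [map_inv]; exact inv_mem h1
  | mul x y hx hy => rw [map_mul]; exact mul_mem hx hy

/-- free product of two groups and an infinite cyclic group, abstractly -/
theorem pieces3 {G H : Type} [Group G] [Group H] {c c' ℓ : ℕ} {T : Set G} {T' : Set H} (hl : 1 ≤ ℓ) (h0 : SP c ℓ G T) (h0' : SP c' ℓ H T') :
    ∃ (K : Type) (_ : Group K) (TK : Set K) (h : G →* K) (h' : H →* K) (z : K), SP (c + (c' + 1)) ℓ K TK ∧
      (∀ g ∈ T, h g ∈ TK) ∧ (∀ g ∈ T', h' g ∈ TK) ∧ z ∈ TK ∧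
      (∀ (Γ : Type) [Group Γ] (a : G →* Γ) (a' : H →* Γ) (ζ : Γ), ∃ f : K →* Γ, (∀ g, f (h g) = a g) ∧ (∀ g, f (h' g) = a' g) ∧ f z = ζ) ∧
      (∀ (Γ : Type) [Group Γ] (ψ : K →* Γ) (P : Subgroup Γ), (∀ g, ψ (h g) ∈ P) → (∀ g, ψ (h' g) ∈ P) → ψ z ∈ P → ∀ x, ψ x ∈ P) := by
  refine ⟨Monoid.Coprod G (Monoid.Coprod H (FreeGroup Unit)), inferInstance, _, Monoid.Coprod.inl,
    Monoid.Coprod.inr.comp Monoid.Coprod.inl, Monoid.Coprod.inr (Monoid.Coprod.inr (FreeGroup.of ())),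
    h0.coprod (h0'.coprod (SP.free Unit ℓ 1 (by simp))), ?_, ?_, ?_, ?_, ?_⟩
  · exact fun g hg => (Or.inl ⟨g, hg, rfl⟩)
  · exact fun g hg => (Or.inr ⟨_, Or.inl ⟨g, hg, rfl⟩, rfl⟩)
  · exact (Or.inr ⟨_, Or.inr ⟨_, Bl.of ⟨(), rfl⟩ (by omega), rfl⟩, rfl⟩)
  · intro Γ _ a a' ζ
    refine ⟨Monoid.Coprod.lift a (Monoid.Coprod.lift a' (FreeGroup.lift (fun _ => ζ))), ?_, ?_, ?_⟩
    · exact fun g => Monoid.Coprod.lift_apply_inl _ _ g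
    · exact fun g => (Monoid.Coprod.lift_apply_inr _ _ _).trans (Monoid.Coprod.lift_apply_inl _ _ g)
    · exact (Monoid.Coprod.lift_apply_inr _ _ _).trans ((Monoid.Coprod.lift_apply_inr _ _ _).trans FreeGroup.lift_apply_of)
  · intro Γ _ ψ P h1 h2 h3 x
    refine coprod_mem ψ P h1 ?_ x
    intro y
    refine coprod_mem (ψ.comp Monoid.Coprod.inr) P h2 ?_ y
    intro y
    exact free1_mem ((ψ.comp Monoid.Coprod.inr).comp Monoid.Coprod.inr) P h3 y

theorem perm_inv_self {Y : Type} (e : Equiv.Perm Y) (x : Y) : e⁻¹ (e x) = x := e.symm_apply_apply x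

namespace P1
open SL2
open scoped Matrix

/-- permutations of an option type -/
def oc (Y : Type) : Equiv.Perm Y →* Equiv.Perm (Option Y) :=
  MonoidHom.mk' (fun e => Equiv.optionCongr e) (by
    intro a b; ext1 x; cases x <;> rfl)
@[simp] theorem oc_none {Y : Type} (e : Equiv.Perm Y) : oc Y e none = none := rfl
@[simp] theorem oc_some {Y : Type} (e : Equiv.Perm Y) (y : Y) : oc Y e (some y) = some (e y) := rfl

variable (p : ℕ) [Fact p.Prime]

/-- the action of `SL` on the projective line plus a fixed point -/
noncomputable def A : SL p →* Equiv.Perm (Option (X p)) := (oc (X p)).comp (pm p)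
@[simp] theorem A_none (g : SL p) : A p g none = none := rfl
@[simp] theorem A_some (g : SL p) (x : X p) : A p g (some x) = some (pm p g x) := rfl

theorem A_swap (g : SL p) (x : X p) : A p g * Equiv.swap none (some x) * (A p g)⁻¹ = Equiv.swap none (some (pm p g x)) := by
  rw [← Equiv.swap_apply_apply]; rfl

theorem exists_tau (hp : 5 ≤ p) (om : (ZMod p)ˣ) (ho : orderOf om = p - 1) :
    ∃ τ : Equiv.Perm (X p), τ OnePoint.infty = OnePoint.infty ∧ ∃ S : Finset (ZMod p), S.card ≤ 3 ∧
      ∀ j : ZMod p, j ∉ S → τ ((j + 1 : ZMod p) : X p) = pm p (D om) (τ (j : X p)) := by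
  classical
  obtain ⟨r, hr⟩ : ∃ r, p = 2 * r + 1 := (Nat.Prime.odd_of_ne_two (Fact.out : p.Prime) (by omega))
  let v : ℕ → ZMod p := fun v => if v < r then (om : ZMod p) ^ (2 * v) else if v < 2 * r then (om : ZMod p) ^ (2 * (v - r) + 1) else 0
  have pw : ∀ i j : ℕ, i < 2 * r → j < 2 * r → (om : ZMod p) ^ i = om ^ j → i = j := by
    intro i j hi hj h
    apply pow_injOn_Iio_orderOf (x := om) (by simp [ho]; omega) (by simp [ho]; omega)
    ext; simpa using h
  have hv : ∀ i j : ℕ, i < p → j < p → v i = v j → i = j := by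
    intro i j hi hj h
    simp only [v] at h
    have h0 : ∀ k : ℕ, (om : ZMod p) ^ k ≠ 0 := fun k => pow_ne_zero _ om.ne_zero
    split_ifs at h with h1 h2 h3 h4 h5 h6
    all_goals first
      | (have := pw _ _ (by omega) (by omega) h; omega)
      | exact absurd h (h0 _)
      | exact absurd h.symm (h0 _)
      | omega
  let t : ZMod p → ZMod p := fun j => v j.val
  have ht : Function.Bijective t := by
    rw [← Finite.injective_iff_bijective]
    intro i j h
    exact ZMod.val_injective p (hv _ _ (ZMod.val_lt i) (ZMod.val_lt j) h)
  obtain ⟨τ, hτ1, e1⟩ : ∃ τ : Equiv.Perm (X p), τ OnePoint.infty = OnePoint.infty ∧ ∀ x : ZMod p, τ (x : X p) = (t x : X p) :=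
    ⟨Equiv.optionCongr (Equiv.ofBijective t ht), rfl, fun _ => rfl⟩
  refine ⟨τ, hτ1, {((r - 1 : ℕ) : ZMod p), ((2 * r - 1 : ℕ) : ZMod p), ((2 * r : ℕ) : ZMod p)}, Finset.card_le_three, ?_⟩
  intro j hj
  rw [e1, e1, pmD]
  congr 1
  simp only [Finset.mem_insert, Finset.mem_singleton, not_or] at hj
  have hval : ∀ k : ℕ, j ≠ (k : ZMod p) → j.val ≠ k := by
    intro k hk h; apply hk; rw [← h]; simp
  have a1 := hval _ hj.1
  have a2 := hval _ hj.2.1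
  have a3 := hval _ hj.2.2
  have a4 := ZMod.val_lt j
  have a5 : (j + 1).val = j.val + 1 := by
    rw [ZMod.val_add_of_lt] <;> rw [ZMod.val_one'' (by omega)]
    omega
  simp only [t, v, a5]
  split_ifs with h1 h2 h3 h4 h5 h6
  all_goals first
    | omega
    | (rw [← pow_add]; congr 1; omega)

theorem presD : ∃ c, ∀ p [Fact p.Prime], 5 ≤ p → SP c (1 + Nat.log 2 p) (Equiv.Perm (Option (X p)))
    (Set.range (A p) ∪ Set.range (Equiv.swap none)) := by
  obtain ⟨c, hc⟩ := SL2.main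
  refine ⟨3 * ((40 + 1) * (c + (c + 1)) + 20), ?_⟩
  intro p _ hp
  obtain ⟨om, hom, hom2, ho⟩ := exists_om p hp
  obtain ⟨τ, hτ, S, hS, hτS⟩ := exists_tau p hp om ho
  set ℓ := 1 + Nat.log 2 p with hℓ
  have h0 : SP c ℓ (SL p) Set.univ := by
    have := hc (ZMod p); rwa [ZMod.card] at this
  obtain ⟨K, _, T, h, h', z, hK, mh, mh', mz, hlift, hmem⟩ := pieces3 (by omega) h0 h0
  have bh : ∀ g, Bl T 1 (h g) := fun g => Bl.of (mh g trivial)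
  have bh' : ∀ g, Bl T 1 (h' g) := fun g => Bl.of (mh' g trivial)
  have bz : Bl T 1 z := Bl.of mz
  let A' : SL p →* Equiv.Perm (Option (X p)) := (MulAut.conj (oc (X p) τ)).toMonoidHom.comp (A p)
  have hA' : ∀ g, A' g = oc (X p) τ * A p g * (oc (X p) τ)⁻¹ := fun g => rfl
  have A'_some : ∀ g x, A' g (some (τ x)) = some (τ (pm p g x)) := by
    intro g x
    rw [hA', Equiv.Perm.mul_apply, Equiv.Perm.mul_apply, ← oc_some, perm_inv_self, A_some, oc_some]
  have A'_none : ∀ g, A' g none = none := by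
    intro g
    rw [hA', Equiv.Perm.mul_apply, Equiv.Perm.mul_apply]
    conv_lhs => rw [← oc_none τ, perm_inv_self]
    simp
  obtain ⟨f, fh, fh', fz⟩ := hlift _ (A p) A' (Equiv.swap none (some OnePoint.infty))
  have fam_map : ∀ (Γ : Type) [Group Γ] (ψ : K →* Γ) (x : X p), ψ (fam h z x) = fam (ψ.comp h) (ψ z) x := by
    intro Γ _ ψ x; simp [fam]
  have bfam : ∀ x, Bl T 3 (fam h z x) := fun x => (bh _).conj bz
  have ffam : ∀ x, f (fam h z x) = Equiv.swap none (some x) := by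
    intro x
    have : f (fam h z x) = A p (gam x) * Equiv.swap none (some OnePoint.infty) * (A p (gam x))⁻¹ := by
      simp [fam, fh, fz]
    rw [this, A_swap, pm_gam]
  -- the word w
  have e0 : Bl (f '' (Set.range (fam h z) ∪ {1})) 9 (A' (U 1) * (A p (D om))⁻¹) := by
    have := supp_bl none (S.image (fun j : ZMod p => (some (pm p (D om) (τ (j : X p))) : Option (X p)))) (A' (U 1) * (A p (D om))⁻¹) ?_
    · refine this.mono ?_ ?_
      · rintro _ ⟨x, rfl⟩
        cases x with
        | none => exact ⟨1, Or.inr rfl, by simp; rfl⟩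
        | some x => exact ⟨_, Or.inl ⟨x, rfl⟩, ffam x⟩
      · have := Finset.card_image_le (s := S) (f := (fun j : ZMod p => (some (pm p (D om) (τ (j : X p))) : Option (X p))))
        omega
    · intro x hx
      obtain ⟨y, rfl⟩ := (A p (D om)).surjective x
      rw [Equiv.Perm.mul_apply, perm_inv_self]
      cases y with
      | none => simp [A'_none]
      | some y =>
        obtain ⟨y, rfl⟩ := τ.surjective y
        rw [A'_some]
        induction y using OnePoint.rec with
        | infty => simp [hτ]
        | coe y =>
          rw [pmU, A_some]
          congr 1
          apply hτS
          intro hy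
          exact hx (Finset.mem_image.2 ⟨y, hy, rfl⟩)
  obtain ⟨w, hw, fw⟩ := Bl.lift (G := K) f e0
  have bw : Bl T 27 w := by
    refine (Bl.comp (k := 3) ?_ hw)
    rintro _ (⟨x, rfl⟩ | rfl)
    · exact bfam x
    · exact Bl.one
  let z0 := fam h z ((0 : ZMod p) : X p)
  let L : List K := [z * z, ⁅h (U 1), z⁆, ⁅h (D om), z⁆, (z * z0 * z) * (z0 * z * z0)⁻¹,
    ⁅z * z0 * z, fam h z ((1 : ZMod p) : X p)⁆, ⁅z * z0 * z, fam h z ((om : ZMod p) : X p)⁆,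
    ⁅h' (U 1), z⁆, ⁅h' (D om), z⁆, (h' W * z * (h' W)⁻¹) * (fam h z (τ ((0 : ZMod p) : X p)))⁻¹,
    (h' (U 1) * (h (D om))⁻¹) * w⁻¹]
  have sw : ∀ a b c : Option (X p), a ≠ b → a ≠ c → b ≠ c →
      Equiv.swap a b * Equiv.swap a c * Equiv.swap a b = Equiv.swap b c := by
    intro a b c h1 h2 h3
    rw [Equiv.swap_comm a c]
    exact (Equiv.swap_mul_swap_mul_swap (x := c) (y := a) (z := b) h2.symm h3.symm).trans rfl
  have swc : ∀ a b c d : Option (X p), a ≠ c → a ≠ d → b ≠ c → b ≠ d →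
      Commute (Equiv.swap a b) (Equiv.swap c d) := by
    intro a b c d h1 h2 h3 h4
    have := Equiv.swap_apply_apply (Equiv.swap a b) c d
    rw [Equiv.swap_apply_of_ne_of_ne h1.symm h3.symm, Equiv.swap_apply_of_ne_of_ne h2.symm h4.symm] at this
    rw [commute_iff_eq]
    conv_rhs => rw [this]
    simp
  have hA'1 : ∀ g x, A' g * Equiv.swap none (some (τ x)) * (A' g)⁻¹ = Equiv.swap none (some (τ (pm p g x))) := by
    intro g x; rw [← Equiv.swap_apply_apply, A'_some, A'_none]
  have hSP := SP.assembleL hK (k := 40) f ?_ 20 L (by simp [L]) ?_ ?_ ?_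
  · refine (hSP.ball 3 (by norm_num)).mono le_rfl le_rfl ?_
    have b1 : ∀ g, Bl (f '' T) 1 (A p g) := fun g => by
      have := (bh g).map f; rwa [fh] at this
    rintro _ (⟨g, rfl⟩ | ⟨x, rfl⟩)
    · exact (b1 g).le (by norm_num)
    · cases x with
      | none => simp only [Equiv.swap_self]; exact Bl.one
      | some x => have := (bfam x).map f; rwa [ffam] at this
  · have : f.range = ⊤ := by
      apply perm_top_of_star none
      intro x
      cases x with
      | none => rw [Equiv.swap_self]; exact one_mem _
      | some x => exact ⟨_, ffam x⟩
    exact MonoidHom.range_eq_top.1 this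
  · intro e he
    simp only [L, List.mem_cons, List.not_mem_nil, or_false] at he
    rcases he with rfl | rfl | rfl | rfl | rfl | rfl | rfl | rfl | rfl | rfl
    all_goals
      apply Bl.le
      · repeat' first
          | exact bz
          | exact bh _
          | exact bh' _
          | exact bfam _
          | exact bw
          | apply Bl.comm
          | apply Bl.mul
          | apply Bl.inv
      · norm_num
  · have hA1 : ∀ g, pm p g OnePoint.infty = OnePoint.infty → A p g * Equiv.swap none (some OnePoint.infty) * (A p g)⁻¹ = Equiv.swap none (some OnePoint.infty) := by
      intro g hg; rw [A_swap, hg]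
    have i0 : (some OnePoint.infty : Option (X p)) ≠ some ((0 : ZMod p) : X p) := by simp
    have i1 : ∀ t : ZMod p, (some OnePoint.infty : Option (X p)) ≠ some (t : X p) := by simp
    have i2 : ∀ t : ZMod p, t ≠ 0 → (some ((0 : ZMod p) : X p) : Option (X p)) ≠ some (t : X p) := by
      intro t ht h; apply ht; simpa using h.symm
    intro e he
    simp only [L, List.mem_cons, List.not_mem_nil, or_false] at he
    rcases he with rfl | rfl | rfl | rfl | rfl | rfl | rfl | rfl | rfl | rfl
    · simp [fz]
    · rw [commutatorElement_def]; simp only [map_mul, map_inv, fh, fz]; rw [hA1 _ (by simp)]; simp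
    · rw [commutatorElement_def]; simp only [map_mul, map_inv, fh, fz]; rw [hA1 _ (by simp)]; simp
    · simp only [map_mul, map_inv, z0, ffam, fz]
      rw [sw _ _ _ (by simp) (by simp) i0, sw _ _ _ (by simp) (by simp) i0.symm, Equiv.swap_comm]; simp
    · rw [map_commutatorElement, commutatorElement_eq_one_iff_commute]
      simp only [map_mul, z0, ffam, fz]
      rw [sw _ _ _ (by simp) (by simp) i0]
      exact swc _ _ _ _ (by simp) (i1 _) (by simp) (i2 _ one_ne_zero)
    · rw [map_commutatorElement, commutatorElement_eq_one_iff_commute]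
      simp only [map_mul, z0, ffam, fz]
      rw [sw _ _ _ (by simp) (by simp) i0]
      exact swc _ _ _ _ (by simp) (i1 _) (by simp) (i2 _ om.ne_zero)
    · rw [commutatorElement_def]; simp only [map_mul, map_inv, fh', fz]
      have := hA'1 (U 1) OnePoint.infty
      rw [pmU_inf, hτ] at this
      rw [this]; simp
    · rw [commutatorElement_def]; simp only [map_mul, map_inv, fh', fz]
      have := hA'1 (D om) OnePoint.infty
      rw [pmD_inf, hτ] at this
      rw [this]; simp
    · simp only [map_mul, map_inv, fh', fz, ffam]
      have := hA'1 W OnePoint.infty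
      rw [pmW_inf, hτ] at this
      rw [this]; simp
    · simp only [map_mul, map_inv, fh', fh, fw]; group
  · intro Γ _ ψ π hψ hπ hr
    let η := ψ.comp h
    let η' := ψ.comp h'
    let ζ := ψ z
    let Z := fam η ζ
    have πψ : ∀ x, π (ψ x) = f x := hπ
    have hZ : ∀ x, ψ (fam h z x) = Z x := fun x => fam_map Γ ψ x
    have πZ : ∀ x, π (Z x) = Equiv.swap none (some x) := fun x => by rw [← hZ, hπ, ffam]
    simp only [L, List.mem_cons, List.not_mem_nil, or_false, forall_eq_or_imp, forall_eq] at hr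
    obtain ⟨r1, r2, r3, r4, r5, r6, r7, r8, r9, r10⟩ := hr
    rw [map_commutatorElement, commutatorElement_eq_one_iff_commute] at r2 r3 r5 r6 r7 r8
    rw [map_mul, map_inv, mul_inv_eq_one] at r4 r9 r10
    simp only [map_mul, map_inv, hZ, z0] at r1 r4 r5 r6 r9 r10
    have Zc : ∀ g x, η g * Z x * (η g)⁻¹ = Z (pm p g x) := fun g x => fam_conj η ζ om hom r2 r3 g x
    have Zi : Z OnePoint.infty = ζ := fam_inf η ζ
    have Zc' : ∀ g x, Z (pm p g x) = MulAut.conj (η g) (Z x) := fun g x => (Zc g x).symm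
    have z2 : ∀ x, Z x * Z x = 1 := by
      intro x
      rw [← pm_gam x, Zc', ← map_mul, Zi]
      have : ζ * ζ = 1 := r1
      rw [this, map_one]
    have z3 : ∀ x y, x ≠ y → Z x * Z y * Z x = Z y * Z x * Z y := by
      intro x y hxy
      obtain ⟨g, rfl, rfl⟩ := trans2 x y hxy
      rw [Zc', Zc']; simp only [← map_mul]; rw [Zi]
      exact congrArg _ r4
    have z4 : ∀ x y w, x ≠ y → x ≠ w → y ≠ w → Commute (Z x * Z y * Z x) (Z w) := by
      intro x y w h1 h2 h3
      obtain ⟨g, rfl, rfl, rfl | rfl⟩ := trans3 om hom x y w h1 h2.symm h3.symm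
      · simp only [Zc', ← map_mul]; rw [Zi]; exact r5.map _
      · simp only [Zc', ← map_mul]; rw [Zi]; exact r6.map _
    let N0 := Subgroup.closure (Set.range Z)
    have ZN : ∀ x, Z x ∈ N0 := fun x => Subgroup.subset_closure ⟨x, rfl⟩
    have inj : ∀ g ∈ N0, π g = 1 → g = 1 := by
      intro g hg h1
      refine starPerm_inj (none : Option (X p)) (fun x => match x with | none => 1 | some x => Z x) π ?_ ?_ ?_ ?_ g ?_ h1
      · rintro (_ | x) hx
        · exact absurd rfl hx
        · exact πZ x
      · rintro (_ | x) hx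
        · exact absurd rfl hx
        · exact z2 x
      · rintro (_ | x) (_ | y) hx hy hxy
        · exact absurd rfl hx
        · exact absurd rfl hx
        · exact absurd rfl hy
        · exact z3 x y (fun h => hxy (h ▸ rfl))
      · rintro (_ | x) (_ | y) (_ | w) hx hy hw hxy hxw hyw
        any_goals first | exact absurd rfl hx | exact absurd rfl hy | exact absurd rfl hw
        exact z4 x y w (fun h => hxy (h ▸ rfl)) (fun h => hxw (h ▸ rfl)) (fun h => hyw (h ▸ rfl))
      · refine Subgroup.closure_mono ?_ hg
        rintro _ ⟨x, rfl⟩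
        exact ⟨some x, by simp, rfl⟩
    have inj2 : ∀ a ∈ N0, ∀ b ∈ N0, π a = π b → a = b := by
      intro a ha b hb hab
      have := inj (a * b⁻¹) (mul_mem ha (inv_mem hb)) (by simp [hab])
      exact mul_inv_eq_one.1 this
    have wN : ψ w ∈ N0 := by
      have := (hw.map ψ).mem_closure
      refine (Subgroup.closure_le N0).2 ?_ this
      rintro _ ⟨_, ⟨x, rfl⟩ | rfl, rfl⟩
      · rw [hZ]; exact ZN x
      · rw [map_one]; exact one_mem _
    let Z' := fam η' ζ
    have Z'c : ∀ g x, η' g * Z' x * (η' g)⁻¹ = Z' (pm p g x) := fun g x => fam_conj η' ζ om hom r7 r8 g x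
    have Z'i : Z' OnePoint.infty = ζ := fam_inf η' ζ
    have Z'nat : ∀ n : ℕ, Z' ((n : ZMod p) : X p) = Z (τ ((n : ZMod p) : X p)) := by
      intro n
      induction n with
      | zero =>
        have := Z'c W OnePoint.infty
        rw [pmW_inf, Z'i] at this
        rw [Nat.cast_zero, ← this]; exact r9
      | succ n ih =>
        have := Z'c (U 1) ((n : ZMod p) : X p)
        rw [pmU] at this
        rw [Nat.cast_succ, ← this, ih]
        have e : η' (U 1) = ψ w * η (D om) := mul_inv_eq_iff_eq_mul.1 r10
        apply inj2 _ _ _ (ZN _)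
        · rw [map_mul, map_mul, map_inv]
          have e2 : π (η' (U 1)) = A' (U 1) := by rw [← fh']; exact hπ _
          rw [e2, πZ, πZ, hA'1, pmU]
        · rw [e]
          have : ψ w * η (D om) * Z (τ ((n : ZMod p) : X p)) * (ψ w * η (D om))⁻¹ = ψ w * (η (D om) * Z (τ ((n : ZMod p) : X p)) * (η (D om))⁻¹) * (ψ w)⁻¹ := by group
          rw [this, Zc]
          exact mul_mem (mul_mem wN (ZN _)) (inv_mem wN)
    have Z'Z : ∀ x, Z' x = Z (τ x) := by
      intro x
      induction x using OnePoint.rec with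
      | infty => rw [hτ, Zi, Z'i]
      | coe x =>
        have := Z'nat x.val
        rwa [ZMod.natCast_zmod_val] at this
    have nη : ∀ g x, x ∈ N0 → η g * x * (η g)⁻¹ ∈ N0 := by
      intro g x hx
      refine norm_of η (Set.range Z) ?_ g x hx
      rintro g _ ⟨x, rfl⟩
      rw [Zc]; exact ZN _
    have nη' : ∀ g x, x ∈ N0 → η' g * x * (η' g)⁻¹ ∈ N0 := by
      intro g x hx
      refine norm_of η' (Set.range Z) ?_ g x hx
      rintro g _ ⟨x, rfl⟩
      obtain ⟨x, rfl⟩ := τ.surjective x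
      rw [← Z'Z, Z'c, Z'Z]; exact ZN _
    have ζN : ζ ∈ N0 := Zi ▸ ZN _
    have genmem : ∀ P : Subgroup Γ, (∀ g, η g ∈ P) → (∀ g, η' g ∈ P) → ζ ∈ P → ∀ x : K, ψ x ∈ P := by
      intro P h1 h2 h3 x
      exact hmem Γ ψ P h1 h2 h3 x
    have hnor : N0.Normal := by
      rw [← Subgroup.normalizer_eq_top_iff, eq_top_iff]
      intro γ _
      obtain ⟨k, rfl⟩ := hψ γ
      have mk : ∀ {G : Type} [Group G] (η : G →* Γ), (∀ g x, x ∈ N0 → η g * x * (η g)⁻¹ ∈ N0) → ∀ g, η g ∈ Subgroup.normalizer (N0 : Set Γ) := by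
        intro G _ η hη g
        rw [Subgroup.mem_normalizer_iff]
        intro x
        refine ⟨hη g x, fun hx => ?_⟩
        have := hη g⁻¹ _ hx
        rw [map_inv] at this
        convert this using 1; group
      refine genmem _ (mk η nη) (mk η' nη') (Subgroup.le_normalizer ζN) k
    let q := QuotientGroup.mk' N0
    have q1 : ∀ x, q x = 1 ↔ x ∈ N0 := fun x => QuotientGroup.eq_one_iff x
    have qe : q (η' (U 1)) = q (η (D om)) := by
      have e : η' (U 1) = ψ w * η (D om) := mul_inv_eq_iff_eq_mul.1 r10
      rw [e, map_mul, (q1 _).2 wN, one_mul]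
    have qp : q (η' (U 1)) ^ p = 1 := by
      rw [← map_pow, ← map_pow, U_nat]; simp [X_zero]
    have qp2 : q (η' (U 1)) ^ (p - 1) = 1 := by
      rw [qe, ← map_pow, ← map_pow, ← D_pow, ← ho, pow_orderOf_eq_one]; simp [D_one]
    have qq : q (η' (U 1)) = 1 := by
      have := pow_succ (q (η' (U 1))) (p - 1)
      rw [Nat.sub_add_cancel (by omega), qp, qp2, one_mul] at this
      exact this.symm
    have hη : ∀ g, η g ∈ N0 := fun g => (q1 _).1 (triv_of_D (q.comp η) om hom2 (by rw [MonoidHom.comp_apply, ← qe, qq]) g)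
    have hη' : ∀ g, η' g ∈ N0 := fun g => (q1 _).1 (triv_of_U (q.comp η') qq g)
    rw [injective_iff_map_eq_one]
    intro γ hγ
    obtain ⟨k, rfl⟩ := hψ γ
    exact inj _ (genmem N0 hη hη' ζN k) hγ
end P1

theorem via_swap {X Y : Type} [DecidableEq X] [DecidableEq Y] (j : X ↪ Y) (a b : X) :
    Equiv.Perm.viaEmbeddingHom j (Equiv.swap a b) = Equiv.swap (j a) (j b) := by
  ext1 x
  rw [Equiv.Perm.viaEmbeddingHom_apply]
  by_cases h : x ∈ Set.range j
  · obtain ⟨x, rfl⟩ := h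
    rw [Equiv.Perm.viaEmbedding_apply]
    by_cases h1 : x = a
    · subst h1; simp
    by_cases h2 : x = b
    · subst h2; simp
    rw [Equiv.swap_apply_of_ne_of_ne h1 h2, Equiv.swap_apply_of_ne_of_ne (j.injective.ne h1) (j.injective.ne h2)]
  · rw [Equiv.Perm.viaEmbedding_apply_of_notMem _ _ _ h, Equiv.swap_apply_of_ne_of_ne]
    · rintro rfl; exact h ⟨a, rfl⟩
    · rintro rfl; exact h ⟨b, rfl⟩

theorem swap_star {X : Type} [DecidableEq X] {a b c : X} (h1 : a ≠ b) (h2 : a ≠ c) (h3 : b ≠ c) :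
      Equiv.swap a b * Equiv.swap a c * Equiv.swap a b = Equiv.swap b c := by
  rw [Equiv.swap_comm a c]
  exact (Equiv.swap_mul_swap_mul_swap (x := c) (y := a) (z := b) h2.symm h3.symm).trans rfl

theorem swap_comm_of {X : Type} [DecidableEq X] {c d : X} (g : Equiv.Perm X) (h1 : g c = c) (h2 : g d = d) :
    Commute g (Equiv.swap c d) := by
  have := Equiv.swap_apply_apply g c d
  rw [h1, h2] at this
  rw [commute_iff_eq]
  conv_rhs => rw [this]
  simp

theorem swap_disj {X : Type} [DecidableEq X] {a b c d : X} (h1 : a ≠ c) (h2 : a ≠ d) (h3 : b ≠ c) (h4 : b ≠ d) :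
    Commute (Equiv.swap a b) (Equiv.swap c d) :=
  swap_comm_of _ (Equiv.swap_apply_of_ne_of_ne h1.symm h3.symm) (Equiv.swap_apply_of_ne_of_ne h2.symm h4.symm)

theorem hom_conj_ext {G Γ : Type} [Group G] [Group Γ] (θ : G →* Γ) (u : Γ) (α : G) (S : Set G) (hS : Subgroup.closure S = ⊤)
    (h : ∀ s ∈ S, u * θ s * u⁻¹ = θ (α * s * α⁻¹)) (s : G) : u * θ s * u⁻¹ = θ (α * s * α⁻¹) := by
  have := MonoidHom.eq_of_eqOn_dense (f := (MulAut.conj u).toMonoidHom.comp θ) (g := θ.comp (MulAut.conj α).toMonoidHom) hS (by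
    intro s hs; simpa using h s hs)
  simpa using congrArg (fun f => f s) this

theorem comm_of_gen {G Γ : Type} [Group G] [Group Γ] (θ : G →* Γ) (u : Γ) (S : Set G) (hS : Subgroup.closure S = ⊤)
    (h : ∀ s ∈ S, Commute u (θ s)) (s : G) : Commute u (θ s) := by
  have := hom_conj_ext θ u 1 S hS (by intro s hs; rw [(h s hs).eq]; simp) s
  rw [commute_iff_eq, ← mul_inv_eq_iff_eq_mul, this]; simp

/-- symmetry of the third star relation -/
theorem star_sym {Γ : Type} [Group Γ] {a b c : Γ} (ha : a * a = 1) (hb : b * b = 1)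
    (hab : a * b * a = b * a * b) (h : Commute (a * b * a) c) : Commute (a * c * a) b := by
  have ai : a⁻¹ = a := inv_eq_of_mul_eq_one_left ha
  have h1 : (a * b * a) * c * (a * b * a)⁻¹ = c := by rw [h.eq]; group
  have bi : b⁻¹ = b := inv_eq_of_mul_eq_one_left hb
  have h2 : b * (a * c * a) * b = a * c * a := by
    calc b * (a * c * a) * b = a * ((a * b * a) * c * (a * b * a)⁻¹) * a := by
          simp only [mul_inv_rev, ai, bi]
          calc _ = b * a * c * a * b := by group
            _ = (a * a) * (b * a * c * a * b) * (a * a) := by rw [ha]; group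
            _ = _ := by group
      _ = _ := by rw [h1]
  rw [commute_iff_eq]
  calc a * c * a * b = b * (a * c * a) * b * b := by rw [h2]
    _ = b * (a * c * a) * (b * b) := by group
    _ = _ := by rw [hb, mul_one]

section glue
variable {A : Type} [DecidableEq A] [Finite A] (C : A → Prop) [DecidablePred C]

/-- the second embedding -/
def jB : A ↪ A ⊕ {x : A // ¬ C x} :=
  ⟨fun x => if h : C x then Sum.inl x else Sum.inr ⟨x, h⟩, by
    intro x y h
    dsimp only at h
    split_ifs at h with h1 h2 h3
    · exact Sum.inl.inj h
    · have := Sum.inr.inj h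
      exact congrArg Subtype.val this⟩

def jA : A ↪ A ⊕ {x : A // ¬ C x} := ⟨Sum.inl, Sum.inl_injective⟩

theorem jB_pos {x : A} (h : C x) : jB C x = Sum.inl x := dif_pos h
theorem jB_neg {x : A} (h : ¬ C x) : jB C x = Sum.inr ⟨x, h⟩ := dif_neg h
theorem jA_eq (x : A) : jA C x = Sum.inl x := rfl

noncomputable def PA : Equiv.Perm A →* Equiv.Perm (A ⊕ {x : A // ¬ C x}) := Equiv.Perm.viaEmbeddingHom (jA C)
noncomputable def PB : Equiv.Perm A →* Equiv.Perm (A ⊕ {x : A // ¬ C x}) := Equiv.Perm.viaEmbeddingHom (jB C)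

theorem PA_inl (s : Equiv.Perm A) (x : A) : PA C s (Sum.inl x) = Sum.inl (s x) :=
  Equiv.Perm.viaEmbedding_apply s (jA C) x
theorem PA_inr (s : Equiv.Perm A) (x) : PA C s (Sum.inr x) = Sum.inr x :=
  Equiv.Perm.viaEmbedding_apply_of_notMem s (jA C) _ (by rintro ⟨y, hy⟩; exact Sum.inl_ne_inr hy)
theorem PB_jB (s : Equiv.Perm A) (x : A) : PB C s (jB C x) = jB C (s x) :=
  Equiv.Perm.viaEmbedding_apply s (jB C) x
theorem PB_inl (s : Equiv.Perm A) (x : A) (h : ¬ C x) : PB C s (Sum.inl x) = Sum.inl x :=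
  Equiv.Perm.viaEmbedding_apply_of_notMem s (jB C) _ (by
    rintro ⟨y, hy⟩
    by_cases h1 : C y
    · rw [jB_pos C h1] at hy; exact h (Sum.inl.inj hy ▸ h1)
    · rw [jB_neg C h1] at hy; exact Sum.inl_ne_inr hy.symm)
theorem PA_swap (x y : A) : PA C (Equiv.swap x y) = Equiv.swap (Sum.inl x) (Sum.inl y) := via_swap (jA C) x y
theorem PB_swap (x y : A) : PB C (Equiv.swap x y) = Equiv.swap (jB C x) (jB C y) := via_swap (jB C) x y

/-- one-sided consequences -/
theorem glue_side {Γ : Type} [Group Γ] (φ θ : Equiv.Perm A →* Γ) (y α : Equiv.Perm A) (s i o b : A)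
    (hs : C s) (hi : C i) (ho : C o) (hb : ¬ C b) (ys : y s = s) (yi : y i = i)
    (hyC : ∀ x, C (y x) ↔ C x) (hα : ∀ x, C x → α x = y x) (hα' : ∀ x, ¬ C x → α x = x)
    (orC : ∀ x, C x → x ≠ s → x ≠ i → ∃ k : ℕ, (y ^ k) o = x) (orD : ∀ x, ¬ C x → ∃ k : ℕ, (y ^ k) b = x)
    (r2 : Commute (φ y) (θ y))
    (r3 : ∀ x ∈ ({i, o, b} : Set A), φ y * θ (Equiv.swap s x) * (φ y)⁻¹ = θ (Equiv.swap s (α x)))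
    (r4 : Commute (φ (Equiv.swap b (y b))) (θ y))
    (r5 : ∀ x ∈ ({i, o, b} : Set A), Commute (φ (Equiv.swap b (y b))) (θ (Equiv.swap s x))) :
    (∀ t, φ y * θ t * (φ y)⁻¹ = θ (α * t * α⁻¹)) ∧
    (∀ d d', ¬ C d → ¬ C d' → ∀ t, Commute (φ (Equiv.swap d d')) (θ t)) := by
  have αs : α s = s := by rw [hα s hs, ys]
  have gen : Subgroup.closure ({y} ∪ (Equiv.swap s) '' {i, o, b}) = ⊤ := by
    set G := Subgroup.closure ({y} ∪ (Equiv.swap s) '' {i, o, b}) with hG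
    have yG : y ∈ G := Subgroup.subset_closure (Or.inl rfl)
    have sG : ∀ x ∈ ({i, o, b} : Set A), Equiv.swap s x ∈ G := fun x hx => Subgroup.subset_closure (Or.inr ⟨x, hx, rfl⟩)
    have ysk : ∀ k : ℕ, (y ^ k) s = s := by
      intro k; induction k with
      | zero => rfl
      | succ k ih => rw [pow_succ, Equiv.Perm.mul_apply, ys, ih]
    have mv : ∀ x (k : ℕ), Equiv.swap s x ∈ G → Equiv.swap s ((y ^ k) x) ∈ G := by
      intro x k hx
      have := Equiv.swap_apply_apply (y ^ k) s x
      rw [ysk] at this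
      rw [this]
      exact mul_mem (mul_mem (pow_mem yG k) hx) (inv_mem (pow_mem yG k))
    apply perm_top_of_star s
    intro x
    by_cases hC : C x
    · by_cases h1 : x = s
      · subst h1; rw [Equiv.swap_self]; exact one_mem _
      by_cases h2 : x = i
      · subst h2; exact sG _ (by simp)
      obtain ⟨k, rfl⟩ := orC x hC h1 h2
      exact mv _ _ (sG _ (by simp))
    · obtain ⟨k, rfl⟩ := orD x hC
      exact mv _ _ (sG _ (by simp))
  have αy : α * y * α⁻¹ = y := by
    rw [mul_inv_eq_iff_eq_mul]
    ext1 x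
    rw [Equiv.Perm.mul_apply, Equiv.Perm.mul_apply]
    by_cases h : C x
    · rw [hα x h, hα _ ((hyC x).2 h)]
    · rw [hα' x h, hα' _ (mt (hyC x).1 h)]
  have h1 : ∀ t, φ y * θ t * (φ y)⁻¹ = θ (α * t * α⁻¹) := by
    apply hom_conj_ext θ (φ y) α _ gen
    rintro t (rfl | ⟨x, hx, rfl⟩)
    · rw [αy, r2.eq]; group
    · rw [r3 x hx]
      have := Equiv.swap_apply_apply α s x
      rw [αs] at this; rw [this]
  have h2 : ∀ t, Commute (φ (Equiv.swap b (y b))) (θ t) := by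
    apply comm_of_gen θ _ _ gen
    rintro t (rfl | ⟨x, hx, rfl⟩)
    · exact r4
    · exact r5 x hx
  have h3 : ∀ (k : ℕ) t, Commute (φ (Equiv.swap ((y ^ k) b) ((y ^ (k + 1)) b))) (θ t) := by
    intro k
    induction k with
    | zero => simpa using h2
    | succ k ih =>
      intro t
      have e1 := Equiv.swap_apply_apply y ((y ^ k) b) ((y ^ (k + 1)) b)
      have e2 : y ((y ^ k) b) = (y ^ (k + 1)) b := by rw [pow_succ', Equiv.Perm.mul_apply]
      have e3 : y ((y ^ (k + 1)) b) = (y ^ (k + 1 + 1)) b := by rw [pow_succ' y (k + 1), Equiv.Perm.mul_apply]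
      rw [e2, e3] at e1
      have := (ih (α⁻¹ * t * α)).map (MulAut.conj (φ y)).toMonoidHom
      simp only [MulEquiv.coe_toMonoidHom, MulAut.conj_apply] at this
      rw [h1, ← map_inv, ← map_mul, ← map_mul, ← e1] at this
      convert this using 2; group
  refine ⟨h1, ?_⟩
  have h4 : ∀ (k j : ℕ) t, Commute (φ (Equiv.swap ((y ^ k) b) ((y ^ (k + j)) b))) (θ t) := by
    intro k j t
    induction j with
    | zero =>
      have : (Equiv.swap ((y ^ k) b) ((y ^ (k + 0)) b)) = 1 := by rw [add_zero, Equiv.swap_self]; rfl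
      rw [this, map_one]; exact Commute.one_left _
    | succ j ih =>
      have h5 := h3 (k + j) t
      by_cases e1 : (y ^ k) b = (y ^ (k + (j + 1))) b
      · rw [← e1, Equiv.swap_self]
        have : (Equiv.refl A : Equiv.Perm A) = 1 := rfl
        rw [this, map_one]; exact Commute.one_left _
      by_cases e2 : (y ^ k) b = (y ^ (k + j)) b
      · rw [e2]; exact h5
      by_cases e3 : (y ^ (k + j)) b = (y ^ (k + (j + 1))) b
      · rw [← e3]; exact ih
      have := swap_star (Ne.symm e2) e3 e1
      rw [← this, Equiv.swap_comm _ ((y ^ k) b), map_mul, map_mul]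
      exact (ih.mul_left h5).mul_left ih
  intro d d' hd hd' t
  obtain ⟨k, rfl⟩ := orD d hd
  obtain ⟨j, rfl⟩ := orD d' hd'
  rcases le_total k j with h | h
  · obtain ⟨m, rfl⟩ := Nat.exists_eq_add_of_le h; exact h4 k m t
  · obtain ⟨m, rfl⟩ := Nat.exists_eq_add_of_le h
    rw [Equiv.swap_comm]; exact h4 j m t
end glue

theorem pieces2 {G H : Type} [Group G] [Group H] {c c' ℓ : ℕ} {T : Set G} {T' : Set H} (h0 : SP c ℓ G T) (h0' : SP c' ℓ H T') :
    ∃ (K : Type) (_ : Group K) (TK : Set K) (h : G →* K) (h' : H →* K), SP (c + c') ℓ K TK ∧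
      (∀ g ∈ T, h g ∈ TK) ∧ (∀ g ∈ T', h' g ∈ TK) ∧
      (∀ (Γ : Type) [Group Γ] (a : G →* Γ) (a' : H →* Γ), ∃ f : K →* Γ, (∀ g, f (h g) = a g) ∧ (∀ g, f (h' g) = a' g)) ∧
      (∀ (Γ : Type) [Group Γ] (ψ : K →* Γ) (P : Subgroup Γ), (∀ g, ψ (h g) ∈ P) → (∀ g, ψ (h' g) ∈ P) → ∀ x, ψ x ∈ P) := by
  refine ⟨Monoid.Coprod G H, inferInstance, _, Monoid.Coprod.inl,
    Monoid.Coprod.inr, h0.coprod h0', ?_, ?_, ?_, ?_⟩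
  · exact fun g hg => (Or.inl ⟨g, hg, rfl⟩)
  · exact fun g hg => (Or.inr ⟨_, hg, rfl⟩)
  · intro Γ _ a a'
    refine ⟨Monoid.Coprod.lift a a', ?_, ?_⟩
    · exact fun g => Monoid.Coprod.lift_apply_inl _ _ g
    · exact fun g => (Monoid.Coprod.lift_apply_inr _ _ _)
  · intro Γ _ ψ P h1 h2 x
    exact coprod_mem ψ P h1 h2 x

section glue
variable {A : Type} [DecidableEq A] [Finite A] (C : A → Prop) [DecidablePred C]

theorem glue_inj {Γ : Type} [Group Γ] (φ θ : Equiv.Perm A →* Γ) (y α : Equiv.Perm A) (s i o b : A)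
    (hs : C s) (hi : C i) (ho : C o) (hb : ¬ C b) (his : i ≠ s) (ys : y s = s) (yi : y i = i)
    (hyC : ∀ x, C (y x) ↔ C x) (hα : ∀ x, C x → α x = y x) (hα' : ∀ x, ¬ C x → α x = x)
    (orC : ∀ x, C x → x ≠ s → x ≠ i → ∃ k : ℕ, (y ^ k) o = x) (orD : ∀ x, ¬ C x → ∃ k : ℕ, (y ^ k) b = x)
    (q1 : ∀ x ∈ ({i, o} : Set A), φ (Equiv.swap s x) = θ (Equiv.swap s x))
    (r1 : ∀ t, φ y * θ t * (φ y)⁻¹ = θ (α * t * α⁻¹)) (r1' : ∀ t, θ y * φ t * (θ y)⁻¹ = φ (α * t * α⁻¹))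
    (r2 : ∀ d d', ¬ C d → ¬ C d' → ∀ t, Commute (φ (Equiv.swap d d')) (θ t))
    (r2' : ∀ d d', ¬ C d → ¬ C d' → ∀ t, Commute (θ (Equiv.swap d d')) (φ t))
    (r3 : φ (Equiv.swap s b) * θ (Equiv.swap s b) * φ (Equiv.swap s b) = θ (Equiv.swap s b) * φ (Equiv.swap s b) * θ (Equiv.swap s b))
    (r4 : Commute (φ (Equiv.swap s b)) (θ (Equiv.swap i b)))
    (π : Γ →* Equiv.Perm (A ⊕ {x : A // ¬ C x})) (πφ : ∀ t, π (φ t) = PA C t) (πθ : ∀ t, π (θ t) = PB C t)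
    (hgen : ∀ P : Subgroup Γ, (∀ t, φ t ∈ P) → (∀ t, θ t ∈ P) → P = ⊤) : Function.Injective π := by
  have αs : α s = s := by rw [hα s hs, ys]
  have αi : α i = i := by rw [hα i hi, yi]
  have ysk : ∀ k : ℕ, (y ^ k) s = s := by
    intro k; induction k with
    | zero => rfl
    | succ k ih => rw [pow_succ, Equiv.Perm.mul_apply, ys, ih]
  have yik : ∀ k : ℕ, (y ^ k) i = i := by
    intro k; induction k with
    | zero => rfl
    | succ k ih => rw [pow_succ, Equiv.Perm.mul_apply, yi, ih]
  have ne : ∀ {x y : A}, C x → ¬ C y → x ≠ y := by rintro x y hx hy rfl; exact hy hx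
  have cj : ∀ (g : Equiv.Perm A) a b, g * Equiv.swap a b * g⁻¹ = Equiv.swap (g a) (g b) := fun g a b => (Equiv.swap_apply_apply g a b).symm
  -- agreement on C
  have E1 : ∀ x, C x → φ (Equiv.swap s x) = θ (Equiv.swap s x) := by
    intro x hC
    by_cases h1 : x = s
    · subst h1; rw [Equiv.swap_self]; exact (map_one φ).trans (map_one θ).symm
    by_cases h2 : x = i
    · subst h2; exact q1 _ (by simp)
    obtain ⟨k, rfl⟩ := orC x hC h1 h2
    clear h1 h2
    induction k with
    | zero => exact q1 _ (by simp)
    | succ k ih =>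
      have hC' : C ((y ^ k) o) := by
        rw [pow_succ', Equiv.Perm.mul_apply, hyC] at hC; exact hC
      have ih := ih hC'
      have e := cj y s ((y ^ k) o)
      have e' := cj α s ((y ^ k) o)
      rw [ys, ← Equiv.Perm.mul_apply, ← pow_succ'] at e
      rw [αs, hα _ hC', ← Equiv.Perm.mul_apply, ← pow_succ'] at e'
      rw [← e, map_mul, map_mul, ih, map_inv, r1, e', e]
  have E2 : ∀ x x', C x → C x' → φ (Equiv.swap x x') = θ (Equiv.swap x x') := by
    intro x x' h h'
    by_cases h1 : x = s
    · subst h1; exact E1 x' h'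
    by_cases h2 : x' = s
    · subst h2; rw [Equiv.swap_comm]; exact E1 x h
    by_cases h3 : x = x'
    · subst h3; rw [Equiv.swap_self]; exact (map_one φ).trans (map_one θ).symm
    rw [← swap_star (Ne.symm h1) (Ne.symm h2) h3]
    simp only [map_mul, E1 x h, E1 x' h']
  -- moving
  have mvA : ∀ (k : ℕ) t, φ y ^ k * θ t * (φ y ^ k)⁻¹ = θ (α ^ k * t * (α ^ k)⁻¹) := by
    intro k t
    induction k with
    | zero => simp
    | succ k ih =>
      calc _ = φ y * (φ y ^ k * θ t * (φ y ^ k)⁻¹) * (φ y)⁻¹ := by rw [pow_succ']; group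
        _ = _ := by rw [ih, r1, pow_succ']; simp only [mul_inv_rev, mul_assoc]
  have mvB : ∀ (k : ℕ) t, θ y ^ k * φ t * (θ y ^ k)⁻¹ = φ (α ^ k * t * (α ^ k)⁻¹) := by
    intro k t
    induction k with
    | zero => simp
    | succ k ih =>
      calc _ = θ y * (θ y ^ k * φ t * (θ y ^ k)⁻¹) * (θ y)⁻¹ := by rw [pow_succ']; group
        _ = _ := by rw [ih, r1', pow_succ']; simp only [mul_inv_rev, mul_assoc]
  have αk : ∀ (k : ℕ) x, α x = x → (α ^ k) x = x := by
    intro k x hx; induction k with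
    | zero => rfl
    | succ k ih => rw [pow_succ, Equiv.Perm.mul_apply, hx, ih]
  have fixA : ∀ (k : ℕ) x x', α x = x → α x' = x' → φ y ^ k * θ (Equiv.swap x x') * (φ y ^ k)⁻¹ = θ (Equiv.swap x x') := by
    intro k x x' h h'
    rw [mvA, cj, αk k x h, αk k x' h']
  have fixB : ∀ (k : ℕ) x x', α x = x → α x' = x' → θ y ^ k * φ (Equiv.swap x x') * (θ y ^ k)⁻¹ = φ (Equiv.swap x x') := by
    intro k x x' h h'
    rw [mvB, cj, αk k x h, αk k x' h']
  have selfA : ∀ (k : ℕ) x x', φ y ^ k * φ (Equiv.swap x x') * (φ y ^ k)⁻¹ = φ (Equiv.swap ((y ^ k) x) ((y ^ k) x')) := by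
    intro k x x'; rw [← map_pow, ← map_inv, ← map_mul, ← map_mul, cj]
  have selfB : ∀ (k : ℕ) x x', θ y ^ k * θ (Equiv.swap x x') * (θ y ^ k)⁻¹ = θ (Equiv.swap ((y ^ k) x) ((y ^ k) x')) := by
    intro k x x'; rw [← map_pow, ← map_inv, ← map_mul, ← map_mul, cj]
  have hDk : ∀ k : ℕ, ¬ C ((y ^ k) b) := by
    intro k; induction k with
    | zero => exact hb
    | succ k ih => rw [pow_succ', Equiv.Perm.mul_apply, hyC]; exact ih
  -- braid between the two sides
  have B1 : ∀ d e, ¬ C d → ¬ C e → φ (Equiv.swap s d) * θ (Equiv.swap s e) * φ (Equiv.swap s d) =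
      θ (Equiv.swap s e) * φ (Equiv.swap s d) * θ (Equiv.swap s e) := by
    intro d e hd he
    obtain ⟨k, rfl⟩ := orD d hd
    obtain ⟨j, rfl⟩ := orD e he
    have h1 := congrArg (MulAut.conj (φ y ^ k)) r3
    simp only [map_mul] at h1
    simp only [MulAut.conj_apply, selfA, fixA k _ _ αs (hα' _ hb), ysk] at h1
    have h2 := congrArg (MulAut.conj (θ y ^ j)) h1
    simp only [map_mul] at h2
    simp only [MulAut.conj_apply, selfB, fixB j _ _ αs (hα' _ (hDk k)), ysk] at h2
    exact h2
  -- mixed commutation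
  have M1 : ∀ d e c, ¬ C d → ¬ C e → C c → c ≠ s → Commute (φ (Equiv.swap s d)) (θ (Equiv.swap c e)) := by
    intro d e c hd he hc hcs
    have M0 : Commute (φ (Equiv.swap s d)) (θ (Equiv.swap i e)) := by
      obtain ⟨k, rfl⟩ := orD d hd
      obtain ⟨j, rfl⟩ := orD e he
      have h1 := r4.map (MulAut.conj (φ y ^ k)).toMonoidHom
      simp only [MulEquiv.coe_toMonoidHom, MulAut.conj_apply, selfA, fixA k _ _ αi (hα' _ hb), ysk] at h1
      have h2 := h1.map (MulAut.conj (θ y ^ j)).toMonoidHom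
      simp only [MulEquiv.coe_toMonoidHom, MulAut.conj_apply, selfB, fixB j _ _ αs (hα' _ (hDk k)), yik] at h2
      exact h2
    have h1 := M0.map (MulAut.conj (φ (Equiv.swap i c))).toMonoidHom
    simp only [MulEquiv.coe_toMonoidHom, MulAut.conj_apply] at h1
    rw [E2 i c hi hc] at h1
    nth_rewrite 1 2 [← E2 i c hi hc] at h1
    rw [← map_inv, ← map_mul, ← map_mul, ← map_inv, ← map_mul, ← map_mul, cj, cj] at h1
    rw [Equiv.swap_apply_of_ne_of_ne his.symm hcs.symm, Equiv.swap_apply_of_ne_of_ne (ne hi hd).symm (ne hc hd).symm,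
      Equiv.swap_apply_left, Equiv.swap_apply_of_ne_of_ne (ne hi he).symm (ne hc he).symm] at h1
    exact h1
  -- the star
  let z : A ⊕ {x : A // ¬ C x} → Γ := fun x => match x with
    | Sum.inl x => φ (Equiv.swap s x)
    | Sum.inr x => θ (Equiv.swap s x.1)
  have zB : ∀ x, z (jB C x) = θ (Equiv.swap s x) := by
    intro x
    by_cases h : C x
    · rw [jB_pos C h]; exact E1 x h
    · rw [jB_neg C h]
  have jBs : jB C s = Sum.inl s := jB_pos C hs
  have z2 : ∀ x, z x * z x = 1 := by
    rintro (x | x)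
    · show φ _ * φ _ = 1
      rw [← map_mul, Equiv.swap_mul_self, map_one]
    · show θ _ * θ _ = 1
      rw [← map_mul, Equiv.swap_mul_self, map_one]
  have braid : ∀ x x' : A, x ≠ s → x' ≠ s → x ≠ x' → Equiv.swap s x * Equiv.swap s x' * Equiv.swap s x =
      Equiv.swap s x' * Equiv.swap s x * Equiv.swap s x' := by
    intro x x' h h' h''
    rw [swap_star h.symm h'.symm h'', swap_star h'.symm h.symm h''.symm, Equiv.swap_comm]
  have st4 : ∀ x x' w : A, x ≠ s → x' ≠ s → w ≠ s → x ≠ x' → x ≠ w → x' ≠ w →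
      Commute (Equiv.swap s x * Equiv.swap s x' * Equiv.swap s x) (Equiv.swap s w) := by
    intro x x' w h h' h'' e1 e2 e3
    rw [swap_star h.symm h'.symm e1]
    exact swap_disj h e2 h' e3
  have zA3 : ∀ x x', x ≠ s → x' ≠ s → x ≠ x' → z (Sum.inl x) * z (Sum.inl x') * z (Sum.inl x) = z (Sum.inl x') * z (Sum.inl x) * z (Sum.inl x') := by
    intro x x' h h' h''
    have := congrArg φ (braid x x' h h' h''); simpa only [map_mul] using this
  have zB3 : ∀ x x', x ≠ s → x' ≠ s → x ≠ x' → z (jB C x) * z (jB C x') * z (jB C x) = z (jB C x') * z (jB C x) * z (jB C x') := by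
    intro x x' h h' h''
    have := congrArg θ (braid x x' h h' h''); simpa only [map_mul, zB] using this
  have z3 : ∀ x x', x ≠ Sum.inl s → x' ≠ Sum.inl s → x ≠ x' → z x * z x' * z x = z x' * z x * z x' := by
    rintro (x | ⟨x, hx⟩) (x' | ⟨x', hx'⟩) h h' h''
    · exact zA3 x x' (fun e => h (e ▸ rfl)) (fun e => h' (e ▸ rfl)) (fun e => h'' (e ▸ rfl))
    · by_cases hC : C x
      · have := zB3 x x' (fun e => h (e ▸ rfl)) (ne hs hx').symm (ne hC hx')
        rwa [jB_pos C hC, jB_neg C hx'] at this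
      · exact B1 x x' hC hx'
    · by_cases hC : C x'
      · have := zB3 x x' (ne hs hx).symm (fun e => h' (e ▸ rfl)) (ne hC hx).symm
        rwa [jB_pos C hC, jB_neg C hx] at this
      · exact (B1 x' x hC hx).symm
    · have := zB3 x x' (ne hs hx).symm (ne hs hx').symm (fun e => h'' (by subst e; rfl))
      rwa [jB_neg C hx, jB_neg C hx'] at this
  have zA4 : ∀ x x' w, x ≠ s → x' ≠ s → w ≠ s → x ≠ x' → x ≠ w → x' ≠ w → Commute (z (Sum.inl x) * z (Sum.inl x') * z (Sum.inl x)) (z (Sum.inl w)) := by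
    intro x x' w h1 h2 h3 h4 h5 h6
    have := (st4 x x' w h1 h2 h3 h4 h5 h6).map φ; simpa only [map_mul] using this
  have zB4 : ∀ x x' w, x ≠ s → x' ≠ s → w ≠ s → x ≠ x' → x ≠ w → x' ≠ w → Commute (z (jB C x) * z (jB C x') * z (jB C x)) (z (jB C w)) := by
    intro x x' w h1 h2 h3 h4 h5 h6
    have := (st4 x x' w h1 h2 h3 h4 h5 h6).map θ; simpa only [map_mul, zB] using this
  -- A A B
  have AAB : ∀ x x' (w : {x : A // ¬ C x}), x ≠ s → x' ≠ s → x ≠ x' → Commute (z (Sum.inl x) * z (Sum.inl x') * z (Sum.inl x)) (z (Sum.inr w)) := by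
    intro x x' ⟨w, hw⟩ h1 h2 h3
    by_cases hx : C x
    · by_cases hx' : C x'
      · have := zB4 x x' w h1 h2 (ne hs hw).symm h3 (ne hx hw) (ne hx' hw)
        rwa [jB_pos C hx, jB_pos C hx', jB_neg C hw] at this
      · -- x in C, x' in DA, w in DB
        have hR : Commute (z (jB C x) * z (jB C w) * z (jB C x)) (z (Sum.inl x')) := by
          have e : z (jB C x) * z (jB C w) * z (jB C x) = θ (Equiv.swap x w) := by
            rw [zB, zB, ← map_mul, ← map_mul, swap_star h1.symm (ne hs hw) (ne hx hw)]
          rw [e]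
          exact (M1 x' w x hx' hw hx h1).symm
        have := star_sym (z2 _) (z2 _) (zB3 x w h1 (ne hs hw).symm (ne hx hw)) hR
        rwa [jB_pos C hx, jB_neg C hw] at this
    · by_cases hx' : C x'
      · have hR : Commute (z (jB C x') * z (jB C w) * z (jB C x')) (z (Sum.inl x)) := by
          have e : z (jB C x') * z (jB C w) * z (jB C x') = θ (Equiv.swap x' w) := by
            rw [zB, zB, ← map_mul, ← map_mul, swap_star h2.symm (ne hs hw) (ne hx' hw)]
          rw [e]
          exact (M1 x w x' hx hw hx' h2).symm
        have := star_sym (z2 _) (z2 _) (zB3 x' w h2 (ne hs hw).symm (ne hx' hw)) hR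
        rw [jB_pos C hx', jB_neg C hw] at this
        rwa [zA3 x x' h1 h2 h3]
      · have e : z (Sum.inl x) * z (Sum.inl x') * z (Sum.inl x) = φ (Equiv.swap x x') := by
          show φ _ * φ _ * φ _ = _
          rw [← map_mul, ← map_mul, swap_star h1.symm h2.symm h3]
        rw [e]
        exact r2 x x' hx hx' _
  have BBA : ∀ (x x' : {x : A // ¬ C x}) w, x ≠ x' → w ≠ s → Commute (z (Sum.inr x) * z (Sum.inr x') * z (Sum.inr x)) (z (Sum.inl w)) := by
    intro ⟨x, hx⟩ ⟨x', hx'⟩ w h hw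
    have hxx : x ≠ x' := by rintro rfl; exact h rfl
    have e : z (Sum.inr ⟨x, hx⟩) * z (Sum.inr ⟨x', hx'⟩) * z (Sum.inr ⟨x, hx⟩) = θ (Equiv.swap x x') := by
      show θ _ * θ _ * θ _ = _
      rw [← map_mul, ← map_mul, swap_star (ne hs hx) (ne hs hx') hxx]
    rw [e]
    exact r2' x x' hx hx' _
  have SS : ∀ x w x', z x * z w * z x = z w * z x * z w → Commute (z x * z w * z x) (z x') → Commute (z x * z x' * z x) (z w) :=
    fun x w x' h h' => star_sym (z2 x) (z2 w) h h'
  have z4 : ∀ x x' w, x ≠ Sum.inl s → x' ≠ Sum.inl s → w ≠ Sum.inl s → x ≠ x' → x ≠ w → x' ≠ w → Commute (z x * z x' * z x) (z w) := by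
    have dn : ∀ {x : A}, (Sum.inl x : A ⊕ {x : A // ¬ C x}) ≠ Sum.inl s → x ≠ s := fun h e => h (e ▸ rfl)
    have dn2 : ∀ {x x' : A}, (Sum.inl x : A ⊕ {x : A // ¬ C x}) ≠ Sum.inl x' → x ≠ x' := fun h e => h (e ▸ rfl)
    have dn3 : ∀ {x x' : {x : A // ¬ C x}}, (Sum.inr x : A ⊕ {x : A // ¬ C x}) ≠ Sum.inr x' → x ≠ x' := fun h e => h (e ▸ rfl)
    rintro (x | x) (x' | x') (w | w) h1 h2 h3 h4 h5 h6
    · exact zA4 x x' w (dn h1) (dn h2) (dn h3) (dn2 h4) (dn2 h5) (dn2 h6)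
    · exact AAB x x' w (dn h1) (dn h2) (dn2 h4)
    · exact SS _ _ (Sum.inr x') (z3 _ _ h1 h3 h5) (AAB x w x' (dn h1) (dn h3) (dn2 h5))
    · rw [z3 _ _ h1 h2 h4]
      exact SS _ _ (Sum.inl x) (z3 _ _ h2 h3 h6) (BBA x' w x (dn3 h6) (dn h1))
    · rw [z3 _ _ h1 h2 h4]
      exact SS _ _ (Sum.inr x) (z3 _ _ h2 h3 h6) (AAB x' w x (dn h2) (dn h3) (dn2 h6))
    · exact SS _ _ (Sum.inl x') (z3 _ _ h1 h3 h5) (BBA x w x' (dn3 h5) (dn h2))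
    · exact BBA x x' w (dn3 h4) (dn h3)
    · have := zB4 x x' w (ne hs x.2).symm (ne hs x'.2).symm (ne hs w.2).symm (fun e => dn3 h4 (Subtype.ext e)) (fun e => dn3 h5 (Subtype.ext e)) (fun e => dn3 h6 (Subtype.ext e))
      rwa [jB_neg C x.2, jB_neg C x'.2, jB_neg C w.2] at this
  have top : Subgroup.closure {g | ∃ x, x ≠ Sum.inl s ∧ g = z x} = ⊤ := by
    set P := Subgroup.closure {g | ∃ x, x ≠ Sum.inl s ∧ g = z x} with hP
    have zP : ∀ x, z x ∈ P := by
      intro x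
      by_cases h : x = Sum.inl s
      · subst h
        show φ (Equiv.swap s s) ∈ P
        rw [Equiv.swap_self]
        have : φ (Equiv.refl A) = 1 := map_one φ
        rw [this]; exact one_mem _
      · exact Subgroup.subset_closure ⟨x, h, rfl⟩
    apply hgen
    · intro t
      have := perm_top_of_star s (P.comap φ) (fun x => zP (Sum.inl x))
      have h : t ∈ P.comap φ := by rw [this]; trivial
      exact h
    · intro t
      have := perm_top_of_star s (P.comap θ) (fun x => by
        rw [Subgroup.mem_comap, ← zB]; exact zP _)
      have h : t ∈ P.comap θ := by rw [this]; trivial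
      exact h
  rw [injective_iff_map_eq_one]
  intro g hg
  refine starPerm_inj (Sum.inl s) z π ?_ (fun x _ => z2 x) z3 z4 g (top ▸ Subgroup.mem_top g) hg
  rintro (x | ⟨x, hx⟩) _
  · show π (φ _) = _
    rw [πφ, PA_swap]
  · show π (θ _) = _
    rw [πθ, PB_swap, jBs, jB_neg C hx]
end glue

section glue
variable {A : Type} [DecidableEq A] [Finite A] (C : A → Prop) [DecidablePred C]

theorem glue {c ℓ : ℕ} {T : Set (Equiv.Perm A)} (h0 : SP c ℓ (Equiv.Perm A) T) (y α : Equiv.Perm A) (s i o b : A)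
    (hs : C s) (hi : C i) (ho : C o) (hb : ¬ C b) (his : i ≠ s) (ys : y s = s) (yi : y i = i)
    (hyC : ∀ x, C (y x) ↔ C x) (hα : ∀ x, C x → α x = y x) (hα' : ∀ x, ¬ C x → α x = x)
    (orC : ∀ x, C x → x ≠ s → x ≠ i → ∃ k : ℕ, (y ^ k) o = x) (orD : ∀ x, ¬ C x → ∃ k : ℕ, (y ^ k) b = x)
    (yT : y ∈ T) (sT : ∀ x x', Equiv.swap x x' ∈ T) :
    SP (21 * (c + c) + 30) ℓ (Equiv.Perm (A ⊕ {x : A // ¬ C x})) (PA C '' T ∪ PB C '' T) := by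
  obtain ⟨K, _, TK, h, h', hK, mh, mh', hlift, hmem⟩ := pieces2 h0 h0
  obtain ⟨f, fh, fh'⟩ := hlift _ (PA C) (PB C)
  have αs : α s = s := by rw [hα s hs, ys]
  have cj : ∀ (g : Equiv.Perm A) a b, g * Equiv.swap a b * g⁻¹ = Equiv.swap (g a) (g b) := fun g a b => (Equiv.swap_apply_apply g a b).symm
  have jBs : jB C s = Sum.inl s := jB_pos C hs
  -- conjugation of PB by PA y
  have cA : ∀ x, jB C (α x) = PA C y (jB C x) := by
    intro x
    by_cases hx : C x
    · rw [jB_pos C hx, PA_inl, hα x hx, jB_pos C ((hyC x).2 hx)]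
    · rw [jB_neg C hx, PA_inr, hα' x hx, jB_neg C hx]
  have cB : ∀ x, Sum.inl (α x) = PB C y (Sum.inl x) := by
    intro x
    by_cases hx : C x
    · rw [← jB_pos C hx, PB_jB, hα x hx, jB_pos C ((hyC x).2 hx)]
    · rw [PB_inl C _ _ hx, hα' x hx]
  have ne : ∀ {x y : A}, C x → ¬ C y → x ≠ y := by rintro x y hx hy rfl; exact hy hx
  have hyb : ¬ C (y b) := fun e => hb ((hyC b).1 e)
  have yAB : Commute (PA C y) (PB C y) := by
    ext x : 1
    rcases x with x | x
    · rw [Equiv.Perm.mul_apply, Equiv.Perm.mul_apply, PA_inl, ← cB, ← cB, PA_inl]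
      by_cases hx : C x
      · rw [hα x hx, hα _ ((hyC x).2 hx)]
      · rw [hα' _ hx, hα' _ (fun e => hx ((hyC x).1 e))]
    · have e : (Sum.inr x : A ⊕ {x : A // ¬ C x}) = jB C x.1 := (jB_neg C x.2).symm
      have e' : ¬ C (y x.1) := fun e => x.2 ((hyC x.1).1 e)
      rw [Equiv.Perm.mul_apply, Equiv.Perm.mul_apply, PA_inr, e, PB_jB, jB_neg C e', PA_inr]
  have fixB : ∀ t, Commute (PA C (Equiv.swap b (y b))) (PB C t) := by
    intro t
    rw [PA_swap]
    exact (swap_comm_of _ (PB_inl C _ _ hb) (PB_inl C _ _ hyb)).symm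
  have fixA : ∀ t, Commute (PB C (Equiv.swap b (y b))) (PA C t) := by
    intro t
    rw [PB_swap, jB_neg C hb, jB_neg C hyb]
    exact (swap_comm_of _ (PA_inr C _ _) (PA_inr C _ _)).symm
  let sw := fun x => Equiv.swap s x
  let L : List K := [h (sw i) * (h' (sw i))⁻¹, h (sw o) * (h' (sw o))⁻¹, ⁅h y, h' y⁆,
    h y * h' (sw i) * (h y)⁻¹ * (h' (sw (α i)))⁻¹, h y * h' (sw o) * (h y)⁻¹ * (h' (sw (α o)))⁻¹, h y * h' (sw b) * (h y)⁻¹ * (h' (sw (α b)))⁻¹,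
    h' y * h (sw i) * (h' y)⁻¹ * (h (sw (α i)))⁻¹, h' y * h (sw o) * (h' y)⁻¹ * (h (sw (α o)))⁻¹, h' y * h (sw b) * (h' y)⁻¹ * (h (sw (α b)))⁻¹,
    ⁅h (Equiv.swap b (y b)), h' y⁆, ⁅h (Equiv.swap b (y b)), h' (sw i)⁆, ⁅h (Equiv.swap b (y b)), h' (sw o)⁆, ⁅h (Equiv.swap b (y b)), h' (sw b)⁆,
    ⁅h' (Equiv.swap b (y b)), h y⁆, ⁅h' (Equiv.swap b (y b)), h (sw i)⁆, ⁅h' (Equiv.swap b (y b)), h (sw o)⁆, ⁅h' (Equiv.swap b (y b)), h (sw b)⁆,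
    h (sw b) * h' (sw b) * h (sw b) * (h' (sw b) * h (sw b) * h' (sw b))⁻¹, ⁅h (sw b), h' (Equiv.swap i b)⁆]
  have := hK.assembleL f ?_ 30 L (by simp [L]) (k := 20) ?_ ?_ ?_
  · refine this.mono (by omega) le_rfl ?_
    rintro _ (⟨t, ht, rfl⟩ | ⟨t, ht, rfl⟩)
    · exact ⟨_, mh t ht, fh t⟩
    · exact ⟨_, mh' t ht, fh' t⟩
  · rw [← MonoidHom.range_eq_top]
    apply perm_top_of_star (Sum.inl s)
    rintro (x | ⟨x, hx⟩)
    · exact ⟨h (sw x), by rw [fh, PA_swap]⟩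
    · exact ⟨h' (sw x), by rw [fh', PB_swap, jBs, jB_neg C hx]⟩
  · have b1 : ∀ x x', Bl TK 1 (h (Equiv.swap x x')) := fun x x' => Bl.of (mh _ (sT x x'))
    have b2 : ∀ x x', Bl TK 1 (h' (Equiv.swap x x')) := fun x x' => Bl.of (mh' _ (sT x x'))
    have b3 : Bl TK 1 (h y) := Bl.of (mh _ yT)
    have b4 : Bl TK 1 (h' y) := Bl.of (mh' _ yT)
    intro e he
    simp only [L, List.mem_cons, List.not_mem_nil, or_false] at he
    rcases he with rfl | rfl | rfl | rfl | rfl | rfl | rfl | rfl | rfl | rfl | rfl | rfl | rfl | rfl | rfl | rfl | rfl | rfl | rfl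
    all_goals
      apply Bl.le
      · repeat' first | exact b1 _ _ | exact b2 _ _ | exact b3 | exact b4 | apply Bl.comm | apply Bl.mul | apply Bl.inv
      · norm_num
  · simp only [L, List.mem_cons, List.not_mem_nil, or_false, forall_eq_or_imp, forall_eq, map_commutatorElement,
      commutatorElement_eq_one_iff_commute, map_mul, map_inv, mul_inv_eq_one, fh, fh', sw]
    have hm : ∀ x, PA C y * PB C (Equiv.swap s x) * (PA C y)⁻¹ = PB C (Equiv.swap s (α x)) := by
      intro x
      rw [PB_swap, PB_swap, ← Equiv.swap_apply_apply, ← cA, ← cA, αs]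
    have hm' : ∀ x, PB C y * PA C (Equiv.swap s x) * (PB C y)⁻¹ = PA C (Equiv.swap s (α x)) := by
      intro x
      rw [PA_swap, PA_swap, ← Equiv.swap_apply_apply, ← cB, ← cB, αs]
    refine ⟨?_, ?_, yAB, hm i, hm o, hm b, hm' i, hm' o, hm' b, fixB _, fixB _, fixB _, fixB _, fixA _, fixA _, fixA _, fixA _, ?_, ?_⟩
    · rw [PA_swap, PB_swap, jB_pos C hs, jB_pos C hi]
    · rw [PA_swap, PB_swap, jB_pos C hs, jB_pos C ho]
    · rw [PA_swap, PB_swap, jB_pos C hs, jB_neg C hb]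
      have e1 : (Sum.inl s : A ⊕ {x : A // ¬ C x}) ≠ Sum.inl b := fun e => ne hs hb (Sum.inl_injective e)
      rw [swap_star e1 (by simp) (by simp), swap_star (by simp) e1 (by simp), Equiv.swap_comm]
    · rw [PA_swap, PB_swap, jB_pos C hi, jB_neg C hb]
      refine swap_disj ?_ (by simp) ?_ (by simp)
      · exact fun e => his (Sum.inl_injective e).symm
      · exact fun e => ne hi hb (Sum.inl_injective e).symm
  · intro Γ _ ψ π hψ hπ hr
    simp only [L, List.mem_cons, List.not_mem_nil, or_false, forall_eq_or_imp, forall_eq, map_commutatorElement,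
      commutatorElement_eq_one_iff_commute, map_mul, map_inv, mul_inv_eq_one, sw] at hr
    obtain ⟨a1, a2, a3, a4, a5, a6, a7, a8, a9, a10, a11, a12, a13, a14, a15, a16, a17, a18, a19⟩ := hr
    have S1 := glue_side C (ψ.comp h) (ψ.comp h') y α s i o b hs hi ho hb ys yi hyC hα hα' orC orD a3
      (by rintro x (rfl | rfl | rfl); exacts [a4, a5, a6]) a10 (by rintro x (rfl | rfl | rfl); exacts [a11, a12, a13])
    have S2 := glue_side C (ψ.comp h') (ψ.comp h) y α s i o b hs hi ho hb ys yi hyC hα hα' orC orD a3.symm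
      (by rintro x (rfl | rfl | rfl); exacts [a7, a8, a9]) a14 (by rintro x (rfl | rfl | rfl); exacts [a15, a16, a17])
    refine glue_inj C (ψ.comp h) (ψ.comp h') y α s i o b hs hi ho hb his ys yi hyC hα hα' orC orD
      (by rintro x (rfl | rfl); exacts [a1, a2]) S1.1 S2.1 S1.2 S2.2 a18 a19 π ?_ ?_ ?_
    · intro t; rw [MonoidHom.comp_apply, hπ, fh]
    · intro t; rw [MonoidHom.comp_apply, hπ, fh']
    · intro P h1 h2
      rw [eq_top_iff]
      intro g _
      obtain ⟨x, rfl⟩ := hψ g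
      exact hmem Γ ψ P h1 h2 x
end glue

theorem oc_swap {ι : Type} [DecidableEq ι] (x y : ι) : P1.oc ι (Equiv.swap x y) = Equiv.swap (some x) (some y) := by
  ext w : 1
  rcases w with _ | w
  · rw [P1.oc_none, Equiv.swap_apply_of_ne_of_ne (by simp) (by simp)]
  · rw [P1.oc_some, Function.Injective.map_swap (Option.some_injective ι)]

theorem exists_perm2 {ι : Type} [DecidableEq ι] {a b x y : ι} (h : b ≠ a) (h' : y ≠ x) : ∃ g : Equiv.Perm ι, g a = x ∧ g b = y := by
  refine ⟨Equiv.swap (Equiv.swap a x b) y * Equiv.swap a x, ?_, ?_⟩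
  · rw [Equiv.Perm.mul_apply, Equiv.swap_apply_left, Equiv.swap_apply_of_ne_of_ne _ h'.symm]
    intro e
    apply h
    apply (Equiv.swap a x).injective
    rw [← e, Equiv.swap_apply_left]
  · rw [Equiv.Perm.mul_apply, Equiv.swap_apply_left]

theorem append_inj {ι : Type} [DecidableEq ι] [Finite ι] {Γ : Type} [Group Γ] (φ : Equiv.Perm ι →* Γ) (z : Γ) (o o' : ι) (hoo : o' ≠ o)
    (h1 : ∀ g : Equiv.Perm ι, g o = o → Commute z (φ g)) (h2 : z * z = 1)
    (h3 : z * (φ (Equiv.swap o o') * z * (φ (Equiv.swap o o'))⁻¹) * z = φ (Equiv.swap o o'))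
    (π : Γ →* Equiv.Perm (Option ι)) (πφ : ∀ g, π (φ g) = P1.oc ι g) (πz : π z = Equiv.swap none (some o))
    (hgen : ∀ P : Subgroup Γ, (∀ t, φ t ∈ P) → z ∈ P → P = ⊤) : Function.Injective π := by
  let Z : ι → Γ := fun x => φ (Equiv.swap o x) * z * (φ (Equiv.swap o x))⁻¹
  have e1 : ∀ g : Equiv.Perm ι, φ g * z * (φ g)⁻¹ = Z (g o) := by
    intro g
    have e := h1 ((Equiv.swap o (g o))⁻¹ * g) (by rw [Equiv.Perm.mul_apply, Equiv.swap_inv, Equiv.swap_apply_right])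
    have e2 : g = Equiv.swap o (g o) * ((Equiv.swap o (g o))⁻¹ * g) := by rw [mul_inv_cancel_left]
    conv_lhs => rw [e2, map_mul]
    show _ = φ (Equiv.swap o (g o)) * z * (φ (Equiv.swap o (g o)))⁻¹
    rw [mul_inv_rev, mul_assoc (φ (Equiv.swap o (g o))), ← e.eq]
    simp only [mul_assoc, mul_inv_cancel_left]
  have e2 : ∀ (g : Equiv.Perm ι) x, φ g * Z x * (φ g)⁻¹ = Z (g x) := by
    intro g x
    have := e1 (g * Equiv.swap o x)
    rw [Equiv.Perm.mul_apply, Equiv.swap_apply_left] at this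
    rw [← this]
    simp only [Z, map_mul, mul_inv_rev, mul_assoc]
  have Zo : Z o = z := by
    have := e1 1
    simpa using this.symm
  have e3 : ∀ x y, x ≠ y → Z x * Z y * Z x = φ (Equiv.swap x y) := by
    intro x y hxy
    obtain ⟨g, rfl, rfl⟩ := exists_perm2 hoo hxy.symm
    have h3' : Z o * Z o' * Z o = φ (Equiv.swap o o') := by rw [Zo]; exact h3
    have := congrArg (MulAut.conj (φ g)) h3'
    simp only [map_mul] at this
    simp only [MulAut.conj_apply, e2] at this
    rw [this, ← map_mul, ← map_inv, ← map_mul, ← Equiv.swap_apply_apply]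
  have Z2 : ∀ x, Z x * Z x = 1 := by
    intro x
    show φ (Equiv.swap o x) * z * (φ (Equiv.swap o x))⁻¹ * (φ (Equiv.swap o x) * z * (φ (Equiv.swap o x))⁻¹) = 1
    have : ∀ a : Γ, a * z * a⁻¹ * (a * z * a⁻¹) = a * (z * z) * a⁻¹ := fun a => by group
    rw [this, h2]; simp
  have πZ : ∀ x, π (Z x) = Equiv.swap none (some x) := by
    intro x
    show π (φ _ * z * (φ _)⁻¹) = _
    rw [map_mul, map_mul, map_inv, πφ, πz, ← Equiv.swap_apply_apply, P1.oc_none, P1.oc_some, Equiv.swap_apply_left]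
  let z' : Option ι → Γ := fun x => x.elim 1 Z
  have top : Subgroup.closure {g | ∃ x, x ≠ none ∧ g = z' x} = ⊤ := by
    set P := Subgroup.closure {g | ∃ x, x ≠ none ∧ g = z' x} with hP
    have ZP : ∀ x, Z x ∈ P := fun x => Subgroup.subset_closure ⟨some x, by simp, rfl⟩
    apply hgen
    · intro t
      have := perm_top_of_star o (P.comap φ) (fun x => by
        rw [Subgroup.mem_comap]
        by_cases hx : o = x
        · subst hx; rw [Equiv.swap_self]
          have : φ (Equiv.refl ι) = 1 := map_one φ
          rw [this]; exact one_mem _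
        · rw [← e3 o x hx]; exact mul_mem (mul_mem (ZP _) (ZP _)) (ZP _))
      have h : t ∈ P.comap φ := by rw [this]; trivial
      exact h
    · rw [← Zo]; exact ZP o
  rw [injective_iff_map_eq_one]
  intro g hg
  refine starPerm_inj none z' π ?_ ?_ ?_ ?_ g (top ▸ Subgroup.mem_top g) hg
  · rintro (_ | x) hx
    · exact absurd rfl hx
    · exact πZ x
  · rintro (_ | x) hx
    · exact absurd rfl hx
    · exact Z2 x
  · rintro (_ | x) (_ | y) hx hy hxy
    · exact absurd rfl hx
    · exact absurd rfl hx
    · exact absurd rfl hy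
    · have : x ≠ y := fun e => hxy (e ▸ rfl)
      show Z x * Z y * Z x = Z y * Z x * Z y
      rw [e3 x y this, e3 y x this.symm, Equiv.swap_comm]
  · rintro (_ | x) (_ | y) (_ | w) hx hy hw h1 h2 h3
    any_goals exact absurd rfl hx
    any_goals exact absurd rfl hy
    any_goals exact absurd rfl hw
    have h1 : x ≠ y := fun e => h1 (e ▸ rfl)
    have h2 : x ≠ w := fun e => h2 (e ▸ rfl)
    have h3 : y ≠ w := fun e => h3 (e ▸ rfl)
    show Commute (Z x * Z y * Z x) (Z w)
    rw [e3 x y h1]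
    have := e2 (Equiv.swap x y) w
    rw [Equiv.swap_apply_of_ne_of_ne h2.symm h3.symm] at this
    exact mul_inv_eq_iff_eq_mul.1 this

theorem append {ι : Type} [DecidableEq ι] [Finite ι] {c ℓ : ℕ} (hl : 1 ≤ ℓ) {T : Set (Equiv.Perm ι)} (h0 : SP c ℓ (Equiv.Perm ι) T)
    (o o' : ι) (hoo : o' ≠ o) (S : List (Equiv.Perm ι)) (hS : ∀ g ∈ S, g ∈ T) (hSo : ∀ g ∈ S, g o = o)
    (hgen : ∀ g : Equiv.Perm ι, g o = o → g ∈ Subgroup.closure {g | g ∈ S}) (sT : ∀ x x', Equiv.swap x x' ∈ T) (N : ℕ) (hN : S.length ≤ N) :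
    SP (21 * (c + (4 + 1)) + (N + 2)) ℓ (Equiv.Perm (Option ι)) (P1.oc ι '' T ∪ {Equiv.swap none (some o)}) := by
  have htriv : SP 4 ℓ PUnit Set.univ := by
    have := SP.finite PUnit 1 ℓ hl (by simp); simpa using this
  obtain ⟨K, _, TK, h, h', z, hK, mh, mh', mz, hlift, hmem⟩ := pieces3 hl h0 htriv
  obtain ⟨f, fh, fh', fz⟩ := hlift _ (P1.oc ι) 1 (Equiv.swap none (some o))
  let L : List K := [z * z, z * (h (Equiv.swap o o') * z * (h (Equiv.swap o o'))⁻¹) * z * (h (Equiv.swap o o'))⁻¹] ++ S.map (fun g => ⁅z, h g⁆)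
  have bz : Bl TK 1 z := Bl.of mz
  have bs : ∀ x x', Bl TK 1 (h (Equiv.swap x x')) := fun x x' => Bl.of (mh _ (sT x x'))
  have hL : ∀ {P : K → Prop}, (∀ e ∈ L, P e) ↔ (P (z * z) ∧ P (z * (h (Equiv.swap o o') * z * (h (Equiv.swap o o'))⁻¹) * z * (h (Equiv.swap o o'))⁻¹) ∧
      ∀ g ∈ S, P ⁅z, h g⁆) := by
    intro P
    simp only [L, List.mem_append, List.mem_cons, List.not_mem_nil, or_false, List.mem_map, or_imp, forall_and, forall_eq,
      forall_exists_index, and_imp, forall_apply_eq_imp_iff₂, and_assoc]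
  have := hK.assembleL f ?_ (N + 2) L (by simp [L]; omega) (k := 20) ?_ ?_ ?_
  · refine this.mono (by omega) le_rfl ?_
    rintro _ (⟨t, ht, rfl⟩ | rfl)
    · exact ⟨_, mh t ht, fh t⟩
    · exact ⟨_, mz, fz⟩
  · rw [← MonoidHom.range_eq_top]
    have key : ∀ x, Equiv.swap none (some x) ∈ f.range := by
      intro x
      refine ⟨h (Equiv.swap o x) * z * (h (Equiv.swap o x))⁻¹, ?_⟩
      rw [map_mul, map_mul, map_inv, fh, fz, ← Equiv.swap_apply_apply, P1.oc_none, P1.oc_some, Equiv.swap_apply_left]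
    apply perm_top_of_star none
    rintro (_ | x)
    · rw [Equiv.swap_self]; exact one_mem _
    · exact key x
  · rw [hL]
    refine ⟨?_, ?_, ?_⟩
    · exact (bz.mul bz).le (by norm_num)
    · exact ((bz.mul (((bs _ _).mul bz).mul (bs _ _).inv)).mul bz |>.mul (bs _ _).inv).le (by norm_num)
    · intro g hg
      exact (bz.comm (Bl.of (k := 1) (mh _ (hS g hg)))).le (by norm_num)
  · rw [hL]
    have e : Equiv.swap (none : Option ι) (some o) * Equiv.swap none (some o) = 1 := Equiv.swap_mul_self _ _
    refine ⟨?_, ?_, ?_⟩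
    · rw [map_mul, fz, e]
    · rw [map_mul, map_mul, map_mul, map_mul, map_mul, map_inv, fh, fz, ← Equiv.swap_apply_apply, P1.oc_none, P1.oc_some, Equiv.swap_apply_left, mul_inv_eq_one,
        swap_star (by simp) (by simp) (by simpa using hoo.symm), oc_swap]
    · intro g hg
      rw [map_commutatorElement, commutatorElement_eq_one_iff_commute, fh, fz]
      exact (swap_comm_of _ (P1.oc_none _) (by rw [P1.oc_some, hSo g hg])).symm
  · intro Γ _ ψ π hψ hπ hr
    rw [hL] at hr
    obtain ⟨r1, r2, r3⟩ := hr
    refine append_inj (ψ.comp h) (ψ z) o o' hoo ?_ ?_ ?_ π ?_ ?_ ?_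
    · intro g hg
      have hle : Subgroup.closure {g | g ∈ S} ≤ (Subgroup.centralizer {ψ z}).comap (ψ.comp h) := by
        rw [Subgroup.closure_le]
        intro g hg
        have := r3 g hg
        rw [map_commutatorElement, commutatorElement_eq_one_iff_commute] at this
        show _ ∈ Subgroup.centralizer {ψ z}
        rw [Subgroup.mem_centralizer_singleton_iff]
        exact this.eq.symm
      have := hle (hgen g hg)
      rw [Subgroup.mem_comap, Subgroup.mem_centralizer_singleton_iff] at this
      exact this.symm
    · rw [← map_mul]; exact r1
    · rw [map_mul, map_inv, mul_inv_eq_one] at r2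
      simpa only [map_mul, map_inv, MonoidHom.comp_apply] using r2
    · intro g; rw [MonoidHom.comp_apply, hπ, fh]
    · rw [hπ, fz]
    · intro P h1 h2
      rw [eq_top_iff]
      intro g _
      obtain ⟨x, rfl⟩ := hψ g
      refine hmem Γ ψ P h1 ?_ h2 x
      intro g
      have : g = 1 := Subsingleton.elim _ _
      rw [this, map_one, map_one]; exact one_mem _

theorem stab_of_star {ι : Type} [DecidableEq ι] [Finite ι] (s i : ι) (hi : i ≠ s) (P : Subgroup (Equiv.Perm ι))
    (h : ∀ x, x ≠ s → Equiv.swap i x ∈ P) (g : Equiv.Perm ι) (hg : g s = s) : g ∈ P := by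
  have h1 := perm_top_of_star (⟨i, hi⟩ : {x // x ≠ s}) (P.comap Equiv.Perm.ofSubtype) (fun x => by
    rw [Subgroup.mem_comap, Equiv.Perm.ofSubtype_swap_eq]; exact h x.1 x.2)
  have hk : ∀ x, g x ≠ s ↔ x ≠ s := fun x => not_congr ⟨fun e => g.injective (e.trans hg.symm), fun e => e ▸ hg⟩
  have h2 : g.subtypePerm (p := fun x => x ≠ s) hk ∈ P.comap Equiv.Perm.ofSubtype := by rw [h1]; trivial
  rw [Subgroup.mem_comap, Equiv.Perm.ofSubtype_subtypePerm] at h2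
  · exact h2
  · intro x hx e; exact hx (e ▸ hg)

open P1 SL2 in
/-- data about a good presentation of a symmetric group -/
structure PG (c ℓ p e : ℕ) [Fact p.Prime] (ι : Type) [DecidableEq ι] [Fintype ι] where
  T : Set (Equiv.Perm ι)
  sp : SP c ℓ (Equiv.Perm ι) T
  sw : ∀ x y, Equiv.swap x y ∈ T
  o : ι
  o' : ι
  ne : o' ≠ o
  S : List (Equiv.Perm ι)
  Slen : S.length ≤ c
  ST : ∀ g ∈ S, g ∈ T
  So : ∀ g ∈ S, g o = o
  Sgen : ∀ g : Equiv.Perm ι, g o = o → g ∈ Subgroup.closure {g | g ∈ S}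
  jA : Option (X p) → ι
  jB : Option (X p) → ι
  ΦA : Equiv.Perm (Option (X p)) →* Equiv.Perm ι
  ΦB : Equiv.Perm (Option (X p)) →* Equiv.Perm ι
  ΦAj : ∀ σ x, ΦA σ (jA x) = jA (σ x)
  ΦBj : ∀ σ x, ΦB σ (jB x) = jB (σ x)
  ΦAs : ∀ x y, ΦA (Equiv.swap x y) = Equiv.swap (jA x) (jA y)
  ΦBs : ∀ x y, ΦB (Equiv.swap x y) = Equiv.swap (jB x) (jB y)
  TA : ∀ g, ΦA (A p g) ∈ T
  TB : ∀ g, ΦB (A p g) ∈ T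
  b : ℕ
  hb : 2 * b ≤ p
  E : List ι
  hE : E.length ≤ e
  hprod : ∀ (M : Type) [CommGroup M] (m : ι → M), (∀ x, m x * m x = 1) → ∏ x, m x =
    (∏ j ∈ Finset.range (2 * ((p - 1) / 2)), m (jA (some ((j : ZMod p) : X p)))) *
    (∏ j ∈ Finset.range (2 * ((p - 1) / 2)), m (jB (some ((j : ZMod p) : X p)))) *
    (∏ j ∈ Finset.range (2 * b), m (jA (some ((j : ZMod p) : X p)))) * (E.map m).prod

/-- additionally generators for a two point stabilizer -/
structure PG2 (c ℓ p e : ℕ) [Fact p.Prime] (ι : Type) [DecidableEq ι] [Fintype ι] extends PG c ℓ p e ι where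
  S' : List (Equiv.Perm ι)
  Slen' : S'.length ≤ c
  ST' : ∀ g ∈ S', g ∈ T
  So' : ∀ g ∈ S', g o = o ∧ g o' = o'
  Sgen' : ∀ g : Equiv.Perm ι, g o = o → g o' = o' → g ∈ Subgroup.closure {g | g ∈ S'}

theorem oc_of_none {ι : Type} (g : Equiv.Perm (Option ι)) (hg : g none = none) : ∃ h, P1.oc ι h = g := by
  refine ⟨g.removeNone, ?_⟩
  ext x : 1
  rcases x with _ | x
  · rw [P1.oc_none, hg]
  · rw [P1.oc_some]
    apply Equiv.removeNone_some
    have : g (some x) ≠ none := fun e => by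
      have := g.injective (e.trans hg.symm); simp at this
    exact Option.ne_none_iff_exists'.1 this

theorem PG.step {c ℓ p e : ℕ} [Fact p.Prime] {ι : Type} [DecidableEq ι] [Fintype ι] (hl : 1 ≤ ℓ) (P : PG c ℓ p e ι) :
    Nonempty (PG2 (3 * (21 * (c + (4 + 1)) + (c + 2))) ℓ p (e + 1) (Option ι)) := by
  obtain ⟨a, ha, hsp⟩ := P.sp.gens hl
  have key := append hl hsp P.o P.o' P.ne P.S (fun g hg => Or.inl (P.ST g hg)) P.So P.Sgen (fun x y => Or.inl (P.sw x y)) c P.Slen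
  have key2 := key.ball 3 (by norm_num)
  set T' := {x | Bl (P1.oc ι '' (P.T ∪ Set.range a) ∪ {Equiv.swap none (some P.o)}) 3 x} with hT'
  have iT : ∀ g ∈ P.T ∪ Set.range a, P1.oc ι g ∈ T' := fun g hg => Bl.of (Or.inl ⟨g, hg, rfl⟩)
  refine ⟨{
    T := T', sp := key2, sw := ?_, o := none, o' := some P.o, ne := by simp, S := List.ofFn (fun i => P1.oc ι (a i)), Slen := ?_, ST := ?_, So := ?_, Sgen := ?_,
    jA := fun x => some (P.jA x), jB := fun x => some (P.jB x), ΦA := (P1.oc ι).comp P.ΦA, ΦB := (P1.oc ι).comp P.ΦB, ΦAj := ?_, ΦBj := ?_, ΦAs := ?_, ΦBs := ?_,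
    TA := fun g => iT _ (Or.inl (P.TA g)), TB := fun g => iT _ (Or.inl (P.TB g)), b := P.b, hb := P.hb, E := none :: P.E.map some, hE := ?_, hprod := ?_, S' := P.S.map (P1.oc ι), Slen' := ?_, ST' := ?_, So' := ?_, Sgen' := ?_ }⟩
  · have h1 : ∀ x y, Bl (P1.oc ι '' (P.T ∪ Set.range a) ∪ {Equiv.swap none (some P.o)}) 1 (Equiv.swap (some x) (some y)) := by
      intro x y; rw [← oc_swap]; exact Bl.of (Or.inl ⟨_, Or.inl (P.sw x y), rfl⟩)
    have h2 : ∀ x, Bl (P1.oc ι '' (P.T ∪ Set.range a) ∪ {Equiv.swap none (some P.o)}) 3 (Equiv.swap none (some x)) := by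
      intro x
      have : Equiv.swap none (some x) = Equiv.swap (some P.o) (some x) * Equiv.swap none (some P.o) * (Equiv.swap (some P.o) (some x))⁻¹ := by
        rw [← Equiv.swap_apply_apply, Equiv.swap_apply_left, Equiv.swap_apply_of_ne_of_ne (by simp) (by simp)]
      rw [this]
      exact ((h1 _ _).mul (Bl.of (k := 1) (Or.inr rfl)) |>.mul (h1 _ _).inv).le (by norm_num)
    rintro (_ | x) (_ | y)
    · rw [Equiv.swap_self]; exact Bl.one
    · exact h2 y
    · rw [Equiv.swap_comm]; exact h2 x
    · exact (h1 x y).le (by norm_num)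
  · simp; omega
  · intro g hg
    rw [List.mem_ofFn] at hg
    obtain ⟨i, rfl⟩ := hg
    exact iT _ (Or.inr ⟨i, rfl⟩)
  · intro g hg
    rw [List.mem_ofFn] at hg
    obtain ⟨i, rfl⟩ := hg
    rfl
  · intro g hg
    obtain ⟨h, rfl⟩ := oc_of_none g hg
    have : Subgroup.closure (Set.range a) ≤ (Subgroup.closure {g | g ∈ List.ofFn (fun i => P1.oc ι (a i))}).comap (P1.oc ι) := by
      rw [Subgroup.closure_le]
      rintro _ ⟨i, rfl⟩
      exact Subgroup.subset_closure (by show _ ∈ List.ofFn _; rw [List.mem_ofFn]; exact ⟨i, rfl⟩)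
    rw [ha] at this
    exact this (Subgroup.mem_top h)
  · intro σ x; simp [P.ΦAj]
  · intro σ x; simp [P.ΦBj]
  · intro x y; simp [P.ΦAs, oc_swap]
  · intro x y; simp [P.ΦBs, oc_swap]
  · simp; exact P.hE
  · intro M _ m hm
    rw [Fintype.prod_option, P.hprod M (fun x => m (some x)) (fun x => hm _)]
    simp only [List.map_cons, List.prod_cons, List.map_map]
    rw [mul_left_comm]; rfl
  · simp; have := P.Slen; omega
  · intro g hg
    rw [List.mem_map] at hg
    obtain ⟨g, hg, rfl⟩ := hg
    exact iT _ (Or.inl (P.ST g hg))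
  · intro g hg
    rw [List.mem_map] at hg
    obtain ⟨g, hg, rfl⟩ := hg
    refine ⟨rfl, ?_⟩
    rw [P1.oc_some, P.So g hg]
  · intro g hg hg'
    obtain ⟨h, rfl⟩ := oc_of_none g hg
    rw [P1.oc_some] at hg'
    have hg' := Option.some_injective _ hg'
    have : Subgroup.closure {g | g ∈ P.S} ≤ (Subgroup.closure {g | g ∈ P.S.map (P1.oc ι)}).comap (P1.oc ι) := by
      rw [Subgroup.closure_le]
      intro g hg
      exact Subgroup.subset_closure (List.mem_map.2 ⟨g, hg, rfl⟩)
    exact this (P.Sgen h hg')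

namespace P1
open SL2

variable (p : ℕ) [Fact p.Prime]

/-- points of the affine line -/
def ep (j : ℕ) : Option (X p) := some ((j : ZMod p) : X p)

theorem ep_inj {i j : ℕ} (hi : i < p) (hj : j < p) (h : ep p i = ep p j) : i = j := by
  have h1 : ((i : ZMod p) : X p) = ((j : ZMod p) : X p) := Option.some_injective _ h
  have h2 : (i : ZMod p) = j := OnePoint.coe_injective h1
  have := congrArg ZMod.val h2
  rwa [ZMod.val_natCast_of_lt hi, ZMod.val_natCast_of_lt hj] at this

theorem ep_ne_inf (j : ℕ) : ep p j ≠ some OnePoint.infty := by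
  intro h
  exact OnePoint.coe_ne_infty _ (Option.some_injective _ h)

theorem ep_cases (x : Option (X p)) : x = none ∨ x = some OnePoint.infty ∨ ∃ j < p, x = ep p j := by
  rcases x with _ | x
  · exact Or.inl rfl
  · right
    induction x using OnePoint.rec with
    | infty => exact Or.inl rfl
    | coe x => exact Or.inr ⟨x.val, ZMod.val_lt x, by simp [ep]⟩

theorem prodA {M : Type} [CommGroup M] (μ : Option (X p) → M) :
    ∏ x, μ x = μ none * (μ (some OnePoint.infty) * ∏ j ∈ Finset.range p, μ (ep p j)) := by
  have h : (Finset.univ : Finset (Option (X p))) = insert none (insert (some OnePoint.infty) ((Finset.range p).image (ep p))) := by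
    ext x
    simp only [Finset.mem_univ, Finset.mem_insert, Finset.mem_image, Finset.mem_range, true_iff]
    rcases ep_cases p x with h | h | ⟨j, hj, h⟩
    · exact Or.inl h
    · exact Or.inr (Or.inl h)
    · exact Or.inr (Or.inr ⟨j, hj, h.symm⟩)
  rw [h, Finset.prod_insert, Finset.prod_insert, Finset.prod_image]
  · intro i hi j hj h
    exact ep_inj p (by simpa using hi) (by simpa using hj) h
  · simp only [Finset.mem_image, not_exists, not_and]
    intro j _ h
    exact ep_ne_inf p j h
  · simp [ep]

/-- the overlap set -/
def Cp (b : ℕ) (x : Option (X p)) : Prop := x = none ∨ x = some OnePoint.infty ∨ ∃ j < b, x = ep p j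

noncomputable instance (b : ℕ) : DecidablePred (Cp p b) := fun _ => Classical.propDecidable _

theorem Cp_ep {b j : ℕ} (hb : b < p) (hj : j < p) : Cp p b (ep p j) ↔ j < b := by
  constructor
  · rintro (h | h | ⟨i, hi, h⟩)
    · simp [ep] at h
    · exact absurd h (ep_ne_inf p j)
    · rw [ep_inj p hj (by omega) h]; exact hi
  · intro h; exact Or.inr (Or.inr ⟨j, h, rfl⟩)

/-- two cycles -/
noncomputable def yp (b : ℕ) : Equiv.Perm (Option (X p)) := Equiv.swap (ep p 0) (ep p b) * A p (U 1)

theorem A_ep (j : ℕ) : A p (U 1) (ep p j) = ep p (j + 1) := by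
  rw [ep, A_some, pmU, ep]; push_cast; rfl

theorem ep_p : ep p p = ep p 0 := by simp [ep]

theorem yp_none (b : ℕ) : yp p b none = none := by
  rw [yp, Equiv.Perm.mul_apply, A_none, Equiv.swap_apply_of_ne_of_ne (by simp [ep]) (by simp [ep])]

theorem yp_inf (b : ℕ) : yp p b (some OnePoint.infty) = some OnePoint.infty := by
  rw [yp, Equiv.Perm.mul_apply, A_some, pmU_inf, Equiv.swap_apply_of_ne_of_ne (ep_ne_inf p _).symm (ep_ne_inf p _).symm]

theorem yp_succ {b j : ℕ} (hb : b < p) (hj : j + 1 < p) (hjb : j + 1 ≠ b) : yp p b (ep p j) = ep p (j + 1) := by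
  rw [yp, Equiv.Perm.mul_apply, A_ep, Equiv.swap_apply_of_ne_of_ne]
  · intro h; have := ep_inj p hj (by omega) h; omega
  · intro h; exact hjb (ep_inj p hj hb h)

theorem yp_b {b j : ℕ} (hjb : j + 1 = b) : yp p b (ep p j) = ep p 0 := by
  rw [yp, Equiv.Perm.mul_apply, A_ep, hjb, Equiv.swap_apply_right]

theorem yp_p {b j : ℕ} (hjb : j + 1 = p) : yp p b (ep p j) = ep p b := by
  rw [yp, Equiv.Perm.mul_apply, A_ep, hjb, ep_p, Equiv.swap_apply_left]

theorem yp_C {b : ℕ} (hb0 : 1 ≤ b) (hb : b < p) (x) : Cp p b (yp p b x) ↔ Cp p b x := by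
  rcases ep_cases p x with h | h | ⟨j, hj, h⟩
  · subst h; rw [yp_none]
  · subst h; rw [yp_inf]
  · subst h
    rw [Cp_ep p hb hj]
    by_cases h1 : j + 1 = b
    · rw [yp_b p h1, Cp_ep p hb (by omega)]; omega
    by_cases h2 : j + 1 = p
    · rw [yp_p p h2, Cp_ep p hb hb]; omega
    · rw [yp_succ p hb (by omega) h1, Cp_ep p hb (by omega)]; omega

theorem yp_orC {b : ℕ} (hb : b < p) (j : ℕ) (hj : j < b) : (yp p b ^ j) (ep p 0) = ep p j := by
  induction j with
  | zero => rfl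
  | succ j ih => rw [pow_succ', Equiv.Perm.mul_apply, ih (by omega), yp_succ p hb (by omega) (by omega)]

theorem yp_orD {b : ℕ} (hb : b < p) (j : ℕ) (hj : b + j < p) : (yp p b ^ j) (ep p b) = ep p (b + j) := by
  induction j with
  | zero => rfl
  | succ j ih => rw [pow_succ', Equiv.Perm.mul_apply, ih (by omega), yp_succ p hb (by omega) (by omega)]; rfl

/-- glued index set -/
abbrev Ip (b : ℕ) := Option (X p) ⊕ {x : Option (X p) // ¬ Cp p b x}

theorem prodC {b : ℕ} (hb : b < p) {M : Type} [CommGroup M] (μ : Option (X p) → M) :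
    ∏ x : {x // Cp p b x}, μ x = μ none * (μ (some OnePoint.infty) * ∏ j ∈ Finset.range b, μ (ep p j)) := by
  have h1 := Fintype.prod_subtype_mul_prod_subtype (Cp p b) (fun x => if Cp p b x then μ x else 1)
  have h2 : ∏ i : {x // ¬ Cp p b x}, (if Cp p b i then μ i else 1) = 1 := by
    apply Finset.prod_eq_one; intro i _; rw [if_neg i.2]
  have h3 : ∏ i : {x // Cp p b x}, (if Cp p b i then μ i else 1) = ∏ i : {x // Cp p b x}, μ i := by
    apply Finset.prod_congr rfl; intro i _; rw [if_pos i.2]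
  rw [h2, mul_one, h3] at h1
  rw [h1, prodA, if_pos (show Cp p b none from Or.inl rfl), if_pos (show Cp p b (some OnePoint.infty) from Or.inr (Or.inl rfl))]
  congr 2
  rw [← Finset.prod_subset (s₁ := Finset.range b) (by intro x; simp; omega)]
  · apply Finset.prod_congr rfl; intro j hj
    rw [Finset.mem_range] at hj
    rw [if_pos ((Cp_ep p hb (by omega)).2 hj)]
  · intro j hj hj'
    rw [Finset.mem_range] at hj hj'
    rw [if_neg (fun h => hj' ((Cp_ep p hb hj).1 h))]

theorem prodI {b : ℕ} (hb : b < p) {M : Type} [CommGroup M] (m : Ip p b → M) (hm : ∀ x, m x * m x = 1) :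
    ∏ x, m x = (∏ x, m (jA (Cp p b) x)) * (∏ x, m (jB (Cp p b) x)) * (∏ x : {x // Cp p b x}, m (jA (Cp p b) x)) := by
  rw [Fintype.prod_sum_type, ← Fintype.prod_subtype_mul_prod_subtype (Cp p b) (fun x => m (jB (Cp p b) x))]
  have h1 : ∏ i : {x // Cp p b x}, m (jB (Cp p b) i) = ∏ i : {x // Cp p b x}, m (jA (Cp p b) i) := by
    apply Finset.prod_congr rfl; intro i _; rw [jB_pos _ i.2]; rfl
  have h2 : ∏ i : {x // ¬ Cp p b x}, m (jB (Cp p b) i) = ∏ i : {x // ¬ Cp p b x}, m (Sum.inr i) := by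
    apply Finset.prod_congr rfl; intro i _; rw [jB_neg _ i.2]
  have h3 : (∏ i : {x // Cp p b x}, m (jA (Cp p b) i)) * (∏ i : {x // Cp p b x}, m (jA (Cp p b) i)) = 1 := by
    rw [← Finset.prod_mul_distrib]; apply Finset.prod_eq_one; intro i _; exact hm _
  rw [h1, h2]
  have h4 : ∀ a c d : M, c * c = 1 → a * d = a * (c * d) * c := by
    intro a c d h
    calc a * d = a * d * (c * c) := by rw [h, mul_one]
      _ = _ := by simp only [mul_comm, mul_left_comm, mul_assoc]
  rw [h4 _ _ _ h3]; rfl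

theorem card_Ip {b : ℕ} (hb : b < p) : Fintype.card (Ip p b) = 2 * p + 2 - b := by
  have hA : Fintype.card (Option (X p)) = p + 2 := by
    have := prodA p (M := Multiplicative ℤ) (fun _ => Multiplicative.ofAdd 1)
    simp only [Finset.prod_const, Finset.card_range, Finset.card_univ] at this
    have h := congrArg Multiplicative.toAdd this
    simp only [toAdd_mul, toAdd_pow, toAdd_ofAdd, smul_eq_mul, mul_one, nsmul_eq_mul] at h
    omega
  have hC : Fintype.card {x // Cp p b x} = b + 2 := by
    have := prodC p hb (M := Multiplicative ℤ) (fun _ => Multiplicative.ofAdd 1)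
    simp only [Finset.prod_const, Finset.card_range, Finset.card_univ] at this
    have h := congrArg Multiplicative.toAdd this
    simp at h
    omega
  rw [Fintype.card_sum, Fintype.card_subtype_compl, hA, hC]
  omega
end P1

namespace P1
open SL2

theorem baseProd (p : ℕ) [Fact p.Prime] (hp2 : p = 2 * ((p - 1) / 2) + 1) {b : ℕ} (hb0 : 1 ≤ b) (hb : b < p) {M : Type} [CommGroup M] (m : Ip p b → M) (hm : ∀ x, m x * m x = 1) :
    ∏ x, m x = (∏ j ∈ Finset.range (2 * ((p - 1) / 2)), m (jA (Cp p b) (some ((j : ZMod p) : X p)))) * (∏ j ∈ Finset.range (2 * ((p - 1) / 2)), m (jB (Cp p b) (some ((j : ZMod p) : X p))))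
      * (∏ j ∈ Finset.range (2 * (b / 2)), m (jA (Cp p b) (some ((j : ZMod p) : X p))))
      * (List.map m ([Sum.inl none, Sum.inl (some OnePoint.infty), Sum.inl (ep p (p - 1)), Sum.inl none, Sum.inl (some OnePoint.infty), jB (Cp p b) (ep p (p - 1)), Sum.inl none, Sum.inl (some OnePoint.infty)] ++ (if b % 2 = 1 then [Sum.inl (ep p (b - 1))] else []))).prod := by
  have jBs : jB (Cp p b) none = Sum.inl none := jB_pos _ (Or.inl rfl)
  have jBi : jB (Cp p b) (some OnePoint.infty) = Sum.inl (some OnePoint.infty) := jB_pos _ (Or.inr (Or.inl rfl))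
  rw [prodI p hb m hm, prodA, prodA, prodC p hb (fun x => m (jA (Cp p b) x))]
  have e1 : ∀ f : ℕ → M, ∏ j ∈ Finset.range p, f j = (∏ j ∈ Finset.range (2 * ((p - 1) / 2)), f j) * f (p - 1) := by
    intro f
    have h1 := Finset.prod_range_succ f (2 * ((p - 1) / 2))
    rw [← hp2] at h1
    rw [h1]; congr 2; omega
  have e2 : ∀ f : ℕ → M, ∏ j ∈ Finset.range b, f j = (∏ j ∈ Finset.range (2 * (b / 2)), f j) * (if b % 2 = 1 then f (b - 1) else 1) := by
    intro f
    split_ifs with h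
    · have h1 := Finset.prod_range_succ f (2 * (b / 2))
      have : b = 2 * (b / 2) + 1 := by omega
      rw [← this] at h1
      rw [h1]; congr 2; omega
    · have : 2 * (b / 2) = b := by omega
      rw [this, mul_one]
  rw [e1, e1, e2, jBs, jBi]
  have e3 : (List.map m (if b % 2 = 1 then [Sum.inl (ep p (b - 1))] else [])).prod = if b % 2 = 1 then m (jA (Cp p b) (ep p (b - 1))) else 1 := by
    split_ifs <;> simp [jA]
  rw [List.map_append, List.prod_append, e3]
  simp only [List.map_cons, List.map_nil, List.prod_cons, List.prod_nil, mul_one]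
  show _ = (∏ j ∈ Finset.range (2 * ((p - 1) / 2)), m (jA (Cp p b) (ep p j))) * (∏ j ∈ Finset.range (2 * ((p - 1) / 2)), m (jB (Cp p b) (ep p j)))
    * (∏ j ∈ Finset.range (2 * (b / 2)), m (jA (Cp p b) (ep p j))) * _
  have j0 : ∀ x, jA (Cp p b) x = Sum.inl x := fun x => rfl
  simp only [j0]
  generalize (∏ j ∈ Finset.range (2 * ((p - 1) / 2)), m (Sum.inl (ep p j))) = a1
  generalize (∏ j ∈ Finset.range (2 * ((p - 1) / 2)), m (jB (Cp p b) (ep p j))) = a2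
  generalize (∏ j ∈ Finset.range (2 * (b / 2)), m (Sum.inl (ep p j))) = a3
  generalize (if b % 2 = 1 then m (Sum.inl (ep p (b - 1))) else 1) = a4
  generalize m (Sum.inl none) = a5
  generalize m (Sum.inl (some OnePoint.infty)) = a6
  generalize m (Sum.inl (ep p (p - 1))) = a7
  generalize m (jB (Cp p b) (ep p (p - 1))) = a8
  simp only [mul_comm, mul_left_comm, mul_assoc]

set_option maxHeartbeats 2000000 in
theorem base : ∃ c, ∀ p [Fact p.Prime], 5 ≤ p → ∀ b, 1 ≤ b → b < p → Nonempty (PG c (1 + Nat.log 2 p) p 20 (Ip p b)) := by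
  obtain ⟨c, hc⟩ := presD
  refine ⟨4 * (21 * (4 * c + 4 * c) + 30), ?_⟩
  intro p _ hp b hb0 hb
  have h0 := (hc p hp).ball 4 (by norm_num)
  set T0 := {x | Bl (Set.range (A p) ∪ Set.range (Equiv.swap (none : Option (X p)))) 4 x} with hT0
  have sb : ∀ x y, Bl (Set.range (A p) ∪ Set.range (Equiv.swap (none : Option (X p)))) 3 (Equiv.swap x y) := fun x y =>
    (swap_bl none x y).mono Set.subset_union_right le_rfl
  have sT : ∀ x y, Equiv.swap x y ∈ T0 := fun x y => (sb x y).le (by norm_num)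
  have yT : yp p b ∈ T0 := (sb _ _).mul (Bl.of (k := 1) (Or.inl ⟨_, rfl⟩))
  have AT : ∀ g, A p g ∈ T0 := fun g => Bl.of (Or.inl ⟨_, rfl⟩)
  have hyC := yp_C p hb0 hb
  have hs : Cp p b none := Or.inl rfl
  have hi : Cp p b (some OnePoint.infty) := Or.inr (Or.inl rfl)
  have ho : Cp p b (ep p 0) := (Cp_ep p hb (by omega)).2 (by omega)
  have hbb : ¬ Cp p b (ep p b) := fun h => by have := (Cp_ep p hb hb).1 h; omega
  have orC : ∀ x, Cp p b x → x ≠ none → x ≠ some OnePoint.infty → ∃ k : ℕ, (yp p b ^ k) (ep p 0) = x := by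
    rintro x (h | h | ⟨j, hj, rfl⟩) h1 h2
    · exact absurd h h1
    · exact absurd h h2
    · exact ⟨j, yp_orC p hb j hj⟩
  have orD : ∀ x, ¬ Cp p b x → ∃ k : ℕ, (yp p b ^ k) (ep p b) = x := by
    intro x hx
    rcases ep_cases p x with h | h | ⟨j, hj, rfl⟩
    · exact absurd (h ▸ hs) hx
    · exact absurd (h ▸ hi) hx
    · rw [Cp_ep p hb hj] at hx
      refine ⟨j - b, ?_⟩
      rw [yp_orD p hb _ (by omega)]; congr 1; omega
  have his : (some OnePoint.infty : Option (X p)) ≠ none := by simp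
  obtain ⟨α, hα, hα'⟩ : ∃ α : Equiv.Perm (Option (X p)), (∀ x, Cp p b x → α x = yp p b x) ∧ (∀ x, ¬ Cp p b x → α x = x) := by
    refine ⟨Equiv.Perm.ofSubtype ((yp p b).subtypePerm hyC), ?_, ?_⟩
    · intro x hx; rw [Equiv.Perm.ofSubtype_apply_of_mem _ hx]; rfl
    · intro x hx; exact Equiv.Perm.ofSubtype_apply_of_not_mem _ hx
  have key := glue (Cp p b) h0 (yp p b) α none (some OnePoint.infty) (ep p 0) (ep p b) hs hi ho hbb his (yp_none p b) (yp_inf p b)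
    hyC hα hα' orC orD yT sT
  set T1 := PA (Cp p b) '' T0 ∪ PB (Cp p b) '' T0 with hT1
  have bA : ∀ t ∈ T0, Bl T1 1 (PA (Cp p b) t) := fun t ht => Bl.of (Or.inl ⟨t, ht, rfl⟩)
  have bB : ∀ t ∈ T0, Bl T1 1 (PB (Cp p b) t) := fun t ht => Bl.of (Or.inr ⟨t, ht, rfl⟩)
  have jBs : jB (Cp p b) none = Sum.inl none := jB_pos _ hs
  have jBi : jB (Cp p b) (some OnePoint.infty) = Sum.inl (some OnePoint.infty) := jB_pos _ hi
  have star : ∀ x, Bl T1 1 (Equiv.swap (Sum.inl none) x) := by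
    rintro (x | ⟨x, hx⟩)
    · rw [← PA_swap]; exact bA _ (sT _ _)
    · rw [← jBs, ← jB_neg (Cp p b) hx, ← PB_swap]; exact bB _ (sT _ _)
  have swT : ∀ x y, Equiv.swap x y ∈ {x | Bl T1 4 x} := by
    intro x y
    have := Bl.comp (S' := T1) (k := 1) (by rintro _ ⟨z, rfl⟩; exact star z) (swap_bl (Sum.inl none) x y)
    exact this.le (by norm_num)
  have key2 := key.ball 4 (by norm_num)
  have hp2 : p = 2 * ((p - 1) / 2) + 1 := by
    obtain ⟨r, hr⟩ : ∃ r, p = 2 * r + 1 := (Nat.Prime.odd_of_ne_two (Fact.out : p.Prime) (by omega))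
    omega
  let iI : Ip p b := Sum.inl (some OnePoint.infty)
  refine ⟨{
    T := {x | Bl T1 4 x}, sp := key2, sw := swT, o := Sum.inl none, o' := iI, ne := ?_,
    S := [PA (Cp p b) (yp p b), PB (Cp p b) (yp p b), Equiv.swap iI (Sum.inl (ep p 0)), Equiv.swap iI (Sum.inl (ep p b)), Equiv.swap iI (jB (Cp p b) (ep p b))],
    Slen := ?_, ST := ?_, So := ?_, Sgen := ?_,
    jA := jA (Cp p b), jB := jB (Cp p b), ΦA := PA (Cp p b), ΦB := PB (Cp p b), ΦAj := fun σ x => PA_inl _ σ x, ΦBj := fun σ x => PB_jB _ σ x, ΦAs := fun x y => PA_swap _ x y, ΦBs := fun x y => PB_swap _ x y,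
    TA := fun g => (bA _ (AT g)).le (by norm_num), TB := fun g => (bB _ (AT g)).le (by norm_num), b := b / 2, hb := by omega,
    E := [Sum.inl none, iI, Sum.inl (ep p (p - 1)), Sum.inl none, iI, jB (Cp p b) (ep p (p - 1)), Sum.inl none, iI] ++ (if b % 2 = 1 then [Sum.inl (ep p (b - 1))] else []), hE := ?_, hprod := ?_ }⟩
  · intro e; exact his (Sum.inl_injective e)
  · simp only [List.length_cons, List.length_nil]; omega
  · intro g hg
    simp only [List.mem_cons, List.not_mem_nil, or_false] at hg
    rcases hg with rfl | rfl | rfl | rfl | rfl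
    · exact (bA _ yT).le (by norm_num)
    · exact (bB _ yT).le (by norm_num)
    all_goals exact swT _ _
  · intro g hg
    simp only [List.mem_cons, List.not_mem_nil, or_false] at hg
    have hne : ∀ x, x ≠ none → (Sum.inl none : Ip p b) ≠ Sum.inl x := fun x hx e => hx (Sum.inl_injective e).symm
    rcases hg with rfl | rfl | rfl | rfl | rfl
    · rw [PA_inl, yp_none]
    · rw [← jBs, PB_jB, yp_none]
    · exact Equiv.swap_apply_of_ne_of_ne (hne _ his) (hne _ (by simp [ep]))
    · exact Equiv.swap_apply_of_ne_of_ne (hne _ his) (hne _ (by simp [ep]))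
    · refine Equiv.swap_apply_of_ne_of_ne (hne _ his) ?_
      rw [jB_neg _ hbb]; simp
  · set P := Subgroup.closure {g | g ∈ [PA (Cp p b) (yp p b), PB (Cp p b) (yp p b), Equiv.swap iI (Sum.inl (ep p 0)), Equiv.swap iI (Sum.inl (ep p b)), Equiv.swap iI (jB (Cp p b) (ep p b))]} with hP
    have yi : ∀ k : ℕ, (yp p b ^ k) (some OnePoint.infty) = some OnePoint.infty := by
      intro k; induction k with
      | zero => rfl
      | succ k ih => rw [pow_succ', Equiv.Perm.mul_apply, ih, yp_inf]
    have P1 : PA (Cp p b) (yp p b) ∈ P := Subgroup.subset_closure (by simp)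
    have P2 : PB (Cp p b) (yp p b) ∈ P := Subgroup.subset_closure (by simp)
    have P3 : Equiv.swap iI (Sum.inl (ep p 0)) ∈ P := Subgroup.subset_closure (by simp)
    have P4 : Equiv.swap iI (Sum.inl (ep p b)) ∈ P := Subgroup.subset_closure (by simp)
    have P5 : Equiv.swap iI (jB (Cp p b) (ep p b)) ∈ P := Subgroup.subset_closure (by simp)
    have mv : ∀ g ∈ P, ∀ x y, Equiv.swap x y ∈ P → Equiv.swap (g x) (g y) ∈ P := by
      intro g hg x y hxy
      rw [Equiv.swap_apply_apply]
      exact mul_mem (mul_mem hg hxy) (inv_mem hg)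
    apply stab_of_star (Sum.inl none) iI (fun e => his (Sum.inl_injective e))
    rintro (x | ⟨x, hx⟩) hx0
    · by_cases hxi : x = some OnePoint.infty
      · subst hxi; rw [Equiv.swap_self]; exact one_mem _
      have hx0 : x ≠ none := fun e => hx0 (by rw [e])
      by_cases hxC : Cp p b x
      · obtain ⟨k, rfl⟩ := orC x hxC hx0 hxi
        have := mv _ (pow_mem P1 k) _ _ P3
        rwa [← map_pow, PA_inl, PA_inl, yi] at this
      · obtain ⟨k, rfl⟩ := orD x hxC
        have := mv _ (pow_mem P1 k) _ _ P4
        rwa [← map_pow, PA_inl, PA_inl, yi] at this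
    · obtain ⟨k, rfl⟩ := orD x hx
      have e : iI = jB (Cp p b) (some OnePoint.infty) := jBi.symm
      have := mv _ (pow_mem P2 k) _ _ P5
      rw [← map_pow, PB_jB, e, PB_jB, yi, jB_neg _ hx, ← e] at this
      exact this
  · simp only [List.length_append, List.length_cons, List.length_nil]
    split_ifs <;> simp
  · intro M _ m hm
    exact baseProd p hp2 hb0 hb m hm
end P1

theorem PG2.mono {c c' ℓ ℓ' p e e' : ℕ} [Fact p.Prime] {ι : Type} [DecidableEq ι] [Fintype ι] (P : PG2 c ℓ p e ι) (hc : c ≤ c') (hl : ℓ ≤ ℓ') (he : e ≤ e') :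
    Nonempty (PG2 c' ℓ' p e' ι) :=
  ⟨{ P with sp := P.sp.mono hc hl le_rfl, Slen := P.Slen.trans hc, Slen' := P.Slen'.trans hc, hE := P.hE.trans he }⟩

theorem permMain : ∃ c, ∀ n, 20 ≤ n → ∃ (p : ℕ) (_ : Fact p.Prime) (ι : Type) (_ : DecidableEq ι) (_ : Fintype ι),
    5 ≤ p ∧ p ≤ n ∧ Fintype.card ι = n ∧ Nonempty (PG2 c (1 + Nat.log 2 n) p 30 ι) := by
  obtain ⟨c, hc⟩ := P1.base
  let F : ℕ → ℕ := fun c => 3 * (21 * (c + (4 + 1)) + (c + 2))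
  have hF : ∀ c, c ≤ F c := fun c => by simp only [F]; omega
  refine ⟨F (F c), ?_⟩
  intro n hn
  obtain ⟨m, hm⟩ : ∃ m, n = 2 * m + 4 ∨ n = 2 * m + 5 := ⟨(n - 4) / 2, by omega⟩
  obtain ⟨p, hp, h1, h2⟩ := Nat.exists_prime_lt_and_le_two_mul m (by omega)
  haveI : Fact p.Prime := ⟨hp⟩
  have hlog : 1 + Nat.log 2 p ≤ 1 + Nat.log 2 n := by
    have := Nat.log_mono_right (b := 2) (show p ≤ n by omega); omega
  obtain ⟨P⟩ := hc p (by omega) (2 * p - 2 * m - 1) (by omega) (by omega)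
  obtain ⟨P'⟩ := P.step (by omega)
  have hcard := P1.card_Ip p (b := 2 * p - 2 * m - 1) (by omega)
  rcases hm with hm | hm
  · refine ⟨p, inferInstance, Option (P1.Ip p (2 * p - 2 * m - 1)), inferInstance, inferInstance, by omega, by omega, ?_, ?_⟩
    · rw [Fintype.card_option, hcard]; omega
    · exact P'.mono (hF (F c)) hlog (by omega)
  · obtain ⟨P''⟩ := P'.toPG.step (by omega)
    refine ⟨p, inferInstance, Option (Option (P1.Ip p (2 * p - 2 * m - 1))), inferInstance, inferInstance, by omega, by omega, ?_, ?_⟩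
    · rw [Fintype.card_option, Fintype.card_option, hcard]; omega
    · exact P''.mono le_rfl hlog (by omega)

namespace P1
open SL2

/-- product of the first sign changes -/
noncomputable def vv (p : ℕ) [Fact p.Prime] (b : ℕ) : Option (X p) → ℤˣ := ∏ j ∈ Finset.range b, Pi.mulSingle (ep p j) (-1)

theorem single_comp {Y : Type} [DecidableEq Y] (σ : Equiv.Perm Y) (x : Y) (t : ℤˣ) : (Pi.mulSingle x t : Y → ℤˣ) ∘ ⇑(σ⁻¹) = Pi.mulSingle (σ x) t := by
  ext1 y
  simp only [Function.comp_apply, Pi.mulSingle_apply, Equiv.Perm.inv_def, Equiv.symm_apply_eq]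

theorem vv_shift (p : ℕ) [Fact p.Prime] (b k : ℕ) : vv p b ∘ ⇑((A p (U (k : ZMod p)))⁻¹) = ∏ j ∈ Finset.range b, Pi.mulSingle (ep p (k + j)) (-1) := by
  have : ∀ j, A p (U (k : ZMod p)) (ep p j) = ep p (k + j) := by
    intro j; simp [ep, A_some, add_comm]
  simp only [← this, ← single_comp, vv]
  ext1 y
  simp only [Function.comp_apply, Finset.prod_apply]

theorem vv_ne (p : ℕ) [Fact p.Prime] (b : ℕ) (x : Option (X p)) (h : ∀ j, ep p j ≠ x) : vv p b x = 1 := by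
  rw [vv, Finset.prod_apply]
  exact Finset.prod_eq_one fun j _ => by rw [Pi.mulSingle_apply, if_neg (h j).symm]

theorem enrich_inj (p : ℕ) [Fact p.Prime] {G Γ : Type} [Group G] [Group Γ] (Φ : Equiv.Perm (Option (X p)) →* G) (s m : G) (φ : G →* Γ) (η : SL p →* Γ)
    (om : (ZMod p)ˣ) (hom : ∀ t : (ZMod p)ˣ, ∃ i : ℕ, t = om ^ i)
    (hs : ∀ x, s * Φ (Equiv.swap none (some x)) * s⁻¹ = Φ (Equiv.swap none (some x)) ∨ s * Φ (Equiv.swap none (some x)) * s⁻¹ = m⁻¹ * Φ (Equiv.swap none (some x)) * m)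
    (hsi : s * Φ (Equiv.swap none (some OnePoint.infty)) * s⁻¹ = Φ (Equiv.swap none (some OnePoint.infty)))
    (x1 x2 : X p) (hU : s * Φ (A p (U 1)) * s⁻¹ = Φ (Equiv.swap none (some x1)) * m * (Φ (Equiv.swap none (some x1)))⁻¹ * (Φ (Equiv.swap none (some x2)) * m * (Φ (Equiv.swap none (some x2)))⁻¹) * Φ (A p (U 1)))
    (r1 : η (U 1) = φ (s * Φ (A p (U 1)) * s⁻¹)) (r2 : Commute (η (D om)) (φ (Φ (Equiv.swap none (some OnePoint.infty)))))
    (r2' : Commute (η (U 1)) (φ (Φ (Equiv.swap none (some OnePoint.infty)))))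
    (r3 : η W * φ (Φ (Equiv.swap none (some OnePoint.infty))) * (η W)⁻¹ = φ (s * Φ (Equiv.swap none (some ((0 : ZMod p) : X p))) * s⁻¹))
    (r4 : Commute (η (U 1)) (φ m)) (r5 : Commute (η W) (φ m)) (g : SL p) : η g ∈ φ.range := by
  set z : X p → G := fun x => Φ (Equiv.swap none (some x)) with hz
  have hz' : ∀ x, Φ (Equiv.swap none (some x)) = z x := fun x => rfl
  simp only [hz'] at hs hsi hU r2 r2' r3
  set Z := fam η (φ (z OnePoint.infty)) with hZ
  have hc : ∀ g x, η g * Z x * (η g)⁻¹ = Z (pm p g x) := fam_conj η _ om hom r2' r2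
  have key : ∀ x, Z x = φ (s * z x * s⁻¹) := by
    intro x
    induction x using OnePoint.rec with
    | infty => rw [hsi, hZ, fam_inf]
    | coe x =>
      have : ∀ n : ℕ, Z ((n : ZMod p) : X p) = φ (s * z ((n : ZMod p) : X p) * s⁻¹) := by
        intro n
        induction n with
        | zero =>
          rw [Nat.cast_zero, ← r3, ← pmW_inf, ← hc, hZ, fam_inf]
        | succ n ih =>
          have e : (((n + 1 : ℕ) : ZMod p) : X p) = pm p (U 1) ((n : ZMod p) : X p) := by simp
          rw [e, ← hc, ih, r1, ← map_mul, ← map_inv, ← map_mul]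
          congr 1
          have : z (pm p (U 1) ((n : ZMod p) : X p)) = Φ (A p (U 1)) * z ((n : ZMod p) : X p) * (Φ (A p (U 1)))⁻¹ := by
            simp only [hz]
            rw [← map_mul, ← map_inv, ← map_mul, A_swap]
          rw [this]; group
      have h := this x.val
      simpa using h
  have hm : ∀ g, Commute (η g) (φ m) := by
    intro g
    have h1 : ∀ t, Commute (η (U t)) (φ m) := fun t => by rw [U_pow, map_pow]; exact r4.pow_left _
    have h2 := (bruhat g).mem_closure
    have hle : Subgroup.closure (Set.range U ∪ {W}) ≤ (Subgroup.centralizer {φ m}).comap η := by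
      rw [Subgroup.closure_le]
      rintro _ (⟨t, rfl⟩ | rfl)
      · exact Subgroup.mem_centralizer_singleton_iff.2 (h1 t).eq
      · exact Subgroup.mem_centralizer_singleton_iff.2 r5.eq
    exact Subgroup.mem_centralizer_singleton_iff.1 (hle h2)
  let M := Subgroup.closure (Set.range Z ∪ {φ m})
  let MG := M.comap φ
  have mM : m ∈ MG := Subgroup.subset_closure (Or.inr rfl)
  have zM : ∀ x, z x ∈ MG := by
    intro x
    have h1 : s * z x * s⁻¹ ∈ MG := by
      show φ _ ∈ M
      rw [← key]; exact Subgroup.subset_closure (Or.inl ⟨x, rfl⟩)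
    rcases hs x with h | h
    · rwa [h] at h1
    · rw [h] at h1
      have := mul_mem (mul_mem mM h1) (inv_mem mM)
      simpa [mul_assoc] using this
  have PM : ∀ σ, Φ σ ∈ MG := by
    have : MG.comap Φ = ⊤ := by
      apply perm_top_of_star none
      rintro (_ | x)
      · rw [Equiv.swap_self]; exact one_mem _
      · exact zM x
    intro σ
    have h : σ ∈ MG.comap Φ := by rw [this]; trivial
    exact h
  have UM : η (U 1) ∈ M := by
    rw [r1]
    show _ ∈ MG
    rw [hU]
    exact mul_mem (mul_mem (mul_mem (mul_mem (zM _) mM) (inv_mem (zM _))) (mul_mem (mul_mem (zM _) mM) (inv_mem (zM _)))) (PM _)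
  have nM : ∀ g, ∀ x ∈ M, η g * x * (η g)⁻¹ ∈ M := by
    intro g x hx
    refine norm_of η _ ?_ g x hx
    rintro g _ (⟨x, rfl⟩ | rfl)
    · rw [hc]; exact Subgroup.subset_closure (Or.inl ⟨_, rfl⟩)
    · rw [(hm g).eq, mul_inv_cancel_right]; exact Subgroup.subset_closure (Or.inr rfl)
  have hN : (M.comap η).Normal := ⟨fun x hx g => by
    show η _ ∈ M
    rw [map_mul, map_mul, map_inv]; exact nM g _ hx⟩
  have h := triv_of_U (QuotientGroup.mk' (M.comap η)) ((QuotientGroup.eq_one_iff _).2 UM) g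
  have h : η g ∈ M := (QuotientGroup.eq_one_iff g).1 h
  refine (Subgroup.closure_le _).2 ?_ h
  rintro _ (⟨x, rfl⟩ | rfl)
  · exact ⟨_, (key x).symm⟩
  · exact ⟨_, rfl⟩

theorem enrich : ∃ k : ℕ, ∀ p [Fact p.Prime], 5 ≤ p → ∀ (G : Type) [Group G] (c ℓ : ℕ) (T : Set G), 1 + Nat.log 2 p ≤ ℓ → SP c ℓ G T →
    ∀ (Φ : Equiv.Perm (Option (X p)) →* G) (μ : (Option (X p) → ℤˣ) →* G) (hμ : ∀ σ v, Φ σ * μ v * (Φ σ)⁻¹ = μ (v ∘ ⇑(σ⁻¹)))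
      (hA : ∀ g, Φ (A p g) ∈ T) (hS : ∀ x y, Φ (Equiv.swap x y) ∈ T) (hm : ∀ x, μ (Pi.mulSingle x (-1)) ∈ T) (b : ℕ),
      SP (k * (c + k)) ℓ G (T ∪ {μ (vv p (2 * b))}) := by
  obtain ⟨c0, hc0⟩ := SL2.main
  refine ⟨2 * (41 * c0 + 41) + 100, ?_⟩
  intro p _ hp G _ c ℓ T hl h0 Φ μ hμ hA hS hm b
  obtain ⟨om, hom, -, -⟩ := exists_om p hp
  have hSL : SP c0 ℓ (SL p) Set.univ := (hc0 (ZMod p)).mono le_rfl (by rw [ZMod.card]; exact hl) le_rfl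
  obtain ⟨K, _, TK, h, h', hK, mh, mh', hlift, hmem⟩ := pieces2 h0 hSL
  set s := μ (vv p b) with hs
  set m := μ (Pi.mulSingle none (-1)) with hmd
  let H : SL p →* G := (MulAut.conj s).toMonoidHom.comp (Φ.comp (A p))
  have hH : ∀ g, H g = s * Φ (A p g) * s⁻¹ := fun g => rfl
  obtain ⟨f, fh, fh'⟩ := hlift G (MonoidHom.id G) H
  have cm : ∀ v w, Commute (μ v) (μ w) := fun v w => by
    show μ v * μ w = μ w * μ v
    rw [← map_mul, mul_comm, map_mul]
  have fixc : ∀ (σ : Equiv.Perm (Option (X p))) v, v ∘ ⇑(σ⁻¹) = v → Commute (Φ σ) (μ v) := by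
    intro σ v e
    have := hμ σ v
    rw [e, mul_inv_eq_iff_eq_mul] at this
    exact this
  have ff : ∀ x (v : Option (X p) → ℤˣ), v none = v (some x) → v ∘ ⇑((Equiv.swap none (some x))⁻¹) = v := by
    intro x v e
    ext1 y
    rw [Equiv.swap_inv, Function.comp_apply]
    rcases eq_or_ne y none with rfl | h1
    · rw [Equiv.swap_apply_left, e]
    rcases eq_or_ne y (some x) with rfl | h2
    · rw [Equiv.swap_apply_right, e]
    · rw [Equiv.swap_apply_of_ne_of_ne h1 h2]
  have vn : vv p b none = 1 := vv_ne p b _ (fun j => by simp [ep])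
  have vi : vv p b (some OnePoint.infty) = 1 := vv_ne p b _ (fun j => ep_ne_inf p j)
  have hsx : ∀ x, s * Φ (Equiv.swap none (some x)) * s⁻¹ = Φ (Equiv.swap none (some x)) ∨ s * Φ (Equiv.swap none (some x)) * s⁻¹ = m⁻¹ * Φ (Equiv.swap none (some x)) * m := by
    intro x
    rcases Int.units_eq_one_or (vv p b (some x)) with e | e
    · left
      have := fixc _ _ (ff x (vv p b) (by rw [vn, e]))
      rw [mul_inv_eq_iff_eq_mul]; exact this.eq.symm
    · right
      have h1 := fixc _ _ (ff x (vv p b * Pi.mulSingle none (-1)) (by simp [vn, e]))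
      rw [map_mul] at h1
      have h2 : s * m = m * s := (cm _ _).eq
      have h3 : Φ (Equiv.swap none (some x)) * (s * m) = s * m * Φ (Equiv.swap none (some x)) := h1.eq
      rw [h2] at h3
      rw [mul_inv_eq_iff_eq_mul, mul_assoc, mul_assoc, eq_inv_mul_iff_mul_eq, ← mul_assoc, ← h3]
  have hsi : s * Φ (Equiv.swap none (some OnePoint.infty)) * s⁻¹ = Φ (Equiv.swap none (some OnePoint.infty)) := by
    have := fixc _ _ (ff _ (vv p b) (by rw [vn, vi]))
    rw [mul_inv_eq_iff_eq_mul]; exact this.eq.symm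
  have mx : ∀ x : X p, Φ (Equiv.swap none (some x)) * m * (Φ (Equiv.swap none (some x)))⁻¹ = μ (Pi.mulSingle (some x) (-1)) := by
    intro x
    rw [hμ, single_comp, Equiv.swap_apply_left]
  have shift : ∀ k : ℕ, s * Φ (A p (U (k : ZMod p))) * s⁻¹ = μ (vv p b * ∏ j ∈ Finset.range b, Pi.mulSingle (ep p (k + j)) (-1)) * Φ (A p (U (k : ZMod p))) := by
    intro k
    have s1 : s⁻¹ = s := by
      rw [hs, ← map_inv]; congr 1; ext1 x; exact Int.units_inv_eq_self _
    rw [← vv_shift, map_mul, ← hμ, s1]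
    simp only [mul_assoc, inv_mul_cancel, mul_one]; rfl
  have hU : s * Φ (A p (U 1)) * s⁻¹ = μ (Pi.mulSingle (some ((0 : ZMod p) : X p)) (-1)) * μ (Pi.mulSingle (some ((b : ZMod p) : X p)) (-1)) * Φ (A p (U 1)) := by
    have h1 := shift 1
    rw [Nat.cast_one] at h1
    rw [h1, ← map_mul]
    congr 2
    have e1 := Finset.prod_range_succ (fun j => (Pi.mulSingle (ep p j) (-1) : Option (X p) → ℤˣ)) b
    rw [Finset.prod_range_succ'] at e1
    have e2 : ∀ w : Option (X p) → ℤˣ, w * w = 1 := fun w => by ext1 x; exact Int.units_mul_self _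
    simp only [add_comm 1]
    have e3 : ep p 0 = some ((0 : ZMod p) : X p) := by simp [ep]
    rw [← e3]
    show vv p b * _ = _ * Pi.mulSingle (ep p b) (-1)
    change _ = vv p b * _ at e1
    calc vv p b * ∏ j ∈ Finset.range b, Pi.mulSingle (ep p (j + 1)) (-1) 
        = vv p b * ((∏ j ∈ Finset.range b, Pi.mulSingle (ep p (j + 1)) (-1)) * Pi.mulSingle (ep p 0) (-1)) * Pi.mulSingle (ep p 0) (-1) := by
          rw [mul_assoc, mul_assoc, e2, mul_one]
      _ = (vv p b * vv p b) * (Pi.mulSingle (ep p 0) (-1) * Pi.mulSingle (ep p b) (-1)) := by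
          rw [e1, mul_assoc, mul_assoc, mul_assoc, mul_comm (Pi.mulSingle (ep p b) (-1))]
      _ = _ := by rw [e2, one_mul]
  have hU' := hU
  rw [← mx, ← mx] at hU'
  have sc : ∀ g, Commute (Φ (A p g)) m := fun g => fixc _ _ (by rw [single_comp, A_none])
  have sm : Commute s m := cm _ _
  have bh : ∀ t ∈ T, Bl TK 1 (h t) := fun t ht => Bl.of (mh _ ht)
  have bh' : ∀ g, Bl TK 1 (h' g) := fun t => Bl.of (mh' _ trivial)
  have bm : Bl TK 1 (h m) := bh _ (hm _)
  have b0 : ∀ x, Bl TK 3 (h (s * Φ (Equiv.swap none (some x)) * s⁻¹)) := by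
    intro x
    rcases hsx x with e | e
    · rw [e]; exact (bh _ (hS _ _)).le (by norm_num)
    · rw [e, map_mul, map_mul, map_inv]; exact ((bm.inv.mul (bh _ (hS _ _))).mul bm)
  have b1 : Bl TK 3 (h (s * Φ (A p (U 1)) * s⁻¹)) := by
    rw [hU, map_mul, map_mul]
    exact ((bh _ (hm _)).mul (bh _ (hm _))).mul (bh _ (hA _))
  have bz : Bl TK 1 (h (Φ (Equiv.swap none (some OnePoint.infty)))) := bh _ (hS _ _)
  let L : List K := [h' (U 1) * (h (s * Φ (A p (U 1)) * s⁻¹))⁻¹,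
    ⁅h' (D om), h (Φ (Equiv.swap none (some OnePoint.infty)))⁆, ⁅h' (U 1), h (Φ (Equiv.swap none (some OnePoint.infty)))⁆,
    h' W * h (Φ (Equiv.swap none (some OnePoint.infty))) * (h' W)⁻¹ * (h (s * Φ (Equiv.swap none (some ((0 : ZMod p) : X p))) * s⁻¹))⁻¹,
    ⁅h' (U 1), h m⁆, ⁅h' W, h m⁆]
  have key := hK.assembleL f (fun g => ⟨h g, fh g⟩) 6 L (by simp [L]) (k := 20) ?_ ?_ ?_
  · refine (key.ball 2 (by norm_num)).mono ?_ le_rfl ?_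
    · calc 2 * ((20 + 1) * (c + c0) + 6) ≤ 100 * c + 100 * (2 * (41 * c0 + 41) + 100) := by omega
        _ = 100 * (c + (2 * (41 * c0 + 41) + 100)) := by ring
        _ ≤ _ := Nat.mul_le_mul_right _ (by omega)
    · have hTf : ∀ t ∈ T, t ∈ f '' TK := fun t ht => ⟨h t, mh t ht, fh t⟩
      rintro t (ht | rfl)
      · exact Bl.of (hTf t ht)
      · have e2 : vv p (2 * b) = vv p b * ∏ j ∈ Finset.range b, Pi.mulSingle (ep p (b + j)) (-1) := by
          rw [two_mul, vv, Finset.prod_range_add]; rfl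
        rw [e2, ← mul_inv_eq_iff_eq_mul.2 (shift b)]
        refine (Bl.of (k := 1) (show _ ∈ f '' TK from ⟨h' (U (b : ZMod p)), mh' _ trivial, by rw [fh', hH]⟩)).mul (Bl.of (k := 1) (hTf _ (hA _))).inv
  · intro e he
    simp only [L, List.mem_cons, List.not_mem_nil, or_false] at he
    rcases he with rfl | rfl | rfl | rfl | rfl | rfl
    all_goals
      apply Bl.le
      · repeat' first | exact b0 _ | exact b1 | exact bz | exact bm | exact bh' _ | apply Bl.comm | apply Bl.mul | apply Bl.inv
      · norm_num
  · simp only [L, List.mem_cons, List.not_mem_nil, or_false, forall_eq_or_imp, forall_eq, map_commutatorElement, commutatorElement_eq_one_iff_commute, map_mul, map_inv, mul_inv_eq_one, fh, fh', MonoidHom.id_apply, hH]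
    have hci : ∀ g, pm p g OnePoint.infty = OnePoint.infty → Commute (s * Φ (A p g) * s⁻¹) (Φ (Equiv.swap none (some OnePoint.infty))) := by
      intro g hg
      have : Commute (Φ (A p g)) (Φ (Equiv.swap none (some OnePoint.infty))) := (swap_comm_of (A p g) (A_none p g) (by rw [A_some, hg])).map Φ
      have h2 := (this.map (MulAut.conj s).toMonoidHom)
      change Commute (s * Φ (A p g) * s⁻¹) (s * Φ (Equiv.swap none (some OnePoint.infty)) * s⁻¹) at h2
      rwa [hsi] at h2
    refine ⟨trivial, hci _ (pmD_inf _), hci _ (pmU_inf _), ?_, ?_, ?_⟩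
    · have e := A_swap p W OnePoint.infty
      rw [pmW_inf] at e
      rw [← e, map_mul, map_mul, map_inv]
      nth_rewrite 1 [← hsi]
      group
    all_goals exact (sm.mul_left (sc _)).mul_left sm.inv_left |> fun h => h
  · intro Γ _ ψ π hψ hπ hr
    simp only [L, List.mem_cons, List.not_mem_nil, or_false, forall_eq_or_imp, forall_eq, map_commutatorElement, commutatorElement_eq_one_iff_commute, map_mul ψ, map_inv ψ, mul_inv_eq_one] at hr
    obtain ⟨r1, r2, r3, r4, r5, r6⟩ := hr
    have hmemr := enrich_inj p Φ s m (ψ.comp h) (ψ.comp h') om hom hsx hsi _ _ hU' r1 r2 r3 r4 r5 r6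
    have hall := hmem Γ ψ (ψ.comp h).range (fun g => ⟨g, rfl⟩) hmemr
    have hsurj : ∀ y, ∃ g, ψ (h g) = y := by
      intro y
      obtain ⟨x, rfl⟩ := hψ y
      exact hall x
    intro y y' e
    obtain ⟨g, rfl⟩ := hsurj y
    obtain ⟨g', rfl⟩ := hsurj y'
    rw [hπ, hπ, fh, fh] at e
    exact congrArg (fun g => ψ (h g)) e
end P1

open P1 in
/-- push forward of sign vectors -/
def pushS {Y ι : Type} [Fintype Y] [DecidableEq ι] (j : Y → ι) : (Y → ℤˣ) →* (ι → ℤˣ) :=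
  MonoidHom.mk' (fun v i => ∏ x, if j x = i then v x else 1) (by
    intro v w; ext1 i
    rw [Pi.mul_apply, ← Finset.prod_mul_distrib]
    refine Finset.prod_congr rfl fun x _ => ?_
    split_ifs <;> simp)

theorem pushS_apply {Y ι : Type} [Fintype Y] [DecidableEq ι] (j : Y → ι) (v : Y → ℤˣ) (i : ι) : pushS j v i = ∏ x, if j x = i then v x else 1 := rfl

theorem pushS_single {Y ι : Type} [Fintype Y] [DecidableEq Y] [DecidableEq ι] (j : Y → ι) (x : Y) (t : ℤˣ) :
    pushS j (Pi.mulSingle x t) = Pi.mulSingle (j x) t := by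
  ext1 i
  rw [pushS_apply, Finset.prod_eq_single x]
  · rw [Pi.mulSingle_eq_same, Pi.mulSingle_apply]; simp only [eq_comm]
  · intro y _ hy; simp [Pi.mulSingle_apply, hy]
  · simp

theorem pushS_comp {Y ι : Type} [Fintype Y] [DecidableEq ι] (j : Y → ι) (σ : Equiv.Perm Y) (τ : Equiv.Perm ι) (h : ∀ x, τ (j x) = j (σ x)) (v : Y → ℤˣ) :
    pushS j (v ∘ ⇑(σ⁻¹)) = pushS j v ∘ ⇑(τ⁻¹) := by
  ext1 i
  rw [Function.comp_apply, pushS_apply, pushS_apply, ← Equiv.prod_comp σ]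
  refine Finset.prod_congr rfl fun x _ => ?_
  have e : j (σ x) = i ↔ j x = τ⁻¹ i := by
    rw [← h, Equiv.Perm.inv_def, Equiv.eq_symm_apply]
  have e2 : (v ∘ ⇑(σ⁻¹)) (σ x) = v x := by simp [Equiv.Perm.inv_def]
  simp only [e, e2]

theorem pushS_vv {p : ℕ} [Fact p.Prime] {ι : Type} [DecidableEq ι] (j : Option (P1.X p) → ι) (b : ℕ) :
    pushS j (P1.vv p b) = ∏ i ∈ Finset.range b, Pi.mulSingle (j (some ((i : ZMod p) : P1.X p))) (-1) := by
  rw [P1.vv, map_prod]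
  exact Finset.prod_congr rfl fun i _ => pushS_single _ _ _

theorem zetaShort : ∃ k : ℕ, ∀ (c ℓ p e c2 : ℕ) [Fact p.Prime], 5 ≤ p → 1 + Nat.log 2 p ≤ ℓ → ∀ (ι : Type) [DecidableEq ι] [Fintype ι] (ℓ' : ℕ) (P : PG c ℓ' p e ι)
    (G : Type) [Group G] (T : Set G) (h0 : SP c2 ℓ G T) (Φ : Equiv.Perm ι →* G) (μ : (ι → ℤˣ) →* G) (hμ : ∀ (σ : Equiv.Perm ι) v, Φ σ * μ v * (Φ σ)⁻¹ = μ (v ∘ ⇑(σ⁻¹)))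
    (hΦ : ∀ σ ∈ P.T, Φ σ ∈ T) (hm : ∀ x, μ (Pi.mulSingle x (-1)) ∈ T),
    SP ((e + 3) * (k * (c2 + k))) ℓ G (T ∪ {μ (fun _ => -1)}) := by
  obtain ⟨k, hk⟩ := P1.enrich
  refine ⟨k * k * k + k * k + k + k * k * k, ?_⟩
  intro c ℓ p e c2 _ hp hl ι _ _ ℓ' P G _ T h0 Φ μ hμ hΦ hm
  have h1 := hk p hp G c2 ℓ T hl h0 (Φ.comp P.ΦA) (μ.comp (pushS P.jA)) (fun σ v => by
    rw [MonoidHom.comp_apply, MonoidHom.comp_apply, MonoidHom.comp_apply, hμ, pushS_comp P.jA σ (P.ΦA σ) (P.ΦAj σ)])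
    (fun g => hΦ _ (P.TA g)) (fun x y => hΦ _ (by rw [P.ΦAs]; exact P.sw _ _))
    (fun x => by rw [MonoidHom.comp_apply, pushS_single]; exact hm _) ((p - 1) / 2)
  have h2 := hk p hp G _ ℓ _ hl h1 (Φ.comp P.ΦB) (μ.comp (pushS P.jB)) (fun σ v => by
    rw [MonoidHom.comp_apply, MonoidHom.comp_apply, MonoidHom.comp_apply, hμ, pushS_comp P.jB σ (P.ΦB σ) (P.ΦBj σ)])
    (fun g => Or.inl (hΦ _ (P.TB g))) (fun x y => Or.inl (hΦ _ (by rw [P.ΦBs]; exact P.sw _ _)))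
    (fun x => Or.inl (by rw [MonoidHom.comp_apply, pushS_single]; exact hm _)) ((p - 1) / 2)
  have h3 := hk p hp G _ ℓ _ hl h2 (Φ.comp P.ΦA) (μ.comp (pushS P.jA)) (fun σ v => by
    rw [MonoidHom.comp_apply, MonoidHom.comp_apply, MonoidHom.comp_apply, hμ, pushS_comp P.jA σ (P.ΦA σ) (P.ΦAj σ)])
    (fun g => Or.inl (Or.inl (hΦ _ (P.TA g)))) (fun x y => Or.inl (Or.inl (hΦ _ (by rw [P.ΦAs]; exact P.sw _ _))))
    (fun x => Or.inl (Or.inl (by rw [MonoidHom.comp_apply, pushS_single]; exact hm _))) P.b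
  refine (h3.ball (e + 3) (by omega)).mono ?_ le_rfl ?_
  · apply Nat.mul_le_mul_left
    have : ∀ k c : ℕ, k * (k * (k * (c + k) + k) + k) ≤ (k * k * k + k * k + k + k * k * k) * (c + (k * k * k + k * k + k + k * k * k)) := by
      intro k c
      have : k * (k * (k * (c + k) + k) + k) = k * k * k * c + (k * k * k * k + k * k * k + k * k) := by ring
      rw [this, mul_add]
      apply add_le_add
      · exact Nat.mul_le_mul_right _ (by omega)
      · rcases Nat.eq_zero_or_pos k with rfl | hk
        · simp
        · have : k * k * k * k + k * k * k + k * k ≤ k * (k * k * k + k * k + k + k * k * k) := by nlinarith [Nat.zero_le (k * k * k * k)]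
          exact this.trans (Nat.mul_le_mul_right _ (by omega))
    exact this k c2
  · rintro t (ht | rfl)
    · exact Bl.of (Or.inl (Or.inl (Or.inl ht))) (by omega)
    · have hp := P.hprod (ι → ℤˣ) (fun x => Pi.mulSingle x (-1)) (fun x => by ext1 i; exact Int.units_mul_self _)
      have e0 : (fun _ : ι => (-1 : ℤˣ)) = ∏ x, Pi.mulSingle x (-1) := (Finset.univ_prod_mulSingle (fun _ : ι => (-1 : ℤˣ))).symm
      rw [e0, hp, ← pushS_vv, ← pushS_vv, ← pushS_vv, map_mul, map_mul, map_mul]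
      refine Bl.le (((Bl.of (k := 1) ?_).mul (Bl.of (k := 1) ?_)).mul (Bl.of (k := 1) ?_) |>.mul (k' := e * 1) ?_) (by omega)
      · exact Or.inl (Or.inl (Or.inr rfl))
      · exact Or.inl (Or.inr rfl)
      · exact Or.inr rfl
      · rw [map_list_prod, List.map_map]
        refine Bl.le (Bl.lprod (k := 1) _ ?_) ?_
        · intro y hy
          obtain ⟨x, hx, rfl⟩ := List.mem_map.1 hy
          exact Bl.of (Or.inl (Or.inl (Or.inl (hm x))))
        · rw [List.length_map]; exact Nat.mul_le_mul_right _ P.hE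

namespace LT
open SL2
open scoped Matrix

variable {F : Type} [Field F]

abbrev S2 (F : Type) [Field F] := Matrix.SpecialLinearGroup (Fin 2) F
abbrev V2 (F : Type) := Fin 2 → F

/-- the alternating form on the plane -/
def fm (a b : V2 F) : F := a 0 * b 1 - a 1 * b 0
/-- the action on the plane -/
def av (A : S2 F) (a : V2 F) : V2 F := (A : Matrix (Fin 2) (Fin 2) F) *ᵥ a

theorem av_apply (A : S2 F) (a : V2 F) (i : Fin 2) : av A a i = A i 0 * a 0 + A i 1 * a 1 := by
  simp [av, Matrix.mulVec, dotProduct, Fin.sum_univ_two]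

theorem v2_ext {a b : V2 F} (h0 : a 0 = b 0) (h1 : a 1 = b 1) : a = b := by
  ext i; fin_cases i <;> assumption

theorem av_mul (A B : S2 F) (a : V2 F) : av (A * B) a = av A (av B a) := by
  show ((A * B : S2 F) : Matrix (Fin 2) (Fin 2) F) *ᵥ a = _
  rw [Matrix.SpecialLinearGroup.coe_mul, ← Matrix.mulVec_mulVec]; rfl
@[simp] theorem av_one (a : V2 F) : av (1 : S2 F) a = a := by simp [av]
@[simp] theorem av_zero (A : S2 F) : av A 0 = 0 := by simp [av]
theorem av_add (A : S2 F) (a b : V2 F) : av A (a + b) = av A a + av A b := by simp [av, Matrix.mulVec_add]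
theorem av_smul (A : S2 F) (t : F) (b : V2 F) : av A (t • b) = t • av A b := by simp [av, Matrix.mulVec_smul]
theorem av_inv (A : S2 F) (a : V2 F) : av A⁻¹ (av A a) = a := by rw [← av_mul]; simp
theorem av_inv' (A : S2 F) (a : V2 F) : av A (av A⁻¹ a) = a := by rw [← av_mul]; simp

theorem fm_av (A : S2 F) (a b : V2 F) : fm (av A a) (av A b) = fm a b := by
  have hd := A.det_coe
  rw [Matrix.det_fin_two] at hd
  simp only [fm, av_apply]
  linear_combination (a 0 * b 1 - a 1 * b 0) * hd

@[simp] theorem fm_self (a : V2 F) : fm a a = 0 := by simp only [fm]; ring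
theorem fm_add_left (a b c : V2 F) : fm (a + b) c = fm a c + fm b c := by simp only [fm, Pi.add_apply]; ring
theorem fm_add_right (a b c : V2 F) : fm a (b + c) = fm a b + fm a c := by simp only [fm, Pi.add_apply]; ring
theorem fm_smul_left (t : F) (b c : V2 F) : fm (t • b) c = t * fm b c := by simp only [fm, Pi.smul_apply, smul_eq_mul]; ring
theorem fm_smul_right (t : F) (b c : V2 F) : fm b (t • c) = t * fm b c := by simp only [fm, Pi.smul_apply, smul_eq_mul]; ring
theorem fm_neg_left (b c : V2 F) : fm (-b) c = - fm b c := by simp only [fm, Pi.neg_apply]; ring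
theorem fm_neg_right (b c : V2 F) : fm b (-c) = - fm b c := by simp only [fm, Pi.neg_apply]; ring
theorem fm_swap (b c : V2 F) : fm b c = - fm c b := by simp only [fm]; ring
@[simp] theorem fm_zero_left (a : V2 F) : fm 0 a = 0 := by simp [fm]
@[simp] theorem fm_zero_right (a : V2 F) : fm a 0 = 0 := by simp [fm]

def ve : V2 F := ![1, 0]
def vf : V2 F := ![0, 1]
@[simp] theorem ve0 : (ve : V2 F) 0 = 1 := rfl
@[simp] theorem ve1 : (ve : V2 F) 1 = 0 := rfl
@[simp] theorem vf0 : (vf : V2 F) 0 = 0 := rfl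
@[simp] theorem vf1 : (vf : V2 F) 1 = 1 := rfl
@[simp] theorem fm_ef : fm (ve : V2 F) vf = 1 := by simp [fm]
@[simp] theorem fm_fe : fm (vf : V2 F) ve = -1 := by simp [fm]
theorem ve_ne : (ve : V2 F) ≠ 0 := fun h => by simpa using congrFun h 0
theorem vf_ne : (vf : V2 F) ≠ 0 := fun h => by simpa using congrFun h 1
theorem v2_decomp (a : V2 F) : a = a 0 • ve + a 1 • vf := by
  apply v2_ext <;> simp

/-- planar transvection -/
def TX (u : V2 F) (s : F) : S2 F := ⟨!![1 + s * u 0 * u 1, -(s * u 0 * u 0); s * u 1 * u 1, 1 - s * u 0 * u 1], by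
  rw [Matrix.det_fin_two_of]; ring⟩

theorem av_TX (u : V2 F) (s : F) (a : V2 F) : av (TX u s) a = a + (s * fm a u) • u := by
  apply v2_ext <;> rw [av_apply] <;> simp [TX, fm] <;> ring

theorem S2_ext {A B : S2 F} (h : ∀ a, av A a = av B a) : A = B := by
  apply SL2.ext'
  ext i j
  have h0 := congrFun (h ve) i
  have h1 := congrFun (h vf) i
  simp [av_apply] at h0 h1
  fin_cases j
  · exact h0
  · exact h1

theorem TX_add (u : V2 F) (s t : F) : TX u s * TX u t = TX u (s + t) := by
  apply S2_ext; intro a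
  rw [av_mul]; simp only [av_TX]
  rw [fm_add_left, fm_smul_left, fm_self, mul_zero, add_zero, add_assoc, ← add_smul]
  congr 2; ring
@[simp] theorem TX_zero (u : V2 F) : TX u 0 = 1 := by
  apply S2_ext; intro a; simp [av_TX]
@[simp] theorem TX_zero' (s : F) : TX (0 : V2 F) s = 1 := by
  apply S2_ext; intro a; simp [av_TX]
theorem TX_inv (u : V2 F) (s : F) : (TX u s)⁻¹ = TX u (-s) := by
  rw [inv_eq_iff_mul_eq_one, TX_add]; simp
theorem TX_conj (A : S2 F) (u : V2 F) (s : F) : A * TX u s * A⁻¹ = TX (av A u) s := by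
  rw [mul_inv_eq_iff_eq_mul]
  apply S2_ext; intro a
  rw [av_mul, av_mul, av_TX, av_TX, av_add, av_smul, fm_av]
theorem TX_smul (u : V2 F) (s t : F) : TX (t • u) s = TX u (s * t ^ 2) := by
  apply S2_ext; intro a
  rw [av_TX, av_TX, fm_smul_right, smul_smul]; congr 2; ring
theorem av_TX_self (u : V2 F) (s : F) : av (TX u s) u = u := by simp [av_TX]

theorem exists_av {u : V2 F} (h : u ≠ 0) : ∃ A : S2 F, av A ve = u := by
  by_cases h0 : u 0 = 0
  · have h1 : u 1 ≠ 0 := fun h1 => h (v2_ext h0 h1)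
    have hd : Matrix.det !![u 0, -(u 1)⁻¹; u 1, 0] = 1 := by
      rw [Matrix.det_fin_two_of]; field_simp; ring
    refine ⟨⟨!![u 0, -(u 1)⁻¹; u 1, 0], hd⟩, ?_⟩
    exact v2_ext ((av_apply _ _ _).trans (by simp)) ((av_apply _ _ _).trans (by simp))
  · have hd : Matrix.det !![u 0, 0; u 1, (u 0)⁻¹] = 1 := by
      rw [Matrix.det_fin_two_of]; field_simp; ring
    refine ⟨⟨!![u 0, 0; u 1, (u 0)⁻¹], hd⟩, ?_⟩
    exact v2_ext ((av_apply _ _ _).trans (by simp)) ((av_apply _ _ _).trans (by simp))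

theorem exists_av2 {u v : V2 F} (hu : u ≠ 0) (hv : v ≠ 0) : ∃ A : S2 F, av A u = v := by
  obtain ⟨A, rfl⟩ := exists_av hu
  obtain ⟨B, rfl⟩ := exists_av hv
  exact ⟨B * A⁻¹, by rw [av_mul, av_inv]⟩

theorem stab_ve {A : S2 F} (h : av A ve = ve) : ∃ s, A = TX ve s := by
  refine ⟨-(A 0 1), ?_⟩
  have h0 := congrFun h 0
  have h1 := congrFun h 1
  simp [av_apply] at h0 h1
  have hd := A.det_coe
  rw [Matrix.det_fin_two, h0, h1] at hd
  simp at hd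
  apply SL2.ext'
  ext i j
  fin_cases i <;> fin_cases j <;> simp [TX, h0, h1, hd]

theorem gen_S2 (P : Subgroup (S2 F)) (he : ∀ s, TX ve s ∈ P) (hf : ∀ s, TX vf s ∈ P) (A : S2 F) : A ∈ P := by
  have hU : ∀ t : F, U t ∈ P := by
    intro t
    have : U t = TX ve (-t) := by apply SL2.ext'; simp [coe_X, TX]
    rw [this]; exact he _
  have hW : (W : S2 F) ∈ P := by
    have : (W : S2 F) = TX ve (-1) * TX vf (-1) * TX ve (-1) := by
      apply SL2.ext'; simp only [Matrix.SpecialLinearGroup.coe_mul]; simp [coe_W, TX]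
    rw [this]; exact mul_mem (mul_mem (he _) (hf _)) (he _)
  refine (Subgroup.closure_le P).2 ?_ (bruhat A).mem_closure
  rintro _ (⟨t, rfl⟩ | rfl)
  · exact hU t
  · exact hW

theorem fm_zero_par {u v : V2 F} (hu : u ≠ 0) (h : fm v u = 0) : ∃ t : F, v = t • u := by
  simp only [fm, sub_eq_zero] at h
  by_cases h0 : u 0 = 0
  · have h1 : u 1 ≠ 0 := fun h1 => hu (v2_ext h0 h1)
    refine ⟨v 1 / u 1, v2_ext ?_ ?_⟩
    · rw [h0, mul_zero] at h
      simp [h0, (mul_eq_zero.1 h).resolve_right h1]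
    · simp; field_simp
  · refine ⟨v 0 / u 0, v2_ext ?_ ?_⟩
    · simp; field_simp
    · simp; field_simp; linear_combination -h

theorem exists_fm {u : V2 F} (h : u ≠ 0) : ∃ w, fm w u = 1 := by
  obtain ⟨A, rfl⟩ := exists_av h
  exact ⟨av A (-vf), by rw [fm_av, fm_neg_left, fm_fe, neg_neg]⟩

variable (ι F) in
/-- data of a group generated by planar groups and Siegel-type elements -/
structure Data (ι F Γ : Type) [Field F] [DecidableEq ι] [Group Γ] where
  g : ι → S2 F →* Γ
  y : ι → ι → V2 F → V2 F → Γ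
  ρ : Γ →* Module.End F (ι → V2 F)
  gg : ∀ {p q : ι}, p ≠ q → ∀ A B, Commute (g p A) (g q B)
  ysymm : ∀ {p q : ι}, p ≠ q → ∀ u v, y p q u v = y q p v u
  y0 : ∀ {p q : ι}, p ≠ q → ∀ v, y p q 0 v = 1
  ysm : ∀ {p q : ι}, p ≠ q → ∀ (t : F) u v, y p q (t • u) v = y p q u (t • v)
  A1 : ∀ {p q : ι}, p ≠ q → ∀ A u v, g p A * y p q u v * (g p A)⁻¹ = y p q (av A u) v
  A1' : ∀ {p q r : ι}, p ≠ q → r ≠ p → r ≠ q → ∀ A u v, Commute (g r A) (y p q u v)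
  A2 : ∀ {p q : ι}, p ≠ q → ∀ u v v', y p q u v * y p q u v' = y p q u (v + v') * g p (TX u (fm v' v))
  A3 : ∀ {p q : ι}, p ≠ q → ∀ u u' v t, y p q u' v * g p (TX u t) * (y p q u' v)⁻¹ =
    g p (TX u t) * y p q u ((t * fm u u') • v) * g q (TX v (t * fm u u' ^ 2))
  A4 : ∀ {p q r : ι}, p ≠ q → p ≠ r → q ≠ r → ∀ u v u' v', y p q u v * y p r u' v' * (y p q u v)⁻¹ =
    y p r u' v' * y q r (fm u' u • v) v'
  A5 : ∀ {p q r s : ι}, p ≠ q → p ≠ r → p ≠ s → q ≠ r → q ≠ s → r ≠ s → ∀ u v u' v', Commute (y p q u v) (y r s u' v')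
  ρg : ∀ p A x, ρ (g p A) x = Function.update x p (av A (x p))
  ρy : ∀ {p q : ι}, p ≠ q → ∀ u v x, ρ (y p q u v) x = x + Pi.single q (fm (x p) u • v) + Pi.single p (fm (x q) v • u)

end LT

namespace LT
open SL2

variable {ι F Γ : Type} [Field F] [DecidableEq ι] [Group Γ]

namespace Data
variable (D : Data ι F Γ)

theorem y0' {p q : ι} (h : p ≠ q) (u : V2 F) : D.y p q u 0 = 1 := by
  rw [D.ysymm h, D.y0 h.symm]
theorem yinv {p q : ι} (h : p ≠ q) (u v : V2 F) : (D.y p q u v)⁻¹ = D.y p q u (-v) := by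
  rw [inv_eq_iff_mul_eq_one, D.A2 h]
  simp [D.y0' h, fm_neg_left]
theorem yy {o r s : ι} (h1 : o ≠ r) (h2 : o ≠ s) (h3 : r ≠ s) (u v v' : V2 F) :
    Commute (D.y o r u v) (D.y o s u v') := by
  have := D.A4 h1 h2 h3 u v u v'
  rw [fm_self, zero_smul, D.y0 h3, mul_one, mul_inv_eq_iff_eq_mul] at this
  exact this
theorem yX {o r : ι} (h1 : o ≠ r) (u v : V2 F) (s : F) : Commute (D.y o r u v) (D.g o (TX u s)) := by
  have := D.A3 h1 u u v s
  rw [fm_self, mul_zero, zero_smul, D.y0' h1, zero_pow two_ne_zero, mul_zero, TX_zero, map_one, mul_one, mul_one,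
    mul_inv_eq_iff_eq_mul] at this
  exact this

/-- the product of Siegel elements -/
def q (J : List ι) (o : ι) (u : V2 F) (z : ι → V2 F) : Γ := (J.map fun r => D.y o r u (z r)).prod

end Data

/-- partial form -/
def om (J : List ι) (x z : ι → V2 F) : F := (J.map fun r => fm (x r) (z r)).sum
def Supp (J : List ι) (z : ι → V2 F) : Prop := ∀ t, t ∉ J → z t = 0

theorem nm {J : List ι} {o t : ι} (ho : o ∉ J) (ht : t ∈ J) : o ≠ t := by
  rintro rfl; exact ho ht
theorem Supp.zero (J : List ι) : Supp J (0 : ι → V2 F) := fun _ _ => rfl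
theorem Supp.add {J : List ι} {z z' : ι → V2 F} (h : Supp J z) (h' : Supp J z') : Supp J (z + z') := fun t ht => by
  simp [h t ht, h' t ht]
theorem Supp.neg {J : List ι} {z : ι → V2 F} (h : Supp J z) : Supp J (-z) := fun t ht => by
  simp [h t ht]
theorem Supp.smul {J : List ι} {z : ι → V2 F} (h : Supp J z) (a : F) : Supp J (a • z) := fun t ht => by
  simp [h t ht]
theorem Supp.single {J : List ι} {r : ι} (hr : r ∈ J) (v : V2 F) : Supp J (Pi.single r v) := fun t ht => by
  rw [Pi.single_apply, if_neg]; rintro rfl; exact ht hr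

theorem om_add_left (J : List ι) (x x' z : ι → V2 F) : om J (x + x') z = om J x z + om J x' z := by
  simp only [om, Pi.add_apply, fm_add_left, List.sum_map_add]
theorem om_add_right (J : List ι) (x z z' : ι → V2 F) : om J x (z + z') = om J x z + om J x z' := by
  simp only [om, Pi.add_apply, fm_add_right, List.sum_map_add]
theorem om_neg_left (J : List ι) (x z : ι → V2 F) : om J (-x) z = - om J x z := by
  simp only [om, Pi.neg_apply, fm_neg_left]
  induction J with
  | nil => simp
  | cons a l ih => simp [ih]; ring
theorem om_self (J : List ι) (x : ι → V2 F) : om J x x = 0 := by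
  simp [om]
theorem om_off (J : List ι) (x z : ι → V2 F) (h : ∀ t ∈ J, x t = 0) : om J x z = 0 := by
  simp only [om]
  apply List.sum_eq_zero
  simp only [List.mem_map]
  rintro _ ⟨r, hr, rfl⟩
  rw [h r hr, fm_zero_left]
theorem om_single (J : List ι) (hJ : J.Nodup) (x : ι → V2 F) (r : ι) (hr : r ∈ J) (w : V2 F) :
    om J x (Pi.single r w) = fm (x r) w := by
  induction J with
  | nil => simp at hr
  | cons a l ih =>
    rw [List.nodup_cons] at hJ
    simp only [om, List.map_cons, List.sum_cons]
    rcases List.mem_cons.1 hr with rfl | hr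
    · rw [Pi.single_eq_same]
      have : (l.map fun t => fm (x t) ((Pi.single r w : ι → V2 F) t)).sum = 0 := by
        apply List.sum_eq_zero
        simp only [List.mem_map]
        rintro _ ⟨t, ht, rfl⟩
        rw [Pi.single_eq_of_ne, fm_zero_right]
        rintro rfl; exact hJ.1 ht
      rw [this, add_zero]
    · have := ih hJ.2 hr
      simp only [om] at this
      rw [this, Pi.single_eq_of_ne, fm_zero_right, zero_add]
      rintro rfl; exact hJ.1 hr

namespace Data
variable (D : Data ι F Γ) {J : List ι} {o : ι}

theorem q_y (ho : o ∉ J) {r : ι} (hr : r ∉ J) (hor : o ≠ r) (u : V2 F) (z : ι → V2 F) (v : V2 F) :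
    Commute (D.q J o u z) (D.y o r u v) := by
  apply Commute.list_prod_left
  simp only [List.mem_map]
  rintro _ ⟨s, hs, rfl⟩
  exact D.yy (nm ho hs) hor (nm hr hs).symm _ _ _
theorem q_X (ho : o ∉ J) (u : V2 F) (z : ι → V2 F) (s : F) : Commute (D.q J o u z) (D.g o (TX u s)) := by
  apply Commute.list_prod_left
  simp only [List.mem_map]
  rintro _ ⟨t, ht, rfl⟩
  exact D.yX (nm ho ht) _ _ _

theorem q_mul (hJ : J.Nodup) (ho : o ∉ J) (u : V2 F) (z z' : ι → V2 F) :
    D.q J o u z * D.q J o u z' = D.q J o u (z + z') * D.g o (TX u (om J z' z)) := by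
  induction J with
  | nil => simp [q, om]
  | cons a l ih =>
    rw [List.nodup_cons] at hJ
    simp only [List.mem_cons, not_or] at ho
    have ih := ih hJ.2 ho.2
    have e1 := D.q_y ho.2 hJ.1 ho.1 u z (z' a)
    have e2 := D.q_X ho.2 u (z + z') (fm (z' a) (z a))
    have e3 := D.A2 ho.1 u (z a) (z' a)
    have c : ∀ w, D.q (a :: l) o u w = D.y o a u (w a) * D.q l o u w := fun w => by simp [q]
    have c' : om (a :: l) z' z = om l z' z + fm (z' a) (z a) := by simp [om, add_comm]
    rw [c, c, c, c', add_comm (om l z' z), ← TX_add, map_mul]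
    calc D.y o a u (z a) * D.q l o u z * (D.y o a u (z' a) * D.q l o u z') 
        = D.y o a u (z a) * (D.q l o u z * D.y o a u (z' a)) * D.q l o u z' := by simp only [mul_assoc]
      _ = (D.y o a u (z a) * D.y o a u (z' a)) * (D.q l o u z * D.q l o u z') := by rw [e1.eq]; simp only [mul_assoc]
      _ = D.y o a u (z a + z' a) * (D.g o (TX u (fm (z' a) (z a))) * D.q l o u (z + z')) * D.g o (TX u (om l z' z)) := by
          rw [e3, ih]; simp only [mul_assoc]
      _ = _ := by rw [← e2.eq]; simp only [mul_assoc, Pi.add_apply]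

theorem q_zero (ho : o ∉ J) (u : V2 F) : D.q J o u 0 = 1 := by
  apply List.prod_eq_one
  simp only [List.mem_map]
  rintro _ ⟨t, ht, rfl⟩
  exact D.y0' (nm ho ht) _
theorem q_zero' (ho : o ∉ J) (z) : D.q J o 0 z = 1 := by
  apply List.prod_eq_one
  simp only [List.mem_map]
  rintro _ ⟨t, ht, rfl⟩
  exact D.y0 (nm ho ht) _
theorem q_smul (ho : o ∉ J) (a : F) (u : V2 F) (z) : D.q J o (a • u) z = D.q J o u (a • z) := by
  simp only [q]
  congr 1
  apply List.map_congr_left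
  intro t ht
  exact D.ysm (nm ho ht) _ _ _
theorem q_inv (hJ : J.Nodup) (ho : o ∉ J) (u : V2 F) (z) : (D.q J o u z)⁻¹ = D.q J o u (-z) := by
  rw [inv_eq_iff_mul_eq_one, D.q_mul hJ ho]
  simp [D.q_zero ho, om_neg_left, om_self]
theorem q_single (hJ : J.Nodup) (ho : o ∉ J) {r : ι} (hr : r ∈ J) (u v : V2 F) : D.q J o u (Pi.single r v) = D.y o r u v := by
  induction J with
  | nil => simp at hr
  | cons a l ih =>
    rw [List.nodup_cons] at hJ
    simp only [List.mem_cons, not_or] at ho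
    have c : ∀ w, D.q (a :: l) o u w = D.y o a u (w a) * D.q l o u w := fun w => by simp [q]
    rw [c]
    rcases List.mem_cons.1 hr with rfl | hr
    · rw [Pi.single_eq_same]
      have : D.q l o u (Pi.single r v) = 1 := by
        apply List.prod_eq_one
        simp only [List.mem_map]
        rintro _ ⟨t, ht, rfl⟩
        rw [Pi.single_eq_of_ne, D.y0' (nm ho.2 ht)]
        rintro rfl; exact hJ.1 ht
      rw [this, mul_one]
    · rw [ih hJ.2 ho.2 hr, Pi.single_eq_of_ne, D.y0' ho.1, one_mul]
      rintro rfl; exact hJ.1 hr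
theorem q_g (ho : o ∉ J) (A : S2 F) (u : V2 F) (z) : D.g o A * D.q J o u z * (D.g o A)⁻¹ = D.q J o (av A u) z := by
  have : MulAut.conj (D.g o A) (D.q J o u z) = D.q J o (av A u) z := by
    simp only [q, map_list_prod, List.map_map]
    congr 1
    apply List.map_congr_left
    intro t ht
    exact D.A1 (nm ho ht) _ _ _
  exact this

theorem ρq (hJ : J.Nodup) (ho : o ∉ J) (u : V2 F) {z : ι → V2 F} (hz : Supp J z) (x : ι → V2 F) :
    D.ρ (D.q J o u z) x = x + Pi.single o (om J x z • u) + fm (x o) u • z := by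
  have key : ∀ t, D.ρ (D.q J o u z) x t = if t = o then x o + om J x z • u else if t ∈ J then x t + fm (x o) u • z t else x t := by
    clear hz
    induction J with
    | nil =>
      intro t
      simp only [q, om, List.map_nil, List.prod_nil, map_one, List.sum_nil]
      by_cases h : t = o
      · subst h; simp
      · simp [h]
    | cons a l ih =>
      rw [List.nodup_cons] at hJ
      simp only [List.mem_cons, not_or] at ho
      have ih := ih hJ.2 ho.2
      have c : D.q (a :: l) o u z = D.y o a u (z a) * D.q l o u z := by simp [q]
      have c' : om (a :: l) x z = om l x z + fm (x a) (z a) := by simp [om, add_comm]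
      intro t
      rw [c, map_mul, Module.End.mul_apply, D.ρy ho.1]
      have io := ih o
      have ia := ih a
      rw [if_pos rfl] at io
      rw [if_neg (Ne.symm ho.1), if_neg hJ.1] at ia
      simp only [Pi.add_apply]
      rw [io, ia, ih t, c', fm_add_left, fm_smul_left, fm_self, mul_zero, add_zero]
      by_cases h : t = o
      · subst h
        rw [if_pos rfl, if_pos rfl, Pi.single_eq_of_ne ho.1, Pi.single_eq_same, add_zero, add_smul, add_assoc]
      · rw [if_neg h, if_neg h, Pi.single_eq_of_ne h, add_zero]
        by_cases h' : t = a
        · subst h'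
          rw [if_neg hJ.1, if_pos List.mem_cons_self, Pi.single_eq_same]
        · rw [Pi.single_eq_of_ne h', add_zero]
          simp [h']
  funext t
  rw [key]
  simp only [Pi.add_apply, Pi.smul_apply]
  by_cases h : t = o
  · subst h; rw [if_pos rfl, Pi.single_eq_same, hz _ ho]; simp
  · rw [if_neg h, Pi.single_eq_of_ne h, add_zero]
    split_ifs with h'
    · rfl
    · rw [hz t h', smul_zero, add_zero]

theorem ρq_o (hJ : J.Nodup) (ho : o ∉ J) (u : V2 F) {z : ι → V2 F} (hz : Supp J z) (w : V2 F) :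
    D.ρ (D.q J o u z) (Pi.single o w) = Pi.single o w + fm w u • z := by
  rw [D.ρq hJ ho u hz, om_off, zero_smul, Pi.single_zero, add_zero, Pi.single_eq_same]
  intro t ht
  rw [Pi.single_eq_of_ne]; rintro rfl; exact ho ht
theorem ρg_o (A : S2 F) (w : V2 F) : D.ρ (D.g o A) (Pi.single o w) = Pi.single o (av A w) := by
  rw [D.ρg, Pi.single_eq_same]
  exact Function.update_idem _ _ _
theorem ρg_z (ho : o ∉ J) (A : S2 F) {z : ι → V2 F} (hz : Supp J z) : D.ρ (D.g o A) z = z := by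
  rw [D.ρg, hz o ho, av_zero, ← hz o ho, Function.update_eq_self]

/-- the subgroup supported on `J` -/
def GJ (J : List ι) : Subgroup Γ := Subgroup.closure ({x | ∃ r ∈ J, ∃ A, x = D.g r A} ∪
  {x | ∃ r ∈ J, ∃ s ∈ J, r ≠ s ∧ ∃ u v, x = D.y r s u v})

theorem g_mem {r : ι} (hr : r ∈ J) (A : S2 F) : D.g r A ∈ D.GJ J := Subgroup.subset_closure (Or.inl ⟨r, hr, A, rfl⟩)
theorem y_mem {r s : ι} (hr : r ∈ J) (hs : s ∈ J) (h : r ≠ s) (u v : V2 F) : D.y r s u v ∈ D.GJ J :=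
  Subgroup.subset_closure (Or.inr ⟨r, hr, s, hs, h, u, v, rfl⟩)

theorem GJ_g (ho : o ∉ J) (A : S2 F) {l : Γ} (hl : l ∈ D.GJ J) : Commute l (D.g o A) := by
  have : D.GJ J ≤ Subgroup.centralizer {D.g o A} := by
    refine (Subgroup.closure_le _).2 ?_
    rintro _ (⟨r, hr, B, rfl⟩ | ⟨r, hr, s, hs, h, u, v, rfl⟩)
    · exact Subgroup.mem_centralizer_singleton_iff.2 (D.gg (nm ho hr).symm B A).eq
    · exact Subgroup.mem_centralizer_singleton_iff.2 (D.A1' h (nm ho hr) (nm ho hs) A u v).eq.symm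
  exact Subgroup.mem_centralizer_singleton_iff.1 (this hl)

theorem ρ_inv (l : Γ) (x : ι → V2 F) : D.ρ l (D.ρ l⁻¹ x) = x := by
  rw [← Module.End.mul_apply, ← map_mul, mul_inv_cancel, map_one]; rfl
theorem ρ_inv' (l : Γ) (x : ι → V2 F) : D.ρ l⁻¹ (D.ρ l x) = x := by
  rw [← Module.End.mul_apply, ← map_mul, inv_mul_cancel, map_one]; rfl
theorem ρ_mul (l l' : Γ) (x : ι → V2 F) : D.ρ (l * l') x = D.ρ l (D.ρ l' x) := by
  rw [map_mul]; rfl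

theorem GJ_off {l : Γ} (hl : l ∈ D.GJ J) : ∀ (x : ι → V2 F) {t : ι} (ht : t ∉ J), D.ρ l x t = x t := by
  refine Subgroup.closure_induction ?_ ?_ ?_ ?_ hl
  · rintro _ (⟨r, hr, B, rfl⟩ | ⟨r, hr, s, hs, h, u, v, rfl⟩) x t ht
    · rw [D.ρg, Function.update_of_ne]; rintro rfl; exact ht hr
    · rw [D.ρy h, Pi.add_apply, Pi.add_apply, Pi.single_eq_of_ne, Pi.single_eq_of_ne, add_zero, add_zero]
      · rintro rfl; exact ht hr
      · rintro rfl; exact ht hs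
  · intro x t ht; simp
  · intro a b _ _ ha hb x t ht
    rw [D.ρ_mul, ha _ ht, hb _ ht]
  · intro a _ ha x t ht
    rw [← ha (D.ρ a⁻¹ x) ht, D.ρ_inv]

theorem GJ_fix {l : Γ} (hl : l ∈ D.GJ J) : ∀ (x : ι → V2 F) (hx : ∀ t ∈ J, x t = 0), D.ρ l x = x := by
  refine Subgroup.closure_induction ?_ ?_ ?_ ?_ hl
  · rintro _ (⟨r, hr, B, rfl⟩ | ⟨r, hr, s, hs, h, u, v, rfl⟩) x hx
    · rw [D.ρg, hx r hr, av_zero, ← hx r hr, Function.update_eq_self]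
    · rw [D.ρy h, hx r hr, hx s hs]; simp
  · intro x hx; simp
  · intro a b _ _ ha hb x hx
    rw [D.ρ_mul, hb _ hx, ha _ hx]
  · intro a _ ha x hx
    conv_lhs => rw [← ha x hx]
    rw [D.ρ_inv']

theorem GJ_o (ho : o ∉ J) {l : Γ} (hl : l ∈ D.GJ J) (w : V2 F) : D.ρ l (Pi.single o w) = Pi.single o w := by
  apply D.GJ_fix hl
  intro t ht
  rw [Pi.single_eq_of_ne]; rintro rfl; exact ho ht
theorem GJ_supp {l : Γ} (hl : l ∈ D.GJ J) {z} (hz : Supp J z) : Supp J (D.ρ l z) := fun t ht => by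
  rw [D.GJ_off hl _ ht, hz t ht]

/-- elements of the Heisenberg type -/
def Qh (J : List ι) (o : ι) (u : V2 F) (x : Γ) : Prop := ∃ z s, Supp J z ∧ x = D.q J o u z * D.g o (TX u s)

theorem Qh_one (ho : o ∉ J) (u : V2 F) : D.Qh J o u 1 := ⟨0, 0, Supp.zero J, by simp [D.q_zero ho]⟩
theorem Qh_mul (hJ : J.Nodup) (ho : o ∉ J) {u : V2 F} {x y : Γ} (hx : D.Qh J o u x) (hy : D.Qh J o u y) : D.Qh J o u (x * y) := by
  obtain ⟨z, s, hz, rfl⟩ := hx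
  obtain ⟨z', s', hz', rfl⟩ := hy
  refine ⟨z + z', om J z' z + (s + s'), hz.add hz', ?_⟩
  rw [← TX_add, ← TX_add, map_mul, map_mul, ← mul_assoc _ (D.g o (TX u (om J z' z))), ← D.q_mul hJ ho]
  rw [mul_assoc _ (D.g o _), ← mul_assoc (D.g o _), ← (D.q_X ho u z' s).eq]
  simp only [mul_assoc]
theorem Qh_y (hJ : J.Nodup) (ho : o ∉ J) {r : ι} (hr : r ∈ J) (u v : V2 F) : D.Qh J o u (D.y o r u v) :=
  ⟨Pi.single r v, 0, Supp.single hr v, by simp [D.q_single hJ ho hr]⟩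

theorem q_conj_gen (hJ : J.Nodup) (ho : o ∉ J) {l : Γ} (hl : l ∈ D.GJ J) (u : V2 F) {z : ι → V2 F} (hz : Supp J z)
    (h : D.Qh J o u (l * D.q J o u z * l⁻¹)) : l * D.q J o u z * l⁻¹ = D.q J o u (D.ρ l z) := by
  by_cases hu : u = 0
  · subst hu; rw [D.q_zero' ho, D.q_zero' ho]; simp
  obtain ⟨z', s, hz', h⟩ := h
  obtain ⟨w, hw⟩ := exists_fm hu
  have e := congrArg (fun γ => D.ρ γ (Pi.single o w)) h
  simp only [D.ρ_mul] at e
  rw [D.GJ_o ho (inv_mem hl), D.ρq_o hJ ho u hz, hw, one_smul, map_add, D.GJ_o ho hl, D.ρg_o, D.ρq_o hJ ho u hz',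
    av_TX, fm_add_left, fm_smul_left, fm_self, mul_zero, add_zero, hw, one_smul, mul_one] at e
  have e1 := congrFun e o
  simp only [Pi.add_apply, Pi.single_eq_same] at e1
  rw [D.GJ_supp hl hz o ho, hz' o ho, add_zero, add_zero] at e1
  have hs : s = 0 := by
    have : s • u = 0 := by simpa using e1.symm
    exact (smul_eq_zero.1 this).resolve_right hu
  subst hs
  rw [zero_smul, add_zero] at e
  have e2 := add_left_cancel e
  rw [h, e2]; simp

theorem equiv (hJ : J.Nodup) (ho : o ∉ J) {l : Γ} (hl : l ∈ D.GJ J) : ∀ (u : V2 F) {z : ι → V2 F} (hz : Supp J z),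
    l * D.q J o u z * l⁻¹ = D.q J o u (D.ρ l z) := by
  have aux : ∀ l : Γ, l ∈ D.GJ J → ∀ u, (∀ r ∈ J, ∀ v, D.Qh J o u (l * D.y o r u v * l⁻¹)) → 
      ∀ (z : ι → V2 F) (hz : Supp J z), l * D.q J o u z * l⁻¹ = D.q J o u (D.ρ l z) := by
    intro l hl u H z hz
    apply D.q_conj_gen hJ ho hl u hz
    have : ∀ L : List ι, (∀ r ∈ L, r ∈ J) → D.Qh J o u (l * (L.map fun r => D.y o r u (z r)).prod * l⁻¹) := by
      intro L
      induction L with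
      | nil => intro _; simpa using D.Qh_one ho u
      | cons a L ih =>
        intro hL
        have h1 := H a (hL a List.mem_cons_self) (z a)
        have h2 := ih fun r hr => hL r (List.mem_cons_of_mem _ hr)
        have := D.Qh_mul hJ ho h1 h2
        rw [List.map_cons, List.prod_cons]
        convert this using 1
        group
    exact this J fun r hr => hr
  refine Subgroup.closure_induction (p := fun l _ => ∀ (u : V2 F) {z : ι → V2 F} (hz : Supp J z),
    l * D.q J o u z * l⁻¹ = D.q J o u (D.ρ l z)) ?_ ?_ ?_ ?_ hl
  · intro l hl u z hz
    apply aux l (Subgroup.subset_closure hl) u _ z hz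
    intro t ht w
    have hot : o ≠ t := fun e => ho (e ▸ ht)
    rcases hl with (⟨r, hr, B, rfl⟩ | ⟨r, hr, s, hs, h, a, b, rfl⟩)
    · by_cases htr : t = r
      · subst htr
        rw [D.ysymm hot, D.A1 hot.symm, D.ysymm hot.symm]
        exact D.Qh_y hJ ho ht _ _
      · rw [(D.A1' hot (nm ho hr).symm (Ne.symm htr) B u w).eq, mul_inv_cancel_right]
        exact D.Qh_y hJ ho ht _ _
    · have hor : o ≠ r := fun e => ho (e ▸ hr)
      have hos : o ≠ s := fun e => ho (e ▸ hs)
      by_cases htr : t = r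
      · subst htr
        rw [D.ysymm hot, D.A4 h hot.symm hos.symm, D.ysymm hot.symm, D.ysymm hos.symm]
        exact D.Qh_mul hJ ho (D.Qh_y hJ ho ht _ _) (D.Qh_y hJ ho hs _ _)
      by_cases hts : t = s
      · subst hts
        rw [D.ysymm hot, D.ysymm h, D.A4 h.symm hot.symm hor.symm, D.ysymm hot.symm, D.ysymm hor.symm]
        exact D.Qh_mul hJ ho (D.Qh_y hJ ho ht _ _) (D.Qh_y hJ ho hr _ _)
      rw [(D.A5 h hor.symm (Ne.symm htr) hos.symm (Ne.symm hts) hot a b u w).eq, mul_inv_cancel_right]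
      exact D.Qh_y hJ ho ht _ _
  · intro u z hz; simp
  · intro a b ha hb iha ihb u z hz
    rw [D.ρ_mul, ← iha u (D.GJ_supp hb hz), ← ihb u hz]
    group
  · intro a ha iha u z hz
    have := iha u (D.GJ_supp (inv_mem ha) hz)
    rw [D.ρ_inv] at this
    rw [← this]; group

theorem om_inv (hJ : J.Nodup) (ho : o ∉ J) {l : Γ} (hl : l ∈ D.GJ J) {x z : ι → V2 F} (hx : Supp J x) (hz : Supp J z) :
    om J (D.ρ l x) (D.ρ l z) = om J x z := by
  have e := congrArg (fun γ => D.ρ γ (D.ρ l x)) (D.equiv hJ ho hl ve hz)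
  simp only [D.ρ_mul] at e
  rw [D.ρ_inv', D.ρq hJ ho _ hz, D.ρq hJ ho _ (D.GJ_supp hl hz), hx o ho, D.GJ_supp hl hx o ho, fm_zero_left, zero_smul,
    zero_smul, add_zero, add_zero, map_add, D.GJ_o ho hl] at e
  have := congrFun (congrFun (add_left_cancel e) o) 0
  simpa using this.symm

/-- transitivity on nonzero vectors -/
def Tr (J : List ι) : Prop := ∀ z z' : ι → V2 F, Supp J z → z ≠ 0 → Supp J z' → z' ≠ 0 → ∃ l ∈ D.GJ J, D.ρ l z = z'

theorem red {D : Data ι F Γ} (hT : D.Tr J) {z : ι → V2 F} (hz : Supp J z) : 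
    z = 0 ∨ ∃ l ∈ D.GJ J, ∃ r ∈ J, z = D.ρ l (Pi.single r ve) := by
  by_cases h : z = 0
  · exact Or.inl h
  right
  obtain ⟨r, hr⟩ := Function.ne_iff.1 h
  have hrJ : r ∈ J := by
    by_contra hc; exact hr (hz r hc)
  obtain ⟨l, hl, e⟩ := hT (Pi.single r ve) z (Supp.single hrJ _) (by simpa using ve_ne) hz h
  exact ⟨l, hl, r, hrJ, e.symm⟩

theorem q4 (hT : D.Tr J) (hJ : J.Nodup) (ho : o ∉ J) (u u' : V2 F) {z : ι → V2 F} (hz : Supp J z) :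
    ∃ l ∈ D.GJ J, D.q J o (u + u') z = D.q J o u z * D.q J o u' z * l := by
  obtain rfl | ⟨l, hl, r, hr, rfl⟩ := red hT hz
  · exact ⟨1, one_mem _, by simp [D.q_zero ho]⟩
  have hor : o ≠ r := fun e => ho (e ▸ hr)
  refine ⟨l * (D.g r (TX ve (fm u' u)))⁻¹ * l⁻¹, mul_mem (mul_mem hl (inv_mem (D.g_mem hr _))) (inv_mem hl), ?_⟩
  have hs : Supp J (Pi.single r (ve : V2 F)) := Supp.single hr _
  rw [← D.equiv hJ ho hl _ hs, ← D.equiv hJ ho hl _ hs, ← D.equiv hJ ho hl _ hs, D.q_single hJ ho hr, D.q_single hJ ho hr,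
    D.q_single hJ ho hr, D.ysymm hor, D.ysymm hor, D.ysymm hor]
  have := D.A2 hor.symm ve u u'
  rw [← mul_inv_eq_iff_eq_mul] at this
  rw [← this]; group

theorem qi (hT : D.Tr J) (hJ : J.Nodup) (ho : o ∉ J) (u u' : V2 F) (t : F) {z : ι → V2 F} (hz : Supp J z) :
    ∃ l ∈ D.GJ J, ∃ w, Supp J w ∧ (D.q J o u' z)⁻¹ * D.g o (TX u t) * D.q J o u' z = D.g o (TX u t) * D.q J o u w * l := by
  obtain rfl | ⟨l, hl, r, hr, rfl⟩ := red hT hz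
  · exact ⟨1, one_mem _, 0, Supp.zero J, by simp [D.q_zero ho]⟩
  have hor : o ≠ r := fun e => ho (e ▸ hr)
  have hs : Supp J (Pi.single r (ve : V2 F)) := Supp.single hr _
  have key := D.A3 hor u u' (-ve) t
  rw [← D.yinv hor, inv_inv, ← D.q_single hJ ho hr, ← D.q_single hJ ho hr] at key
  have hw : Supp J (Pi.single r ((t * fm u u') • (-ve) : V2 F)) := Supp.single hr _
  refine ⟨l * D.g r (TX (-ve) (t * fm u u' ^ 2)) * l⁻¹, mul_mem (mul_mem hl (D.g_mem hr _)) (inv_mem hl), 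
    D.ρ l (Pi.single r ((t * fm u u') • (-ve))), D.GJ_supp hl hw, ?_⟩
  rw [← D.equiv hJ ho hl _ hs, ← D.equiv hJ ho hl _ hw]
  have c := (D.GJ_g ho (TX u t) hl)
  have c1 : l⁻¹ * D.g o (TX u t) * l = D.g o (TX u t) := by rw [mul_assoc, ← c.eq, inv_mul_cancel_left]
  have c2 : l * D.g o (TX u t) * l⁻¹ = D.g o (TX u t) := by rw [c.eq, mul_inv_cancel_right]
  calc _ = l * ((D.q J o u' (Pi.single r ve))⁻¹ * (l⁻¹ * D.g o (TX u t) * l) * D.q J o u' (Pi.single r ve)) * l⁻¹ := by group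
    _ = (l * D.g o (TX u t) * l⁻¹) * (l * D.q J o u (Pi.single r ((t * fm u u') • (-ve))) * l⁻¹) * (l * D.g r (TX (-ve) (t * fm u u' ^ 2)) * l⁻¹) := by
      rw [c1, key]; group
    _ = _ := by rw [c2]

end Data
end LT

namespace LT
open SL2

variable {ι F Γ : Type} [Field F] [DecidableEq ι] [Group Γ]

namespace Data
variable (D : Data ι F Γ) {J : List ι} {o : ι}

theorem equiv' (hJ : J.Nodup) (ho : o ∉ J) {l : Γ} (hl : l ∈ D.GJ J) (u : V2 F) {z : ι → V2 F} (hz : Supp J z) :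
    l * D.q J o u z = D.q J o u (D.ρ l z) * l := by
  rw [← D.equiv hJ ho hl u hz, inv_mul_cancel_right]
theorem q_g' (ho : o ∉ J) (A : S2 F) (u : V2 F) (z) : D.q J o u z * D.g o A = D.g o A * D.q J o (av A⁻¹ u) z := by
  rw [← D.q_g ho, map_inv, inv_inv]; group

/-- the stabilizer of the first basis vector -/
def Sh (hJ : J.Nodup) (ho : o ∉ J) : Subgroup Γ where
  carrier := {x | ∃ s z l, Supp J z ∧ l ∈ D.GJ J ∧ x = D.g o (TX ve s) * D.q J o ve z * l}
  one_mem' := ⟨0, 0, 1, Supp.zero J, one_mem _, by simp [D.q_zero ho]⟩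
  mul_mem' := by
    rintro _ _ ⟨s, z, l, hz, hl, rfl⟩ ⟨s', z', l', hz', hl', rfl⟩
    refine ⟨s + (om J (D.ρ l z') z + s'), z + D.ρ l z', l * l', hz.add (D.GJ_supp hl hz'), mul_mem hl hl', ?_⟩
    have e1 := (D.GJ_g ho (TX ve s') hl).eq
    have e2 := D.equiv' hJ ho hl ve hz'
    have e3 := (D.q_X ho ve z s').eq
    have e4 := D.q_mul hJ ho ve z (D.ρ l z')
    rw [(D.q_X ho _ _ _).eq] at e4
    calc D.g o (TX ve s) * D.q J o ve z * l * (D.g o (TX ve s') * D.q J o ve z' * l')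
        = D.g o (TX ve s) * D.q J o ve z * (l * D.g o (TX ve s')) * (D.q J o ve z' * l') := by simp only [mul_assoc]
      _ = D.g o (TX ve s) * (D.q J o ve z * D.g o (TX ve s')) * (l * D.q J o ve z') * l' := by
        rw [e1]; simp only [mul_assoc]
      _ = D.g o (TX ve s) * D.g o (TX ve s') * (D.q J o ve z * D.q J o ve (D.ρ l z')) * (l * l') := by
        rw [e2, e3]; simp only [mul_assoc]
      _ = _ := by
        rw [e4, add_comm (om J (D.ρ l z') z), ← TX_add, ← TX_add, map_mul, map_mul]; simp only [mul_assoc]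
  inv_mem' := by
    rintro _ ⟨s, z, l, hz, hl, rfl⟩
    have hl' := inv_mem hl
    refine ⟨-s, D.ρ l⁻¹ (-z), l⁻¹, D.GJ_supp hl' hz.neg, hl', ?_⟩
    rw [mul_inv_rev, mul_inv_rev, D.q_inv hJ ho, ← map_inv, TX_inv, (D.q_X ho _ _ _).eq, ← mul_assoc, 
      (D.GJ_g ho _ hl').eq, mul_assoc, D.equiv' hJ ho hl' ve hz.neg, mul_assoc]

variable (hJ : J.Nodup) (ho : o ∉ J)
theorem Sh_X (s : F) : D.g o (TX ve s) ∈ D.Sh hJ ho := ⟨s, 0, 1, Supp.zero J, one_mem _, by simp [D.q_zero ho]⟩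
theorem Sh_q {z} (hz : Supp J z) : D.q J o ve z ∈ D.Sh hJ ho := ⟨0, z, 1, hz, one_mem _, by simp⟩
theorem Sh_l {l} (hl : l ∈ D.GJ J) : l ∈ D.Sh hJ ho := ⟨0, 0, l, Supp.zero J, hl, by simp [D.q_zero ho]⟩
theorem Sh_fix {s : Γ} (hs : s ∈ D.Sh hJ ho) : D.ρ s (Pi.single o ve) = Pi.single o ve := by
  obtain ⟨s, z, l, hz, hl, rfl⟩ := hs
  rw [D.ρ_mul, D.ρ_mul, D.GJ_o ho hl, D.ρq_o hJ ho _ hz, fm_self, zero_smul, add_zero, D.ρg_o, av_TX_self]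

/-- coset representatives -/
def YY (x : Γ) : Prop := (∃ A v, Supp J v ∧ ∃ s ∈ D.Sh hJ ho, x = D.g o A * D.q J o vf v * s) ∨
  (∃ z v, Supp J z ∧ Supp J v ∧ om J v z = -1 ∧ ∃ s ∈ D.Sh hJ ho, x = D.q J o ve z * D.q J o vf v * s)

theorem YY_s {x s : Γ} (hx : D.YY hJ ho x) (hs : s ∈ D.Sh hJ ho) : D.YY hJ ho (x * s) := by
  rcases hx with ⟨A, v, hv, s', hs', rfl⟩ | ⟨z, v, hz, hv, h, s', hs', rfl⟩
  · exact Or.inl ⟨A, v, hv, _, mul_mem hs' hs, by simp only [mul_assoc]⟩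
  · exact Or.inr ⟨z, v, hz, hv, h, _, mul_mem hs' hs, by simp only [mul_assoc]⟩

theorem YY_l {x l : Γ} (hl : l ∈ D.GJ J) (hx : D.YY hJ ho x) : D.YY hJ ho (l * x) := by
  rcases hx with ⟨A, v, hv, s', hs', rfl⟩ | ⟨z, v, hz, hv, h, s', hs', rfl⟩
  · refine Or.inl ⟨A, D.ρ l v, D.GJ_supp hl hv, _, mul_mem (D.Sh_l hJ ho hl) hs', ?_⟩
    rw [← mul_assoc, ← mul_assoc, (D.GJ_g ho A hl).eq, mul_assoc _ l, D.equiv' hJ ho hl vf hv]; simp only [mul_assoc]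
  · refine Or.inr ⟨D.ρ l z, D.ρ l v, D.GJ_supp hl hz, D.GJ_supp hl hv, ?_, _, mul_mem (D.Sh_l hJ ho hl) hs', ?_⟩
    · rw [D.om_inv hJ ho hl hv hz, h]
    · rw [← mul_assoc, ← mul_assoc, D.equiv' hJ ho hl ve hz, mul_assoc _ l, D.equiv' hJ ho hl vf hv]; simp only [mul_assoc]

/-- the vector hit by a second-type representative -/
theorem rep_vec (hJ : J.Nodup) (ho : o ∉ J) {z v : ι → V2 F} (hz : Supp J z) (hv : Supp J v) :
    D.ρ (D.q J o ve z * D.q J o vf v) (Pi.single o ve) = Pi.single o ((1 + om J v z) • ve) + v := by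
  rw [D.ρ_mul, D.ρq_o hJ ho _ hv, fm_ef, one_smul, map_add, D.ρq_o hJ ho _ hz, fm_self, zero_smul, add_zero, D.ρq hJ ho _ hz,
    hv o ho, fm_zero_left, zero_smul, add_zero, add_comm v, ← add_assoc, ← Pi.single_add, add_smul, one_smul]

theorem X_f (hT : D.Tr J) {v : ι → V2 F} (hv : Supp J v) (t : F) :
    (D.q J o vf v)⁻¹ * D.g o (TX ve t) * D.q J o vf v ∈ D.Sh hJ ho := by
  obtain ⟨l, hl, w, hw, e⟩ := D.qi hT hJ ho ve vf t hv
  rw [e]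
  exact mul_mem (mul_mem (D.Sh_X hJ ho t) (D.Sh_q hJ ho hw)) (D.Sh_l hJ ho hl)

theorem rep_g (hT : D.Tr J) {z v : ι → V2 F} (hz : Supp J z) (hv : Supp J v) (h : om J v z = -1) (A : S2 F) :
    (D.q J o ve z * D.q J o vf v)⁻¹ * D.g o A * (D.q J o ve z * D.q J o vf v) ∈ D.Sh hJ ho := by
  set R := D.q J o ve z * D.q J o vf v with hR
  have hRv : D.ρ R (Pi.single o ve) = v := by
    rw [hR, D.rep_vec hJ ho hz hv, h]; simp
  have key : A ∈ (D.Sh hJ ho).comap ((MulAut.conj R⁻¹).toMonoidHom.comp (D.g o)) := by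
    apply gen_S2
    · intro t
      simp only [Subgroup.mem_comap, MonoidHom.comp_apply, MulEquiv.coe_toMonoidHom, MulAut.conj_apply, inv_inv]
      have : R⁻¹ * D.g o (TX ve t) * R = (D.q J o vf v)⁻¹ * D.g o (TX ve t) * D.q J o vf v := by
        have e := (D.q_X ho ve z t).eq
        rw [hR, mul_inv_rev]
        calc _ = (D.q J o vf v)⁻¹ * ((D.q J o ve z)⁻¹ * (D.g o (TX ve t) * D.q J o ve z)) * D.q J o vf v := by
              simp only [mul_assoc]
          _ = _ := by rw [← e, inv_mul_cancel_left]
      rw [this]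
      exact D.X_f hJ ho hT hv t
    · intro t
      simp only [Subgroup.mem_comap, MonoidHom.comp_apply, MulEquiv.coe_toMonoidHom, MulAut.conj_apply, inv_inv]
      have fix : D.ρ (R⁻¹ * D.g o (TX vf t) * R) (Pi.single o ve) = Pi.single o ve := by
        rw [D.ρ_mul, D.ρ_mul, hRv, D.ρg_z ho _ hv]
        conv_lhs => rw [← hRv]
        rw [D.ρ_inv']
      obtain ⟨l, hl, w, hw, e⟩ := D.qi hT hJ ho vf ve t hz
      have e' : R⁻¹ * D.g o (TX vf t) * R = D.g o (TX vf (t + om J (D.ρ l v) (-v + w) + om J w (-v))) * D.q J o vf (-v + w + D.ρ l v) * l := by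
        have h1 : R⁻¹ * D.g o (TX vf t) * R = D.q J o vf (-v) * (D.g o (TX vf t) * D.q J o vf w * l) * D.q J o vf v := by
          rw [← e, hR, mul_inv_rev, D.q_inv hJ ho]; simp only [mul_assoc]
        rw [h1]
        have h2 := (D.q_X ho vf (-v) t).eq
        have h3 := D.equiv' hJ ho hl vf hv
        have h4 := D.q_mul hJ ho vf (-v) w
        have h5 := D.q_mul hJ ho vf (-v + w) (D.ρ l v)
        have h6 := (D.q_X ho vf (D.ρ l v) (om J w (-v))).eq
        have h7 := (D.q_X ho vf (-v + w + D.ρ l v) (om J (D.ρ l v) (-v + w))).eq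
        have h8 := (D.q_X ho vf (-v + w + D.ρ l v) (om J w (-v))).eq
        calc _ = (D.q J o vf (-v) * D.g o (TX vf t)) * D.q J o vf w * (l * D.q J o vf v) := by simp only [mul_assoc]
          _ = D.g o (TX vf t) * (D.q J o vf (-v) * D.q J o vf w) * D.q J o vf (D.ρ l v) * l := by
            rw [h2, h3]; simp only [mul_assoc]
          _ = D.g o (TX vf t) * (D.q J o vf (-v + w) * D.q J o vf (D.ρ l v)) * D.g o (TX vf (om J w (-v))) * l := by
            rw [h4, mul_assoc _ (D.q J o vf (-v + w) * _), mul_assoc (D.q J o vf (-v + w)), ← h6]; simp only [mul_assoc]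
          _ = D.g o (TX vf t) * (D.g o (TX vf (om J (D.ρ l v) (-v + w))) * (D.q J o vf (-v + w + D.ρ l v) * D.g o (TX vf (om J w (-v))))) * l := by
            rw [h5, h7]; simp only [mul_assoc]
          _ = _ := by rw [h8, ← TX_add, ← TX_add, map_mul, map_mul]; simp only [mul_assoc]
      rw [e'] at fix ⊢
      have hW : Supp J (-v + w + D.ρ l v) := (hv.neg.add hw).add (D.GJ_supp hl hv)
      revert fix hW
      generalize -v + w + D.ρ l v = W
      generalize t + om J (D.ρ l v) (-v + w) + om J w (-v) = s
      intro fix hW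
      rw [D.ρ_mul, D.ρ_mul, D.GJ_o ho hl, D.ρq_o hJ ho _ hW, fm_ef, one_smul, map_add, D.ρg_o, D.ρg_z ho _ hW, av_TX, fm_ef, mul_one] at fix
      have f1 := congrFun fix o
      simp only [Pi.add_apply, Pi.single_eq_same] at f1
      rw [hW o ho, add_zero] at f1
      have hs : s = 0 := by
        have : s • (vf : V2 F) = 0 := by simpa using f1
        exact (smul_eq_zero.1 this).resolve_right vf_ne
      subst hs
      have hW0 : W = 0 := by simpa using fix
      subst hW0
      rw [TX_zero, map_one, D.q_zero ho, one_mul, one_mul]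
      exact D.Sh_l hJ ho hl
  simpa using key

theorem YY_g (hT : D.Tr J) (A : S2 F) {x : Γ} (hx : D.YY hJ ho x) : D.YY hJ ho (D.g o A * x) := by
  rcases hx with ⟨B, v, hv, s', hs', rfl⟩ | ⟨z, v, hz, hv, h, s', hs', rfl⟩
  · exact Or.inl ⟨A * B, v, hv, s', hs', by rw [map_mul]; simp only [mul_assoc]⟩
  · refine Or.inr ⟨z, v, hz, hv, h, _, mul_mem (D.rep_g hJ ho hT hz hv h A) hs', ?_⟩
    group

/-- adding in the second direction, generic case -/
theorem YY_q1 (hT : D.Tr J) (u : V2 F) (hu : u 1 ≠ 0) {z v : ι → V2 F} (hz : Supp J z) (hv : Supp J v) :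
    D.YY hJ ho (D.q J o u z * D.q J o vf v) := by
  have e1 : D.q J o vf v = D.g o (TX ve (-(u 0 / u 1))) * D.q J o vf v * ((D.q J o vf v)⁻¹ * D.g o (TX ve (-(u 0 / u 1))) * D.q J o vf v)⁻¹ := by
    group
  rw [e1]
  rw [← mul_assoc]
  apply D.YY_s hJ ho _ (inv_mem (D.X_f hJ ho hT hv _))
  rw [← mul_assoc, D.q_g' ho, mul_assoc]
  apply D.YY_g hJ ho hT
  have : av (TX ve (-(u 0 / u 1)))⁻¹ u = u 1 • vf := by
    rw [TX_inv, av_TX]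
    apply v2_ext
    · simp [fm]; field_simp; ring
    · simp [fm]
  rw [this, D.q_smul ho, D.q_mul hJ ho, (D.q_X ho _ _ _).eq]
  exact Or.inl ⟨_, _, (hz.smul (u 1)).add hv, 1, one_mem _, (mul_one _).symm⟩

theorem YY_q2 (hT : D.Tr J) {z v : ι → V2 F} (hz : Supp J z) (hv : Supp J v) :
    D.YY hJ ho (D.q J o ve z * D.q J o vf v) := by
  by_cases h : om J v z = -1
  · exact Or.inr ⟨z, v, hz, hv, h, 1, one_mem _, by simp⟩
  obtain ⟨l, hl, e⟩ := D.q4 hT hJ ho (ve + vf) ((-1 : F) • vf) hz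
  have e0 : (ve + vf + (-1 : F) • vf : V2 F) = ve := by apply v2_ext <;> simp
  rw [e0, D.q_smul ho] at e
  have hz' : Supp J ((-1 : F) • z) := hz.smul _
  generalize (-1 : F) • z = z' at e hz'
  have hw : Supp J (z' + D.ρ l v) := hz'.add (D.GJ_supp hl hv)
  have e1 : D.q J o ve z * D.q J o vf v = D.g o (TX vf (om J (D.ρ l v) z')) * 
      (D.q J o (ve + (1 - om J (D.ρ l v) z') • vf) z * D.q J o vf (z' + D.ρ l v)) * l := by
    have h1 := D.equiv' hJ ho hl vf hv
    have h2 := D.q_mul hJ ho vf z' (D.ρ l v)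
    rw [(D.q_X ho _ _ _).eq] at h2
    have h3 := D.q_g' ho (TX vf (om J (D.ρ l v) z')) (ve + vf) z
    have h4 : av (TX vf (om J (D.ρ l v) z'))⁻¹ (ve + vf) = ve + (1 - om J (D.ρ l v) z') • vf := by
      rw [TX_inv, av_TX]
      apply v2_ext
      · simp [fm]
      · simp [fm]; ring
    rw [h4] at h3
    calc _ = D.q J o (ve + vf) z * D.q J o vf z' * (l * D.q J o vf v) := by rw [e]; simp only [mul_assoc]
      _ = D.q J o (ve + vf) z * (D.q J o vf z' * D.q J o vf (D.ρ l v)) * l := by rw [h1]; simp only [mul_assoc]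
      _ = (D.q J o (ve + vf) z * D.g o (TX vf (om J (D.ρ l v) z'))) * D.q J o vf (z' + D.ρ l v) * l := by
        rw [h2]; simp only [mul_assoc]
      _ = _ := by rw [h3]; simp only [mul_assoc]
  by_cases hs : om J (D.ρ l v) z' = 1
  · exfalso
    rw [hs, sub_self, zero_smul, add_zero] at e1
    have := congrArg (fun γ => D.ρ γ (Pi.single o ve)) e1
    rw [D.rep_vec hJ ho hz hv, D.ρ_mul, D.GJ_o ho hl, D.ρ_mul, D.rep_vec hJ ho hz hw, map_add, D.ρg_o, D.ρg_z ho _ hw, av_TX] at this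
    generalize z' + D.ρ l v = w at this hw
    have t := congrFun this o
    simp only [Pi.add_apply, Pi.single_eq_same] at t
    rw [hv o ho, hw o ho, add_zero, add_zero, fm_smul_left, fm_ef] at t
    have t0 := congrFun t 0
    have t1 := congrFun t 1
    simp at t0 t1
    exact h (by linear_combination t0 - t1)
  · rw [e1]
    apply D.YY_s hJ ho _ (D.Sh_l hJ ho hl)
    apply D.YY_g hJ ho hT
    apply D.YY_q1 hJ ho hT _ _ hz hw
    simpa [sub_eq_zero] using Ne.symm hs

theorem YY_q (hT : D.Tr J) (u : V2 F) {z : ι → V2 F} (hz : Supp J z) {x : Γ} (hx : D.YY hJ ho x) :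
    D.YY hJ ho (D.q J o u z * x) := by
  have base : ∀ (u : V2 F) {z v : ι → V2 F} (hz : Supp J z) (hv : Supp J v), D.YY hJ ho (D.q J o u z * D.q J o vf v) := by
    intro u z v hz hv
    by_cases hu : u 1 = 0
    · have : u = u 0 • ve := by apply v2_ext <;> simp [hu]
      rw [this, D.q_smul ho]
      exact D.YY_q2 hJ ho hT (hz.smul _) hv
    · exact D.YY_q1 hJ ho hT u hu hz hv
  rcases hx with ⟨B, v, hv, s', hs', rfl⟩ | ⟨z', v, hz', hv, h, s', hs', rfl⟩
  · rw [← mul_assoc]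
    apply D.YY_s hJ ho _ hs'
    rw [← mul_assoc, D.q_g' ho, mul_assoc]
    apply D.YY_g hJ ho hT
    exact base _ hz hv
  · rw [← mul_assoc]
    apply D.YY_s hJ ho _ hs'
    by_cases hu : u = 0
    · subst hu
      rw [D.q_zero' ho, one_mul]
      exact base _ hz' hv
    obtain ⟨A, hA⟩ := exists_av2 hu ve_ne
    have e1 : D.q J o ve z' * D.q J o vf v = D.g o A⁻¹ * (D.q J o ve z' * D.q J o vf v) * 
      ((D.q J o ve z' * D.q J o vf v)⁻¹ * D.g o A⁻¹ * (D.q J o ve z' * D.q J o vf v))⁻¹ := by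
      group
    rw [e1, ← mul_assoc]
    apply D.YY_s hJ ho _ (inv_mem (D.rep_g hJ ho hT hz' hv h _))
    rw [← mul_assoc, D.q_g' ho, inv_inv, hA, mul_assoc]
    apply D.YY_g hJ ho hT
    rw [← mul_assoc, D.q_mul hJ ho, (D.q_X ho _ _ _).eq, mul_assoc]
    apply D.YY_g hJ ho hT
    exact base _ (hz.add hz') hv

theorem GJ_gen_ind {J : List ι} (P : Γ → Prop) (h1 : P 1) (hg : ∀ r ∈ J, ∀ A x, P x → P (D.g r A * x))
    (hy : ∀ r ∈ J, ∀ s ∈ J, r ≠ s → ∀ u v x, P x → P (D.y r s u v * x)) {γ : Γ} (hγ : γ ∈ D.GJ J) : P γ := by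
  have : ∀ x, P x → P (γ * x) := by
    refine Subgroup.closure_induction_left (p := fun γ _ => ∀ x, P x → P (γ * x)) ?_ ?_ ?_ hγ
    · intro x hx; rwa [one_mul]
    · rintro a (⟨r, hr, B, rfl⟩ | ⟨r, hr, s, hs, h, u, v, rfl⟩) b hb ih x hx
      · rw [mul_assoc]; exact hg _ hr _ _ (ih x hx)
      · rw [mul_assoc]; exact hy _ hr _ hs h _ _ _ (ih x hx)
    · rintro a (⟨r, hr, B, rfl⟩ | ⟨r, hr, s, hs, h, u, v, rfl⟩) b hb ih x hx
      · rw [mul_assoc, ← map_inv]; exact hg _ hr _ _ (ih x hx)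
      · rw [mul_assoc, D.yinv h]; exact hy _ hr _ hs h _ _ _ (ih x hx)
  simpa using this 1 h1

theorem YY_all (hT : D.Tr J) {γ : Γ} (hγ : γ ∈ D.GJ (o :: J)) : D.YY hJ ho γ := by
  refine D.GJ_gen_ind (D.YY hJ ho) ?_ ?_ ?_ hγ
  · exact Or.inl ⟨1, 0, Supp.zero J, 1, one_mem _, by simp [D.q_zero ho]⟩
  · intro r hr A x hx
    rcases List.mem_cons.1 hr with rfl | hr
    · exact D.YY_g hJ ho hT A hx
    · exact D.YY_l hJ ho (D.g_mem hr A) hx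
  · intro r hr s hs h u v x hx
    rcases List.mem_cons.1 hr with hro | hr'
    · subst hro
      rcases List.mem_cons.1 hs with hso | hs'
      · exact absurd hso.symm h
      · rw [← D.q_single hJ ho hs']
        exact D.YY_q hJ ho hT u (Supp.single hs' v) hx
    · rcases List.mem_cons.1 hs with hso | hs'
      · subst hso
        rw [D.ysymm h, ← D.q_single hJ ho hr']
        exact D.YY_q hJ ho hT v (Supp.single hr' u) hx
      · exact D.YY_l hJ ho (D.y_mem hr' hs' h u v) hx

theorem stab (hT : D.Tr J) {γ : Γ} (hγ : γ ∈ D.GJ (o :: J)) (hfix : D.ρ γ (Pi.single o ve) = Pi.single o ve) :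
    γ ∈ D.Sh hJ ho := by
  rcases D.YY_all hJ ho hT hγ with ⟨A, v, hv, s, hs, rfl⟩ | ⟨z, v, hz, hv, h, s, hs, rfl⟩
  · rw [D.ρ_mul, D.Sh_fix hJ ho hs, D.ρ_mul, D.ρq_o hJ ho _ hv, fm_ef, one_smul, map_add, D.ρg_o, D.ρg_z ho _ hv] at hfix
    have f1 := congrFun hfix o
    simp only [Pi.add_apply, Pi.single_eq_same] at f1
    rw [hv o ho, add_zero] at f1
    obtain ⟨t, rfl⟩ := stab_ve f1
    rw [f1] at hfix
    have hv0 : v = 0 := by simpa using hfix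
    subst hv0
    rw [D.q_zero ho, mul_one]
    exact mul_mem (D.Sh_X hJ ho t) hs
  · rw [D.ρ_mul, D.Sh_fix hJ ho hs, D.rep_vec hJ ho hz hv, h] at hfix
    have f1 := congrFun hfix o
    simp only [Pi.add_apply, Pi.single_eq_same] at f1
    rw [hv o ho] at f1
    simp at f1
    exact absurd f1.symm ve_ne

theorem GJ_mono {J J' : List ι} (h : ∀ r ∈ J, r ∈ J') : D.GJ J ≤ D.GJ J' := by
  refine (Subgroup.closure_le _).2 ?_
  rintro a (⟨r, hr, B, rfl⟩ | ⟨r, hr, s, hs, hn, u, v, rfl⟩)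
  · exact D.g_mem (h _ hr) _
  · exact D.y_mem (h _ hr) (h _ hs) hn _ _
theorem q_mem (ho : o ∉ J) (u : V2 F) (z : ι → V2 F) : D.q J o u z ∈ D.GJ (o :: J) := by
  apply Subgroup.list_prod_mem
  simp only [List.mem_map]
  rintro _ ⟨r, hr, rfl⟩
  exact D.y_mem List.mem_cons_self (List.mem_cons_of_mem _ hr) (nm ho hr) _ _

theorem Tr_cons (hJ : J.Nodup) (ho : o ∉ J) (hT : D.Tr J) : D.Tr (o :: J) := by
  have key : ∀ x : ι → V2 F, Supp (o :: J) x → x ≠ 0 → ∃ γ ∈ D.GJ (o :: J), D.ρ γ (Pi.single o ve) = x := by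
    intro x hx hx0
    by_cases h : x o = 0
    · have hxJ : Supp J x := by
        intro t ht
        by_cases hto : t = o
        · rw [hto, h]
        · apply hx; simp [hto, ht]
      obtain ⟨r, hr⟩ := Function.ne_iff.1 hx0
      have hrJ : r ∈ J := by
        by_contra hc; exact hr (hxJ r hc)
      obtain ⟨w, hw⟩ := exists_fm hr
      refine ⟨D.q J o ve (Pi.single r w) * D.q J o vf x, mul_mem (D.q_mem ho _ _) (D.q_mem ho _ _), ?_⟩
      rw [D.rep_vec hJ ho (Supp.single hrJ w) hxJ, om_single J hJ _ _ hrJ, fm_swap, hw]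
      simp
    · obtain ⟨A, hA⟩ := exists_av h
      have hxJ : Supp J (Function.update x o 0) := by
        intro t ht
        by_cases hto : t = o
        · rw [hto, Function.update_self]
        · rw [Function.update_of_ne hto]; apply hx; simp [hto, ht]
      refine ⟨D.g o A * D.q J o vf (Function.update x o 0), mul_mem (D.g_mem List.mem_cons_self _) (D.q_mem ho _ _), ?_⟩
      rw [D.ρ_mul, D.ρq_o hJ ho _ hxJ, fm_ef, one_smul, map_add, D.ρg_o, D.ρg_z ho _ hxJ, hA]
      funext t
      by_cases hto : t = o
      · subst hto; simp
      · simp [Function.update_of_ne hto, Pi.single_eq_of_ne hto]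
  intro z z' hz hz0 hz' hz0'
  obtain ⟨γ, hγ, e⟩ := key z hz hz0
  obtain ⟨γ', hγ', e'⟩ := key z' hz' hz0'
  refine ⟨γ' * γ⁻¹, mul_mem hγ' (inv_mem hγ), ?_⟩
  rw [D.ρ_mul, ← e, D.ρ_inv', e']

theorem Inj_cons (hJ : J.Nodup) (ho : o ∉ J) (hT : D.Tr J) (hI : ∀ l ∈ D.GJ J, D.ρ l = 1 → l = 1) : ∀ l ∈ D.GJ (o :: J), D.ρ l = 1 → l = 1 := by
  intro γ hγ h
  obtain ⟨s, z, l, hz, hl, rfl⟩ := D.stab hJ ho hT hγ (by rw [h]; rfl)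
  have e := congrArg (fun φ => φ (Pi.single o vf)) h
  simp only [Module.End.one_apply] at e
  rw [D.ρ_mul, D.ρ_mul, D.GJ_o ho hl, D.ρq_o hJ ho _ hz, fm_fe, map_add, D.ρg_o, map_smul, D.ρg_z ho _ hz, av_TX, fm_fe] at e
  have f1 := congrFun e o
  simp only [Pi.add_apply, Pi.single_eq_same, Pi.smul_apply] at f1
  rw [hz o ho] at f1
  have hs : s = 0 := by
    have := congrFun f1 0
    simpa using this
  subst hs
  have hz0 : z = 0 := by simpa using e
  subst hz0
  rw [TX_zero, map_one, D.q_zero ho, one_mul, one_mul] at h ⊢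
  exact hI l hl h

theorem TrInj (J : List ι) (hJ : J.Nodup) : D.Tr J ∧ ∀ l ∈ D.GJ J, D.ρ l = 1 → l = 1 := by
  induction J with
  | nil =>
    constructor
    · intro z z' hz hz0
      exact absurd (funext fun t => hz t (by simp)) hz0
    · intro l hl _
      have : D.GJ [] = ⊥ := by
        simp [GJ]
      rw [this] at hl
      exact hl
  | cons o J ih =>
    rw [List.nodup_cons] at hJ
    obtain ⟨h1, h2⟩ := ih hJ.2
    exact ⟨D.Tr_cons hJ.2 hJ.1 h1, D.Inj_cons hJ.2 hJ.1 h1 h2⟩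

/-- the full form -/
def Om [Fintype ι] (x y : ι → V2 F) : F := ∑ t, fm (x t) (y t)

theorem Surj [Fintype ι] (hΩ : ∀ γ x y, Om (D.ρ γ x) (D.ρ γ y) = Om x y) (J : List ι) (hJ : J.Nodup) :
    ∀ σ : Module.End F (ι → V2 F), (∀ x y, Om (σ x) (σ y) = Om x y) → (∀ t ∉ J, ∀ w, σ (Pi.single t w) = Pi.single t w) →
      ∃ l ∈ D.GJ J, D.ρ l = σ := by
  have Om_single : ∀ (x : ι → V2 F) t w, Om x (Pi.single t w) = fm (x t) w := by
    intro x t w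
    rw [Om, Finset.sum_eq_single t]
    · rw [Pi.single_eq_same]
    · intro b _ hb; rw [Pi.single_eq_of_ne hb, fm_zero_right]
    · simp
  have fm0 : ∀ a : V2 F, (∀ w, fm a w = 0) → a = 0 := by
    intro a h
    apply v2_ext
    · simpa [fm] using h vf
    · simpa [fm] using h ve
  induction J with
  | nil =>
    intro σ h1 h2
    refine ⟨1, one_mem _, ?_⟩
    rw [map_one]
    symm
    apply LinearMap.pi_ext
    intro i x
    exact h2 i (by simp) x
  | cons o J ih =>
    rw [List.nodup_cons] at hJ
    intro σ h1 h2
    obtain ⟨hT, _⟩ := D.TrInj (o :: J) (List.nodup_cons.2 hJ)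
    have supp : ∀ x, Supp (o :: J) x → Supp (o :: J) (σ x) := by
      intro x hx t ht
      apply fm0
      intro w
      rw [← Om_single, ← h2 t ht, h1, Om_single, hx t ht, fm_zero_left]
    have hso : ∀ w : V2 F, Supp (o :: J) (Pi.single o w) := fun w => Supp.single List.mem_cons_self w
    obtain ⟨γ, hγ, e⟩ := hT (Pi.single o ve) (σ (Pi.single o ve)) (hso _) (by simpa using ve_ne) (supp _ (hso _)) (by
      intro h
      have := h1 (Pi.single o ve) (Pi.single o vf)
      rw [h, Om_single, Pi.single_eq_same, fm_ef] at this
      simp [Om] at this)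
    set x := D.ρ γ⁻¹ (σ (Pi.single o vf)) with hx
    have hxs : Supp (o :: J) x := D.GJ_supp (inv_mem hγ) (supp _ (hso _))
    have hxo : fm ve (x o) = 1 := by
      have : Om (Pi.single o ve) x = 1 := by
        have : (Pi.single o ve : ι → V2 F) = D.ρ γ⁻¹ (σ (Pi.single o ve)) := by rw [← e, D.ρ_inv']
        rw [this, hx, hΩ, h1, Om_single, Pi.single_eq_same, fm_ef]
      rw [Om, Finset.sum_eq_single o] at this
      · rwa [Pi.single_eq_same] at this
      · intro b _ hb; rw [Pi.single_eq_of_ne hb, fm_zero_left]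
      · simp
    set z : ι → V2 F := - Function.update x o 0 with hz
    have hzJ : Supp J z := by
      apply Supp.neg
      intro t ht
      by_cases hto : t = o
      · rw [hto, Function.update_self]
      · rw [Function.update_of_ne hto]; apply hxs; simp [hto, ht]
    set δ := D.g o (TX ve (-(x o 0))) * D.q J o ve z with hδ
    have hδm : δ ∈ D.GJ (o :: J) := mul_mem (D.g_mem List.mem_cons_self _) (D.q_mem hJ.1 _ _)
    have d1 : D.ρ δ (Pi.single o ve) = Pi.single o ve := by
      rw [hδ, D.ρ_mul, D.ρq_o hJ.2 hJ.1 _ hzJ, fm_self, zero_smul, add_zero, D.ρg_o, av_TX_self]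
    have d2 : D.ρ δ (Pi.single o vf) = x := by
      rw [hδ, D.ρ_mul, D.ρq_o hJ.2 hJ.1 _ hzJ, fm_fe, map_add, D.ρg_o, map_smul, D.ρg_z hJ.1 _ hzJ, av_TX, fm_fe]
      funext t
      by_cases hto : t = o
      · subst hto
        simp only [Pi.add_apply, Pi.single_eq_same, Pi.smul_apply, hz, Pi.neg_apply, Function.update_self]
        have : x t 1 = 1 := by simpa [fm] using hxo
        apply v2_ext <;> simp [this]
      · simp [hz, Function.update_of_ne hto, Pi.single_eq_of_ne hto]
    obtain ⟨l, hl, hle⟩ := ih hJ.2 (D.ρ (δ⁻¹ * γ⁻¹) * σ) (by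
        intro a b
        simp only [Module.End.mul_apply]
        rw [hΩ, h1]) (by
        intro t ht w
        simp only [Module.End.mul_apply]
        rw [D.ρ_mul]
        by_cases hto : t = o
        · subst hto
          have a1 : D.ρ δ⁻¹ (D.ρ γ⁻¹ (σ (Pi.single t ve))) = Pi.single t ve := by
            rw [← e, D.ρ_inv']
            conv_lhs => rw [← d1]
            rw [D.ρ_inv']
          have a2 : D.ρ δ⁻¹ (D.ρ γ⁻¹ (σ (Pi.single t vf))) = Pi.single t vf := by
            rw [← hx, ← d2, D.ρ_inv']
          have hw : (Pi.single t w : ι → V2 F) = w 0 • (Pi.single t ve : ι → V2 F) + w 1 • (Pi.single t vf : ι → V2 F) := by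
            rw [← Pi.single_smul, ← Pi.single_smul, ← Pi.single_add, ← v2_decomp]
          rw [hw]
          simp only [map_add, map_smul, a1, a2]
        · have ht' : t ∉ o :: J := by simp [hto, ht]
          have fx : ∀ γ ∈ D.GJ (o :: J), D.ρ γ (Pi.single t w) = Pi.single t w := fun γ hγ => D.GJ_o ht' hγ w
          rw [h2 t ht', fx _ (inv_mem hγ), fx _ (inv_mem hδm)])
    refine ⟨γ * δ * l, mul_mem (mul_mem hγ hδm) (D.GJ_mono (fun r hr => List.mem_cons_of_mem _ hr) hl), ?_⟩
    rw [map_mul, hle, ← mul_assoc, ← map_mul]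
    have : γ * δ * (δ⁻¹ * γ⁻¹) = 1 := by group
    rw [this, map_one, one_mul]

end Data
end LT

namespace LT
open SL2
variable {ι F Γ : Type} [Field F] [DecidableEq ι] [Group Γ]

/-- conjugation as a homomorphism -/
def cj (x : Γ) : Γ →* Γ := (MulAut.conj x).toMonoidHom
theorem cj_apply (x w : Γ) : cj x w = x * w * x⁻¹ := rfl
theorem cj_mul (x x' w : Γ) : cj (x * x') w = cj x (cj x' w) := by simp only [cj_apply]; group
theorem cj_one (w : Γ) : cj 1 w = w := by simp [cj_apply]
theorem cj_comm {x w : Γ} (h : Commute x w) : cj x w = w := by rw [cj_apply, h.eq, mul_inv_cancel_right]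
theorem comm_cj {x w : Γ} (h : cj x w = w) : Commute x w := by
  rw [cj_apply, mul_inv_eq_iff_eq_mul] at h; exact h
theorem comm_map {Γ' : Type} [Group Γ'] (f : Γ →* Γ') {x w : Γ} (h : Commute x w) : Commute (f x) (f w) := h.map f

theorem exists_basis {v w : V2 F} (h : fm v w = 1) : ∃ B : S2 F, av B ve = v ∧ av B vf = w := by
  refine ⟨⟨!![v 0, w 0; v 1, w 1], ?_⟩, ?_, ?_⟩
  · rw [Matrix.det_fin_two_of]; simp only [fm] at h; linear_combination h
  · exact v2_ext ((av_apply _ _ _).trans (by simp)) ((av_apply _ _ _).trans (by simp))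
  · exact v2_ext ((av_apply _ _ _).trans (by simp)) ((av_apply _ _ _).trans (by simp))

theorem exists_basis' {v w : V2 F} (h : fm v w ≠ 0) : ∃ B : S2 F, av B ve = v ∧ av B (fm v w • vf) = w := by
  obtain ⟨B, h1, h2⟩ := exists_basis (v := v) (w := (fm v w)⁻¹ • w) (by rw [fm_smul_right, inv_mul_cancel₀ h])
  exact ⟨B, h1, by rw [av_smul, h2, smul_smul, mul_inv_cancel₀ h, one_smul]⟩

theorem av_D_ve (t : Fˣ) : av (D t) ve = (t : F) • ve :=
  v2_ext ((av_apply _ _ _).trans (by simp [coe_D])) ((av_apply _ _ _).trans (by simp [coe_D]))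
theorem av_D_vf (t : Fˣ) : av (D t) vf = (t : F)⁻¹ • vf :=
  v2_ext ((av_apply _ _ _).trans (by simp [coe_D])) ((av_apply _ _ _).trans (by simp [coe_D]))

theorem av_ne {A : S2 F} {u : V2 F} (h : u ≠ 0) : av A u ≠ 0 := fun h0 => h (by rw [← av_inv A u, h0, av_zero])

open Classical in
/-- a chosen matrix with given first column -/
noncomputable def Av (u : V2 F) : S2 F := if h : u ≠ 0 then (exists_av h).choose else 1
theorem Av_spec {u : V2 F} (h : u ≠ 0) : av (Av u) ve = u := by
  rw [Av, dif_pos h]; exact (exists_av h).choose_spec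

open Classical in
/-- general Siegel element from base ones -/
noncomputable def yF (g : ι → S2 F →* Γ) (yb : ι → ι → Γ) (p q : ι) (u v : V2 F) : Γ :=
  if u = 0 ∨ v = 0 then 1 else cj (g p (Av u) * g q (Av v)) (yb p q)

theorem yF_ρ {g : ι → S2 F →* Γ} {yb : ι → ι → Γ} (ρ : Γ →* Module.End F (ι → V2 F)) (ρg : ∀ p A x, ρ (g p A) x = Function.update x p (av A (x p))) {p q : ι} (h : p ≠ q)
    (ρb : ∀ x, ρ (yb p q) x = x + Pi.single q (fm (x p) ve • ve) + Pi.single p (fm (x q) ve • ve)) (u v : V2 F) (x : ι → V2 F) :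
    ρ (yF g yb p q u v) x = x + Pi.single q (fm (x p) u • v) + Pi.single p (fm (x q) v • u) := by
  by_cases hu : u = 0
  · rw [yF, if_pos (Or.inl hu), hu]; simp
  by_cases hv : v = 0
  · rw [yF, if_pos (Or.inr hv), hv]; simp
  rw [yF, if_neg (by tauto), cj_apply, mul_inv_rev, ← map_inv, ← map_inv]
  simp only [map_mul, Module.End.mul_apply, ρg, ρb]
  have k1 : fm (av (Av u)⁻¹ (x p)) ve = fm (x p) u := by rw [← fm_av (Av u), av_inv', Av_spec hu]
  have k2 : fm (av (Av v)⁻¹ (x q)) ve = fm (x q) v := by rw [← fm_av (Av v), av_inv', Av_spec hv]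
  ext1 t
  by_cases hp : t = p
  · subst hp; simp [Function.update_of_ne h, Function.update_of_ne h.symm, Pi.single_eq_of_ne h, av_add, av_smul, av_inv', k1, k2, Av_spec hu]
  by_cases hq : t = q
  · subst hq; simp [Function.update_of_ne h, Function.update_of_ne h.symm, Pi.single_eq_of_ne h.symm, av_add, av_smul, av_inv', k1, k2, Av_spec hv]
  simp [Function.update_of_ne hp, Function.update_of_ne hq, Pi.single_eq_of_ne hp, Pi.single_eq_of_ne hq]

structure Mid (ι F Γ : Type) [Field F] [DecidableEq ι] [Group Γ] where
  g : ι → S2 F →* Γ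
  yb : ι → ι → Γ
  om : Fˣ
  hom : ∀ t : Fˣ, ∃ i : ℕ, t = om ^ i
  ρ : Γ →* Module.End F (ι → V2 F)
  gg : ∀ {p q : ι}, p ≠ q → ∀ A B, Commute (g p A) (g q B)
  bs : ∀ {p q : ι}, p ≠ q → yb p q = yb q p
  b1 : ∀ {p q : ι}, p ≠ q → Commute (yb p q) (g p (TX ve 1))
  b2 : ∀ {p q : ι}, p ≠ q → Commute (yb p q) (g p (TX ve om))
  bD : ∀ {p q : ι}, p ≠ q → Commute (yb p q) (g p (D om) * g q (D om⁻¹))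
  bg : ∀ {p q r : ι}, p ≠ q → r ≠ p → r ≠ q → ∀ A, Commute (g r A) (yb p q)
  a2 : ∀ {p q : ι}, p ≠ q → ∀ d : F, d = 1 ∨ d = om → yF g yb p q ve ve * yF g yb p q ve (d • vf) = yF g yb p q ve (ve + d • vf) * g p (TX ve (fm (d • vf) ve))
  a2n : ∀ {p q : ι}, p ≠ q → yF g yb p q ve ve * yF g yb p q ve (-ve) = 1
  a3 : ∀ {p q : ι}, p ≠ q → ∀ d : F, d = 1 ∨ d = om → yF g yb p q ve ve * g p (TX vf d) * (yF g yb p q ve ve)⁻¹ =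
    g p (TX vf d) * yF g yb p q vf ((d * fm vf ve) • ve) * g q (TX ve (d * fm vf ve ^ 2))
  a4 : ∀ {p q r : ι}, p ≠ q → p ≠ r → q ≠ r → ∀ u', u' = ve ∨ u' = vf → yF g yb p q ve ve * yF g yb p r u' ve * (yF g yb p q ve ve)⁻¹ =
    yF g yb p r u' ve * yF g yb q r (fm u' ve • ve) ve
  a5 : ∀ {p q r s : ι}, p ≠ q → p ≠ r → p ≠ s → q ≠ r → q ≠ s → r ≠ s → Commute (yF g yb p q ve ve) (yF g yb r s ve ve)
  ρg : ∀ p A x, ρ (g p A) x = Function.update x p (av A (x p))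
  ρb : ∀ {p q : ι}, p ≠ q → ∀ x, ρ (yb p q) x = x + Pi.single q (fm (x p) ve • ve) + Pi.single p (fm (x q) ve • ve)

namespace Mid
variable (M : Mid ι F Γ)
/-- Siegel element -/
noncomputable def y (p q : ι) (u v : V2 F) : Γ := yF M.g M.yb p q u v

theorem y00 (p q : ι) {u v : V2 F} (h : u = 0 ∨ v = 0) : M.y p q u v = 1 := if_pos h
theorem y0 (p q : ι) (v : V2 F) : M.y p q 0 v = 1 := M.y00 p q (Or.inl rfl)
theorem y0' (p q : ι) (u : V2 F) : M.y p q u 0 = 1 := M.y00 p q (Or.inr rfl)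

theorem sq (d : F) (hd : d ≠ 0) : ∃ (d0 : F) (t : Fˣ), (d0 = 1 ∨ d0 = M.om) ∧ d = d0 * t ^ 2 := by
  obtain ⟨i, hi⟩ := M.hom (Units.mk0 d hd)
  have hi' : d = (M.om : F) ^ i := by have := congrArg Units.val hi; simpa using this
  obtain ⟨j, rfl | rfl⟩ := Nat.even_or_odd' i
  · exact ⟨1, M.om ^ j, Or.inl rfl, by rw [hi']; push_cast; ring⟩
  · exact ⟨M.om, M.om ^ j, Or.inr rfl, by rw [hi']; push_cast; ring⟩

theorem bD' {p q : ι} (h : p ≠ q) (t : Fˣ) : Commute (M.yb p q) (M.g p (D t) * M.g q (D t⁻¹)) := by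
  obtain ⟨i, rfl⟩ := M.hom t
  have e : ∀ t : Fˣ, ∀ i : ℕ, D (t ^ i) = D t ^ i := by
    intro t i; induction i with
    | zero => simp [D_one]
    | succ i ih => rw [pow_succ, pow_succ, D_mul, ih]
  rw [← inv_pow, e, e, map_pow, map_pow, ← (M.gg h _ _).mul_pow]
  exact (M.bD h).pow_right i

theorem cgg (p : ι) (A B : S2 F) : cj (M.g p A) (M.g p B) = M.g p (A * B * A⁻¹) := by
  rw [cj_apply, ← map_mul, ← map_inv, ← map_mul]
theorem cgX (p : ι) (A : S2 F) (u : V2 F) (s : F) : cj (M.g p A) (M.g p (TX u s)) = M.g p (TX (av A u) s) := by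
  rw [cgg, TX_conj]
theorem cgq {p q : ι} (h : p ≠ q) (A B : S2 F) : cj (M.g p A) (M.g q B) = M.g q B := cj_comm (M.gg h A B)

theorem bX {p q : ι} (h : p ≠ q) (d : F) : Commute (M.yb p q) (M.g p (TX ve d)) := by
  by_cases hd : d = 0
  · rw [hd]; simp
  obtain ⟨d0, t, h0, rfl⟩ := M.sq d hd
  have h1 : Commute (M.yb p q) (M.g p (TX ve d0)) := by
    rcases h0 with rfl | rfl
    · exact M.b1 h
    · exact M.b2 h
  have h2 := comm_map (cj (M.g p (D t) * M.g q (D t⁻¹))) h1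
  rwa [cj_comm (M.bD' h t).symm, cj_mul, M.cgq h.symm, M.cgX, av_D_ve, TX_smul] at h2
theorem bX' {p q : ι} (h : p ≠ q) (d : F) : Commute (M.yb p q) (M.g q (TX ve d)) := by
  rw [M.bs h]; exact M.bX h.symm d

theorem yAB {p q : ι} (h : p ≠ q) (A B : S2 F) : M.y p q (av A ve) (av B ve) = cj (M.g p A) (cj (M.g q B) (M.yb p q)) := by
  have hA := av_ne (A := A) ve_ne
  have hB := av_ne (A := B) ve_ne
  have e : ∀ A : S2 F, ∃ s, Av (av A ve) = A * TX ve s := by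
    intro A
    obtain ⟨s, hs⟩ := stab_ve (A := A⁻¹ * Av (av A ve)) (by rw [av_mul, Av_spec (av_ne ve_ne), av_inv])
    exact ⟨s, by rw [← hs, mul_inv_cancel_left]⟩
  obtain ⟨s, hs⟩ := e A
  obtain ⟨s', hs'⟩ := e B
  rw [y, yF, if_neg (by tauto), hs, hs', map_mul, map_mul]
  have : M.g p A * M.g p (TX ve s) * (M.g q B * M.g q (TX ve s')) = M.g p A * (M.g q B * (M.g p (TX ve s) * M.g q (TX ve s'))) := by
    have := (M.gg h (TX ve s) B).eq
    simp only [mul_assoc]; rw [← mul_assoc (M.g p (TX ve s)), this]; simp only [mul_assoc]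
  rw [this, cj_mul, cj_mul, cj_mul, cj_comm (M.bX' h s').symm, cj_comm (M.bX h s).symm]

theorem cp {p q : ι} (h : p ≠ q) (A : S2 F) (u v : V2 F) : cj (M.g p A) (M.y p q u v) = M.y p q (av A u) v := by
  by_cases hu : u = 0
  · rw [hu, av_zero, y0, map_one]
  by_cases hv : v = 0
  · rw [hv, y0', y0', map_one]
  obtain ⟨U, rfl⟩ := exists_av hu
  obtain ⟨V, rfl⟩ := exists_av hv
  rw [← av_mul, M.yAB h, M.yAB h, map_mul, cj_mul]

theorem ysymm {p q : ι} (h : p ≠ q) (u v : V2 F) : M.y p q u v = M.y q p v u := by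
  by_cases hu : u = 0
  · rw [hu, y0, y0']
  by_cases hv : v = 0
  · rw [hv, y0', y0]
  obtain ⟨U, rfl⟩ := exists_av hu
  obtain ⟨V, rfl⟩ := exists_av hv
  rw [M.yAB h, M.yAB h.symm, ← cj_mul, ← cj_mul, (M.gg h _ _).eq, M.bs h]

theorem cq {p q : ι} (h : p ≠ q) (A : S2 F) (u v : V2 F) : cj (M.g q A) (M.y p q u v) = M.y p q u (av A v) := by
  rw [M.ysymm h, M.cp h.symm, M.ysymm h]

theorem cr {p q r : ι} (h : p ≠ q) (h1 : r ≠ p) (h2 : r ≠ q) (A : S2 F) (u v : V2 F) : Commute (M.g r A) (M.y p q u v) := by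
  by_cases hu : u = 0
  · rw [hu, y0]; exact Commute.one_right _
  by_cases hv : v = 0
  · rw [hv, y0']; exact Commute.one_right _
  obtain ⟨U, rfl⟩ := exists_av hu
  obtain ⟨V, rfl⟩ := exists_av hv
  rw [M.yAB h, ← cj_mul, cj_apply]
  have := (M.gg h1 A U).mul_right (M.gg h2 A V)
  exact (this.mul_right (M.bg h h1 h2 A)).mul_right this.inv_right
theorem cr' {p q r : ι} (h : p ≠ q) (h1 : r ≠ p) (h2 : r ≠ q) (A : S2 F) (u v : V2 F) : cj (M.g r A) (M.y p q u v) = M.y p q u v :=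
  cj_comm (M.cr h h1 h2 A u v)

theorem ysm {p q : ι} (h : p ≠ q) (t : F) (u v : V2 F) : M.y p q (t • u) v = M.y p q u (t • v) := by
  by_cases ht : t = 0
  · simp [ht, y0, y0']
  by_cases hu : u = 0
  · simp [hu, y0]
  by_cases hv : v = 0
  · simp [hv, y0']
  obtain ⟨U, rfl⟩ := exists_av hu
  obtain ⟨V, rfl⟩ := exists_av hv
  have e : ∀ A : S2 F, t • av A ve = av (A * D (Units.mk0 t ht)) ve := by
    intro A; rw [av_mul, av_D_ve, av_smul, Units.val_mk0]
  have h1 := cj_comm (M.bD' h (Units.mk0 t ht)).symm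
  rw [(M.gg h _ _).eq, cj_mul] at h1
  have hD : D (Units.mk0 t ht)⁻¹ = (D (Units.mk0 t ht))⁻¹ := by
    rw [eq_inv_iff_mul_eq_one, ← D_mul, inv_mul_cancel, D_one]
  have h2 := congrArg (cj (M.g q (D (Units.mk0 t ht)))) h1
  rw [← cj_mul, ← map_mul, hD, mul_inv_cancel, map_one, cj_one] at h2
  rw [e, e, M.yAB h, M.yAB h, map_mul, map_mul, cj_mul, cj_mul, ← cj_mul _ (M.g q V), (M.gg h _ _).eq, cj_mul, h2]

theorem yX {p q : ι} (h : p ≠ q) (u v : V2 F) (s : F) : Commute (M.y p q u v) (M.g p (TX u s)) := by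
  by_cases hu : u = 0
  · rw [hu, y0]; exact Commute.one_left _
  apply Commute.symm; apply comm_cj
  rw [M.cp h, av_TX_self]

/-- the statement of law A2 -/
def S (p q : ι) (u v v' : V2 F) : Prop := M.y p q u v * M.y p q u v' = M.y p q u (v + v') * M.g p (TX u (fm v' v))

variable {p q r s : ι}
theorem Sp (h : p ≠ q) (A : S2 F) {u v v' : V2 F} (hS : M.S p q u v v') : M.S p q (av A u) v v' := by
  have := congrArg (cj (M.g p A)) hS
  rw [S]
  simpa only [map_mul, M.cp h, M.cgX] using this
theorem Sq (h : p ≠ q) (A : S2 F) {u v v' : V2 F} (hS : M.S p q u v v') : M.S p q u (av A v) (av A v') := by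
  have := congrArg (cj (M.g q A)) hS
  rw [S, fm_av, ← av_add]
  simpa only [map_mul, M.cq h, M.cgq h.symm] using this
theorem Ssm (h : p ≠ q) (t : F) (u v v' : V2 F) : M.S p q (t • u) v v' ↔ M.S p q u (t • v) (t • v') := by
  rw [S, S, M.ysm h, M.ysm h, M.ysm h, smul_add, TX_smul, fm_smul_left, fm_smul_right]
  ring_nf

theorem S_ef (h : p ≠ q) (d : F) (hd : d ≠ 0) : M.S p q ve ve (d • vf) := by
  obtain ⟨d0, t, h0, rfl⟩ := M.sq d hd
  have h1 : M.S p q ve ve (d0 • vf) := M.a2 h d0 h0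
  have h2 := M.Sp h (D t) (M.Sq h (D t⁻¹) h1)
  rw [av_smul, av_D_ve, av_D_ve, av_D_vf, M.Ssm h, smul_smul, smul_smul, smul_smul] at h2
  simp only [Units.val_inv_eq_inv_val, inv_inv, mul_inv_cancel₀ t.ne_zero, one_smul] at h2
  convert h2 using 2; ring

theorem S_ind (h : p ≠ q) (u : V2 F) {v v' : V2 F} (hv : fm v v' ≠ 0) : M.S p q u v v' := by
  by_cases hu : u = 0
  · rw [S, hu]; simp [y0]
  obtain ⟨A, rfl⟩ := exists_av hu
  obtain ⟨B, h1, h2⟩ := exists_basis' hv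
  have := M.Sp h A (M.Sq h B (M.S_ef h _ hv))
  rwa [h1, h2] at this

theorem S_neg (h : p ≠ q) (u v : V2 F) : M.S p q u v (-v) := by
  by_cases hu : u = 0
  · rw [S, hu]; simp [y0]
  by_cases hv : v = 0
  · rw [S, hv]; simp [y0']
  obtain ⟨A, rfl⟩ := exists_av hu
  obtain ⟨B, rfl⟩ := exists_av hv
  have h1 : M.S p q ve ve (-ve) := by
    have : M.y p q ve ve * M.y p q ve (-ve) = 1 := M.a2n h
    rw [S, add_neg_cancel, y0', fm_neg_left, fm_self]; simpa using this
  have := M.Sp h A (M.Sq h B h1)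
  rwa [← neg_one_smul F (ve : V2 F), av_smul, neg_one_smul] at this

theorem A2 (h : p ≠ q) (u v v' : V2 F) : M.S p q u v v' := by
  by_cases hv : v = 0
  · rw [S, hv]; simp [y0']
  by_cases hi : fm v v' = 0
  swap
  · exact M.S_ind h u hi
  rw [fm_swap, neg_eq_zero] at hi
  obtain ⟨l, rfl⟩ := fm_zero_par hv hi
  by_cases hl : l = 0
  · rw [hl, S]; simp [y0']
  by_cases hl1 : l = -1
  · rw [hl1, neg_one_smul]; exact M.S_neg h u v
  obtain ⟨w, hw⟩ := exists_fm hv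
  have hw' : fm v w = -1 := by rw [fm_swap, hw]
  have e1 := M.S_ind h u (v := l • v - w) (v' := w) (by rw [sub_eq_add_neg, fm_add_left, fm_smul_left, fm_neg_left, fm_self, hw']; simpa)
  have e2 := M.S_ind h u (v := v) (v' := l • v - w) (by rw [sub_eq_add_neg, fm_add_right, fm_smul_right, fm_neg_right, fm_self, hw']; simp)
  have e3 := M.S_ind h u (v := v + (l • v - w)) (v' := w) (by
    rw [sub_eq_add_neg, fm_add_left, fm_add_left, fm_smul_left, fm_neg_left, fm_self, hw']
    intro h0; apply hl1; linear_combination -h0)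
  simp only [S] at e1 e2 e3 ⊢
  have f1 : fm w (l • v - w) = l := by rw [sub_eq_add_neg, fm_add_right, fm_smul_right, fm_neg_right, fm_self, hw]; ring
  have f2 : fm (l • v - w) v = -1 := by rw [sub_eq_add_neg, fm_add_left, fm_smul_left, fm_neg_left, fm_self, hw]; ring
  have f3 : fm w (v + (l • v - w)) = 1 + l := by rw [fm_add_right, f1, hw]
  rw [f1, sub_add_cancel] at e1
  rw [f2] at e2
  rw [f3, show v + (l • v - w) + w = v + l • v by abel] at e3
  have e1' : M.y p q u (l • v) = M.y p q u (l • v - w) * M.y p q u w * M.g p (TX u (-l)) := by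
    rw [e1, mul_assoc, ← map_mul, TX_add, add_neg_cancel, TX_zero, map_one, mul_one]
  rw [e1', fm_smul_left, fm_self, mul_zero, TX_zero, map_one, mul_one, ← mul_assoc, ← mul_assoc, e2, mul_assoc (M.y p q u _), ← (M.yX h u w _).eq,
    ← mul_assoc, e3, mul_assoc, mul_assoc, ← map_mul, ← map_mul, TX_add, TX_add, show 1 + l + (-1 + -l) = 0 by ring, TX_zero, map_one, mul_one]

/-- the statement of law A3 -/
def T (p q : ι) (u u' v : V2 F) (t : F) : Prop := M.y p q u' v * M.g p (TX u t) * (M.y p q u' v)⁻¹ =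
    M.g p (TX u t) * M.y p q u ((t * fm u u') • v) * M.g q (TX v (t * fm u u' ^ 2))

theorem Tp (h : p ≠ q) (A : S2 F) {u u' v : V2 F} {t : F} (hT : M.T p q u u' v t) : M.T p q (av A u) (av A u') v t := by
  have := congrArg (cj (M.g p A)) hT
  rw [T, fm_av]
  simpa only [map_mul, map_inv, M.cp h, M.cgX, M.cgq h] using this
theorem Tq (h : p ≠ q) (A : S2 F) {u u' v : V2 F} {t : F} (hT : M.T p q u u' v t) : M.T p q u u' (av A v) t := by
  have := congrArg (cj (M.g q A)) hT
  rw [T, ← av_smul]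
  simpa only [map_mul, map_inv, M.cq h, M.cgX, M.cgq h.symm] using this
theorem Tsm (h : p ≠ q) (c : F) (u u' v : V2 F) (t : F) : M.T p q (c • u) u' v t ↔ M.T p q u u' v (t * c ^ 2) := by
  rw [T, T, M.ysm h, TX_smul, fm_smul_left, smul_smul]
  ring_nf
theorem Tsm' (h : p ≠ q) (c : F) (u u' v : V2 F) (t : F) : M.T p q u (c • u') v t ↔ M.T p q u u' (c • v) t := by
  rw [T, T, M.ysm h, TX_smul, fm_smul_right, smul_smul]
  ring_nf

theorem T_ef (h : p ≠ q) (d : F) : M.T p q vf ve ve d := by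
  by_cases hd : d = 0
  · rw [hd, T]; simp [y0']
  obtain ⟨d0, t, h0, rfl⟩ := M.sq d hd
  have h1 : M.T p q vf ve ve d0 := M.a3 h d0 h0
  have h2 := M.Tp h (D t⁻¹) (M.Tq h (D t) h1)
  rw [av_D_ve, av_D_ve, av_D_vf, M.Tsm h, M.Tsm' h, smul_smul] at h2
  simpa only [Units.val_inv_eq_inv_val, inv_inv, inv_mul_cancel₀ t.ne_zero, one_smul] using h2

theorem A3 (h : p ≠ q) (u u' v : V2 F) (t : F) : M.T p q u u' v t := by
  by_cases hu' : u' = 0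
  · rw [T, hu']; simp [y0, y0']
  by_cases hv : v = 0
  · rw [T, hv]; simp [y0']
  by_cases hk : fm u' u = 0
  · rw [fm_swap, neg_eq_zero] at hk
    obtain ⟨c, rfl⟩ := fm_zero_par hu' hk
    rw [M.Tsm h, T, (M.yX h _ _ _).eq]; simp [y0']
  obtain ⟨A, h1, h2⟩ := exists_basis' hk
  obtain ⟨B, rfl⟩ := exists_av hv
  have := M.Tp h A (M.Tq h B ((M.Tsm h (fm u' u) _ _ _ t).2 (M.T_ef h _)))
  rwa [h1, h2] at this

/-- the statement of law A4 -/
def Q (p q r : ι) (u v u' v' : V2 F) : Prop := M.y p q u v * M.y p r u' v' * (M.y p q u v)⁻¹ = M.y p r u' v' * M.y q r (fm u' u • v) v'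

theorem Qsm (h1 : p ≠ q) (h2 : p ≠ r) (h3 : q ≠ r) (c : F) (u v u' v' : V2 F) : M.Q p q r u v (c • u') v' ↔ M.Q p q r u v u' (c • v') := by
  rw [Q, Q, M.ysm h2, fm_smul_left, ← M.ysm h3, smul_smul]

theorem Qc (h1 : p ≠ q) (h2 : p ≠ r) (h3 : q ≠ r) (A B C : S2 F) {u v u' v' : V2 F} (hQ : M.Q p q r u v u' v') :
    M.Q p q r (av A u) (av B v) (av A u') (av C v') := by
  have := congrArg (fun x => cj (M.g p A) (cj (M.g q B) (cj (M.g r C) x))) hQ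
  rw [Q, fm_av, ← av_smul]
  simpa only [map_mul, map_inv, M.cp h1, M.cp h2, M.cp h3, M.cq h1, M.cq h2, M.cq h3, M.cr' h1 h2.symm h3.symm, M.cr' h2 h1.symm h3, M.cr' h3 h1 h2] using this

theorem A4 (h1 : p ≠ q) (h2 : p ≠ r) (h3 : q ≠ r) (u v u' v' : V2 F) : M.Q p q r u v u' v' := by
  by_cases hu : u = 0
  · rw [Q, hu]; simp [y0]
  by_cases hv : v = 0
  · rw [Q, hv]; simp [y0, y0']
  by_cases hv' : v' = 0
  · rw [Q, hv']; simp [y0']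
  by_cases hk : fm u u' = 0
  · rw [fm_swap, neg_eq_zero] at hk
    obtain ⟨c, rfl⟩ := fm_zero_par hu hk
    rw [M.Qsm h1 h2 h3]
    by_cases hc : c = 0
    · rw [Q, hc]; simp [y0']
    obtain ⟨A, rfl⟩ := exists_av hu
    obtain ⟨B, rfl⟩ := exists_av hv
    obtain ⟨C, hC⟩ := exists_av (u := c • v') (smul_ne_zero hc hv')
    rw [← hC]
    exact M.Qc h1 h2 h3 A B C (M.a4 h1 h2 h3 ve (Or.inl rfl))
  · obtain ⟨A, e1, e2⟩ := exists_basis' hk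
    obtain ⟨B, rfl⟩ := exists_av hv
    obtain ⟨C, hC⟩ := exists_av (u := fm u u' • v') (smul_ne_zero hk hv')
    have := M.Qc h1 h2 h3 A B C (M.a4 h1 h2 h3 vf (Or.inr rfl))
    rw [e1, hC, ← M.Qsm h1 h2 h3, ← av_smul, e2] at this
    exact this

theorem A5 (h1 : p ≠ q) (h2 : p ≠ r) (h3 : p ≠ s) (h4 : q ≠ r) (h5 : q ≠ s) (h6 : r ≠ s) (u v u' v' : V2 F) : Commute (M.y p q u v) (M.y r s u' v') := by
  by_cases hu : u = 0
  · rw [hu, y0]; exact Commute.one_left _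
  by_cases hv : v = 0
  · rw [hv, y0']; exact Commute.one_left _
  by_cases hu' : u' = 0
  · rw [hu', y0]; exact Commute.one_right _
  by_cases hv' : v' = 0
  · rw [hv', y0']; exact Commute.one_right _
  obtain ⟨A, rfl⟩ := exists_av hu
  obtain ⟨B, rfl⟩ := exists_av hv
  obtain ⟨A', rfl⟩ := exists_av hu'
  obtain ⟨B', rfl⟩ := exists_av hv'
  have h0 : Commute (M.y p q ve ve) (M.y r s ve ve) := M.a5 h1 h2 h3 h4 h5 h6
  have := comm_map (cj (M.g p A)) (comm_map (cj (M.g q B)) (comm_map (cj (M.g r A')) (comm_map (cj (M.g s B')) h0)))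
  simpa only [M.cp h1, M.cq h1, M.cp h6, M.cq h6, M.cr' h1 h2.symm h4.symm, M.cr' h1 h3.symm h5.symm, M.cr' h6 h2 h3, M.cr' h6 h4 h5] using this

theorem ρy (h : p ≠ q) (u v : V2 F) (x : ι → V2 F) : M.ρ (M.y p q u v) x = x + Pi.single q (fm (x p) u • v) + Pi.single p (fm (x q) v • u) :=
  yF_ρ M.ρ M.ρg h (M.ρb h) u v x

/-- the final data -/
noncomputable def toData : Data ι F Γ where
  g := M.g
  y := M.y
  ρ := M.ρ
  gg := M.gg
  ysymm := M.ysymm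
  y0 := fun _ v => M.y0 _ _ v
  ysm := M.ysm
  A1 := fun h A u v => M.cp h A u v
  A1' := M.cr
  A2 := M.A2
  A3 := M.A3
  A4 := M.A4
  A5 := M.A5
  ρg := M.ρg
  ρy := M.ρy

end Mid
end LT

namespace LT
open SL2
variable {ι F Γ Γ' : Type} [Field F] [DecidableEq ι] [Group Γ] [Group Γ']

theorem perm_self_inv {Y : Type} (e : Equiv.Perm Y) (x : Y) : e (e⁻¹ x) = x := e.apply_symm_apply x

/-- base data: planar group at a point, permutations, and one Siegel element -/
structure Bs (ι F Γ : Type) [Field F] [DecidableEq ι] [Group Γ] where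
  o : ι
  o' : ι
  ne : o' ≠ o
  a : S2 F →* Γ
  s : Equiv.Perm ι →* Γ
  z : Γ

namespace Bs
variable (B : Bs ι F Γ)

def g (p : ι) : S2 F →* Γ := (cj (B.s (Equiv.swap B.o p))).comp B.a
def tau (o o' p q : ι) : Equiv.Perm ι := Equiv.swap (Equiv.swap o p o') q * Equiv.swap o p
def yb (p q : ι) : Γ := cj (B.s (tau B.o B.o' p q)) B.z
noncomputable def y (p q : ι) (u v : V2 F) : Γ := yF B.g B.yb p q u v

theorem g_apply (p : ι) (A : S2 F) : B.g p A = B.s (Equiv.swap B.o p) * B.a A * (B.s (Equiv.swap B.o p))⁻¹ := rfl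

/-- image of base data -/
def map (φ : Γ →* Γ') : Bs ι F Γ' where
  o := B.o
  o' := B.o'
  ne := B.ne
  a := φ.comp B.a
  s := φ.comp B.s
  z := φ B.z

theorem map_cj (φ : Γ →* Γ') (x w : Γ) : φ (cj x w) = cj (φ x) (φ w) := by simp only [cj_apply, map_mul, map_inv]
theorem map_g (φ : Γ →* Γ') (p : ι) (A : S2 F) : φ (B.g p A) = (B.map φ).g p A := map_cj φ _ _
theorem map_yb (φ : Γ →* Γ') (p q : ι) : φ (B.yb p q) = (B.map φ).yb p q := map_cj φ _ _
theorem map_y (φ : Γ →* Γ') (p q : ι) (u v : V2 F) : φ (B.y p q u v) = (B.map φ).y p q u v := by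
  unfold y yF
  split_ifs
  · exact map_one φ
  · rw [map_cj, map_mul, map_g, map_g, map_yb]

/-- the list of relations -/
structure Rel (B : Bs ι F Γ) (o2 o3 : ι) (om : Fˣ) : Prop where
  r1 : ∀ σ, σ B.o = B.o → ∀ A, Commute (B.s σ) (B.a A)
  r2 : ∀ A A', Commute (B.a A) (B.g B.o' A')
  r3 : ∀ σ, σ B.o = B.o → σ B.o' = B.o' → Commute (B.s σ) B.z
  r3' : Commute (B.s (Equiv.swap B.o B.o')) B.z
  r4 : Commute B.z (B.a (TX ve 1))
  r4' : Commute B.z (B.a (TX ve om))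
  r4D : Commute B.z (B.a (D om) * B.g B.o' (D om⁻¹))
  r5 : o2 ≠ B.o → o2 ≠ B.o' → ∀ A, Commute B.z (B.g o2 A)
  r6 : ∀ d : F, d = 1 ∨ d = om → B.y B.o B.o' ve ve * B.y B.o B.o' ve (d • vf) = B.y B.o B.o' ve (ve + d • vf) * B.g B.o (TX ve (fm (d • vf) ve))
  r6' : B.y B.o B.o' ve ve * B.y B.o B.o' ve (-ve) = 1
  r7 : ∀ d : F, d = 1 ∨ d = om → B.y B.o B.o' ve ve * B.g B.o (TX vf d) * (B.y B.o B.o' ve ve)⁻¹ =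
    B.g B.o (TX vf d) * B.y B.o B.o' vf ((d * fm vf ve) • ve) * B.g B.o' (TX ve (d * fm vf ve ^ 2))
  r8 : o2 ≠ B.o → o2 ≠ B.o' → ∀ u', u' = ve ∨ u' = vf → B.y B.o B.o' ve ve * B.y B.o o2 u' ve * (B.y B.o B.o' ve ve)⁻¹ =
    B.y B.o o2 u' ve * B.y B.o' o2 (fm u' ve • ve) ve
  r9 : o2 ≠ B.o → o2 ≠ B.o' → o3 ≠ B.o → o3 ≠ B.o' → o3 ≠ o2 → Commute (B.y B.o B.o' ve ve) (B.y o2 o3 ve ve)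
  r10 : B.s (Equiv.swap B.o B.o') = B.g B.o' (D (-1)) * B.y B.o B.o' ve vf * B.y B.o B.o' vf (-ve) * B.y B.o B.o' ve vf

/-- action on the symplectic space -/
structure Act (B : Bs ι F Γ) (ρ : Γ →* Module.End F (ι → V2 F)) : Prop where
  ρa : ∀ A x, ρ (B.a A) x = Function.update x B.o (av A (x B.o))
  ρs : ∀ (σ : Equiv.Perm ι) x, ρ (B.s σ) x = x ∘ ⇑(σ⁻¹)
  ρz : ∀ x, ρ B.z x = x + Pi.single B.o' (fm (x B.o) ve • ve) + Pi.single B.o (fm (x B.o') ve • ve)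

theorem step {a b : ι} (σ : Equiv.Perm ι) (x : ι) (h1 : σ x ≠ b) (h2 : x ≠ a) : (Equiv.swap (σ a) b * σ) x = σ x := by
  rw [Equiv.Perm.mul_apply, Equiv.swap_apply_of_ne_of_ne (fun h => h2 (σ.injective h)) h1]
theorem step' (a b : ι) (σ : Equiv.Perm ι) : (Equiv.swap (σ a) b * σ) a = b := by
  rw [Equiv.Perm.mul_apply, Equiv.swap_apply_left]

variable {B} {o2 o3 : ι} {om : Fˣ}
theorem tau_o {p q : ι} (h : p ≠ q) : tau B.o B.o' p q B.o = p := by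
  have := step (a := B.o') (b := q) (Equiv.swap B.o p) B.o (by simpa) B.ne.symm
  rw [Equiv.swap_apply_left] at this; exact this
theorem tau_o' (p q : ι) : tau B.o B.o' p q B.o' = q := step' B.o' q (Equiv.swap B.o p)

theorem ex3 {p q r : ι} (h1 : p ≠ q) (h2 : p ≠ r) (h3 : q ≠ r) (k1 : o2 ≠ B.o) (k2 : o2 ≠ B.o') :
    ∃ σ : Equiv.Perm ι, σ B.o = p ∧ σ B.o' = q ∧ σ o2 = r := by
  refine ⟨Equiv.swap (tau B.o B.o' p q o2) r * tau B.o B.o' p q, ?_, ?_, step' _ _ _⟩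
  · rw [step _ _ (by rwa [tau_o h1]) k1.symm, tau_o h1]
  · rw [step _ _ (by rwa [tau_o']) k2.symm, tau_o']
theorem ex4 {p q r s : ι} (h1 : p ≠ q) (h2 : p ≠ r) (h3 : q ≠ r) (h4 : p ≠ s) (h5 : q ≠ s) (h6 : r ≠ s) (k1 : o2 ≠ B.o) (k2 : o2 ≠ B.o') (k3 : o3 ≠ B.o) (k4 : o3 ≠ B.o')
    (k5 : o3 ≠ o2) : ∃ σ : Equiv.Perm ι, σ B.o = p ∧ σ B.o' = q ∧ σ o2 = r ∧ σ o3 = s := by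
  obtain ⟨σ, e1, e2, e3⟩ := ex3 (B := B) h1 h2 h3 k1 k2
  refine ⟨Equiv.swap (σ o3) s * σ, ?_, ?_, ?_, step' _ _ _⟩
  · rw [step _ _ (by rwa [e1]) k3.symm, e1]
  · rw [step _ _ (by rwa [e2]) k4.symm, e2]
  · rw [step _ _ (by rwa [e3]) k5.symm, e3]

theorem Act.ρg {ρ : Γ →* Module.End F (ι → V2 F)} (H : B.Act ρ) (p : ι) (A : S2 F) (x : ι → V2 F) : ρ (B.g p A) x = Function.update x p (av A (x p)) := by
  rw [g_apply, ← map_inv]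
  simp only [map_mul, Module.End.mul_apply, H.ρa, H.ρs]
  ext1 t
  simp only [Function.comp_apply, Function.update_apply, inv_inv, Equiv.swap_inv, Equiv.swap_apply_left, Equiv.swap_apply_self, Equiv.swap_apply_eq_iff]

theorem Act.ρb {ρ : Γ →* Module.End F (ι → V2 F)} (H : B.Act ρ) {p q : ι} (h : p ≠ q) (x : ι → V2 F) : ρ (B.yb p q) x = x + Pi.single q (fm (x p) ve • ve) + Pi.single p (fm (x q) ve • ve) := by
  rw [yb, cj_apply, ← map_inv]
  have h1 := tau_o (B := B) h
  have h2 := tau_o' (B := B) p q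
  generalize tau B.o B.o' p q = σ at h1 h2 ⊢
  have e1 : ∀ t, σ⁻¹ t = B.o ↔ t = p := fun t => by rw [Equiv.Perm.inv_eq_iff_eq, h1]
  have e2 : ∀ t, σ⁻¹ t = B.o' ↔ t = q := fun t => by rw [Equiv.Perm.inv_eq_iff_eq, h2]
  simp only [map_mul, Module.End.mul_apply, H.ρz, H.ρs]
  ext1 t
  simp only [Function.comp_apply, inv_inv, Pi.add_apply, Pi.single_apply, e1, e2, h1, h2, perm_self_inv]

theorem Act.ρy {ρ : Γ →* Module.End F (ι → V2 F)} (H : B.Act ρ) {p q : ι} (h : p ≠ q) (u v : V2 F) (x : ι → V2 F) :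
    ρ (B.y p q u v) x = x + Pi.single q (fm (x p) u • v) + Pi.single p (fm (x q) v • u) := yF_ρ ρ H.ρg h (H.ρb h) u v x

namespace Rel
variable (R : B.Rel o2 o3 om)

theorem g_of (R : B.Rel o2 o3 om) {σ : Equiv.Perm ι} {p : ι} (h : σ B.o = p) (A : S2 F) : B.g p A = cj (B.s σ) (B.a A) := by
  have h1 : (σ⁻¹ * Equiv.swap B.o p) B.o = B.o := by
    rw [Equiv.Perm.mul_apply, Equiv.swap_apply_left, ← h, perm_inv_self]
  have e : Equiv.swap B.o p = σ * (σ⁻¹ * Equiv.swap B.o p) := by rw [mul_inv_cancel_left]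
  show cj (B.s _) _ = _
  rw [e, map_mul, cj_mul, cj_comm (R.r1 _ h1 A)]

theorem yb_of (R : B.Rel o2 o3 om) {σ : Equiv.Perm ι} {p q : ι} (hpq : p ≠ q) (h : σ B.o = p) (h' : σ B.o' = q) : B.yb p q = cj (B.s σ) B.z := by
  have h1 : (σ⁻¹ * tau B.o B.o' p q) B.o = B.o := by
    rw [Equiv.Perm.mul_apply, tau_o hpq, ← h, perm_inv_self]
  have h2 : (σ⁻¹ * tau B.o B.o' p q) B.o' = B.o' := by
    rw [Equiv.Perm.mul_apply, tau_o', ← h', perm_inv_self]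
  have e : tau B.o B.o' p q = σ * (σ⁻¹ * tau B.o B.o' p q) := by rw [mul_inv_cancel_left]
  rw [yb, e, map_mul, cj_mul, cj_comm (R.r3 _ h1 h2)]

theorem cg (R : B.Rel o2 o3 om) (σ : Equiv.Perm ι) (p : ι) (A : S2 F) : cj (B.s σ) (B.g p A) = B.g (σ p) A := by
  rw [R.g_of (σ := σ * Equiv.swap B.o p) (p := σ p) (by simp), map_mul, cj_mul]; rfl
theorem cyb (R : B.Rel o2 o3 om) (σ : Equiv.Perm ι) {p q : ι} (h : p ≠ q) : cj (B.s σ) (B.yb p q) = B.yb (σ p) (σ q) := by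
  rw [R.yb_of (σ := σ * tau B.o B.o' p q) (p := σ p) (q := σ q) (fun h' => h (σ.injective h')) (by rw [Equiv.Perm.mul_apply, tau_o h]) (by rw [Equiv.Perm.mul_apply, tau_o']), map_mul, cj_mul]; rfl
theorem cy (R : B.Rel o2 o3 om) (σ : Equiv.Perm ι) {p q : ι} (h : p ≠ q) (u v : V2 F) : cj (B.s σ) (B.y p q u v) = B.y (σ p) (σ q) u v := by
  unfold y yF
  split_ifs
  · exact map_one _
  · rw [map_cj, map_mul, R.cg, R.cg, R.cyb σ h]
theorem ga (R : B.Rel o2 o3 om) (A : S2 F) : B.g B.o A = B.a A := by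
  rw [R.g_of (σ := 1) (p := B.o) rfl, map_one, cj_one]
theorem ybz (R : B.Rel o2 o3 om) : B.yb B.o B.o' = B.z := by
  rw [R.yb_of (σ := 1) (p := B.o) (q := B.o') B.ne.symm rfl rfl, map_one, cj_one]

theorem has2 (B : Bs ι F Γ) {p q r : ι} (h1 : p ≠ q) (h2 : p ≠ r) (h3 : q ≠ r) : ∃ t, t ≠ B.o ∧ t ≠ B.o' := by
  refine ⟨(tau B.o B.o' p q)⁻¹ r, fun h => ?_, fun h => ?_⟩
  · rw [Equiv.Perm.inv_eq_iff_eq, tau_o h1] at h; exact h2 h.symm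
  · rw [Equiv.Perm.inv_eq_iff_eq, tau_o'] at h; exact h3 h.symm

/-- the relations give the middle data -/
noncomputable def toMid (R : B.Rel o2 o3 om) (hom : ∀ t : Fˣ, ∃ i : ℕ, t = om ^ i) (ho2 : ∀ r, r ≠ B.o → r ≠ B.o' → o2 ≠ B.o ∧ o2 ≠ B.o')
    (ho3 : o2 ≠ B.o → o2 ≠ B.o' → ∀ r, r ≠ B.o → r ≠ B.o' → r ≠ o2 → o3 ≠ B.o ∧ o3 ≠ B.o' ∧ o3 ≠ o2)
    {ρ : Γ →* Module.End F (ι → V2 F)} (H : B.Act ρ) : Mid ι F Γ :=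
  have E : ∀ {p q : ι}, p ≠ q → ∃ σ : Equiv.Perm ι, σ B.o = p ∧ σ B.o' = q := fun h => ⟨_, tau_o h, tau_o' _ _⟩
  have E3 : ∀ {p q r : ι}, p ≠ q → p ≠ r → q ≠ r → o2 ≠ B.o ∧ o2 ≠ B.o' := fun h1 h2 h3 => by
    obtain ⟨t, k1, k2⟩ := has2 B h1 h2 h3
    exact ho2 t k1 k2
  { g := B.g
    yb := B.yb
    om := om
    hom := hom
    ρ := ρ
    gg := fun {p q} h A A' => by
      obtain ⟨σ, rfl, rfl⟩ := E h
      rw [← R.cg, ← R.cg, R.ga]; exact comm_map _ (R.r2 A A')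
    bs := fun {p q} h => by
      obtain ⟨σ, rfl, rfl⟩ := E h
      rw [R.yb_of h rfl rfl, R.yb_of (σ := σ * Equiv.swap B.o B.o') h.symm (by simp) (by simp), map_mul, cj_mul, cj_comm R.r3']
    b1 := fun {p q} h => by
      obtain ⟨σ, rfl, rfl⟩ := E h
      rw [← R.cg, ← R.cyb _ B.ne.symm, R.ga, R.ybz]; exact comm_map _ R.r4
    b2 := fun {p q} h => by
      obtain ⟨σ, rfl, rfl⟩ := E h
      rw [← R.cg, ← R.cyb _ B.ne.symm, R.ga, R.ybz]; exact comm_map _ R.r4'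
    bD := fun {p q} h => by
      obtain ⟨σ, rfl, rfl⟩ := E h
      rw [← R.cg, ← R.cg, ← R.cyb _ B.ne.symm, R.ga, R.ybz, ← map_mul]; exact comm_map _ R.r4D
    bg := fun {p q r} h h1 h2 A => by
      obtain ⟨k1, k2⟩ := E3 h h1.symm h2.symm
      obtain ⟨σ, rfl, rfl, rfl⟩ := ex3 (B := B) h h1.symm h2.symm k1 k2
      rw [← R.cg, ← R.cyb _ B.ne.symm, R.ybz]; exact comm_map _ (R.r5 k1 k2 A).symm
    a2 := fun {p q} h d hd => by
      obtain ⟨σ, rfl, rfl⟩ := E h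
      have := congrArg (cj (B.s σ)) (R.r6 d hd)
      simp only [map_mul, R.cg, R.cy σ B.ne.symm] at this
      exact this
    a2n := fun {p q} h => by
      obtain ⟨σ, rfl, rfl⟩ := E h
      have := congrArg (cj (B.s σ)) R.r6'
      simp only [map_mul, map_one, R.cg, R.cy σ B.ne.symm] at this
      exact this
    a3 := fun {p q} h d hd => by
      obtain ⟨σ, rfl, rfl⟩ := E h
      have := congrArg (cj (B.s σ)) (R.r7 d hd)
      simp only [map_mul, map_inv, R.cg, R.cy σ B.ne.symm] at this
      exact this
    a4 := fun {p q r} h1 h2 h3 u' hu' => by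
      obtain ⟨k1, k2⟩ := E3 h1 h2 h3
      obtain ⟨σ, rfl, rfl, rfl⟩ := ex3 (B := B) h1 h2 h3 k1 k2
      have := congrArg (cj (B.s σ)) (R.r8 k1 k2 u' hu')
      simp only [map_mul, map_inv, R.cg, R.cy σ B.ne.symm, R.cy σ k1.symm, R.cy σ k2.symm] at this
      exact this
    a5 := fun {p q r s} h1 h2 h3 h4 h5 h6 => by
      obtain ⟨k1, k2⟩ := E3 h1 h2 h4
      obtain ⟨σ, e1, e2, e3⟩ := ex3 (B := B) h1 h2 h4 k1 k2
      obtain ⟨k3, k4, k5⟩ := ho3 k1 k2 (σ⁻¹ s) (fun h => h3 (by rw [← e1, ← h, perm_self_inv]))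
        (fun h => h5 (by rw [← e2, ← h, perm_self_inv])) (fun h => h6 (by rw [← e3, ← h, perm_self_inv]))
      obtain ⟨τ, rfl, rfl, rfl, rfl⟩ := ex4 (B := B) h1 h2 h4 h3 h5 h6 k1 k2 k3 k4 k5
      have := comm_map (cj (B.s τ)) (R.r9 k1 k2 k3 k4 k5)
      simp only [R.cy τ B.ne.symm, R.cy τ k5.symm] at this
      exact this
    ρg := H.ρg
    ρb := fun h x => H.ρb h x }

theorem inj [Fintype ι] (R : B.Rel o2 o3 om) (hom : ∀ t : Fˣ, ∃ i : ℕ, t = om ^ i) (ho2 : ∀ r, r ≠ B.o → r ≠ B.o' → o2 ≠ B.o ∧ o2 ≠ B.o')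
    (ho3 : o2 ≠ B.o → o2 ≠ B.o' → ∀ r, r ≠ B.o → r ≠ B.o' → r ≠ o2 → o3 ≠ B.o ∧ o3 ≠ B.o' ∧ o3 ≠ o2)
    {ρ : Γ →* Module.End F (ι → V2 F)} (H : B.Act ρ)
    (hgen : ∀ P : Subgroup Γ, (∀ A, B.a A ∈ P) → (∀ σ, B.s σ ∈ P) → B.z ∈ P → ∀ x, x ∈ P) (x : Γ) (hx : ρ x = 1) : x = 1 := by
  let M := R.toMid hom ho2 ho3 H
  let Dt := M.toData
  have hJ : (Finset.univ : Finset ι).toList.Nodup := Finset.nodup_toList _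
  refine (Dt.TrInj Finset.univ.toList hJ).2 x ?_ hx
  have mem : ∀ t : ι, t ∈ (Finset.univ : Finset ι).toList := fun t => by simp
  have hg : ∀ p A, B.g p A ∈ Dt.GJ Finset.univ.toList := fun p A => Dt.g_mem (mem p) A
  have hy : ∀ {p q : ι}, p ≠ q → ∀ u v, B.y p q u v ∈ Dt.GJ Finset.univ.toList := fun h u v => Dt.y_mem (mem _) (mem _) h u v
  have ha : ∀ A, B.a A ∈ Dt.GJ Finset.univ.toList := fun A => by rw [← R.ga]; exact hg _ _
  have hz : B.z ∈ Dt.GJ Finset.univ.toList := by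
    have h1 := hy B.ne.symm ve ve
    have h2 := M.yAB B.ne.symm 1 1
    rw [av_one, map_one, map_one, cj_one, cj_one] at h2
    have h3 : B.y B.o B.o' ve ve = B.yb B.o B.o' := h2
    rw [h3, R.ybz] at h1; exact h1
  have hs : B.s (Equiv.swap B.o B.o') ∈ Dt.GJ Finset.univ.toList := by
    rw [R.r10]
    exact mul_mem (mul_mem (mul_mem (hg _ _) (hy B.ne.symm _ _)) (hy B.ne.symm _ _)) (hy B.ne.symm _ _)
  have hc : ∀ {p q : ι}, p ≠ q → B.s (Equiv.swap p q) ∈ Dt.GJ Finset.univ.toList := by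
    intro p q h
    have := congrArg (cj (B.s (tau B.o B.o' p q))) R.r10
    rw [cj_apply, ← map_mul, ← map_inv, ← map_mul, ← Equiv.swap_apply_apply, tau_o h, tau_o'] at this
    rw [this]
    simp only [map_mul, R.cg, R.cy _ B.ne.symm, tau_o h, tau_o']
    exact mul_mem (mul_mem (mul_mem (hg _ _) (hy h _ _)) (hy h _ _)) (hy h _ _)
  refine hgen _ ha (fun σ => ?_) hz x
  have : (Dt.GJ Finset.univ.toList).comap B.s = ⊤ := by
    apply perm_top_of_star B.o
    intro p
    by_cases h : B.o = p
    · rw [h, Equiv.swap_self]; exact one_mem _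
    · exact hc h
  have h2 : σ ∈ (Dt.GJ Finset.univ.toList).comap B.s := by rw [this]; trivial
  exact h2

theorem surj [Fintype ι] (R : B.Rel o2 o3 om) (hom : ∀ t : Fˣ, ∃ i : ℕ, t = om ^ i) (ho2 : ∀ r, r ≠ B.o → r ≠ B.o' → o2 ≠ B.o ∧ o2 ≠ B.o')
    (ho3 : o2 ≠ B.o → o2 ≠ B.o' → ∀ r, r ≠ B.o → r ≠ B.o' → r ≠ o2 → o3 ≠ B.o ∧ o3 ≠ B.o' ∧ o3 ≠ o2)
    {ρ : Γ →* Module.End F (ι → V2 F)} (H : B.Act ρ) (hρ : Function.Injective ρ) (hΩ : ∀ γ x y, Data.Om (ρ γ x) (ρ γ y) = Data.Om x y)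
    (P : Subgroup Γ) (ha : ∀ A, B.a A ∈ P) (hs : ∀ σ, B.s σ ∈ P) (hz : B.z ∈ P) (x : Γ) : x ∈ P := by
  let M := R.toMid hom ho2 ho3 H
  let Dt := M.toData
  have hJ : (Finset.univ : Finset ι).toList.Nodup := Finset.nodup_toList _
  obtain ⟨l, hl, hl'⟩ := Dt.Surj hΩ Finset.univ.toList hJ (ρ x) (hΩ x) (fun t ht => absurd (by simp) ht)
  have : l = x := hρ hl'
  rw [← this]
  refine (Subgroup.closure_le P).2 ?_ hl
  have hcj : ∀ {w k}, w ∈ P → k ∈ P → cj w k ∈ P := fun hw hk => mul_mem (mul_mem hw hk) (inv_mem hw)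
  have hg : ∀ p A, B.g p A ∈ P := fun p A => hcj (hs _) (ha A)
  rintro _ (⟨r, hr, A, rfl⟩ | hh)
  · exact hg r A
  · obtain ⟨r, hr, s, hs', h, u, v, rfl⟩ := hh
    show B.y r s u v ∈ P
    unfold y yF
    split_ifs
    · exact one_mem P
    · exact hcj (mul_mem (hg _ _) (hg _ _)) (hcj (hs _) hz)

end Rel
end Bs
end LT

namespace LT
open SL2
variable {ι F : Type} [Field F] [DecidableEq ι] [Fintype ι]

/-- the symplectic group on the sum of planes -/
def SpI (ι F : Type) [Field F] [Fintype ι] : Subgroup ((ι → V2 F) ≃ₗ[F] (ι → V2 F)) where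
  carrier := {σ | ∀ x y, Data.Om (σ x) (σ y) = Data.Om x y}
  one_mem' := fun _ _ => rfl
  mul_mem' := fun {a b} ha hb x y => (ha (b x) (b y)).trans (hb x y)
  inv_mem' := fun {a} ha x y => by
    have := ha (a⁻¹ x) (a⁻¹ y)
    rw [← this]
    exact congrArg₂ _ (a.apply_symm_apply x) (a.apply_symm_apply y)

/-- the inclusion -/
def rS (ι F : Type) [Field F] [Fintype ι] : SpI ι F →* Module.End F (ι → V2 F) :=
  (LinearEquiv.automorphismGroup.toLinearMapMonoidHom).comp (SpI ι F).subtype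
theorem rS_apply (σ : SpI ι F) (x) : rS ι F σ x = σ.1 x := rfl
theorem rS_inj : Function.Injective (rS ι F) := fun σ τ h => Subtype.ext (LinearEquiv.toLinearMap_injective h)
theorem Sp_ext {σ τ : SpI ι F} (h : ∀ x t, rS ι F σ x t = rS ι F τ x t) : σ = τ := rS_inj (LinearMap.ext fun x => funext (h x))
theorem rS_Om (σ : SpI ι F) (x y) : Data.Om (rS ι F σ x) (rS ι F σ y) = Data.Om x y := σ.2 x y

/-- planar group at a point -/
def aE (o : ι) : S2 F →* SpI ι F where
  toFun A := ⟨{ toFun := fun x => Function.update x o (av A (x o))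
                invFun := fun x => Function.update x o (av A⁻¹ (x o))
                map_add' := fun x y => by
                  ext1 t; by_cases h : t = o
                  · subst h; simp [av_add]
                  · simp [Function.update_of_ne h]
                map_smul' := fun c x => by
                  ext1 t; by_cases h : t = o
                  · subst h; simp [av_smul]
                  · simp [Function.update_of_ne h]
                left_inv := fun x => by simp [av_inv]
                right_inv := fun x => by simp [av_inv'] }, fun x y => by
      refine Finset.sum_congr rfl fun t _ => ?_
      by_cases h : t = o
      · subst h; simp [fm_av]
      · simp [Function.update_of_ne h]⟩
  map_one' := by
    refine Subtype.ext (LinearEquiv.ext fun x => ?_)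
    simp
  map_mul' A B := by
    refine Subtype.ext (LinearEquiv.ext fun x => ?_)
    simp [av_mul]

/-- permutations -/
def pE : Equiv.Perm ι →* SpI ι F where
  toFun σ := ⟨LinearEquiv.funCongrLeft F (V2 F) σ⁻¹, fun x y => by
    exact Equiv.sum_comp (σ⁻¹ : Equiv.Perm ι) (fun t => fm (x t) (y t))⟩
  map_one' := rfl
  map_mul' σ τ := by
    refine Subtype.ext (LinearEquiv.ext fun x => ?_)
    ext1 t
    show x ((σ * τ)⁻¹ t) = x (τ⁻¹ (σ⁻¹ t))
    rw [mul_inv_rev]; rfl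

theorem zOm {o o' : ι} (h : o' ≠ o) (x y : ι → V2 F) : Data.Om (x + Pi.single o' (fm (x o) ve • ve) + Pi.single o (fm (x o') ve • ve))
    (y + Pi.single o' (fm (y o) ve • ve) + Pi.single o (fm (y o') ve • ve)) = Data.Om x y := by
  simp only [Data.Om]
  rw [← sub_eq_zero, ← Finset.sum_sub_distrib]
  rw [← Finset.sum_subset (Finset.subset_univ {o', o}), Finset.sum_pair h]
  · simp [fm, Pi.single_eq_of_ne h, Pi.single_eq_of_ne h.symm]; ring
  · intro t _ ht
    simp only [Finset.mem_insert, Finset.mem_singleton, not_or] at ht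
    simp [Pi.single_eq_of_ne ht.1, Pi.single_eq_of_ne ht.2]

/-- base Siegel element -/
def zE {o o' : ι} (h : o' ≠ o) : SpI ι F :=
  ⟨{ toFun := fun x => x + Pi.single o' (fm (x o) ve • ve) + Pi.single o (fm (x o') ve • ve)
     invFun := fun x => x - Pi.single o' (fm (x o) ve • ve) - Pi.single o (fm (x o') ve • ve)
     map_add' := fun x y => by
       simp only [Pi.add_apply, fm_add_left, add_smul, Pi.single_add]; abel
     map_smul' := fun c x => by
       simp only [Pi.smul_apply, fm_smul_left, mul_smul, Pi.single_smul, smul_add, RingHom.id_apply]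
     left_inv := fun x => by
       simp only [Pi.add_apply, Pi.single_eq_same, Pi.single_eq_of_ne h, Pi.single_eq_of_ne h.symm, fm_add_left, fm_smul_left, fm_self, mul_zero, add_zero, fm_zero_left]
       abel
     right_inv := fun x => by
       simp only [Pi.sub_apply, sub_eq_add_neg, Pi.add_apply, Pi.neg_apply, fm_neg_left, Pi.single_eq_same, Pi.single_eq_of_ne h, Pi.single_eq_of_ne h.symm, fm_add_left, fm_smul_left, fm_self, mul_zero, add_zero, fm_zero_left, neg_zero]
       abel }, fun x y => zOm h x y⟩

/-- base data in the symplectic group -/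
def BE {o o' : ι} (h : o' ≠ o) : Bs ι F (SpI ι F) where
  o := o
  o' := o'
  ne := h
  a := aE o
  s := pE
  z := zE h

theorem actE {o o' : ι} (h : o' ≠ o) : (BE (F := F) h).Act (rS ι F) where
  ρa _ _ := rfl
  ρs _ _ := rfl
  ρz _ := rfl

theorem D_neg (a : V2 F) : av (D (-1 : Fˣ)) a = -a := by
  exact v2_ext ((av_apply _ _ _).trans (by simp [coe_D])) ((av_apply _ _ _).trans (by simp [coe_D]))

set_option maxHeartbeats 4000000 in
theorem Bs.Act.rel {Γ : Type} [Group Γ] {B : Bs ι F Γ} {ρ : Γ →* Module.End F (ι → V2 F)} (H : B.Act ρ) (hρ : Function.Injective ρ) (o2 o3 : ι) (om : Fˣ) : B.Rel o2 o3 om := by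
  have h := B.ne
  have h' := B.ne.symm
  have hg := H.ρg
  have hy := fun u v x => H.ρy B.ne.symm u v x
  have ext : ∀ {X Y : Γ}, (∀ x t, ρ X x t = ρ Y x t) → X = Y := fun hh => hρ (LinearMap.ext fun x => funext (hh x))
  have yi : ∀ {p q : ι} (u v : V2 F), p ≠ q → ∀ x t, ρ (B.y p q u v) x t = x t + (if t = q then fm (x p) u • v else 0) + (if t = p then fm (x q) v • u else 0) := by
    intro p q u v hpq x t
    rw [H.ρy hpq]; simp only [Pi.add_apply, Pi.single_apply]
  have gi : ∀ (p : ι) A x t, ρ (B.g p A) x t = if t = p then av A (x p) else x t := by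
    intro p A x t
    rw [H.ρg]; simp only [Function.update_apply]
  have ai : ∀ A x t, ρ (B.a A) x t = if t = B.o then av A (x B.o) else x t := by
    intro A x t
    rw [H.ρa]; simp only [Function.update_apply]
  have zi : ∀ x t, ρ B.z x t = x t + (if t = B.o' then fm (x B.o) ve • ve else 0) + (if t = B.o then fm (x B.o') ve • ve else 0) := by
    intro x t
    rw [H.ρz]; simp only [Pi.add_apply, Pi.single_apply]
  have si : ∀ σ x t, ρ (B.s σ) x t = x (σ⁻¹ t) := fun σ x t => by rw [H.ρs]; rfl
  constructor
  · intro σ hσ A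
    apply ext; intro x t
    have e : σ⁻¹ B.o = B.o := by rw [Equiv.Perm.inv_eq_iff_eq]; exact hσ.symm
    have e' : σ⁻¹ t = B.o ↔ t = B.o := by rw [Equiv.Perm.inv_eq_iff_eq, hσ]
    simp only [map_mul, Module.End.mul_apply, ai, si, e, e']
  · intro A A'
    apply ext; intro x t
    simp only [map_mul, Module.End.mul_apply, ai, gi, h, h', if_false]
    clear yi gi ai zi si ext hg hy H hρ
    split_ifs <;> simp_all
  · intro σ hσ hσ'
    apply ext; intro x t
    have e : σ⁻¹ B.o = B.o := by rw [Equiv.Perm.inv_eq_iff_eq]; exact hσ.symm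
    have e' : σ⁻¹ t = B.o ↔ t = B.o := by rw [Equiv.Perm.inv_eq_iff_eq, hσ]
    have e1 : σ⁻¹ B.o' = B.o' := by rw [Equiv.Perm.inv_eq_iff_eq]; exact hσ'.symm
    have e1' : σ⁻¹ t = B.o' ↔ t = B.o' := by rw [Equiv.Perm.inv_eq_iff_eq, hσ']
    simp only [map_mul, Module.End.mul_apply, zi, si, e, e', e1, e1']
  · apply ext; intro x t
    simp only [map_mul, Module.End.mul_apply, zi, si, Equiv.swap_inv, Equiv.swap_apply_left, Equiv.swap_apply_right, Equiv.swap_apply_eq_iff]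
    exact add_right_comm _ _ _
  · apply ext; intro x t
    simp only [map_mul, Module.End.mul_apply, ai, zi, h, h', if_false, if_true]
    clear yi gi ai zi si ext hg hy H hρ
    split_ifs <;> simp_all [av_TX, fm_add_left, fm_smul_left] ; abel
  · apply ext; intro x t
    simp only [map_mul, Module.End.mul_apply, ai, zi, h, h', if_false, if_true]
    clear yi gi ai zi si ext hg hy H hρ
    split_ifs <;> simp_all [av_TX, fm_add_left, fm_smul_left] ; abel
  · apply ext; intro x t
    have e1 : ∀ (t : Fˣ) (w : V2 F), fm (av (D t) w) ve = (t : F)⁻¹ * fm w ve := by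
      intro t w; simp only [fm, av_apply]; simp [coe_D]
    simp only [map_mul, Module.End.mul_apply, ai, gi, zi, h, h', if_false, if_true, av_add, av_zero, add_zero, e1, av_smul, av_D_ve]
    clear yi gi ai zi si ext hg hy H hρ
    split_ifs <;> simp_all [smul_smul, mul_comm]
  · intro k1 k2 A
    apply ext; intro x t
    simp only [map_mul, Module.End.mul_apply, ai, gi, zi, h, h', k1, k2, k1.symm, k2.symm, if_false, if_true, add_zero]
    clear yi gi ai zi si ext hg hy H hρ
    split_ifs <;> simp_all
  · intro d _
    apply ext; intro x t
    simp only [map_mul, Module.End.mul_apply, gi, yi _ _ h', h, h', if_false, if_true]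
    clear yi gi ai zi si ext hg hy H hρ
    split_ifs <;> simp_all [av_TX] <;> refine v2_ext ?_ ?_ <;> simp [fm] <;> ring
  · apply ext; intro x t
    simp only [map_mul, Module.End.mul_apply, gi, yi _ _ h', h, h', if_false, if_true]
    clear yi gi ai zi si ext hg hy H hρ
    split_ifs <;> simp_all <;> refine v2_ext ?_ ?_ <;> simp [fm] <;> ring
  · intro d _
    rw [mul_inv_eq_iff_eq_mul]
    apply ext; intro x t
    simp only [map_mul, Module.End.mul_apply, gi, yi _ _ h', h, h', if_false, if_true]
    clear yi gi ai zi si ext hg hy H hρ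
    split_ifs <;> simp_all [av_TX] <;> refine v2_ext ?_ ?_ <;> simp [fm] <;> ring
  · intro k1 k2 u' _
    rw [mul_inv_eq_iff_eq_mul]
    apply ext; intro x t
    simp only [map_mul, Module.End.mul_apply, gi, yi _ _ h', yi _ _ k1.symm, yi _ _ k2.symm, k1, k2, k1.symm, k2.symm, h, h', if_false, if_true]
    clear yi gi ai zi si ext hg hy
    by_cases ht : t = B.o
    · subst ht
      simp only [h, h', k1.symm, if_false, if_true, add_zero]
      refine v2_ext ?_ ?_ <;> simp [fm] <;> ring
    by_cases ht' : t = B.o'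
    · subst ht'
      simp only [h, h', k2.symm, if_false, if_true, add_zero]
      refine v2_ext ?_ ?_ <;> simp [fm] <;> ring
    by_cases ht2 : t = o2
    · subst ht2
      simp only [k1, k2, if_false, if_true, add_zero]
      refine v2_ext ?_ ?_ <;> simp [fm] <;> ring
    · simp only [ht, ht', ht2, if_false, add_zero]
  · intro k1 k2 k3 k4 k5
    apply ext; intro x t
    simp only [map_mul, Module.End.mul_apply, gi, yi _ _ h', yi _ _ k5.symm, k1, k2, k3, k4, k1.symm, k2.symm, k3.symm, k4.symm, k5, k5.symm, h, h', if_false, if_true, add_zero]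
    clear yi gi ai zi si ext hg hy
    abel
  · apply ext; intro x t
    simp only [map_mul, Module.End.mul_apply, gi, si, yi _ _ h', h, h', if_false, if_true, D_neg, Equiv.swap_inv]
    by_cases ht : t = B.o
    · subst ht
      simp [h, h']
      refine v2_ext ?_ ?_ <;> simp [fm] <;> ring
    by_cases ht' : t = B.o'
    · subst ht'
      simp [h, h']
      refine v2_ext ?_ ?_ <;> simp [fm] <;> ring
    · simp [Equiv.swap_apply_of_ne_of_ne ht ht', ht, ht']

end LT

namespace LT
open SL2
variable {ι F Γ Γ' : Type} [Field F] [DecidableEq ι] [Group Γ] [Group Γ']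

open Classical in
/-- the finite list of relators -/
noncomputable def Bs.rl (B : Bs ι F Γ) (o2 o3 : ι) (om : Fˣ) (A : List (S2 F)) (S S' : List (Equiv.Perm ι)) : List Γ :=
  ((S ×ˢ A).map (fun x => ⁅B.s x.1, B.a x.2⁆) ++ (A ×ˢ A).map (fun x => ⁅B.a x.1, B.g B.o' x.2⁆) ++ S'.map (fun σ => ⁅B.s σ, B.z⁆) ++
    A.map (fun x => if o2 ≠ B.o ∧ o2 ≠ B.o' then ⁅B.z, B.g o2 x⁆ else 1)) ++
  ([⁅B.s (Equiv.swap B.o B.o'), B.z⁆, ⁅B.z, B.a (TX ve 1)⁆, ⁅B.z, B.a (TX ve om)⁆, ⁅B.z, B.a (D om) * B.g B.o' (D om⁻¹)⁆,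
    B.y B.o B.o' ve ve * B.y B.o B.o' ve (-ve),
    (if o2 ≠ B.o ∧ o2 ≠ B.o' ∧ o3 ≠ B.o ∧ o3 ≠ B.o' ∧ o3 ≠ o2 then ⁅B.y B.o B.o' ve ve, B.y o2 o3 ve ve⁆ else 1),
    B.s (Equiv.swap B.o B.o') * (B.g B.o' (D (-1)) * B.y B.o B.o' ve vf * B.y B.o B.o' vf (-ve) * B.y B.o B.o' ve vf)⁻¹] ++
  [(1 : F), om].map (fun d => B.y B.o B.o' ve ve * B.y B.o B.o' ve (d • vf) * (B.y B.o B.o' ve (ve + d • vf) * B.g B.o (TX ve (fm (d • vf) ve)))⁻¹) ++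
  [(1 : F), om].map (fun d => B.y B.o B.o' ve ve * B.g B.o (TX vf d) * (B.y B.o B.o' ve ve)⁻¹ *
    (B.g B.o (TX vf d) * B.y B.o B.o' vf ((d * fm vf ve) • ve) * B.g B.o' (TX ve (d * fm vf ve ^ 2)))⁻¹) ++
  [(ve : V2 F), vf].map (fun u' => if o2 ≠ B.o ∧ o2 ≠ B.o' then B.y B.o B.o' ve ve * B.y B.o o2 u' ve * (B.y B.o B.o' ve ve)⁻¹ *
    (B.y B.o o2 u' ve * B.y B.o' o2 (fm u' ve • ve) ve)⁻¹ else 1))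

theorem Bs.rl_length (B : Bs ι F Γ) (o2 o3 : ι) (om : Fˣ) (A : List (S2 F)) (S S' : List (Equiv.Perm ι)) :
    (B.rl o2 o3 om A S S').length = S.length * A.length + A.length * A.length + S'.length + A.length + 13 := by
  simp [Bs.rl, List.length_product]; ring

theorem Bs.rl_map (B : Bs ι F Γ) (φ : Γ →* Γ') (o2 o3 : ι) (om : Fˣ) (A : List (S2 F)) (S S' : List (Equiv.Perm ι)) :
    (B.rl o2 o3 om A S S').map φ = (B.map φ).rl o2 o3 om A S S' := by
  have e : ∀ (P : Prop) [Decidable P] (x : Γ), φ (if P then x else 1) = if P then φ x else 1 := by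
    intro P _ x; split_ifs; rfl; exact map_one φ
  simp only [Bs.rl, List.map_append, List.map_map, Function.comp_def, List.map_cons, List.map_nil, e, map_commutatorElement, map_mul, map_inv, Bs.map_g, Bs.map_y]
  rfl

theorem cent_le {X Y : Type} [Group X] [Group Y] (f : X →* Y) (S : Set X) (z : Y) (h : ∀ s ∈ S, Commute (f s) z) : ∀ x ∈ Subgroup.closure S, Commute (f x) z := by
  have hle : Subgroup.closure S ≤ (Subgroup.centralizer {z}).comap f := by
    rw [Subgroup.closure_le]
    intro g hg
    show _ ∈ Subgroup.centralizer {z}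
    rw [Subgroup.mem_centralizer_singleton_iff]
    exact (h g hg).eq
  intro x hx
  have := hle hx
  rw [Subgroup.mem_comap, Subgroup.mem_centralizer_singleton_iff] at this
  exact this

theorem Bs.rl_rel (B : Bs ι F Γ) (o2 o3 : ι) (om : Fˣ) (A : List (S2 F)) (S S' : List (Equiv.Perm ι)) (hA : Subgroup.closure {x | x ∈ A} = ⊤)
    (hS : ∀ g : Equiv.Perm ι, g B.o = B.o → g ∈ Subgroup.closure {g | g ∈ S})
    (hS' : ∀ g : Equiv.Perm ι, g B.o = B.o → g B.o' = B.o' → g ∈ Subgroup.closure {g | g ∈ S'})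
    (h : ∀ e ∈ B.rl o2 o3 om A S S', e = 1) : B.Rel o2 o3 om := by
  simp only [Bs.rl, List.forall_mem_append, List.forall_mem_map, List.forall_mem_cons, List.not_mem_nil, false_imp_iff, implies_true, and_true,
    commutatorElement_eq_one_iff_commute, mul_inv_eq_one, List.mem_product, Prod.forall, and_imp, ite_eq_right_iff] at h
  obtain ⟨⟨⟨⟨h1, h2⟩, h3⟩, h5⟩, ⟨⟨⟨h3', h4, h4', h4D, h6', h9, h10⟩, h6⟩, h7⟩, h8⟩ := h
  have tA : ∀ x : S2 F, x ∈ Subgroup.closure {x | x ∈ A} := fun x => hA ▸ Subgroup.mem_top x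
  exact {
    r1 := fun σ hσ x => cent_le B.s {g | g ∈ S} _ (fun g hg => (cent_le B.a {x | x ∈ A} _ (fun x hx => (h1 g x hg hx).symm) x (tA x)).symm) σ (hS σ hσ)
    r2 := fun x x' => cent_le B.a {x | x ∈ A} _ (fun x hx => (cent_le (B.g B.o') {x | x ∈ A} _ (fun x' hx' => (h2 x x' hx hx').symm) x' (tA x')).symm) x (tA x)
    r3 := fun σ hσ hσ' => cent_le B.s {g | g ∈ S'} _ h3 σ (hS' σ hσ hσ')
    r3' := h3'
    r4 := h4
    r4' := h4'
    r4D := h4D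
    r5 := fun k1 k2 x => (cent_le (B.g o2) {x | x ∈ A} _ (fun x hx => (h5 x hx k1 k2).symm) x (tA x)).symm
    r6 := fun d hd => by
      rcases hd with rfl | rfl
      · exact h6.1
      · exact h6.2
    r6' := h6'
    r7 := fun d hd => by
      rcases hd with rfl | rfl
      · exact h7.1
      · exact h7.2
    r8 := fun k1 k2 u hu => by
      rcases hu with rfl | rfl
      · exact h8.1 k1 k2
      · exact h8.2 k1 k2
    r9 := h9
    r10 := h10 }

theorem Bs.rel_rl (B : Bs ι F Γ) (o2 o3 : ι) (om : Fˣ) (A : List (S2 F)) (S S' : List (Equiv.Perm ι))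
    (hS : ∀ g ∈ S, g B.o = B.o) (hS' : ∀ g ∈ S', g B.o = B.o ∧ g B.o' = B.o') (R : B.Rel o2 o3 om) : ∀ e ∈ B.rl o2 o3 om A S S', e = 1 := by
  simp only [Bs.rl, List.forall_mem_append, List.forall_mem_map, List.forall_mem_cons, List.not_mem_nil, false_imp_iff, implies_true, and_true,
    commutatorElement_eq_one_iff_commute, mul_inv_eq_one, List.mem_product, Prod.forall, and_imp, ite_eq_right_iff]
  exact ⟨⟨⟨⟨fun σ x hσ _ => R.r1 σ (hS σ hσ) x, fun x x' _ _ => R.r2 x x'⟩, fun σ hσ => R.r3 σ (hS' σ hσ).1 (hS' σ hσ).2⟩, fun x _ k1 k2 => R.r5 k1 k2 x⟩,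
    ⟨⟨⟨R.r3', R.r4, R.r4', R.r4D, R.r6', R.r9, R.r10⟩, R.r6 _ (Or.inl rfl), R.r6 _ (Or.inr rfl)⟩, R.r7 _ (Or.inl rfl), R.r7 _ (Or.inr rfl)⟩,
    fun k1 k2 => R.r8 k1 k2 _ (Or.inl rfl), fun k1 k2 => R.r8 k1 k2 _ (Or.inr rfl)⟩

theorem Bs.rl_bl (B : Bs ι F Γ) (T : Set Γ) (ha : ∀ x, B.a x ∈ T) (hs : ∀ x y, B.s (Equiv.swap x y) ∈ T) (hz : B.z ∈ T) (o2 o3 : ι) (om : Fˣ) (A : List (S2 F)) (S S' : List (Equiv.Perm ι))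
    (hS : ∀ g ∈ S, B.s g ∈ T) (hS' : ∀ g ∈ S', B.s g ∈ T) : ∀ e ∈ B.rl o2 o3 om A S S', Bl T 100 e := by
  have ba : ∀ x, Bl T 1 (B.a x) := fun x => Bl.of (ha x)
  have bs : ∀ x y, Bl T 1 (B.s (Equiv.swap x y)) := fun x y => Bl.of (hs x y)
  have bz : Bl T 1 B.z := Bl.of hz
  have bg : ∀ p x, Bl T 3 (B.g p x) := fun p x => (((bs _ _).mul (ba x)).mul (bs _ _).inv).le (by norm_num)
  have byb : ∀ p q, Bl T 5 (B.yb p q) := fun p q => by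
    have : Bl T 2 (B.s (Bs.tau B.o B.o' p q)) := by rw [Bs.tau, map_mul]; exact (bs _ _).mul (bs _ _)
    exact ((this.mul bz).mul this.inv).le (by norm_num)
  have by' : ∀ p q u v, Bl T 17 (B.y p q u v) := fun p q u v => by
    unfold Bs.y yF
    split_ifs
    · exact Bl.one
    · exact ((((bg _ _).mul (bg _ _)).mul (byb _ _)).mul ((bg _ _).mul (bg _ _)).inv).le (by norm_num)
  have bi : ∀ (P : Prop) [Decidable P] (x : Γ), Bl T 100 x → Bl T 100 (if P then x else 1) := by
    intro P _ x hx; split_ifs; exact hx; exact Bl.one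
  simp only [Bs.rl, List.forall_mem_append, List.forall_mem_map, List.forall_mem_cons, List.not_mem_nil, false_imp_iff, implies_true, and_true,
    List.mem_product, Prod.forall, and_imp]
  refine ⟨⟨⟨⟨fun σ x hσ _ => (Bl.comm (Bl.of (k := 1) (hS σ hσ)) (ba x)).le (by norm_num), fun x x' _ _ => ((ba x).comm (bg _ _)).le (by norm_num)⟩,
    fun σ hσ => (Bl.comm (Bl.of (k := 1) (hS' σ hσ)) bz).le (by norm_num)⟩, fun x _ => bi _ _ ((bz.comm (bg _ _)).le (by norm_num))⟩,
    ⟨⟨⟨?_, ?_, ?_, ?_, ?_, bi _ _ ?_, ?_⟩, ?_, ?_⟩, ?_, ?_⟩,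
    bi _ _ ?_, bi _ _ ?_⟩
  all_goals
    apply Bl.le
    · repeat' first
        | exact bz
        | exact ba _
        | exact bs _ _
        | exact bg _ _
        | exact by' _ _ _ _
        | apply Bl.comm
        | apply Bl.mul
        | apply Bl.inv
    · norm_num

theorem spMain [Fintype ι] [Fintype F] {c1 c2 ℓ N : ℕ} (hl : 1 ≤ ℓ) (h1 : SP c1 ℓ (S2 F) Set.univ) {T : Set (Equiv.Perm ι)} (h2 : SP c2 ℓ (Equiv.Perm ι) T)
    (sw : ∀ x y, Equiv.swap x y ∈ T) {o o' : ι} (h : o' ≠ o) (S S' : List (Equiv.Perm ι)) (hN : S.length ≤ N) (hN' : S'.length ≤ N)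
    (ST : ∀ g ∈ S, g ∈ T) (ST' : ∀ g ∈ S', g ∈ T) (So : ∀ g ∈ S, g o = o) (So' : ∀ g ∈ S', g o = o ∧ g o' = o')
    (Sg : ∀ g : Equiv.Perm ι, g o = o → g ∈ Subgroup.closure {g | g ∈ S})
    (Sg' : ∀ g : Equiv.Perm ι, g o = o → g o' = o' → g ∈ Subgroup.closure {g | g ∈ S'}) :
    SP (101 * (c1 + (c2 + 1)) + (N * c1 + c1 * c1 + N + c1 + 13)) ℓ (SpI ι F) (Set.range (aE o) ∪ pE '' T ∪ {zE h}) := by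
  obtain ⟨om, hom⟩ := IsCyclic.exists_monoid_generator (α := Fˣ)
  obtain ⟨a, hA, -⟩ := h1.gens hl
  obtain ⟨o2, o3, ho2, ho3⟩ : ∃ o2 o3 : ι, (∀ r, r ≠ o → r ≠ o' → o2 ≠ o ∧ o2 ≠ o') ∧
      (o2 ≠ o → o2 ≠ o' → ∀ r, r ≠ o → r ≠ o' → r ≠ o2 → o3 ≠ o ∧ o3 ≠ o' ∧ o3 ≠ o2) := by
    by_cases k : ∃ r, r ≠ o ∧ r ≠ o'
    · obtain ⟨r, k1, k2⟩ := k
      by_cases k' : ∃ r', r' ≠ o ∧ r' ≠ o' ∧ r' ≠ r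
      · obtain ⟨r', k3⟩ := k'
        exact ⟨r, r', fun _ _ _ => ⟨k1, k2⟩, fun _ _ _ _ _ _ => k3⟩
      · exact ⟨r, r, fun _ _ _ => ⟨k1, k2⟩, fun _ _ r' a b c => absurd ⟨r', a, b, c⟩ k'⟩
    · exact ⟨o, o, fun r a b => absurd ⟨r, a, b⟩ k, fun k => absurd rfl k⟩
  have hom' : ∀ t : Fˣ, ∃ i : ℕ, t = om ^ i := fun t => by
    obtain ⟨i, hi⟩ := hom t; exact ⟨i, hi.symm⟩
  have hA' : Subgroup.closure {x | x ∈ List.ofFn a} = ⊤ := by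
    rw [← hA]; congr 1; ext x; simp [List.mem_ofFn]
  obtain ⟨K, _, TK, j, j', z, hK, mh, mh', mz, hlift, hmem⟩ := pieces3 hl h1 h2
  obtain ⟨f, fh, fh', fz⟩ := hlift _ (aE (F := F) o) pE (zE h)
  let B : Bs ι F K := ⟨o, o', h, j, j', z⟩
  have Bf : B.map f = BE h := by
    simp only [B, Bs.map, BE, fz]
    congr 1
    · ext1 x; exact fh x
    · ext1 x; exact fh' x
  have := hK.assembleL f ?_ (N * c1 + c1 * c1 + N + c1 + 13) (B.rl o2 o3 om (List.ofFn a) S S') ?_ (k := 100) ?_ ?_ ?_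
  · refine this.mono (by omega) le_rfl ?_
    rintro _ ((⟨t, rfl⟩ | ⟨t, ht, rfl⟩) | rfl)
    · exact ⟨_, mh t trivial, fh t⟩
    · exact ⟨_, mh' t ht, fh' t⟩
    · exact ⟨_, mz, fz⟩
  · intro x
    refine ((actE (F := F) h).rel rS_inj o2 o3 om).surj hom' ho2 ho3 (actE h) rS_inj rS_Om f.range ?_ ?_ ?_ x
    · exact fun A => ⟨_, fh A⟩
    · exact fun A => ⟨_, fh' A⟩
    · exact ⟨_, fz⟩
  · rw [Bs.rl_length, List.length_ofFn]
    gcongr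
  · exact B.rl_bl TK (fun x => mh _ trivial) (fun x y => mh' _ (sw x y)) mz _ _ _ _ _ _ (fun g hg => mh' _ (ST g hg)) (fun g hg => mh' _ (ST' g hg))
  · intro e he
    have := (BE (F := F) h).rel_rl o2 o3 om (List.ofFn a) S S' So So' ((actE (F := F) h).rel rS_inj o2 o3 om)
    rw [← Bf, ← Bs.rl_map] at this
    exact this _ (List.mem_map_of_mem he)
  · intro Γ _ ψ π hψ hπ hr
    have R : (B.map ψ).Rel o2 o3 om := by
      refine Bs.rl_rel _ o2 o3 om (List.ofFn a) S S' hA' Sg Sg' ?_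
      rw [← Bs.rl_map]
      intro e he
      obtain ⟨x, hx, rfl⟩ := List.mem_map.1 he
      exact hr x hx
    have H : (B.map ψ).Act ((rS ι F).comp π) := by
      have H := actE (F := F) h
      refine ⟨fun A x => ?_, fun σ x => ?_, fun x => ?_⟩
      · show rS ι F (π (ψ (j A))) x = _
        rw [hπ, fh]; rfl
      · show rS ι F (π (ψ (j' σ))) x = _
        rw [hπ, fh']; rfl
      · show rS ι F (π (ψ z)) x = _
        rw [hπ, fz]; rfl
    rw [injective_iff_map_eq_one]
    intro x hx
    refine R.inj hom' ho2 ho3 H ?_ x (by rw [MonoidHom.comp_apply, hx, map_one])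
    intro P p1 p2 p3 x
    obtain ⟨x, rfl⟩ := hψ x
    exact hmem Γ ψ P p1 p2 p3 x

end LT

namespace LT
open SL2
variable {ι F : Type} [Field F] [DecidableEq ι] [Fintype ι]

theorem sgn_sq (s : ℤˣ) : ((s : ℤ) : F) * ((s : ℤ) : F) = 1 := by
  rw [← Int.cast_mul, ← Units.val_mul, Int.units_mul_self]; simp

/-- diagonal signs -/
def muE : (ι → ℤˣ) →* SpI ι F where
  toFun v := ⟨{ toFun := fun x t => ((v t : ℤ) : F) • x t
                invFun := fun x t => ((v t : ℤ) : F) • x t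
                map_add' := fun x y => by ext1 t; simp
                map_smul' := fun c x => by ext1 t; simp [smul_comm c]
                left_inv := fun x => by ext1 t; simp only [smul_smul, sgn_sq, one_smul]
                right_inv := fun x => by ext1 t; simp only [smul_smul, sgn_sq, one_smul] }, fun x y => by
      refine Finset.sum_congr rfl fun t _ => ?_
      show fm (((v t : ℤ) : F) • x t) (((v t : ℤ) : F) • y t) = _
      rw [fm_smul_left, fm_smul_right, ← mul_assoc, sgn_sq, one_mul]⟩
  map_one' := by
    refine Sp_ext fun x t => ?_
    show (((1 : ℤˣ) : ℤ) : F) • x t = x t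
    simp
  map_mul' v w := by
    refine Sp_ext fun x t => ?_
    show (((v t * w t : ℤˣ) : ℤ) : F) • x t = ((v t : ℤ) : F) • (((w t : ℤ) : F) • x t)
    rw [smul_smul]; push_cast; rfl

theorem muE_rS (v : ι → ℤˣ) (x : ι → V2 F) (t : ι) : rS ι F (muE v) x t = ((v t : ℤ) : F) • x t := rfl
theorem pE_rS (σ : Equiv.Perm ι) (x : ι → V2 F) (t : ι) : rS ι F (pE σ) x t = x (σ⁻¹ t) := rfl
theorem aE_rS (o : ι) (A : S2 F) (x : ι → V2 F) : rS ι F (aE o A) x = Function.update x o (av A (x o)) := rfl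

theorem muE_conj (σ : Equiv.Perm ι) (v : ι → ℤˣ) : pE σ * muE v * (pE σ)⁻¹ = (muE (v ∘ ⇑(σ⁻¹)) : SpI ι F) := by
  rw [mul_inv_eq_iff_eq_mul]
  refine Sp_ext fun x t => ?_
  simp only [map_mul, Module.End.mul_apply, muE_rS, pE_rS, Function.comp_apply]

theorem muE_single (o : ι) : (muE (Pi.mulSingle o (-1)) : SpI ι F) = aE o (D (-1)) := by
  refine Sp_ext fun x t => ?_
  rw [muE_rS, aE_rS, D_neg]
  by_cases h : t = o
  · subst h; simp
  · simp [h]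

theorem muE_single' (o t : ι) : (muE (Pi.mulSingle t (-1)) : SpI ι F) = pE (Equiv.swap o t) * aE o (D (-1)) * (pE (Equiv.swap o t))⁻¹ := by
  rw [← muE_single, muE_conj, P1.single_comp, Equiv.swap_apply_left]

theorem center_SpI (o : ι) (σ : SpI ι F) (h : ∀ τ, σ * τ = τ * σ) : σ = 1 ∨ σ = muE (fun _ => -1) := by
  have hc : ∀ τ x, rS ι F σ (rS ι F τ x) = rS ι F τ (rS ι F σ x) := fun τ x => by
    have := congrArg (fun s => rS ι F s x) (h τ)
    simpa only [map_mul, Module.End.mul_apply] using this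
  have hu : ∀ (u : V2 F) A, Function.update (Pi.single o u : ι → V2 F) o (av A ((Pi.single o u : ι → V2 F) o)) = Pi.single o (av A u) := fun u A => by
    ext1 t; by_cases ht : t = o
    · subst ht; simp
    · simp [ht]
  have h1 : rS ι F σ (Pi.single o ve) = fm (rS ι F σ (Pi.single o (-vf)) o) ve • (Pi.single o ve : ι → V2 F) := by
    have := hc (aE o (TX ve 1)) (Pi.single o (-vf))
    rw [aE_rS, hu, aE_rS, av_TX] at this
    simp only [fm_neg_left, fm_fe, neg_neg, mul_one, one_smul, Pi.single_add, map_add, av_TX, one_mul] at this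
    ext1 t
    have := congrFun this t
    by_cases ht : t = o
    · subst ht; simpa using this
    · simpa [ht] using this
  generalize fm (rS ι F σ (Pi.single o (-vf)) o) ve = c at h1
  have h2 : ∀ u : V2 F, rS ι F σ (Pi.single o u) = c • (Pi.single o u : ι → V2 F) := by
    intro u
    by_cases hu0 : u = 0
    · subst hu0; simp
    have := hc (aE o (Av u)) (Pi.single o ve)
    rw [aE_rS, hu, aE_rS, h1, Av_spec hu0] at this
    rw [this]
    ext1 t; by_cases ht : t = o
    · subst ht; simp [av_smul, Av_spec hu0]
    · simp [ht]
  have h3 : ∀ t (u : V2 F), rS ι F σ (Pi.single t u) = c • (Pi.single t u : ι → V2 F) := by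
    intro t u
    have e : rS ι F (pE (Equiv.swap o t)) (Pi.single o u) = Pi.single t u := by
      ext1 s
      rw [pE_rS, Equiv.swap_inv]
      simp only [Pi.single_apply, Equiv.swap_apply_eq_iff, Equiv.swap_apply_left]
    have := hc (pE (Equiv.swap o t)) (Pi.single o u)
    rw [e, h2, map_smul, e] at this
    exact this
  have h4 : ∀ x, rS ι F σ x = c • x := by
    intro x
    conv_lhs => rw [← Finset.univ_sum_single x]
    rw [map_sum]
    simp only [h3]
    rw [← Finset.smul_sum, Finset.univ_sum_single]
  have h5 : c * c = 1 := by
    have := rS_Om σ (Pi.single o ve) (Pi.single o vf)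
    simp only [h4, Data.Om, Pi.smul_apply, fm_smul_left, fm_smul_right] at this
    rw [Finset.sum_eq_single o (by intro b _ hb; simp [hb]) (by simp), Finset.sum_eq_single o (by intro b _ hb; simp [hb]) (by simp)] at this
    simpa using this
  rcases mul_self_eq_one_iff.1 h5 with rfl | rfl
  · left; refine Sp_ext fun x t => ?_
    rw [h4]; simp
  · right; refine Sp_ext fun x t => ?_
    rw [h4, muE_rS]; simp

/-- coordinates -/
def cE {n : ℕ} (k : Fin n ≃ ι) : (ι → V2 F) ≃ₗ[F] (Fin n ⊕ Fin n → F) where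
  toFun x := Sum.elim (fun i => x (k i) 0) (fun i => x (k i) 1)
  invFun v := fun t => ![v (Sum.inl (k.symm t)), v (Sum.inr (k.symm t))]
  map_add' x y := by ext (i | i) <;> simp
  map_smul' c x := by ext (i | i) <;> simp
  left_inv x := by ext1 t; exact v2_ext (by simp) (by simp)
  right_inv v := by ext (i | i) <;> simp

open Matrix in
theorem cE_form {n : ℕ} (k : Fin n ≃ ι) (x y : ι → V2 F) : cE k x ⬝ᵥ (J (Fin n) F *ᵥ cE k y) = - Data.Om x y := by
  have : Data.Om x y = ∑ i, fm (x (k i)) (y (k i)) := (Equiv.sum_comp k (fun t => fm (x t) (y t))).symm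
  rw [this]
  simp only [cE, J, LinearEquiv.coe_mk, LinearMap.coe_mk, AddHom.coe_mk, Matrix.fromBlocks_mulVec, dotProduct, Fintype.sum_sum_type, Sum.elim_inl, Sum.elim_inr]
  rw [← Finset.sum_add_distrib, ← Finset.sum_neg_distrib]
  refine Finset.sum_congr rfl fun i _ => ?_
  simp [fm, Function.comp_def, Matrix.neg_mulVec]; ring

open Matrix in
theorem mulVec_form {n : ℕ} (A M : Matrix (Fin n ⊕ Fin n) (Fin n ⊕ Fin n) F) (v w : Fin n ⊕ Fin n → F) : (A *ᵥ v) ⬝ᵥ (M *ᵥ (A *ᵥ w)) = v ⬝ᵥ ((Aᵀ * M * A) *ᵥ w) := by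
  rw [← Matrix.mulVec_mulVec, ← Matrix.mulVec_mulVec, Matrix.dotProduct_mulVec v Aᵀ, Matrix.vecMul_transpose]

open Matrix in
/-- the matrix group and the geometric group -/
def isoHom {n : ℕ} (k : Fin n ≃ ι) : symplecticGroup (Fin n) F →* SpI ι F where
  toFun A := ⟨{ toFun := fun x => (cE k).symm (A.1 *ᵥ cE k x)
                invFun := fun x => (cE k).symm ((A⁻¹).1 *ᵥ cE k x)
                map_add' := fun x y => by simp [Matrix.mulVec_add]
                map_smul' := fun c x => by simp [Matrix.mulVec_smul]
                left_inv := fun x => by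
                  have : (A⁻¹).1 * A.1 = 1 := congrArg Subtype.val (inv_mul_cancel A)
                  simp only [LinearEquiv.apply_symm_apply, Matrix.mulVec_mulVec, this, Matrix.one_mulVec, LinearEquiv.symm_apply_apply]
                right_inv := fun x => by
                  have : A.1 * (A⁻¹).1 = 1 := congrArg Subtype.val (mul_inv_cancel A)
                  simp only [LinearEquiv.apply_symm_apply, Matrix.mulVec_mulVec, this, Matrix.one_mulVec, LinearEquiv.symm_apply_apply] }, fun x y => by
      apply neg_injective
      rw [← cE_form k, ← cE_form k]
      show cE k ((cE k).symm _) ⬝ᵥ (J (Fin n) F *ᵥ (cE k ((cE k).symm _))) = _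
      rw [LinearEquiv.apply_symm_apply, LinearEquiv.apply_symm_apply, mulVec_form, SymplecticGroup.mem_iff'.1 A.2]⟩
  map_one' := by
    refine Subtype.ext (LinearEquiv.ext fun x => ?_)
    show (cE k).symm ((1 : Matrix _ _ F) *ᵥ cE k x) = x
    simp
  map_mul' A B := by
    refine Subtype.ext (LinearEquiv.ext fun x => ?_)
    show (cE k).symm ((A.1 * B.1) *ᵥ cE k x) = (cE k).symm (A.1 *ᵥ cE k ((cE k).symm (B.1 *ᵥ cE k x)))
    rw [LinearEquiv.apply_symm_apply, Matrix.mulVec_mulVec]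

open Matrix in
theorem isoHom_bij {n : ℕ} (k : Fin n ≃ ι) : Function.Bijective (isoHom (F := F) k) := by
  constructor
  · intro A B h
    apply Subtype.ext
    apply Matrix.ext_of_mulVec_single
    intro i
    have := congrArg (fun s => cE k (rS ι F s ((cE k).symm (Pi.single i 1)))) h
    simpa only [rS_apply, isoHom, MonoidHom.coe_mk, OneHom.coe_mk, LinearEquiv.coe_mk, LinearMap.coe_mk, AddHom.coe_mk, LinearEquiv.apply_symm_apply] using this
  · intro σ
    let M := LinearMap.toMatrix' ((cE k).toLinearMap ∘ₗ rS ι F σ ∘ₗ (cE k).symm.toLinearMap)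
    have hM : ∀ v, M *ᵥ v = cE k (rS ι F σ ((cE k).symm v)) := fun v => by
      rw [← Matrix.toLin'_apply, Matrix.toLin'_toMatrix']; rfl
    have mem : M ∈ symplecticGroup (Fin n) F := by
      rw [SymplecticGroup.mem_iff']
      refine Matrix.ext fun i j => ?_
      have : ∀ N : Matrix (Fin n ⊕ Fin n) (Fin n ⊕ Fin n) F, N i j = (Pi.single i 1 : Fin n ⊕ Fin n → F) ⬝ᵥ (N *ᵥ Pi.single j 1) := fun N => by simp
      exact (this (Mᵀ * J (Fin n) F * M)).trans ((by rw [← mulVec_form, hM, hM, cE_form, rS_Om, ← cE_form k, LinearEquiv.apply_symm_apply, LinearEquiv.apply_symm_apply] : _ = _).trans (this (J (Fin n) F)).symm)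
    refine ⟨⟨M, mem⟩, Sp_ext fun x t => ?_⟩
    show (cE k).symm (M *ᵥ cE k x) t = _
    rw [hM, LinearEquiv.symm_apply_apply, LinearEquiv.symm_apply_apply]

/-- from the geometric group to the projective matrix group -/
theorem toPSp {n c ℓ : ℕ} (k : Fin n ≃ ι) (o : ι) {T : Set (SpI ι F)} (h : SP c ℓ (SpI ι F) T) (hT : muE (fun _ => -1) ∈ T) :
    ∃ T', SP (2 * c + 1) ℓ (Matrix.symplecticGroup (Fin n) F ⧸ Subgroup.center (Matrix.symplecticGroup (Fin n) F)) T' := by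
  let e := MulEquiv.ofBijective (isoHom (F := F) k) (isoHom_bij k)
  have hz : ∀ τ : SpI ι F, τ * muE (fun _ => -1) = muE (fun _ => -1) * τ := fun τ => by
    refine Sp_ext fun x t => ?_
    have : ∀ x : ι → V2 F, rS ι F (muE (fun _ => -1)) x = -x := fun x => by ext1 t; rw [muE_rS]; simp
    simp only [map_mul, Module.End.mul_apply, this, map_neg]
  refine ⟨_, h.quot ((QuotientGroup.mk' (Subgroup.center _)).comp e.symm.toMonoidHom) ?_ (N := Unit) (c' := 1) (by simp) (fun _ => muE (fun _ => -1)) (k := 1) (fun _ => Bl.of hT) ?_ ?_⟩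
  · exact (QuotientGroup.mk'_surjective _).comp e.symm.surjective
  · intro _
    show QuotientGroup.mk' _ (e.symm _) = 1
    rw [QuotientGroup.mk'_apply, QuotientGroup.eq_one_iff, Subgroup.mem_center_iff]
    intro A
    apply e.injective
    rw [map_mul, map_mul, e.apply_symm_apply, hz]
  · intro x hx
    have hx : QuotientGroup.mk' (Subgroup.center _) (e.symm x) = 1 := hx
    rw [QuotientGroup.mk'_apply, QuotientGroup.eq_one_iff, Subgroup.mem_center_iff] at hx
    rcases center_SpI o x (fun τ => by
      apply e.symm.injective
      rw [map_mul, map_mul, hx]) with rfl | rfl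
    · exact one_mem _
    · exact Subgroup.subset_normalClosure ⟨(), rfl⟩

end LT

namespace LT
open SL2

theorem large : ∃ c, ∀ (n : ℕ), 20 ≤ n → ∀ (F : Type) [Field F] [Fintype F], ∃ (ι : Type) (_ : DecidableEq ι) (_ : Fintype ι) (T : Set (SpI ι F)),
    Fintype.card ι = n ∧ SP c (1 + Nat.log 2 n + Nat.log 2 (Fintype.card F)) (SpI ι F) T ∧ muE (fun _ => -1) ∈ T := by
  obtain ⟨c1, h1⟩ := SL2.main
  obtain ⟨c2, h2⟩ := permMain
  obtain ⟨k, hk⟩ := zetaShort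
  refine ⟨(30 + 3) * (k * (3 * (101 * (c1 + (c2 + 1)) + (c2 * c1 + c1 * c1 + c2 + c1 + 13)) + k)), ?_⟩
  intro n hn F _ _
  obtain ⟨p, _, ι, _, _, hp, hpn, hc, ⟨P⟩⟩ := h2 n hn
  have a1 := (h1 F).mono le_rfl (show 1 + Nat.log 2 (Fintype.card F) ≤ 1 + Nat.log 2 n + Nat.log 2 (Fintype.card F) by omega) le_rfl
  have a2 := P.sp.mono le_rfl (show 1 + Nat.log 2 n ≤ 1 + Nat.log 2 n + Nat.log 2 (Fintype.card F) by omega) le_rfl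
  have a3 := spMain (by omega) a1 a2 P.sw P.ne P.S P.S' P.Slen P.Slen' P.ST P.ST' P.So P.So' P.Sgen P.Sgen'
  have a4 := a3.ball 3 (by norm_num)
  have hlog : Nat.log 2 p ≤ Nat.log 2 n := Nat.log_mono_right hpn
  have a5 := hk c2 (1 + Nat.log 2 n + Nat.log 2 (Fintype.card F)) p 30 _ hp (by omega) ι _ P.toPG (SpI ι F) _ a4 pE muE muE_conj ?_ ?_
  · exact ⟨ι, _, _, _, hc, a5, Or.inr rfl⟩
  · intro σ hσ
    exact Bl.of (Or.inl (Or.inr ⟨σ, hσ, rfl⟩))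
  · intro x
    have bs : Bl (Set.range (aE (F := F) P.o) ∪ pE '' P.T ∪ {zE P.ne}) 1 (pE (Equiv.swap P.o x)) := Bl.of (Or.inl (Or.inr ⟨_, P.sw _ _, rfl⟩))
    show Bl _ 3 _
    rw [muE_single' P.o]
    exact (bs.mul (Bl.of (k := 1) (Or.inl (Or.inl ⟨_, rfl⟩)))).mul bs.inv

theorem small : ∃ c, ∀ (n : ℕ), 2 ≤ n → n < 20 → ∀ (F : Type) [Field F] [Fintype F], ∃ T : Set (SpI (Fin n) F),
    SP c (1 + Nat.log 2 n + Nat.log 2 (Fintype.card F)) (SpI (Fin n) F) T ∧ muE (fun _ => -1) ∈ T := by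
  classical
  obtain ⟨c1, h1⟩ := SL2.main
  obtain ⟨N, hN⟩ : ∃ N : ℕ, N = Nat.factorial 20 := ⟨_, rfl⟩
  refine ⟨60 * (101 * (c1 + (N ^ 2 + 3 + 1)) + (N * c1 + c1 * c1 + N + c1 + 13)), ?_⟩
  intro n hn hn' F _ _
  have hl : 1 ≤ 1 + Nat.log 2 n + Nat.log 2 (Fintype.card F) := by omega
  have hcard : Fintype.card (Equiv.Perm (Fin n)) ≤ N := by
    rw [Fintype.card_perm, Fintype.card_fin, hN]; exact Nat.factorial_le hn'.le
  have a1 := (h1 F).mono le_rfl (show 1 + Nat.log 2 (Fintype.card F) ≤ 1 + Nat.log 2 n + Nat.log 2 (Fintype.card F) by omega) le_rfl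
  have a2 := SP.finite (Equiv.Perm (Fin n)) N _ hl (by rw [Nat.card_eq_fintype_card]; exact hcard)
  let o : Fin n := ⟨0, by omega⟩
  let o' : Fin n := ⟨1, by omega⟩
  have hne : o' ≠ o := by simp [o, o', Fin.ext_iff]
  have len : ∀ (p : Equiv.Perm (Fin n) → Prop) [DecidablePred p], (Finset.univ.filter p).toList.length ≤ N := fun p _ => by
    rw [Finset.length_toList]; exact (Finset.card_filter_le _ _).trans hcard
  have a3 := spMain (F := F) hl a1 a2 (fun _ _ => trivial) hne (Finset.univ.filter (fun g : Equiv.Perm (Fin n) => g o = o)).toList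
    (Finset.univ.filter (fun g : Equiv.Perm (Fin n) => g o = o ∧ g o' = o')).toList (len _) (len _) (fun _ _ => trivial) (fun _ _ => trivial)
    (by simp) (by simp) (fun g hg => Subgroup.subset_closure (by simpa using hg)) (fun g hg hg' => Subgroup.subset_closure (by simpa using ⟨hg, hg'⟩))
  refine ⟨_, a3.ball 60 (by norm_num), ?_⟩
  show Bl _ 60 _
  have bs : ∀ x, Bl (Set.range (aE (F := F) o) ∪ pE '' Set.univ ∪ {zE hne}) 3 (muE (Pi.mulSingle x (-1))) := by
    intro x
    have bs : Bl (Set.range (aE (F := F) o) ∪ pE '' Set.univ ∪ {zE hne}) 1 (pE (Equiv.swap o x)) := Bl.of (Or.inl (Or.inr ⟨_, trivial, rfl⟩))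
    rw [muE_single' o]
    exact (bs.mul (Bl.of (k := 1) (Or.inl (Or.inl ⟨_, rfl⟩)))).mul bs.inv
  have e : (muE (fun _ => -1) : SpI (Fin n) F) = ((List.finRange n).map (fun x => muE (Pi.mulSingle x (-1)))).prod := by
    have : (fun _ => -1 : Fin n → ℤˣ) = ((List.finRange n).map (fun x => Pi.mulSingle x (-1))).prod := by
      rw [← List.ofFn_eq_map, List.prod_ofFn]
      exact (Finset.univ_prod_mulSingle (fun _ : Fin n => (-1 : ℤˣ))).symm
    rw [this, map_list_prod, List.map_map]; rfl
  rw [e]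
  refine (Bl.lprod _ (k := 3) ?_).le ?_
  · intro y hy
    obtain ⟨x, -, rfl⟩ := List.mem_map.1 hy
    exact bs x
  · simp; omega

theorem one : ∃ c, ∀ (F : Type) [Field F] [Fintype F], ∃ T : Set (SpI Unit F),
    SP c (1 + Nat.log 2 1 + Nat.log 2 (Fintype.card F)) (SpI Unit F) T ∧ muE (fun _ => -1) ∈ T := by
  obtain ⟨c1, h1⟩ := SL2.main
  refine ⟨c1, fun F _ _ => ?_⟩
  have hb : Function.Bijective (aE () : S2 F →* SpI Unit F) := by
    constructor
    · intro A B h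
      apply S2_ext
      intro a
      have := congrArg (fun s => rS Unit F s (fun _ => a) ()) h
      simpa only [aE_rS, Function.update_self] using this
    · intro σ
      let c : V2 F → (Unit → V2 F) := fun a _ => a
      obtain ⟨B, hB, hB'⟩ := exists_basis (v := rS Unit F σ (c ve) ()) (w := rS Unit F σ (c vf) ()) (by
        have := rS_Om σ (c ve) (c vf)
        simpa [Data.Om, c] using this)
      refine ⟨B, Sp_ext fun x t => ?_⟩
      rw [aE_rS, Function.update_self]
      have e : x = x () 0 • c ve + x () 1 • c vf := by
        ext1 t
        exact v2_ext (by simp [c]) (by simp [c])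
      have e' : x () = x () 0 • ve + x () 1 • vf := congrFun e ()
      rw [e', av_add, av_smul, av_smul, hB, hB']
      conv_rhs => rw [e]
      rw [map_add, map_smul, map_smul]; rfl
  have a1 := (h1 F).mono le_rfl (show 1 + Nat.log 2 (Fintype.card F) ≤ 1 + Nat.log 2 1 + Nat.log 2 (Fintype.card F) by simp) le_rfl
  refine ⟨_, a1.equiv (MulEquiv.ofBijective _ hb), D (-1), trivial, ?_⟩
  show aE () (D (-1)) = _
  rw [← muE_single]
  congr 1

theorem final : ∃ C : ℕ, ∀ (n : ℕ), 1 ≤ n → ∀ (F : Type) [Field F] [Fintype F], ∃ T,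
    SP C (1 + Nat.log 2 n + Nat.log 2 (Fintype.card F)) (Matrix.symplecticGroup (Fin n) F ⧸ Subgroup.center (Matrix.symplecticGroup (Fin n) F)) T := by
  obtain ⟨c1, h1⟩ := large
  obtain ⟨c2, h2⟩ := small
  obtain ⟨c3, h3⟩ := one
  refine ⟨2 * (c1 + c2 + c3) + 1, ?_⟩
  intro n hn F _ _
  obtain ⟨ι, _, _, T, hc, hT, hz⟩ : ∃ (ι : Type) (_ : DecidableEq ι) (_ : Fintype ι) (T : Set (SpI ι F)),
      Fintype.card ι = n ∧ SP (c1 + c2 + c3) (1 + Nat.log 2 n + Nat.log 2 (Fintype.card F)) (SpI ι F) T ∧ muE (fun _ => -1) ∈ T := by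
    by_cases k1 : 20 ≤ n
    · obtain ⟨ι, d, f, T, hc, hT, hz⟩ := h1 n k1 F
      exact ⟨ι, d, f, T, hc, hT.mono (by omega) le_rfl le_rfl, hz⟩
    by_cases k2 : 2 ≤ n
    · obtain ⟨T, hT, hz⟩ := h2 n k2 (by omega) F
      exact ⟨Fin n, inferInstance, inferInstance, T, by simp, hT.mono (by omega) le_rfl le_rfl, hz⟩
    · obtain rfl : n = 1 := by omega
      obtain ⟨T, hT, hz⟩ := h3 F
      exact ⟨Unit, inferInstance, inferInstance, T, by simp, hT.mono (by omega) le_rfl le_rfl, hz⟩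
  have k : Fin n ≃ ι := (Fintype.equivFinOfCardEq hc).symm
  exact toPSp k (k ⟨0, hn⟩) hT hz

end LT

/-- There is a constant `C` such that for every `n ≥ 1` and every finite field `F` of
order `q`, the projective symplectic group `PSp(2n, F)` (the symplectic group modulo its
center) has a presentation with at most `C` generators and at most `C` relators, of
length at most `C·(1 + log₂ n + log₂ q)`. -/
theorem PSp_short_bounded_presentation :
    ∃ C : ℕ, ∀ (n : ℕ), 1 ≤ n → ∀ (F : Type) [Field F] [Fintype F],
      HasBoundedPresentation
        ((Matrix.symplecticGroup (Fin n) F) ⧸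
          Subgroup.center (Matrix.symplecticGroup (Fin n) F)) C C
        (C * (1 + Real.logb 2 n + Real.logb 2 (Fintype.card F))) := by
  obtain ⟨c, hc⟩ := LT.final
  refine ⟨c + c * c, ?_⟩
  intro n hn F _ _
  obtain ⟨T, hT⟩ := hc n hn F
  refine hT.toHBP _ _ (by omega) ?_
  have e1 : (Nat.log 2 n : ℝ) ≤ Real.logb 2 n := by exact_mod_cast Real.natLog_le_logb n 2
  have e2 : (Nat.log 2 (Fintype.card F) : ℝ) ≤ Real.logb 2 (Fintype.card F) := by exact_mod_cast Real.natLog_le_logb (Fintype.card F) 2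
  push_cast
  have p1 : (0 : ℝ) ≤ Nat.log 2 n := Nat.cast_nonneg _
  have p2 : (0 : ℝ) ≤ Nat.log 2 (Fintype.card F) := Nat.cast_nonneg _
  have p3 : (0 : ℝ) ≤ c := Nat.cast_nonneg _
  calc (c : ℝ) + c * (c * (1 + Nat.log 2 n + Nat.log 2 (Fintype.card F)))
      ≤ (c + c * c) * (1 + Nat.log 2 n + Nat.log 2 (Fintype.card F)) := by nlinarith [mul_nonneg p3 p1, mul_nonneg p3 p2]
    _ ≤ _ := by gcongr
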